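/- Assume the Riemann hypothesis holds up to height T, where T ≥ 10^7. Then for every real x > max(T, 10^9) one has |ψ(x) − x·(π/T)·coth(π/T)| ≤ (π/(T−1))·x + ((1/(2π))·(log(T/(2π)))^2 − (1/(6π))·log(T/(2π)))·√x, and moreover |∑_{n ≤ x} Λ(n)/n − (log x − γ)| ≤ π/(T−1) + ((1/(2π))·(log(T/(2π)))^2 − (1/(6π))·log(T/(2π)))/√x. -/

import Mathlib

open Real Finset

/-- The Chebyshev function `ψ(x) = ∑_{n ≤ x} Λ(n)`. -/
noncomputable def chebyshevPsi (x : ℝ) : ℝ :=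
  ∑ n ∈ Finset.Icc 1 ⌊x⌋₊, ArithmeticFunction.vonMangoldt n

/-- The Riemann hypothesis holds up to height `T`: every zero `ρ` of `ζ` with
`0 < Im ρ ≤ T` satisfies `Re ρ = 1/2`. -/
def RHUpTo (T : ℝ) : Prop :=
  ∀ ρ : ℂ, riemannZeta ρ = 0 → 0 < ρ.im → ρ.im ≤ T → ρ.re = 1 / 2

section
open Real Finset
namespace PS

lemma sin_pi_ne_zero {z : ℝ} (hz : ∀ n : ℤ, z ≠ n) : Real.sin (π * z) ≠ 0 := by
  intro h
  rw [Real.sin_eq_zero_iff] at h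
  obtain ⟨n, hn⟩ := h
  apply hz n
  have : π ≠ 0 := Real.pi_ne_zero
  field_simp at hn
  exact hn.symm

lemma integral_e {z : ℝ} (hz : z ≠ 0) :
    ∫ t in (0:ℝ)..1, Complex.exp (2 * π * Complex.I * z * t) =
      (Complex.exp (2 * π * Complex.I * z) - 1) / (2 * π * Complex.I * z) := by
  rw [integral_exp_mul_complex]
  · simp
  · have := Real.pi_ne_zero
    simp [hz, this]

lemma normSq_e_sub (z : ℝ) : ‖Complex.exp (2 * π * Complex.I * z) - 1‖ ^ 2 = 4 * Real.sin (π * z) ^ 2 := by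
  have h : (2 * π * Complex.I * z : ℂ) = ((2 * (π * z) : ℝ) : ℂ) * Complex.I := by push_cast; ring
  rw [h, ← Complex.normSq_eq_norm_sq, Complex.normSq_apply]
  simp only [Complex.sub_re, Complex.sub_im, Complex.exp_ofReal_mul_I_re,
    Complex.exp_ofReal_mul_I_im, Complex.one_re, Complex.one_im]
  rw [Real.cos_two_mul, Real.sin_two_mul]
  have := Real.sin_sq_add_cos_sq (π * z)
  have h2 : Real.cos (π * z) ^ 2 = 1 - Real.sin (π * z) ^ 2 := by linarith
  ring_nf
  have h4 : Real.cos (π * z) ^ 4 = (1 - Real.sin (π * z) ^ 2) ^ 2 := by rw [← h2]; ring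
  rw [h4, h2]; ring

lemma cosec_hasSum {z : ℝ} (hz : ∀ n : ℤ, z ≠ n) :
    HasSum (fun n : ℤ => 1 / (z - n) ^ 2) (π ^ 2 / Real.sin (π * z) ^ 2) := by
  have key := hasSum_sq_fourierCoeffOn (a := 0) (b := 1)
    (f := fun t : ℝ => Complex.exp (2 * π * Complex.I * z * t)) (by norm_num) (by
      apply MeasureTheory.MemLp.of_bound (C := 1)
      · exact (by fun_prop : Continuous fun t : ℝ => Complex.exp (2 * π * Complex.I * z * t)).aestronglyMeasurable
      · refine Filter.Eventually.of_forall fun t => ?_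
        have h : (2 * π * Complex.I * z * t : ℂ) = ((2 * π * z * t : ℝ) : ℂ) * Complex.I := by
          push_cast; ring
        rw [h, Complex.norm_exp_ofReal_mul_I])
  have hR : ((1 : ℝ) - 0)⁻¹ • ∫ (x : ℝ) in (0:ℝ)..1, ‖Complex.exp (2 * π * Complex.I * z * x)‖ ^ 2 = 1 := by
    have : ∀ x : ℝ, ‖Complex.exp (2 * π * Complex.I * z * x)‖ ^ 2 = 1 := by
      intro t
      have h : (2 * π * Complex.I * z * t : ℂ) = ((2 * π * z * t : ℝ) : ℂ) * Complex.I := by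
          push_cast; ring
      rw [h, Complex.norm_exp_ofReal_mul_I]; norm_num
    simp [this]
  rw [hR] at key
  have hs := sin_pi_ne_zero hz
  have hpi := Real.pi_ne_zero
  have key2 := key.mul_left (π ^ 2 / Real.sin (π * z) ^ 2)
  rw [mul_one] at key2
  refine key2.congr_fun ?_ |> fun h => h
  intro n
  have hzn : z - n ≠ 0 := sub_ne_zero.mpr (hz n)
  have hc : fourierCoeffOn (by norm_num : (0:ℝ) < 1) (fun t : ℝ => Complex.exp (2 * π * Complex.I * z * t)) n
      = (Complex.exp (2 * π * Complex.I * (z - n : ℝ)) - 1) / (2 * π * Complex.I * (z - n : ℝ)) := by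
    rw [fourierCoeffOn_eq_integral, ← integral_e hzn]
    simp only [sub_zero, div_one, one_smul]
    apply intervalIntegral.integral_congr
    intro t _
    simp only [fourier_coe_apply, smul_eq_mul]
    rw [← Complex.exp_add]
    congr 1
    push_cast; ring
  rw [hc, norm_div, div_pow, normSq_e_sub]
  have hn : ‖(2 * π * Complex.I * (z - n : ℝ) : ℂ)‖ ^ 2 = 4 * π ^ 2 * (z - n) ^ 2 := by
    rw [norm_mul, norm_mul, norm_mul, Complex.norm_real, Complex.norm_I, Complex.norm_real]
    simp only [Complex.norm_ofNat, Real.norm_eq_abs, mul_pow, sq_abs]; ring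
  rw [hn]
  have hs2 : Real.sin (π * (z - n)) ^ 2 = Real.sin (π * z) ^ 2 := by
    rw [mul_sub, mul_comm π (n:ℝ), Real.sin_sub_int_mul_pi, mul_pow]
    have : ((-1 : ℝ) ^ n) ^ 2 = 1 := by
      rw [← zpow_natCast, ← zpow_mul, mul_comm, zpow_mul]; simp
    rw [this, one_mul]
  rw [hs2]
  generalize Real.sin (π * z) = q at *
  field_simp
end PS
end

section
open Real Finset
namespace PS

/-- `h(v) = v / (e^v - 1)`, with the removable singularity removed. -/
noncomputable def hc (v : ℂ) : ℂ := (dslope Complex.exp 0 v)⁻¹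

lemma hc_of_ne {v : ℂ} (hv : v ≠ 0) : hc v = v / (Complex.exp v - 1) := by
  rw [hc, dslope_of_ne _ hv, slope_def_field]; simp

lemma hc_zero : hc 0 = 1 := by
  rw [hc, dslope_same]; simp

lemma hc_mul {v : ℂ} (hv : Complex.exp v ≠ 1) : hc v * (Complex.exp v - 1) = v := by
  have h0 : v ≠ 0 := by rintro rfl; simp at hv
  rw [hc_of_ne h0]
  exact div_mul_cancel₀ _ (sub_ne_zero.mpr hv)

lemma hc_neg {v : ℂ} (hv : Complex.exp v ≠ 1) : hc (-v) = hc v + v := by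
  have h0 : v ≠ 0 := by rintro rfl; simp at hv
  rw [hc_of_ne h0, hc_of_ne (neg_ne_zero.mpr h0), Complex.exp_neg]
  have h1 := Complex.exp_ne_zero v
  have h2 := sub_ne_zero.mpr hv
  have h3 : (1 : ℂ) - Complex.exp v ≠ 0 := sub_ne_zero.mpr hv.symm
  have h4 : (Complex.exp v)⁻¹ - 1 = (1 - Complex.exp v) / Complex.exp v := by field_simp
  rw [h4, div_div_eq_mul_div]
  field_simp
  ring

lemma differentiable_dslope_exp : Differentiable ℂ (dslope Complex.exp 0) := by
  have := (Complex.differentiableOn_dslope (s := Set.univ) (f := Complex.exp) (c := 0)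
    Filter.univ_mem).mpr Complex.differentiable_exp.differentiableOn
  exact differentiableOn_univ.mp this

lemma dslope_exp_ne {v : ℂ} (hv : Complex.exp v ≠ 1 ∨ v = 0) : dslope Complex.exp 0 v ≠ 0 := by
  rcases hv with hv | rfl
  · have h0 : v ≠ 0 := by rintro rfl; simp at hv
    rw [dslope_of_ne _ h0, slope_def_field]
    simp only [sub_zero, Complex.exp_zero]
    exact div_ne_zero (sub_ne_zero.mpr hv) h0
  · rw [dslope_same]; simp

lemma hc_differentiableAt {v : ℂ} (hv : Complex.exp v ≠ 1 ∨ v = 0) : DifferentiableAt ℂ hc v :=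
  (differentiable_dslope_exp v).inv (dslope_exp_ne hv)

/-- real `h(l)` for `l ≠ 0` -/
noncomputable def hr (l : ℝ) : ℝ := l / (Real.exp l - 1)

lemma hc_ofReal {l : ℝ} (hl : l ≠ 0) : hc (l : ℂ) = (hr l : ℂ) := by
  rw [hc_of_ne (by exact_mod_cast hl), hr]; push_cast; rfl

lemma hr_neg {l : ℝ} (hl : l ≠ 0) : hr (-l) = hr l + l := by
  have h1 : Complex.exp (l : ℂ) ≠ 1 := by
    rw [← Complex.ofReal_exp]
    intro h
    have h' : Real.exp l = 1 := by exact_mod_cast h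
    exact hl (by simpa using h')
  have := hc_neg h1
  rw [← Complex.ofReal_neg, hc_ofReal (neg_ne_zero.mpr hl), hc_ofReal hl] at this
  exact_mod_cast this

lemma hr_le_one {l : ℝ} (hl : 0 < l) : hr l ≤ 1 := by
  have := Real.add_one_le_exp l
  rw [hr, div_le_one] <;> linarith

lemma hr_pos {l : ℝ} (hl : 0 < l) : 0 < hr l := by
  have := Real.add_one_le_exp l
  rw [hr]; apply div_pos hl; linarith

lemma exp_neg_le_hr {l : ℝ} (hl : 0 < l) : Real.exp (-l) ≤ hr l := by
  have := Real.add_one_le_exp l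
  have h2 := Real.add_one_le_exp (-l)
  rw [hr, le_div_iff₀ (by linarith), mul_sub, ← Real.exp_add]
  simp; linarith

noncomputable def vK (l t : ℝ) : ℂ := 2 * π * Complex.I * (1 - t) - l

/-- kernel symbol; `b = 0` majorant, `b = 1` minorant -/
noncomputable def PhiK (b l t : ℝ) : ℂ :=
  (1 / (2 * π * Complex.I)) * (hc (-l) - hc (vK l t)) - b * (1 - t)

noncomputable def MK (b l z : ℝ) : ℝ :=
  2 * (∫ t in (0:ℝ)..1, PhiK b l t * Complex.exp (2 * π * Complex.I * z * t)).re

lemma exp_vK (l t : ℝ) : Complex.exp (vK l t) =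
    Real.exp (-l) * Complex.exp (-(2 * π * Complex.I * t)) := by
  have : vK l t = (-l : ℝ) + (-(2 * π * Complex.I * t)) + 2 * π * Complex.I := by
    rw [vK]; push_cast; ring
  rw [this, Complex.exp_add, Complex.exp_two_pi_mul_I, mul_one, Complex.exp_add, Complex.ofReal_exp]

lemma norm_e (t : ℝ) : ‖Complex.exp (2 * π * Complex.I * t)‖ = 1 := by
  have h : (2 * π * Complex.I * t : ℂ) = ((2 * π * t : ℝ) : ℂ) * Complex.I := by
    push_cast; ring
  rw [h, Complex.norm_exp_ofReal_mul_I]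

lemma norm_exp_vK (l t : ℝ) : ‖Complex.exp (vK l t)‖ = Real.exp (-l) := by
  rw [exp_vK, norm_mul]
  have : (-(2 * π * Complex.I * t) : ℂ) = 2 * π * Complex.I * ((-t : ℝ) : ℂ) := by push_cast; ring
  rw [this, norm_e, mul_one, Complex.norm_real, Real.norm_eq_abs, abs_of_pos (Real.exp_pos _)]

lemma exp_vK_ne {l : ℝ} (hl : 0 < l) (t : ℝ) : Complex.exp (vK l t) ≠ 1 := by
  intro h
  have := norm_exp_vK l t
  rw [h] at this
  rw [norm_one] at this
  have h2 : Real.exp (-l) < 1 := by simpa using hl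
  linarith

lemma continuous_PhiK {b l : ℝ} (hl : 0 < l) : Continuous (PhiK b l) := by
  have h1 : Continuous fun t : ℝ => hc (vK l t) := by
    rw [continuous_iff_continuousAt]
    intro t
    have h2 : ContinuousAt (vK l) t := by unfold vK; fun_prop
    exact ContinuousAt.comp (g := hc) (f := vK l) (hc_differentiableAt (Or.inl (exp_vK_ne hl t))).continuousAt h2
  unfold PhiK
  fun_prop

lemma continuous_MK {b l : ℝ} (hl : 0 < l) : Continuous (MK b l) := by
  unfold MK
  have h := continuous_PhiK (b := b) hl
  refine continuous_const.mul (Complex.continuous_re.comp ?_)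
  apply intervalIntegral.continuous_parametric_intervalIntegral_of_continuous'
  fun_prop

lemma c_int {z : ℝ} (hz : z ≠ 0) :
    2 * (∫ t in (0:ℝ)..1, (1 / (2 * π * Complex.I)) * Complex.exp (2 * π * Complex.I * z * t)).re
      = Real.sin (π * z) ^ 2 / π ^ 2 * (1 / z) := by
  rw [intervalIntegral.integral_const_mul, integral_e hz]
  have hpi := Real.pi_ne_zero
  have hpc : (π : ℂ) ≠ 0 := by exact_mod_cast hpi
  have hzc : (z : ℂ) ≠ 0 := by exact_mod_cast hz
  have h : (2 * π * Complex.I * z : ℂ) = ((2 * (π * z) : ℝ) : ℂ) * Complex.I := by push_cast; ring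
  have : (1 / (2 * π * Complex.I)) * ((Complex.exp (2 * π * Complex.I * z) - 1) / (2 * π * Complex.I * z))
      = (Complex.exp (2 * π * Complex.I * z) - 1) * ((-1 / (4 * π ^ 2 * z) : ℝ) : ℂ) := by
    push_cast
    field_simp
    rw [Complex.I_sq]; ring
  rw [this, h, Complex.re_mul_ofReal, Complex.sub_re, Complex.exp_ofReal_mul_I_re, Complex.one_re,
    Real.cos_two_mul, Real.cos_sq']
  field_simp; ring

lemma d_int {z : ℝ} (hz : z ≠ 0) :
    2 * (∫ t in (0:ℝ)..1, (1 - t : ℂ) * Complex.exp (2 * π * Complex.I * z * t)).re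
      = Real.sin (π * z) ^ 2 / π ^ 2 * (1 / z ^ 2) := by
  have hpi := Real.pi_ne_zero
  have hpc : (π : ℂ) ≠ 0 := by exact_mod_cast hpi
  have hzc : (z : ℂ) ≠ 0 := by exact_mod_cast hz
  set c : ℂ := 2 * π * Complex.I * z with hc
  have hc0 : c ≠ 0 := by simp [hc, hz, hpi]
  have hd : ∀ t ∈ Set.uIcc (0:ℝ) 1, HasDerivAt
      (fun t : ℝ => (1 - t : ℂ) * Complex.exp (c * t) / c + Complex.exp (c * t) / c ^ 2)
      ((1 - t : ℂ) * Complex.exp (c * t)) t := by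
    intro t _
    have h1 : HasDerivAt (fun t : ℂ => (1 - t : ℂ) * Complex.exp (c * t) / c + Complex.exp (c * t) / c ^ 2)
      ((1 - t : ℂ) * Complex.exp (c * t)) t := by
      have he : HasDerivAt (fun t : ℂ => Complex.exp (c * t)) (Complex.exp (c * t) * (c * 1)) t :=
        ((hasDerivAt_id _).const_mul c).cexp
      have h1 : HasDerivAt (fun t : ℂ => 1 - t) (-1) (t : ℂ) := by
        simpa using (hasDerivAt_id (t : ℂ)).const_sub 1
      have := ((h1.mul he).div_const c).add (he.div_const (c ^ 2))
      refine this.congr_deriv ?_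
      field_simp; ring
    exact h1.comp_ofReal
  rw [intervalIntegral.integral_eq_sub_of_hasDerivAt hd
    ((by fun_prop : Continuous fun t : ℝ => (1 - t : ℂ) * Complex.exp (c * t)).intervalIntegrable _ _)]
  have h : c = ((2 * (π * z) : ℝ) : ℂ) * Complex.I := by rw [hc]; push_cast; ring
  have e1 : ((1 - (1:ℝ) : ℂ) * Complex.exp (c * (1:ℝ)) / c + Complex.exp (c * (1:ℝ)) / c ^ 2 -
      ((1 - (0:ℝ) : ℂ) * Complex.exp (c * (0:ℝ)) / c + Complex.exp (c * (0:ℝ)) / c ^ 2))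
      = (Complex.exp c - 1) * ((-1 / (4 * π ^ 2 * z ^ 2) : ℝ) : ℂ)
        + ((1 / (2 * π * z) : ℝ) : ℂ) * Complex.I := by
    have hc2 : c ^ 2 = -(4 * π ^ 2 * z ^ 2) := by rw [hc]; ring_nf; rw [Complex.I_sq]; ring
    have hc1 : 1 / c = -(1 / (2 * π * z) * Complex.I) := by
      rw [hc]; field_simp; rw [Complex.I_sq]; ring
    simp only [Complex.ofReal_one, Complex.ofReal_zero, sub_self, zero_mul, mul_one, mul_zero,
      Complex.exp_zero, sub_zero, zero_div, zero_add]
    rw [hc1, hc2]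
    push_cast
    field_simp; ring
  rw [e1, Complex.add_re, Complex.re_mul_ofReal, Complex.re_ofReal_mul, Complex.I_re, h, Complex.sub_re,
    Complex.exp_ofReal_mul_I_re, Complex.one_re, Real.cos_two_mul, Real.cos_sq']
  field_simp; ring

end PS
end

section
open Real Finset
namespace PS

lemma PhiK_hasSum {l : ℝ} (hl : 0 < l) (t z : ℝ) :
    HasSum (fun k : ℕ => (1 / (2 * π * Complex.I)) * (vK l t * Complex.exp (vK l t) ^ k) *
        Complex.exp (2 * π * Complex.I * z * t))
      ((PhiK 0 l t - (1 / (2 * π * Complex.I)) * hc (-l)) * Complex.exp (2 * π * Complex.I * z * t)) := by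
  have hn : ‖Complex.exp (vK l t)‖ < 1 := by rw [norm_exp_vK]; simpa using hl
  have h1 := ((hasSum_geometric_of_norm_lt_one hn).mul_left (vK l t)).mul_left (1 / (2 * π * Complex.I))
    |>.mul_right (Complex.exp (2 * π * Complex.I * z * t))
  have hne := exp_vK_ne hl t
  have := hc_mul hne
  have h2 : hc (vK l t) = - (vK l t * (1 - Complex.exp (vK l t))⁻¹) := by
    have h3 : (1 : ℂ) - Complex.exp (vK l t) ≠ 0 := sub_ne_zero.mpr hne.symm
    field_simp
    linear_combination -this
  have h4 : PhiK 0 l t - (1 / (2 * π * Complex.I)) * hc (-l) =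
      1 / (2 * π * Complex.I) * (vK l t * (1 - Complex.exp (vK l t))⁻¹) := by
    rw [PhiK, h2]
    push_cast; ring
  rw [h4]; exact h1

lemma MK_hasSum {l : ℝ} (hl : 0 < l) {z : ℝ} (hz : ∀ n : ℤ, z ≠ n) :
    HasSum (fun k : ℕ => Real.sin (π * z) ^ 2 / π ^ 2 *
        (Real.exp (-l * k) * (1 / (z - k) ^ 2 - l * (1 / (z - k)))))
      (MK 0 l z - hr (-l) * (Real.sin (π * z) ^ 2 / π ^ 2 * (1 / z))) := by
  have hpi := Real.pi_ne_zero
  have hpc : (π : ℂ) ≠ 0 := by exact_mod_cast hpi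
  have hz0 : z ≠ 0 := by exact_mod_cast hz 0
  have hlc : hc (-(l:ℂ)) = (hr (-l) : ℂ) := by
    rw [← Complex.ofReal_neg, hc_ofReal (neg_ne_zero.mpr hl.ne')]
  have key : HasSum (fun k : ℕ => ∫ t in (0:ℝ)..1, (1 / (2 * π * Complex.I)) * (vK l t * Complex.exp (vK l t) ^ k) *
        Complex.exp (2 * π * Complex.I * z * t))
      (∫ t in (0:ℝ)..1, (PhiK 0 l t - (1 / (2 * π * Complex.I)) * hc (-l)) * Complex.exp (2 * π * Complex.I * z * t)) := by
    apply intervalIntegral.hasSum_integral_of_dominated_convergence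
      (bound := fun k _ => (2 * π + l) * Real.exp (-l) ^ k)
    · intro k
      have : Continuous fun t : ℝ => (1 / (2 * π * Complex.I)) * (vK l t * Complex.exp (vK l t) ^ k) *
        Complex.exp (2 * π * Complex.I * z * t) := by unfold vK; fun_prop
      exact this.aestronglyMeasurable
    · intro k
      refine Filter.Eventually.of_forall fun t ht => ?_
      rw [Set.uIoc_of_le zero_le_one] at ht
      have e1 : ‖Complex.exp (2 * π * Complex.I * z * t)‖ = 1 := by
        have := norm_e (z * t); push_cast at this; rw [← mul_assoc] at this; exact this
      rw [norm_mul, e1, mul_one, norm_mul, norm_mul, norm_pow, norm_exp_vK]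
      have e2 : ‖(1 / (2 * π * Complex.I) : ℂ)‖ ≤ 1 := by
        rw [norm_div, norm_mul, norm_mul, Complex.norm_I, Complex.norm_real]
        simp only [norm_one, Complex.norm_ofNat, Real.norm_eq_abs, abs_of_pos Real.pi_pos, mul_one]
        rw [div_le_one (by positivity)]
        linarith [Real.pi_gt_three]
      have e3 : ‖vK l t‖ ≤ 2 * π + l := by
        rw [vK]
        refine (norm_sub_le _ _).trans ?_
        have : (1 - t : ℂ) = ((1 - t : ℝ) : ℂ) := by push_cast; ring
        rw [this, norm_mul, norm_mul, norm_mul, Complex.norm_I, Complex.norm_real, Complex.norm_real, Complex.norm_real]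
        simp only [Complex.norm_ofNat, Real.norm_eq_abs, abs_of_pos Real.pi_pos, mul_one, abs_of_pos hl]
        rw [abs_of_nonneg (by linarith [ht.2])]
        nlinarith [Real.pi_pos, ht.1]
      calc _ ≤ 1 * ((2 * π + l) * Real.exp (-l) ^ k) := by gcongr
        _ = _ := one_mul _
    · refine Filter.Eventually.of_forall fun t ht => ?_
      exact (summable_geometric_of_lt_one (Real.exp_pos _).le (by simpa using hl)).mul_left _
    · exact intervalIntegrable_const
    · exact Filter.Eventually.of_forall fun t ht => PhiK_hasSum hl t z
  have key2 := (Complex.reCLM.hasSum key).mul_left 2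
  have hA : ∀ k : ℕ, Real.sin (π * z) ^ 2 / π ^ 2 *
        (Real.exp (-l * k) * (1 / (z - k) ^ 2 - l * (1 / (z - k)))) = 2 * Complex.reCLM (∫ t in (0:ℝ)..1, (1 / (2 * π * Complex.I)) * (vK l t * Complex.exp (vK l t) ^ k) *
        Complex.exp (2 * π * Complex.I * z * t)) := by
    intro k
    have hzk : z - k ≠ 0 := sub_ne_zero.mpr (by exact_mod_cast hz k)
    have hs2 : Real.sin (π * z) ^ 2 = Real.sin (π * (z - k)) ^ 2 := by
      rw [mul_sub, mul_comm π (k:ℝ), Real.sin_sub_nat_mul_pi, mul_pow]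
      have : ((-1 : ℝ) ^ k) ^ 2 = 1 := by rw [← pow_mul, mul_comm, pow_mul]; simp
      rw [this, one_mul]
    have e : ∀ t : ℝ, (1 / (2 * π * Complex.I)) * (vK l t * Complex.exp (vK l t) ^ k) *
        Complex.exp (2 * π * Complex.I * z * t) =
        (Real.exp (-l * k) : ℂ) * ((1 - t : ℂ) * Complex.exp (2 * π * Complex.I * (z - k : ℝ) * t)
          - l * ((1 / (2 * π * Complex.I)) * Complex.exp (2 * π * Complex.I * (z - k : ℝ) * t))) := by
      intro t
      rw [exp_vK, mul_pow, ← Complex.exp_nat_mul, ← Complex.ofReal_pow, ← Real.exp_nat_mul]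
      have h1 : Complex.exp (2 * π * Complex.I * (z - k : ℝ) * t) =
          Complex.exp (k * -(2 * π * Complex.I * t)) * Complex.exp (2 * π * Complex.I * z * t) := by
        rw [← Complex.exp_add]; congr 1; push_cast; ring
      rw [h1, vK, show (k : ℝ) * -l = -l * k by ring]
      field_simp
    simp only [e]
    rw [intervalIntegral.integral_const_mul, intervalIntegral.integral_sub,
      intervalIntegral.integral_const_mul (l : ℂ)]
    · simp only [Complex.reCLM_apply]
      rw [Complex.re_ofReal_mul, Complex.sub_re, Complex.re_ofReal_mul]
      have h1 := c_int hzk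
      have h2 := d_int hzk
      rw [← hs2] at h1 h2
      linear_combination (-Real.exp (-l * k)) * h2 + Real.exp (-l * k) * l * h1
    · exact Continuous.intervalIntegrable (by fun_prop) _ _
    · exact Continuous.intervalIntegrable (by fun_prop) _ _
  have hB : MK 0 l z - hr (-l) * (Real.sin (π * z) ^ 2 / π ^ 2 * (1 / z)) = 2 * Complex.reCLM
      (∫ t in (0:ℝ)..1, (PhiK 0 l t - (1 / (2 * π * Complex.I)) * hc (-l)) * Complex.exp (2 * π * Complex.I * z * t)) := by
    have hP := continuous_PhiK (b := 0) hl
    simp only [sub_mul]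
    rw [intervalIntegral.integral_sub, Complex.reCLM_apply, Complex.sub_re, MK]
    · have e : ∀ t : ℝ, (1 / (2 * π * Complex.I)) * hc (-l) * Complex.exp (2 * π * Complex.I * z * t) =
        (hr (-l) : ℂ) * ((1 / (2 * π * Complex.I)) * Complex.exp (2 * π * Complex.I * z * t)) := by
        intro t; rw [hlc]; ring
      simp only [e]
      rw [intervalIntegral.integral_const_mul, Complex.re_ofReal_mul]
      have h1 := c_int hz0
      linear_combination hr (-l) * h1
    · exact Continuous.intervalIntegrable (by fun_prop) _ _
    · exact Continuous.intervalIntegrable (by fun_prop) _ _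
  rw [hB]; exact key2.congr_fun hA

lemma MK_one {l : ℝ} (hl : 0 < l) {z : ℝ} (hz : z ≠ 0) :
    MK 1 l z = MK 0 l z - Real.sin (π * z) ^ 2 / π ^ 2 * (1 / z ^ 2) := by
  have hP := continuous_PhiK (b := 0) hl
  rw [← d_int hz, MK, MK, ← mul_sub, ← Complex.sub_re, ← intervalIntegral.integral_sub]
  · congr 3
    funext t
    unfold PhiK; push_cast; ring
  · exact Continuous.intervalIntegrable (by fun_prop) _ _
  · exact Continuous.intervalIntegrable (by fun_prop) _ _
end PS
end

section
open Real Finset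
namespace PS

lemma hr_antitone {u v : ℝ} (hu : u ≠ 0) (hv : v ≠ 0) (h : u ≤ v) : hr v ≤ hr u := by
  have h1 := convexOn_exp.secant_mono (a := 0) (x := u) (y := v) (Set.mem_univ _) (Set.mem_univ _)
    (Set.mem_univ _) hu hv h
  have e : ∀ w : ℝ, w ≠ 0 → 0 < (Real.exp w - 1) / w := by
    intro w hw
    rcases lt_or_gt_of_ne hw with h | h
    · apply div_pos_of_neg_of_neg _ h
      have : Real.exp w < 1 := by simpa using h
      linarith
    · apply div_pos _ h
      have : 1 < Real.exp w := by simpa using h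
      linarith
  simp only [Real.exp_zero, sub_zero] at h1
  have := one_div_le_one_div_of_le (e u hu) h1
  simpa [hr, one_div, inv_div] using this

lemma tele_hasSum {z : ℝ} (hz : 0 < z) :
    HasSum (fun j : ℕ => 1 / (z + j) - 1 / (z + j + 1)) (1 / z) := by
  rw [hasSum_iff_tendsto_nat_of_nonneg]
  · have e : ∀ n : ℕ, ∑ j ∈ range n, (1 / (z + j) - 1 / (z + j + 1)) = 1 / z - 1 / (z + n) := by
      intro n
      have := Finset.sum_range_sub' (fun j : ℕ => 1 / (z + j)) n
      simp only [Nat.cast_zero, add_zero, Nat.cast_add, Nat.cast_one, ← add_assoc] at this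
      exact this
    simp only [e]
    have h1 : Filter.Tendsto (fun n : ℕ => 1 / (z + n)) Filter.atTop (nhds 0) := by
      simp only [one_div]
      exact (Filter.tendsto_atTop_add_const_left _ _ tendsto_natCast_atTop_atTop).inv_tendsto_atTop
    simpa using h1.const_sub (1 / z)
  · intro j
    rw [sub_nonneg]
    apply one_div_le_one_div_of_le <;> linarith [Nat.cast_nonneg (α := ℝ) j]

lemma sq_tail_summable {z : ℝ} (hz : ∀ n : ℤ, z ≠ n) :
    Summable (fun k : ℕ => 1 / (z - k) ^ 2) ∧ Summable (fun j : ℕ => 1 / (z + (j + 1)) ^ 2) := by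
  have h := (cosec_hasSum hz).summable
  constructor
  · exact h.comp_injective (i := fun k : ℕ => (k : ℤ)) Nat.cast_injective |>.congr fun k => by simp
  · refine h.comp_injective (i := fun k : ℕ => (-(k + 1) : ℤ)) ?_ |>.congr fun k => ?_
    · intro a b hab; simpa using hab
    · simp only [Function.comp]; push_cast; ring

lemma cosec_split {z : ℝ} (hz : ∀ n : ℤ, z ≠ n) :
    (∑' k : ℕ, 1 / (z - k) ^ 2) + (∑' j : ℕ, 1 / (z + (j + 1)) ^ 2) = π ^ 2 / Real.sin (π * z) ^ 2 := by
  obtain ⟨h1, h2⟩ := sq_tail_summable hz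
  have h3 := HasSum.of_nat_of_neg_add_one (f := fun n : ℤ => 1 / (z - n) ^ 2)
    (m := ∑' k : ℕ, 1 / (z - k) ^ 2) (m' := ∑' j : ℕ, 1 / (z + (j + 1)) ^ 2)
    (by simpa using h1.hasSum) (by
      refine h2.hasSum.congr_fun fun j => ?_
      push_cast; ring)
  exact h3.unique (cosec_hasSum hz)

lemma G_int {l u : ℝ} (hu : u ≠ 0) :
    ∫ s in (0:ℝ)..l, s * Real.exp (s * u) = (1 - Real.exp (l * u) * (1 - l * u)) / u ^ 2 := by
  have hd : ∀ s ∈ Set.uIcc (0:ℝ) l, HasDerivAt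
      (fun s : ℝ => - (Real.exp (s * u) * (1 - s * u)) / u ^ 2) (s * Real.exp (s * u)) s := by
    intro s _
    have he : HasDerivAt (fun s : ℝ => Real.exp (s * u)) (Real.exp (s * u) * (1 * u)) s :=
      ((hasDerivAt_id _).mul_const u).exp
    have h1 : HasDerivAt (fun s : ℝ => 1 - s * u) (-(1 * u)) s := by
      simpa using ((hasDerivAt_id s).mul_const u).const_sub 1
    refine (((he.mul h1).neg).div_const (u ^ 2)).congr_deriv ?_
    field_simp; ring
  rw [intervalIntegral.integral_eq_sub_of_hasDerivAt hd (Continuous.intervalIntegrable (by fun_prop) _ _)]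
  simp; field_simp; ring

lemma hrn_eq {s : ℝ} : hr (-s) = s * (1 - Real.exp (-s))⁻¹ := by
  rw [hr, ← neg_div_neg_eq, neg_neg, neg_sub, div_eq_mul_inv]

lemma hasSum_geo {s : ℝ} (hs : 0 < s) (z : ℝ) :
    HasSum (fun k : ℕ => s * Real.exp (s * (z - k))) (hr (-s) * Real.exp (s * z)) := by
  have h := (hasSum_geometric_of_lt_one (Real.exp_pos (-s)).le (by simpa using hs)).mul_left s
    |>.mul_right (Real.exp (s * z))
  rw [hrn_eq]
  refine h.congr_fun fun k => ?_
  rw [← Real.exp_nat_mul, mul_assoc, ← Real.exp_add]; congr 2; ring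

lemma G_hasSum {l z : ℝ} (hl : 0 < l) (hz : ∀ n : ℤ, z ≠ n) :
    HasSum (fun k : ℕ => (1 - Real.exp (l * (z - k)) * (1 - l * (z - k))) / (z - k) ^ 2)
      (∫ s in (0:ℝ)..l, hr (-s) * Real.exp (s * z)) ∧
    IntervalIntegrable (fun s => hr (-s) * Real.exp (s * z)) MeasureTheory.volume 0 l := by
  have hcont : Continuous fun s : ℝ => (hc (-(s:ℂ))).re * Real.exp (s * z) := by
    have : Continuous fun s : ℝ => hc (-(s:ℂ)) := by
      rw [continuous_iff_continuousAt]
      intro s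
      refine ContinuousAt.comp (g := hc) (f := fun s : ℝ => -(s:ℂ)) ?_ (by fun_prop)
      refine (hc_differentiableAt ?_).continuousAt
      by_cases h : s = 0
      · right; simp [h]
      · left
        rw [← Complex.ofReal_neg, ← Complex.ofReal_exp]
        intro h'
        have h'' : Real.exp (-s) = 1 := by exact_mod_cast h'
        simp at h''; exact h h''
    exact (Complex.continuous_re.comp this).mul (by fun_prop)
  have hii : IntervalIntegrable (fun s => hr (-s) * Real.exp (s * z)) MeasureTheory.volume 0 l := by
    refine (hcont.intervalIntegrable 0 l).congr ?_
    intro s hs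
    rw [Set.uIoc_of_le hl.le] at hs
    simp only
    rw [← Complex.ofReal_neg, hc_ofReal (by linarith [hs.1]), Complex.ofReal_re]
  refine ⟨?_, hii⟩
  have key := intervalIntegral.hasSum_integral_of_dominated_convergence (a := 0) (b := l)
    (μ := MeasureTheory.volume)
    (F := fun k : ℕ => fun s : ℝ => s * Real.exp (s * (z - k)))
    (f := fun s => hr (-s) * Real.exp (s * z))
    (bound := fun k : ℕ => fun s : ℝ => s * Real.exp (s * (z - k))) ?_ ?_ ?_ ?_ ?_
  · refine key.congr_fun fun k => ?_
    rw [G_int (sub_ne_zero.mpr (by exact_mod_cast hz k))]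
  · intro k
    exact (by fun_prop : Continuous fun s : ℝ => s * Real.exp (s * (z - k))).aestronglyMeasurable
  · intro k
    refine Filter.Eventually.of_forall fun s hs => ?_
    rw [Set.uIoc_of_le hl.le] at hs
    rw [Real.norm_of_nonneg]
    have := hs.1; positivity
  · refine Filter.Eventually.of_forall fun s hs => ?_
    rw [Set.uIoc_of_le hl.le] at hs
    exact (hasSum_geo hs.1 z).summable
  · refine hii.congr ?_
    intro s hs
    rw [Set.uIoc_of_le hl.le] at hs
    exact (hasSum_geo hs.1 z).tsum_eq.symm
  · refine Filter.Eventually.of_forall fun s hs => ?_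
    rw [Set.uIoc_of_le hl.le] at hs
    exact hasSum_geo hs.1 z

lemma int_exp_mul {l z : ℝ} (hz : z ≠ 0) : ∫ s in (0:ℝ)..l, Real.exp (s * z) = (Real.exp (l * z) - 1) / z := by
  rw [intervalIntegral.integral_comp_mul_right (fun s => Real.exp s) hz]; simp; field_simp

lemma H_bounds {l z : ℝ} (hl : 0 < l) (hz0 : 0 < z) (hz : ∀ n : ℤ, z ≠ n) :
    (∫ s in (0:ℝ)..l, hr (-s) * Real.exp (s * z)) ≤ hr (-l) * ((Real.exp (l * z) - 1) / z) ∧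
    hr (-l) * ((Real.exp (l * z) - 1) / z) - (Real.exp (l * z) - 1 - l * z) / z ^ 2
     ≤ (∫ s in (0:ℝ)..l, hr (-s) * Real.exp (s * z)) := by
  have hii := (G_hasSum hl hz).2
  constructor
  · rw [← int_exp_mul hz0.ne', ← intervalIntegral.integral_const_mul]
    apply intervalIntegral.integral_mono_on_of_le_Ioo hl.le hii (Continuous.intervalIntegrable (by fun_prop) _ _)
    intro s hs
    have := hr_antitone (u := -l) (v := -s) (by linarith) (by linarith [hs.1]) (by linarith [hs.2])
    gcongr
  · have e : hr (-l) * ((Real.exp (l * z) - 1) / z) - (Real.exp (l * z) - 1 - l * z) / z ^ 2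
      = ∫ s in (0:ℝ)..l, ((hr (-l) - l) * Real.exp (s * z) + s * Real.exp (s * z)) := by
      rw [intervalIntegral.integral_add (Continuous.intervalIntegrable (by fun_prop) _ _)
        (Continuous.intervalIntegrable (by fun_prop) _ _), intervalIntegral.integral_const_mul,
        G_int hz0.ne', int_exp_mul hz0.ne']
      field_simp; ring
    rw [e]
    apply intervalIntegral.integral_mono_on_of_le_Ioo hl.le (Continuous.intervalIntegrable (by fun_prop) _ _) hii
    intro s hs
    have h1 := hr_antitone (u := s) (v := l) (by linarith [hs.1]) (by linarith) (by linarith [hs.2])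
    rw [hr_neg hl.ne', hr_neg (by linarith [hs.1] : s ≠ 0)]
    have := Real.exp_pos (s * z)
    nlinarith

lemma S_hasSum {l : ℝ} (hl : 0 < l) {z : ℝ} (hz : ∀ n : ℤ, z ≠ n) :
    HasSum (fun k : ℕ => (Real.exp (-l * k) * (1 / (z - k) ^ 2 - l * (1 / (z - k)))))
      (π ^ 2 / Real.sin (π * z) ^ 2 * MK 0 l z - hr (-l) * (1 / z)) := by
  have hs := sin_pi_ne_zero hz
  have hpi := Real.pi_ne_zero
  have h := (MK_hasSum hl hz).mul_left (π ^ 2 / Real.sin (π * z) ^ 2)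
  have e : π ^ 2 / Real.sin (π * z) ^ 2 * MK 0 l z - hr (-l) * (1 / z) = π ^ 2 / Real.sin (π * z) ^ 2 *
    (MK 0 l z - hr (-l) * (Real.sin (π * z) ^ 2 / π ^ 2 * (1 / z))) := by
    generalize Real.sin (π * z) = q at *
    field_simp
  rw [e]
  refine h.congr_fun fun k => ?_
  generalize Real.sin (π * z) = q at *
  field_simp

lemma MK_pos_bounds {l : ℝ} (hl : 0 < l) {z : ℝ} (hz0 : 0 < z) (hz : ∀ n : ℤ, z ≠ n) :
    Real.exp (-l * z) ≤ MK 0 l z ∧ MK 1 l z ≤ Real.exp (-l * z) := by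
  rw [MK_one hl hz0.ne']
  have hs := sin_pi_ne_zero hz
  have hpi := Real.pi_pos
  have hS := S_hasSum hl hz
  have hG := (G_hasSum hl hz).1
  obtain ⟨b1, b2⟩ := H_bounds hl hz0 hz
  obtain ⟨s1, s2⟩ := sq_tail_summable hz
  have hsplit := cosec_split hz
  set I := ∫ s in (0:ℝ)..l, hr (-s) * Real.exp (s * z)
  set C := ∑' k : ℕ, 1 / (z - k) ^ 2
  set P := ∑' j : ℕ, 1 / (z + (j + 1)) ^ 2
  set E := Real.exp (l * z) with hE
  have hE0 : 0 < E := Real.exp_pos _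
  have hEn : Real.exp (-l * z) = 1 / E := by rw [neg_mul, Real.exp_neg, hE, one_div]
  -- combine
  have hC : C = I + E * (π ^ 2 / Real.sin (π * z) ^ 2 * MK 0 l z - hr (-l) * (1 / z)) := by
    refine s1.hasSum.unique ((hG.add (hS.mul_left E)).congr_fun fun k => ?_)
    have hzk : z - k ≠ 0 := sub_ne_zero.mpr (by exact_mod_cast hz k)
    have : Real.exp (l * (z - k)) = E * Real.exp (-l * k) := by
      rw [hE, ← Real.exp_add]; congr 1; ring
    rw [this]
    field_simp
    ring
  have hP1 : P ≤ 1 / z := by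
    refine hasSum_le (fun j => ?_) s2.hasSum (tele_hasSum hz0)
    have : 0 < z + j := by positivity
    rw [div_sub_div _ _ this.ne' (by positivity), div_le_div_iff₀ (by positivity) (by positivity)]
    nlinarith
  have hP2 : 1 / z ≤ 1 / z ^ 2 + P := by
    have h0 : Summable fun j : ℕ => 1 / (z + j) ^ 2 := by
      rw [← summable_nat_add_iff 1]
      refine s2.congr fun j => ?_
      push_cast; rfl
    have h1 : 1 / z ^ 2 + P = ∑' j : ℕ, 1 / (z + j) ^ 2 := by
      rw [h0.tsum_eq_zero_add]; simp [P]
    rw [h1]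
    refine hasSum_le (fun j => ?_) (tele_hasSum hz0) h0.hasSum
    have : 0 < z + j := by positivity
    rw [div_sub_div _ _ this.ne' (by positivity), div_le_div_iff₀ (by positivity) (by positivity)]
    nlinarith
  have hh1 : 1 ≤ hr (-l) := by
    rw [hr_neg hl.ne']
    have := Real.add_one_le_exp (-l)
    have h2 : 1 < Real.exp l := by simpa using hl
    rw [hr, div_add' _ _ _ (by linarith), le_div_iff₀ (by linarith)]
    have h3 : Real.exp l * Real.exp (-l) = 1 := by rw [← Real.exp_add]; simp
    nlinarith [Real.exp_pos l]
  have hh2 := hr_le_one hl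
  have hh3 := hr_neg hl.ne'
  set q := π ^ 2 / Real.sin (π * z) ^ 2 with hq
  have hq0 : 0 < q := by positivity
  have hqi : Real.sin (π * z) ^ 2 / π ^ 2 = 1 / q := by rw [hq]; field_simp
  have e1 : E * (q * MK 0 l z) = hr (-l) * (E / z) + C - I := by rw [hC]; ring
  have hz1 : hr (-l) * ((E - 1) / z) = hr (-l) * (E / z) - hr (-l) * (1 / z) := by ring
  have hiz : 0 < 1 / z := by positivity
  rw [hEn, hqi]
  constructor
  · rw [div_le_iff₀ hE0]
    have h1 : q ≤ E * (q * MK 0 l z) := by rw [e1]; nlinarith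
    have h2 : q * 1 ≤ q * (MK 0 l z * E) := by linarith [mul_comm E (q * MK 0 l z), mul_assoc q (MK 0 l z) E]
    exact le_of_mul_le_mul_left h2 hq0
  · rw [le_div_iff₀ hE0]
    have h3 : (E - 1 - l * z) / z ^ 2 = E * (1 / z ^ 2) - 1 / z ^ 2 - l * (1 / z) := by
      field_simp
    have h1 : E * (q * MK 0 l z) ≤ q + E * (1 / z ^ 2) := by rw [e1]; nlinarith
    have h2 : q * ((MK 0 l z - 1 / q * (1 / z ^ 2)) * E) ≤ q * 1 := by
      have : q * ((MK 0 l z - 1 / q * (1 / z ^ 2)) * E) = E * (q * MK 0 l z) - E * (1 / z ^ 2) := by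
        field_simp
      rw [this]; linarith
    exact le_of_mul_le_mul_left h2 hq0

lemma MK_neg_bounds {l : ℝ} (hl : 0 < l) {z : ℝ} (hz0 : z < 0) (hz : ∀ n : ℤ, z ≠ n) :
    0 ≤ MK 0 l z ∧ MK 1 l z ≤ 0 := by
  rw [MK_one hl hz0.ne]
  have hs := sin_pi_ne_zero hz
  have hpi := Real.pi_pos
  have hS := S_hasSum hl hz
  obtain ⟨y, rfl⟩ : ∃ y, z = -y := ⟨-z, by ring⟩
  have hy : 0 < y := by linarith
  set q := π ^ 2 / Real.sin (π * -y) ^ 2 with hq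
  have hq0 : 0 < q := by positivity
  have hqi : Real.sin (π * -y) ^ 2 / π ^ 2 = 1 / q := by rw [hq]; field_simp
  rw [hqi]
  have hx : 0 < Real.exp l - 1 := by
    have : 1 < Real.exp l := by simpa using hl
    linarith
  have hgeo := summable_geometric_of_lt_one (Real.exp_pos (-l)).le (by simpa using hl : Real.exp (-l) < 1)
  have hek : ∀ k : ℕ, Real.exp (-l * k) = Real.exp (-l) ^ k := fun k => by
    rw [← Real.exp_nat_mul]; congr 1; ring
  have hA : Summable fun k : ℕ => Real.exp (-l * k) * (1 / (y + k)) := by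
    refine Summable.of_nonneg_of_le (fun k => by positivity) (fun k => ?_) (hgeo.mul_right (1 / y))
    rw [hek]; gcongr; simp
  have hB : Summable fun k : ℕ => Real.exp (-l * k) * (1 / (y + k) ^ 2) := by
    refine Summable.of_nonneg_of_le (fun k => by positivity) (fun k => ?_) (hgeo.mul_right (1 / y ^ 2))
    rw [hek]; gcongr; simp
  set A := ∑' k : ℕ, Real.exp (-l * k) * (1 / (y + k)) with hAd
  set B := ∑' k : ℕ, Real.exp (-l * k) * (1 / (y + k) ^ 2) with hBd
  have e1 : q * MK 0 l (-y) - hr (-l) * (1 / -y) = B + l * A := by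
    refine hS.unique ((hB.hasSum.add (hA.hasSum.mul_left l)).congr_fun fun k => ?_)
    have : -y - (k:ℝ) = -(y + k) := by ring
    rw [this, neg_sq, one_div_neg_eq_neg_one_div]; ring
  have hA' : HasSum (fun k : ℕ => Real.exp (-l * k) * (1 / (y + k + 1))) (Real.exp l * (A - 1 / y)) := by
    have h1 := (hasSum_nat_add_iff' 1).mpr hA.hasSum
    have h2 := h1.mul_left (Real.exp l)
    simp only [sum_range_one, Nat.cast_zero, mul_zero, Real.exp_zero, one_mul, add_zero] at h2
    refine h2.congr_fun fun k => ?_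
    rw [← mul_assoc, ← Real.exp_add]; push_cast
    rw [← add_assoc]; congr 2; ring
  have hB' : HasSum (fun k : ℕ => Real.exp (-l * (k + 1 : ℕ)) * (1 / (y + (k + 1 : ℕ)) ^ 2)) (B - 1 / y ^ 2) := by
    have h1 := (hasSum_nat_add_iff' 1).mpr hB.hasSum
    rw [← hBd] at h1
    simpa only [sum_range_one, Nat.cast_zero, mul_zero, Real.exp_zero, one_mul, add_zero] using h1
  have hD := (hA.hasSum.sub hA').mul_left (hr l)
  have hDe : hr l * (A - Real.exp l * (A - 1 / y)) = - l * A + hr (-l) * (1 / y) := by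
    rw [hr_neg hl.ne', hr]; field_simp; ring
  rw [hDe] at hD
  have e2 : q * MK 0 l (-y) = B - (- l * A + hr (-l) * (1 / y)) := by
    rw [one_div_neg_eq_neg_one_div] at e1; linarith
  have hh1 := hr_le_one hl
  have hh2 := exp_neg_le_hr hl
  have hh0 := hr_pos hl
  constructor
  · have : 0 ≤ q * MK 0 l (-y) := by
      rw [e2, sub_nonneg]
      refine hasSum_le (fun k => ?_) hD hB.hasSum
      have hyk : 0 < y + k := by positivity
      rw [← mul_sub, mul_left_comm]
      apply mul_le_mul_of_nonneg_left _ (Real.exp_pos _).le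
      have h4 : 1 / (y + k) - 1 / (y + k + 1) ≤ 1 / (y + k) ^ 2 := by
        rw [div_sub_div _ _ hyk.ne' (by positivity), div_le_div_iff₀ (by positivity) (by positivity)]
        nlinarith
      have h5 : 0 ≤ 1 / (y + k) - 1 / (y + k + 1) := by
        rw [sub_nonneg]; apply one_div_le_one_div_of_le hyk; linarith
      nlinarith
    exact nonneg_of_mul_nonneg_right this hq0
  · have h6 : q * MK 0 l (-y) ≤ 1 / y ^ 2 := by
      have : B - 1 / y ^ 2 ≤ (- l * A + hr (-l) * (1 / y)) := by
        refine hasSum_le (fun k => ?_) hB' hD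
        have hyk : 0 < y + k := by positivity
        rw [← mul_sub, mul_left_comm]
        have : Real.exp (-l * (k + 1 : ℕ)) = Real.exp (-l * k) * Real.exp (-l) := by
          rw [← Real.exp_add]; push_cast; congr 1; ring
        rw [this, mul_assoc]
        apply mul_le_mul_of_nonneg_left _ (Real.exp_pos _).le
        have h4 : 1 / (y + (k + 1 : ℕ)) ^ 2 ≤ 1 / (y + k) - 1 / (y + k + 1) := by
          push_cast
          rw [div_sub_div _ _ hyk.ne' (by positivity), div_le_div_iff₀ (by positivity) (by positivity)]
          nlinarith
        have h5 : 0 ≤ 1 / (y + (k + 1 : ℕ)) ^ 2 := by positivity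
        exact mul_le_mul hh2 h4 h5 hh0.le
      linarith
    rw [neg_sq]
    have : q * (MK 0 l (-y) - 1 / q * (1 / y ^ 2)) ≤ 0 := by
      have : q * (MK 0 l (-y) - 1 / q * (1 / y ^ 2)) = q * MK 0 l (-y) - 1 / y ^ 2 := by field_simp
      linarith
    exact nonpos_of_mul_nonpos_right this hq0

/-- The majorant/minorant property. -/
noncomputable def EK (l z : ℝ) : ℝ := if 0 ≤ z then Real.exp (-l * z) else 0

lemma MK_bounds {l : ℝ} (hl : 0 < l) (z : ℝ) : EK l z ≤ MK 0 l z ∧ MK 1 l z ≤ EK l z := by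
  have hni : ∀ z : ℝ, (∀ n : ℤ, z ≠ n) → EK l z ≤ MK 0 l z ∧ MK 1 l z ≤ EK l z := by
    intro z hz
    unfold EK
    have hz0 : z ≠ 0 := by exact_mod_cast hz 0
    rcases lt_or_gt_of_ne hz0 with h | h
    · rw [if_neg (by linarith)]; exact MK_neg_bounds hl h hz
    · rw [if_pos h.le]; exact MK_pos_bounds hl h hz
  by_cases hz : ∀ n : ℤ, z ≠ n
  · exact hni z hz
  push Not at hz
  obtain ⟨n, rfl⟩ := hz
  have hev : ∀ᶠ w in nhdsWithin (n:ℝ) (Set.Ioi n), EK l w ≤ MK 0 l w ∧ MK 1 l w ≤ EK l w := by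
    have : Set.Ioo (n:ℝ) (n + 1) ∈ nhdsWithin (n:ℝ) (Set.Ioi n) := Ioo_mem_nhdsGT (by linarith)
    filter_upwards [this] with w hw
    apply hni
    rintro m rfl
    have h1 : n < m := by exact_mod_cast hw.1
    have h2 : m < n + 1 := by exact_mod_cast hw.2
    omega
  have hE : Filter.Tendsto (EK l) (nhdsWithin (n:ℝ) (Set.Ioi n)) (nhds (EK l n)) := by
    rcases lt_or_ge n 0 with h | h
    · have h' : (n:ℝ) < 0 := by exact_mod_cast h
      have e : EK l n = 0 := by unfold EK; rw [if_neg (by linarith)]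
      rw [e]
      refine tendsto_const_nhds.congr' ?_
      have : Set.Ioo (n:ℝ) 0 ∈ nhdsWithin (n:ℝ) (Set.Ioi n) := Ioo_mem_nhdsGT h'
      filter_upwards [this] with w hw
      unfold EK; rw [if_neg (by linarith [hw.2])]
    · have h' : (0:ℝ) ≤ n := by exact_mod_cast h
      have e : EK l n = Real.exp (-l * n) := by unfold EK; rw [if_pos h']
      rw [e]
      have hc : Filter.Tendsto (fun w => Real.exp (-l * w)) (nhdsWithin (n:ℝ) (Set.Ioi n)) (nhds (Real.exp (-l * n))) :=
        (by fun_prop : Continuous fun w => Real.exp (-l * w)).continuousAt.tendsto.mono_left nhdsWithin_le_nhds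
      refine hc.congr' ?_
      filter_upwards [self_mem_nhdsWithin] with w hw
      have : (n:ℝ) < w := hw
      unfold EK; rw [if_pos (by linarith)]
  have hM : ∀ b, Filter.Tendsto (MK b l) (nhdsWithin (n:ℝ) (Set.Ioi n)) (nhds (MK b l n)) := fun b =>
    (continuous_MK hl).continuousAt.tendsto.mono_left nhdsWithin_le_nhds
  exact ⟨le_of_tendsto_of_tendsto hE (hM 0) (hev.mono fun w h => h.1),
    le_of_tendsto_of_tendsto (hM 1) hE (hev.mono fun w h => h.2)⟩
end PS
end

section
open Real Finset
namespace PS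
open HurwitzZeta

lemma one_le_evenKernel {t : ℝ} (ht : 0 < t) : 1 ≤ evenKernel 0 t := by
  have h := hasSum_int_evenKernel₀ 0 ht
  have h2 : 0 ≤ evenKernel ((0:ℝ) : UnitAddCircle) t - if ((0:ℝ) : UnitAddCircle) = 0 then 1 else 0 := by
    refine h.nonneg fun n => ?_
    split_ifs <;> positivity
  simp at h2
  exact h2

noncomputable def rM (x : ℝ) : ℝ := ((hurwitzEvenFEPair 0).f_modif x).re

lemma rM_spec {x : ℝ} (hx : 0 < x) : (hurwitzEvenFEPair 0).f_modif x = (rM x : ℂ) ∧ 0 ≤ rM x := by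
  have key : ∃ r : ℝ, (hurwitzEvenFEPair 0).f_modif x = (r : ℂ) ∧ 0 ≤ r := by
    rw [WeakFEPair.f_modif, Pi.add_apply]
    rcases lt_trichotomy x 1 with h | h | h
    · rw [Set.indicator_of_notMem (by simp; linarith), Set.indicator_of_mem (by exact ⟨hx, h⟩)]
      refine ⟨evenKernel 0 x - x ^ (-(1/2:ℝ)), ?_, ?_⟩
      · simp [hurwitzEvenFEPair]
      · have h1 := evenKernel_functional_equation 0 x
        rw [← evenKernel_eq_cosKernel_of_zero] at h1
        have h2 := one_le_evenKernel (t := 1 / x) (by positivity)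
        rw [h1, Real.rpow_neg hx.le, ← one_div]
        have : 0 < 1 / x ^ (1/2:ℝ) := by positivity
        nlinarith
    · refine ⟨0, ?_, le_refl _⟩
      rw [Set.indicator_of_notMem (by simp; linarith), Set.indicator_of_notMem (by simp; intro _; linarith)]
      simp
    · rw [Set.indicator_of_mem (by simpa using h), Set.indicator_of_notMem (by simp; intro _; linarith)]
      refine ⟨evenKernel 0 x - 1, ?_, ?_⟩
      · simp [hurwitzEvenFEPair]
      · linarith [one_le_evenKernel hx]
  obtain ⟨r, h1, h2⟩ := key
  have : rM x = r := by rw [rM, h1, Complex.ofReal_re]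
  rw [this]; exact ⟨h1, h2⟩

lemma Lam0_conv (s : ℂ) : MellinConvergent (hurwitzEvenFEPair 0).f_modif s :=
  ((hurwitzEvenFEPair 0).isStrongFEPair_toStrongFEPair.hasMellin s).1

lemma Lam0_eq (s : ℂ) : completedRiemannZeta₀ s =
    (∫ t in Set.Ioi (0:ℝ), (t : ℂ) ^ (s / 2 - 1) * (rM t : ℂ)) / 2 := by
  rw [completedRiemannZeta₀, completedHurwitzZetaEven₀, WeakFEPair.Λ₀, mellin]
  congr 1
  apply MeasureTheory.setIntegral_congr_fun measurableSet_Ioi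
  intro t ht
  simp only [smul_eq_mul]
  rw [(rM_spec ht).1]

/-- Real version of `Λ₀`. -/
noncomputable def Lr (σ : ℝ) : ℝ := (∫ t in Set.Ioi (0:ℝ), t ^ (σ / 2 - 1) * rM t) / 2

lemma Lr_int (σ : ℝ) : MeasureTheory.IntegrableOn (fun t : ℝ => t ^ (σ / 2 - 1) * rM t) (Set.Ioi 0) := by
  have h := (Lam0_conv (σ / 2)).norm
  refine MeasureTheory.IntegrableOn.congr_fun h ?_ measurableSet_Ioi
  intro t ht
  have h1 := rM_spec ht
  simp only [smul_eq_mul]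
  rw [norm_mul, h1.1, Complex.norm_cpow_eq_rpow_re_of_pos ht, Complex.norm_real, Real.norm_of_nonneg h1.2]
  congr 2
  simp

lemma Lam0_ofReal (σ : ℝ) : completedRiemannZeta₀ σ = (Lr σ : ℂ) := by
  rw [Lam0_eq, Lr]
  push_cast
  congr 1
  refine Eq.trans ?_ integral_complex_ofReal
  apply MeasureTheory.setIntegral_congr_fun measurableSet_Ioi
  intro t ht
  simp only
  push_cast
  rw [Complex.ofReal_cpow (le_of_lt ht)]
  push_cast; rfl

lemma norm_Lam0_le (s : ℂ) : ‖completedRiemannZeta₀ s‖ ≤ Lr s.re := by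
  rw [Lam0_eq, Lr, norm_div, Complex.norm_ofNat]
  gcongr
  refine (MeasureTheory.norm_integral_le_integral_norm _).trans (le_of_eq ?_)
  apply MeasureTheory.setIntegral_congr_fun measurableSet_Ioi
  intro t ht
  have h1 := rM_spec ht
  simp only
  rw [norm_mul, Complex.norm_cpow_eq_rpow_re_of_pos ht, Complex.norm_real, Real.norm_of_nonneg h1.2]
  congr 2
  simp

lemma Lr_nonneg (σ : ℝ) : 0 ≤ Lr σ := by
  have := norm_Lam0_le (σ : ℂ)
  exact (norm_nonneg _).trans (by simpa using this)

lemma Lr_one : Lr 1 = (Real.eulerMascheroniConstant - Real.log (4 * π)) / 2 + 1 := by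
  have h := Lam0_ofReal 1
  rw [Complex.ofReal_one, completedRiemannZeta₀_one] at h
  have h2 : Complex.log (4 * π) = (Real.log (4 * π) : ℂ) := by
    rw [Complex.ofReal_log (by positivity)]; push_cast; rfl
  rw [h2] at h
  exact_mod_cast h.symm

lemma Lr_symm (σ : ℝ) : Lr (1 - σ) = Lr σ := by
  have h := completedRiemannZeta₀_one_sub (σ : ℂ)
  rw [Lam0_ofReal, show (1 - σ : ℂ) = ((1 - σ : ℝ) : ℂ) by push_cast; ring, Lam0_ofReal] at h
  exact_mod_cast h

lemma Lr_convex {a b c : ℝ} (h1 : a ≤ b) (h2 : b ≤ c) : Lr b ≤ Lr a + Lr c := by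
  unfold Lr
  rw [← add_div, ← MeasureTheory.integral_add (Lr_int a) (Lr_int c)]
  apply div_le_div_of_nonneg_right _ (by norm_num)
  apply MeasureTheory.setIntegral_mono_on (Lr_int b) ((Lr_int a).add (Lr_int c)) measurableSet_Ioi
  intro t ht
  have ht' : (0:ℝ) < t := ht
  have h3 := (rM_spec ht).2
  simp only [Pi.add_apply]
  rw [← add_mul]
  gcongr
  rcases le_total 1 t with h | h
  · have := Real.rpow_le_rpow_of_exponent_le h (by linarith : b / 2 - 1 ≤ c / 2 - 1)
    have := Real.rpow_pos_of_pos ht' (a / 2 - 1)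
    linarith
  · have := Real.rpow_le_rpow_of_exponent_ge ht' h (by linarith : a / 2 - 1 ≤ b / 2 - 1)
    have := Real.rpow_pos_of_pos ht' (c / 2 - 1)
    linarith

lemma Lr_le_one {σ : ℝ} (h0 : 0 ≤ σ) (h1 : σ ≤ 1) : Lr σ ≤ Lr 1 := by
  have e : Lr 1 = (1 - σ) * Lr 0 + σ * Lr 1 := by
    have := Lr_symm 0; rw [sub_zero] at this; rw [this]; ring
  rw [e]
  unfold Lr
  rw [← mul_div_assoc, ← mul_div_assoc, ← add_div, ← MeasureTheory.integral_const_mul,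
    ← MeasureTheory.integral_const_mul,
    ← MeasureTheory.integral_add ((Lr_int 0).const_mul _) ((Lr_int 1).const_mul _)]
  apply div_le_div_of_nonneg_right _ (by norm_num)
  apply MeasureTheory.setIntegral_mono_on (Lr_int σ) (((Lr_int 0).const_mul _).add ((Lr_int 1).const_mul _)) measurableSet_Ioi
  intro t ht
  have ht' : (0:ℝ) < t := ht
  have h3 := (rM_spec ht).2
  simp only [Pi.add_apply]
  rw [← mul_assoc, ← mul_assoc, ← add_mul]
  gcongr
  have := Real.geom_mean_le_arith_mean2_weighted (w₁ := 1 - σ) (w₂ := σ)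
    (p₁ := t ^ ((0:ℝ) / 2 - 1)) (p₂ := t ^ ((1:ℝ) / 2 - 1)) (by linarith) h0
    (by positivity) (by positivity) (by ring)
  rw [← Real.rpow_mul ht'.le, ← Real.rpow_mul ht'.le, ← Real.rpow_add ht'] at this
  have e2 : σ / 2 - 1 = (0 / 2 - 1) * (1 - σ) + (1 / 2 - 1) * σ := by ring
  rw [e2]; exact this

lemma Lam0_conj (s : ℂ) : completedRiemannZeta₀ (starRingEnd ℂ s) = starRingEnd ℂ (completedRiemannZeta₀ s) := by
  rw [Lam0_eq, Lam0_eq, map_div₀, ← integral_conj]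
  congr 1
  · apply MeasureTheory.setIntegral_congr_fun measurableSet_Ioi
    intro t ht
    have ht' : (0:ℝ) < t := ht
    simp only [map_mul, Complex.conj_ofReal]
    congr 1
    have e : (starRingEnd ℂ) s / 2 - 1 = (starRingEnd ℂ) (s / 2 - 1) := by
      rw [map_sub, map_div₀, map_one, map_ofNat]
    rw [e, Complex.cpow_conj, Complex.conj_ofReal]
    · rw [Complex.arg_ofReal_of_nonneg ht'.le]; exact Real.pi_pos.ne
  · rw [map_ofNat]
end PS
end

section
open Real Finset
namespace PS

noncomputable def xi (s : ℂ) : ℂ := 1 + s * (s - 1) * completedRiemannZeta₀ s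

lemma differentiable_xi : Differentiable ℂ xi := by
  unfold xi
  have := differentiable_completedZeta₀
  fun_prop

lemma xi_one_sub (s : ℂ) : xi (1 - s) = xi s := by
  unfold xi; rw [completedRiemannZeta₀_one_sub]; ring

lemma xi_conj (s : ℂ) : xi (starRingEnd ℂ s) = starRingEnd ℂ (xi s) := by
  unfold xi; rw [Lam0_conj]; simp

lemma xi_zero : xi 0 = 1 := by simp [xi]
lemma xi_one : xi 1 = 1 := by simp [xi]

lemma xi_eq {s : ℂ} (h0 : s ≠ 0) (h1 : s ≠ 1) : xi s = s * (s - 1) * completedRiemannZeta s := by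
  have h2 : s - 1 ≠ 0 := sub_ne_zero.2 h1
  have h3 : 1 - s ≠ 0 := sub_ne_zero.2 (Ne.symm h1)
  rw [xi, completedRiemannZeta_eq]
  field_simp
  ring

lemma xi_eq_zeta {s : ℂ} (h0 : s ≠ 0) (h1 : s ≠ 1) (h2 : Complex.Gammaℝ s ≠ 0) :
    xi s = s * (s - 1) * (Complex.Gammaℝ s * riemannZeta s) := by
  rw [xi_eq h0 h1, riemannZeta_def_of_ne_zero h0]
  field_simp

lemma xi_ne_zero_of_one_le_re {s : ℂ} (h : 1 ≤ s.re) : xi s ≠ 0 := by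
  by_cases h1 : s = 1
  · rw [h1, xi_one]; exact one_ne_zero
  have h0 : s ≠ 0 := by rintro rfl; simp at h; linarith
  have hG : Complex.Gammaℝ s ≠ 0 := Complex.Gammaℝ_ne_zero_of_re_pos (by linarith)
  rw [xi_eq_zeta h0 h1 hG]
  have := riemannZeta_ne_zero_of_one_le_re h
  have h2 : s - 1 ≠ 0 := sub_ne_zero.2 h1
  positivity

lemma xi_ne_zero_of_re_nonpos {s : ℂ} (h : s.re ≤ 0) : xi s ≠ 0 := by
  rw [← xi_one_sub]; apply xi_ne_zero_of_one_le_re; simp; linarith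

lemma xi_zero_re {s : ℂ} (h : xi s = 0) : 0 < s.re ∧ s.re < 1 := by
  constructor <;> by_contra! h1
  · exact xi_ne_zero_of_re_nonpos h1 h
  · exact xi_ne_zero_of_one_le_re h1 h

lemma zeta_zero_of_xi {s : ℂ} (h : xi s = 0) : riemannZeta s = 0 := by
  obtain ⟨h1, h2⟩ := xi_zero_re h
  have h0 : s ≠ 0 := by rintro rfl; simp at h1
  have h3 : s ≠ 1 := by rintro rfl; simp at h2
  have hG : Complex.Gammaℝ s ≠ 0 := Complex.Gammaℝ_ne_zero_of_re_pos h1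
  rw [xi_eq_zeta h0 h3 hG] at h
  have h4 : s - 1 ≠ 0 := sub_ne_zero.2 h3
  simpa [h0, h4, hG] using h

lemma xi_zero_norm {s : ℂ} (h : xi s = 0) : 1 ≤ ‖s‖ * ‖s - 1‖ * Lr 1 := by
  obtain ⟨h1, h2⟩ := xi_zero_re h
  have e : s * (s - 1) * completedRiemannZeta₀ s = -1 := by
    unfold xi at h; linear_combination h
  have e2 := congrArg norm e
  rw [norm_mul, norm_mul, norm_neg, norm_one] at e2
  calc (1:ℝ) = ‖s‖ * ‖s - 1‖ * ‖completedRiemannZeta₀ s‖ := e2.symm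
    _ ≤ _ := by
      gcongr
      exact (norm_Lam0_le s).trans (Lr_le_one h1.le h2.le)

/-! growth -/
lemma zeta_nat_norm_le {k : ℕ} (hk : 2 ≤ k) : ‖riemannZeta k‖ ≤ 2 := by
  rw [zeta_nat_eq_tsum_of_gt_one (by omega)]
  have hs := hasSum_zeta_two
  have hle : ∀ n : ℕ, ‖(1 / (n:ℂ) ^ k)‖ ≤ 1 / (n:ℝ) ^ 2 := by
    intro n
    rw [norm_div, norm_one, norm_pow, Complex.norm_natCast]
    rcases Nat.eq_zero_or_pos n with rfl | hn
    · have : k ≠ 0 := by omega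
      simp [this]
    · have : (1:ℝ) ≤ n := by exact_mod_cast hn
      gcongr
  have h1 := tsum_of_norm_bounded hs hle
  refine h1.trans ?_
  have := Real.pi_lt_d2
  nlinarith [Real.pi_pos]

lemma Lr_even_le {k : ℕ} (hk : 1 ≤ k) : Lr (2 * k) ≤ 3 * (k:ℝ) ^ k := by
  have hk' : (1:ℝ) ≤ k := by exact_mod_cast hk
  have h0 : ((2 * k : ℝ) : ℂ) ≠ 0 := by
    rw [Complex.ofReal_ne_zero]; positivity
  have e := completedRiemannZeta_eq ((2 * k : ℝ) : ℂ)
  have hG : Complex.Gammaℝ ((2 * k : ℝ) : ℂ) ≠ 0 :=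
    Complex.Gammaℝ_ne_zero_of_re_pos (by simp; positivity)
  have e2 := riemannZeta_def_of_ne_zero h0
  rw [eq_div_iff hG] at e2
  rw [← e2, Lam0_ofReal] at e
  have e3 : (Lr (2 * k) : ℂ) = riemannZeta ((2 * k : ℝ) : ℂ) * Complex.Gammaℝ ((2 * k : ℝ) : ℂ)
    + 1 / ((2 * k : ℝ) : ℂ) + 1 / (1 - ((2 * k : ℝ) : ℂ)) := by rw [e]; ring
  have e4 := congrArg norm e3
  rw [Complex.norm_real, Real.norm_of_nonneg (Lr_nonneg _)] at e4
  have hz : ‖riemannZeta ((2 * k : ℝ) : ℂ)‖ ≤ 2 := by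
    have := zeta_nat_norm_le (k := 2 * k) (by omega)
    push_cast at this ⊢; exact this
  have hg : ‖Complex.Gammaℝ ((2 * k : ℝ) : ℂ)‖ ≤ (k:ℝ) ^ k / 2 := by
    rw [Complex.Gammaℝ_def, norm_mul]
    have ek : ((2 * k : ℝ) : ℂ) / 2 = ((k - 1 : ℕ) : ℂ) + 1 := by
      push_cast [Nat.cast_sub hk]; ring
    have ek2 : -((2 * k : ℝ) : ℂ) / 2 = ((-(k:ℝ) : ℝ) : ℂ) := by push_cast; ring
    rw [ek, Complex.Gamma_nat_eq_factorial, Complex.norm_natCast, ek2,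
      Complex.norm_cpow_eq_rpow_re_of_pos Real.pi_pos, Complex.ofReal_re, Real.rpow_neg Real.pi_pos.le]
    have h1 : ((Nat.factorial (k - 1) : ℕ) : ℝ) ≤ (k:ℝ) ^ k := by
      have h2 : Nat.factorial (k - 1) ≤ Nat.factorial k := Nat.factorial_le (by omega)
      exact_mod_cast h2.trans (Nat.factorial_le_pow k)
    have h3 : (π ^ (k:ℝ))⁻¹ ≤ 1 / 2 := by
      rw [Real.rpow_natCast, ← one_div]
      apply one_div_le_one_div_of_le (by norm_num)
      calc (2:ℝ) ≤ π := Real.two_le_pi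
        _ = π ^ 1 := (pow_one _).symm
        _ ≤ π ^ k := pow_le_pow_right₀ (by linarith [Real.two_le_pi]) hk
    calc (π ^ (k:ℝ))⁻¹ * ((Nat.factorial (k - 1) : ℕ) : ℝ) ≤ 1 / 2 * (k:ℝ)^k := by gcongr
      _ = _ := by ring
  have h5 : ‖1 / ((2 * k : ℝ) : ℂ)‖ ≤ 1 := by
    rw [norm_div, norm_one, Complex.norm_real, Real.norm_of_nonneg (by positivity), div_le_one (by positivity)]
    linarith
  have h6 : ‖1 / (1 - ((2 * k : ℝ) : ℂ))‖ ≤ 1 := by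
    have : (1 - ((2 * k : ℝ) : ℂ)) = ((1 - 2 * k : ℝ) : ℂ) := by push_cast; ring
    rw [this, norm_div, norm_one, Complex.norm_real, div_le_one]
    · rw [Real.norm_eq_abs, abs_of_neg (by linarith)]; linarith
    · rw [Real.norm_eq_abs, abs_of_neg (by linarith)]; linarith
  have hkk : (1:ℝ) ≤ (k:ℝ) ^ k := one_le_pow₀ hk'
  rw [e4]
  calc _ ≤ ‖riemannZeta ((2 * k : ℝ) : ℂ)‖ * ‖Complex.Gammaℝ ((2 * k : ℝ) : ℂ)‖ + 1 + 1 := by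
        refine (norm_add_le _ _).trans (add_le_add ((norm_add_le _ _).trans ?_) h6)
        rw [norm_mul]; gcongr
    _ ≤ 2 * ((k:ℝ) ^ k / 2) + 1 + 1 := by gcongr
    _ ≤ _ := by linarith

lemma xi_growth : ∃ C : ℝ, 0 < C ∧ ∀ R : ℝ, 1 ≤ R → ∀ z : ℂ, ‖z‖ ≤ R →
    ‖xi (1 / 2 + z)‖ ≤ Real.exp (C * (R * √R)) := by
  refine ⟨100, by norm_num, fun R hR z hz => ?_⟩
  obtain ⟨k, hk1, hk2⟩ : ∃ k : ℕ, R + 1 ≤ 2 * k ∧ (k:ℝ) ≤ 2 * R := by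
    refine ⟨⌈(R + 1) / 2⌉₊, ?_, ?_⟩
    · linarith [Nat.le_ceil ((R + 1) / 2)]
    · have := Nat.ceil_lt_add_one (show 0 ≤ (R + 1) / 2 by linarith)
      nlinarith [this]
  have hk : 1 ≤ k := by
    by_contra! h; have : k = 0 := by omega
    subst this; simp at hk1; linarith
  have hk' : (1:ℝ) ≤ k := by exact_mod_cast hk
  have hre := abs_le.1 ((Complex.abs_re_le_norm z).trans hz)
  have hL : Lr (1 / 2 + z).re ≤ 6 * (k:ℝ) ^ k := by
    have h1 := Lr_convex (a := 1 - 2 * k) (b := (1 / 2 + z).re) (c := 2 * k) (by simp; linarith) (by simp; linarith)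
    rw [Lr_symm] at h1
    linarith [Lr_even_le hk]
  have hkk : (k:ℝ) ^ k ≤ Real.exp (8 * (R * √R)) := by
    have hs : 0 < √R := by positivity
    have hlog : Real.log k ≤ 4 * √R := by
      have h1 : Real.log k ≤ Real.log (2 * R) := Real.log_le_log (by linarith) hk2
      have h2 : Real.log (2 * R) = Real.log 2 + 2 * Real.log (√R) := by
        rw [Real.log_mul (by norm_num) (by linarith), Real.log_sqrt (by linarith)]; ring
      have h3 := Real.log_le_sub_one_of_pos hs
      have h4 := Real.log_two_lt_d9
      have : 1 ≤ √R := Real.one_le_sqrt.2 hR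
      linarith
    rw [← Real.rpow_natCast, Real.rpow_def_of_pos (by linarith)]
    apply Real.exp_le_exp.2
    calc Real.log k * k ≤ 4 * √R * (2 * R) := by gcongr
      _ = _ := by ring
  have hs1 : 1 ≤ √R := Real.one_le_sqrt.2 hR
  have hRR : R ≤ R * √R := le_mul_of_one_le_right (by linarith) hs1
  have n1 : ‖(1 / 2 + z)‖ ≤ 2 * R := by
    refine (norm_add_le _ _).trans ?_
    have : ‖(1 / 2 : ℂ)‖ = 1 / 2 := by norm_num
    linarith
  have n2 : ‖(1 / 2 + z - 1)‖ ≤ 2 * R := by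
    rw [show (1 / 2 + z - 1) = z - 1 / 2 by ring]
    refine (norm_sub_le _ _).trans ?_
    have : ‖(1 / 2 : ℂ)‖ = 1 / 2 := by norm_num
    linarith
  have hR2 : R ≤ Real.exp (R * √R) := by linarith [Real.add_one_le_exp (R * √R)]
  have hE : (1:ℝ) ≤ Real.exp (R * √R) := by linarith
  set E := Real.exp (R * √R) with hEd
  have hE8 : Real.exp (8 * (R * √R)) = E ^ 8 := by
    rw [hEd, ← Real.exp_nat_mul]; norm_num
  have hE100 : Real.exp (100 * (R * √R)) = E ^ 100 := by
    rw [hEd, ← Real.exp_nat_mul]; norm_num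
  have hE2 : 2 ≤ E := by
    have : 1 ≤ R * √R := by linarith
    linarith [Real.add_one_le_exp (R * √R)]
  rw [hE100]
  rw [hE8] at hkk
  unfold xi
  calc _ ≤ 1 + ‖(1 / 2 + z)‖ * ‖(1 / 2 + z - 1)‖ * Lr (1 / 2 + z).re := by
        refine (norm_add_le _ _).trans ?_
        rw [norm_mul, norm_mul, norm_one]
        gcongr; exact norm_Lam0_le _
    _ ≤ 1 + (2 * R) * (2 * R) * (6 * E ^ 8) := by
        gcongr
        · exact Lr_nonneg _
        · linarith
    _ ≤ E ^ 10 + (2 * E) * (2 * E) * (6 * E ^ 8) := by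
        gcongr
        exact one_le_pow₀ hE
    _ = 25 * E ^ 10 := by ring
    _ ≤ 2 ^ 90 * E ^ 10 := by gcongr; norm_num
    _ ≤ E ^ 90 * E ^ 10 := by gcongr
    _ = E ^ 100 := by ring
end PS
end

section
open Real Finset
namespace PS

lemma log_ge_series {y : ℝ} (h0 : 0 ≤ y) (h1 : y < 1) :
    2 * (y + y ^ 3 / 3 + y ^ 5 / 5) ≤ Real.log ((1 + y) / (1 - y)) := by
  have h := Real.hasSum_log_sub_log_of_abs_lt_one (x := y) (by rw [abs_of_nonneg h0]; exact h1)
  rw [Real.log_div (by linarith) (by linarith)]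
  have := sum_le_hasSum (Finset.range 3) (fun i _ => by positivity) h
  simp [Finset.sum_range_succ] at this
  linarith

lemma gamma_anti : Antitone fun n : ℕ => ((harmonic n : ℚ) : ℝ) - Real.log (n + 1 / 2) := by
  apply antitone_nat_of_succ_le
  intro n
  have h := log_ge_series (y := 1 / (2 * n + 2)) (by positivity) (by
    rw [div_lt_one (by positivity)]; linarith [(Nat.cast_nonneg n : (0:ℝ) ≤ n)])
  have hn : (0:ℝ) ≤ n := Nat.cast_nonneg n
  have e : (1 + 1 / (2 * (n:ℝ) + 2)) / (1 - 1 / (2 * n + 2)) = (n + 1 + 1 / 2) / (n + 1 / 2) := by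
    have e1 : (1 - 1 / (2 * (n:ℝ) + 2)) = (2 * n + 1) / (2 * n + 2) := by field_simp; ring
    rw [e1]
    field_simp
  rw [e, Real.log_div (by positivity) (by positivity)] at h
  rw [harmonic_succ]
  push_cast
  have h2 : 2 * (1 / (2 * (n:ℝ) + 2)) = ((n:ℝ) + 1)⁻¹ := by field_simp; try ring
  have h3 : 0 ≤ (1 / (2 * (n:ℝ) + 2)) ^ 3 := by positivity
  have h4 : 0 ≤ (1 / (2 * (n:ℝ) + 2)) ^ 5 := by positivity
  linarith

lemma gamma_le (n : ℕ) : Real.eulerMascheroniConstant ≤ ((harmonic n : ℚ) : ℝ) - Real.log (n + 1 / 2) := by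
  refine le_of_tendsto Real.tendsto_eulerMascheroniSeq ?_
  filter_upwards [Filter.eventually_ge_atTop n] with m hm
  refine le_trans ?_ (gamma_anti hm)
  simp only [Real.eulerMascheroniSeq]
  have : Real.log (m + 1 / 2) ≤ Real.log (m + 1) := Real.log_le_log (by positivity) (by linarith)
  linarith

lemma gamma_lt : Real.eulerMascheroniConstant < 0.5777 := by
  have h := gamma_le 10
  have h1 := log_ge_series (y := 5 / 37) (by norm_num) (by norm_num)
  have h2 := Real.log_two_gt_d9
  have e : Real.log ((10:ℕ) + 1 / 2) = 3 * Real.log 2 + Real.log ((1 + 5 / 37) / (1 - 5 / 37)) := by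
    rw [show (3:ℝ) * Real.log 2 = Real.log (2 ^ 3) by rw [Real.log_pow]; norm_num, ← Real.log_mul (by norm_num) (by norm_num)]
    norm_num
  have hH : ((harmonic 10 : ℚ) : ℝ) = 7381 / 2520 := by
    have : harmonic 10 = 7381 / 2520 := by
      simp only [harmonic, Finset.sum_range_succ, Finset.sum_range_zero]; norm_num
    rw [this]; norm_num
  rw [e, hH] at h
  norm_num at h1 h ⊢
  linarith

lemma log_four_pi : 2.5309 < Real.log (4 * π) := by
  have h1 := log_ge_series (y := 0.57075 / 2.57075) (by norm_num) (by norm_num)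
  have h2 := Real.log_two_gt_d9
  have h3 : Real.log (2 ^ 3 * ((1 + 0.57075 / 2.57075) / (1 - 0.57075 / 2.57075))) ≤ Real.log (4 * π) := by
    apply Real.log_le_log (by norm_num)
    have := Real.pi_gt_d4
    norm_num at this ⊢
    linarith
  rw [Real.log_mul (by norm_num) (by norm_num), Real.log_pow] at h3
  norm_num at h1 h2 h3 ⊢
  linarith

lemma Lr_one_le : Lr 1 ≤ 0.0234 := by
  rw [Lr_one]
  have := gamma_lt; have := log_four_pi
  norm_num at *
  linarith

lemma xi_zero_im {s : ℂ} (h : xi s = 0) : 6.49 ≤ |s.im| := by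
  obtain ⟨h1, h2⟩ := xi_zero_re h
  have h3 := xi_zero_norm h
  have h4 : ‖s‖ ^ 2 = s.re ^ 2 + s.im ^ 2 := by rw [Complex.sq_norm, Complex.normSq_apply]; ring
  have h5 : ‖s - 1‖ ^ 2 = (s.re - 1) ^ 2 + s.im ^ 2 := by
    rw [Complex.sq_norm, Complex.normSq_apply]; simp; ring
  have h6 : ‖s‖ * ‖s - 1‖ ≤ s.im ^ 2 + 1 / 2 := by nlinarith [sq_nonneg (‖s‖ - ‖s - 1‖)]
  have h7 : 1 ≤ (s.im ^ 2 + 1 / 2) * 0.0234 :=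
    h3.trans (mul_le_mul h6 Lr_one_le (Lr_nonneg _) (by positivity))
  have h8 : 6.49 ^ 2 ≤ |s.im| ^ 2 := by rw [sq_abs]; norm_num at *; linarith
  exact le_of_sq_le_sq h8 (abs_nonneg _) 
end PS
end

section
open Real Finset
namespace PS
open Metric

/-- logarithmic derivative bound for zero free function -/
lemma logDeriv_bound {g : ℂ → ℂ} {c : ℂ} {R M : ℝ} (hR : 0 < R) (hM : 0 < M)
    (hg : Differentiable ℂ g) (hg0 : ∀ z ∈ ball c R, g z ≠ 0)
    (hgM : ∀ z ∈ ball c R, ‖g z‖ ≤ ‖g c‖ * Real.exp M) (hd : logDeriv g c = 0) {z : ℂ}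
    (hz : z ∈ ball c (R / 4)) : ‖logDeriv g z‖ ≤ 32 * M / R ^ 2 * dist z c := by
  have hcb : c ∈ ball c R := mem_ball_self hR
  have hLD : DifferentiableOn ℂ (logDeriv g) (ball c R) := by
    intro w hw
    have h1 : DifferentiableAt ℂ (deriv g) w := by
      have : Differentiable ℂ (deriv g) := by
        have := hg.contDiff (n := 2)
        exact (contDiff_succ_iff_deriv.1 (show ContDiff ℂ (1+1) g from by simpa [one_add_one_eq_two] using this)).2.2.differentiable (by norm_num)
      exact this w
    exact (h1.div (hg w) (hg0 w hw)).differentiableWithinAt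
  obtain ⟨F, hF⟩ := hLD.isExactOn_ball
  set l : ℂ → ℂ := fun w => F (c + w) - F c with hl
  have hmem : ∀ w, w ∈ ball (0:ℂ) R → c + w ∈ ball c R := by
    intro w hw; simpa [mem_ball, dist_eq_norm] using hw
  have hlD : ∀ w ∈ ball (0:ℂ) R, HasDerivAt l (logDeriv g (c + w)) w := by
    intro w hw
    have h1 := (hF _ (hmem w hw)).comp_const_add c w
    exact h1.sub_const (F c)
  have hexp : ∀ w ∈ ball (0:ℂ) R, g (c + w) = g c * Complex.exp (l w) := by
    intro w hw
    have key : ∀ y ∈ ball (0:ℂ) R, HasDerivAt (fun y => g (c + y) * Complex.exp (-(l y))) 0 y := by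
      intro y hy
      have h1 := ((hg (c + y)).hasDerivAt.comp_const_add c y).mul ((hlD y hy).neg.cexp)
      refine h1.congr_deriv ?_
      rw [logDeriv_apply]
      have := hg0 _ (hmem y hy)
      field_simp
      ring
    have hconst := (convex_ball (0:ℂ) R).is_const_of_fderivWithin_eq_zero (𝕜 := ℂ)
      (f := fun y => g (c + y) * Complex.exp (-(l y)))
      (fun y hy => (key y hy).differentiableAt.differentiableWithinAt)
      (fun y hy => by
        rw [fderivWithin_of_isOpen isOpen_ball hy]
        have := (key y hy).hasFDerivAt.fderiv
        rw [this]; ext; simp) hw (mem_ball_self hR)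
    simp only [hl, add_zero, sub_self, neg_zero, Complex.exp_zero, mul_one] at hconst
    rw [← hconst, mul_assoc, ← Complex.exp_add]
    simp [hl]
  have hbc : ∀ w ∈ ball (0:ℂ) R, ‖l w‖ ≤ 2 * M * ‖w‖ / (R - ‖w‖) := by
    intro w hw
    apply Complex.borelCaratheodory_zero hM _ _ hR hw (by simp [hl])
    · exact fun y hy => (hlD y hy).differentiableAt.differentiableWithinAt
    · intro y hy
      have h1 := hgM _ (hmem y hy)
      rw [hexp y hy, norm_mul, Complex.norm_exp] at h1
      have h2 : 0 < ‖g c‖ := norm_pos_iff.2 (hg0 c hcb)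
      exact Real.exp_le_exp.1 (le_of_mul_le_mul_left h1 h2)
  have hcau : ∀ w ∈ ball c (R / 4), ‖logDeriv g w‖ ≤ 8 * M / R := by
    intro w hw
    have hw' : ‖w - c‖ < R / 4 := by simpa [dist_eq_norm] using hw
    have hin : ∀ y ∈ closedBall (w - c) (R / 4), ‖y‖ ≤ R / 2 := by
      intro y hy
      have : ‖y - (w - c)‖ ≤ R / 4 := by simpa [dist_eq_norm] using hy
      calc ‖y‖ = ‖(y - (w - c)) + (w - c)‖ := by ring_nf
        _ ≤ _ := norm_add_le _ _
        _ ≤ R / 2 := by linarith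
    have hin2 : ∀ y ∈ closedBall (w - c) (R / 4), y ∈ ball (0:ℂ) R := by
      intro y hy
      have := hin y hy
      simp; linarith
    have h1 := Complex.norm_deriv_le_of_forall_mem_sphere_norm_le (c := w - c) (R := R / 4) (C := 2 * M) (f := l)
      (by positivity) (by
        apply DifferentiableOn.diffContOnCl
        rw [closure_ball _ (by positivity)]
        intro y hy
        exact (hlD y (hin2 y hy)).differentiableAt.differentiableWithinAt) (by
        intro y hy
        have hy' := sphere_subset_closedBall hy
        refine (hbc y (hin2 y hy')).trans ?_
        have h3 := hin y hy'
        rw [div_le_iff₀ (by linarith)]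
        nlinarith)
    rw [(hlD (w - c) (hin2 _ (mem_closedBall_self (by positivity)))).deriv] at h1
    rw [show c + (w - c) = w by ring] at h1
    refine h1.trans (le_of_eq ?_)
    field_simp
    ring
  have hsch := Complex.dist_le_div_mul_dist_of_mapsTo_ball (f := logDeriv g) (c := c) (R₁ := R / 4) (R₂ := 8 * M / R) (z := z)
    (hLD.mono (ball_subset_ball (by linarith))) (by
      intro w hw
      rw [hd]; simpa using hcau w hw) hz
  rw [hd, dist_zero_right] at hsch
  refine hsch.trans (le_of_eq ?_)
  field_simp
  ring

lemma factor_one {f : ℂ → ℂ} (hf : Differentiable ℂ f) (hne : ∃ z, f z ≠ 0) (ρ : ℂ) :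
    ∃ g : ℂ → ℂ, Differentiable ℂ g ∧ g ρ ≠ 0 ∧ ∀ z, f z = (z - ρ) ^ (analyticOrderNatAt f ρ) * g z := by
  have han : AnalyticAt ℂ f ρ := hf.analyticAt ρ
  have htop : analyticOrderAt f ρ ≠ ⊤ := by
    intro h
    rw [analyticOrderAt_eq_top] at h
    obtain ⟨z, hz⟩ := hne
    have := (hf.differentiableOn.analyticOnNhd isOpen_univ).eqOn_zero_of_preconnected_of_eventuallyEq_zero isPreconnected_univ (Set.mem_univ ρ) h
    exact hz (this (Set.mem_univ z))
  obtain ⟨g0, h1, h2, h3⟩ := (han.analyticOrderNatAt_eq_iff htop).1 rfl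
  set n := analyticOrderNatAt f ρ
  classical
  set g : ℂ → ℂ := fun z => if z = ρ then g0 ρ else f z / (z - ρ) ^ n with hg
  have hev : g =ᶠ[nhds ρ] g0 := by
    filter_upwards [h3] with z hz
    by_cases hzr : z = ρ
    · simp [hg, hzr]
    · have : z - ρ ≠ 0 := sub_ne_zero.2 hzr
      simp only [hg, if_neg hzr, hz, smul_eq_mul]
      field_simp
  refine ⟨g, ?_, by simpa [hg] using h2, ?_⟩
  · intro z
    by_cases hzr : z = ρ
    · subst hzr
      exact (h1.differentiableAt).congr_of_eventuallyEq hev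
    · have : (fun y => f y / (y - ρ) ^ n) =ᶠ[nhds z] g := by
        filter_upwards [isOpen_ne.mem_nhds hzr] with y hy
        simp only [hg, if_neg hy]
      refine DifferentiableAt.congr_of_eventuallyEq ?_ this.symm
      apply (hf z).div (by fun_prop)
      exact pow_ne_zero _ (sub_ne_zero.2 hzr)
  · intro z
    by_cases hzr : z = ρ
    · subst hzr
      have := h3.self_of_nhds
      simpa [hg] using this
    · have : z - ρ ≠ 0 := sub_ne_zero.2 hzr
      simp only [hg, if_neg hzr]
      field_simp

lemma order_unique {f g : ℂ → ℂ} (hf : Differentiable ℂ f) (hg : Differentiable ℂ g) {ρ : ℂ} {n : ℕ}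
    (h0 : g ρ ≠ 0) (h : ∀ z, f z = (z - ρ) ^ n * g z) : analyticOrderNatAt f ρ = n := by
  have : analyticOrderAt f ρ = n := by
    rw [(hf.analyticAt ρ).analyticOrderAt_eq_natCast]
    exact ⟨g, hg.analyticAt ρ, h0, Filter.Eventually.of_forall h⟩
  rw [analyticOrderNatAt, this]; rfl

lemma factor_finset {f : ℂ → ℂ} (hf : Differentiable ℂ f) (hne : ∃ z, f z ≠ 0) (S : Finset ℂ) :
    ∃ g : ℂ → ℂ, Differentiable ℂ g ∧ (∀ ρ ∈ S, g ρ ≠ 0) ∧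
      ∀ z, f z = (∏ ρ ∈ S, (z - ρ) ^ (analyticOrderNatAt f ρ)) * g z := by
  classical
  induction S using Finset.induction_on with
  | empty => exact ⟨f, hf, by simp, by simp⟩
  | insert ρ S hρ ih =>
    obtain ⟨g, hg, hg0, hfg⟩ := ih
    have hne2 : ∃ z, g z ≠ 0 := by
      obtain ⟨z, hz⟩ := hne
      exact ⟨z, fun h => hz (by rw [hfg, h, mul_zero])⟩
    obtain ⟨g1, hg1, hg10, hfg1⟩ := factor_one hg hne2 ρ
    have hord : analyticOrderNatAt f ρ = analyticOrderNatAt g ρ := by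
      refine order_unique hf (g := fun z => (∏ ρ ∈ S, (z - ρ) ^ (analyticOrderNatAt f ρ)) * g1 z) (by fun_prop) ?_ ?_
      · refine mul_ne_zero (Finset.prod_ne_zero_iff.2 fun τ hτ => pow_ne_zero _ (sub_ne_zero.2 ?_)) hg10
        rintro rfl; exact hρ hτ
      · intro z
        rw [hfg, hfg1]; ring
    refine ⟨g1, hg1, ?_, ?_⟩
    · intro τ hτ
      rcases Finset.mem_insert.1 hτ with rfl | h
      · exact hg10
      · intro h2; exact hg0 τ h (by rw [hfg1, h2, mul_zero])
    · intro z
      rw [Finset.prod_insert hρ, hord, hfg, hfg1]; ring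
end PS
end

section
open Real Finset
namespace PS
open Metric

/-- multiplicity of a zero of `xi` -/
noncomputable def mz (ρ : ℂ) : ℕ := analyticOrderNatAt xi ρ

lemma xi_ne : ∃ z, xi z ≠ 0 := ⟨1, by rw [xi_one]; exact one_ne_zero⟩

lemma mz_one_sub (ρ : ℂ) : mz (1 - ρ) = mz ρ := by
  obtain ⟨g, hg, h0, h⟩ := factor_one differentiable_xi xi_ne ρ
  refine order_unique differentiable_xi (g := fun z => (-1) ^ (mz ρ) * g (1 - z)) (by fun_prop) ?_ ?_
  · simpa using h0
  · intro z
    rw [← xi_one_sub, h]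
    rw [show 1 - z - ρ = -1 * (z - (1 - ρ)) by ring, mul_pow, mz]
    ring

lemma mz_conj (ρ : ℂ) : mz (starRingEnd ℂ ρ) = mz ρ := by
  obtain ⟨g, hg, h0, h⟩ := factor_one differentiable_xi xi_ne ρ
  refine order_unique differentiable_xi (g := fun z => starRingEnd ℂ (g (starRingEnd ℂ z))) ?_ ?_ ?_
  · intro z
    have := (hg (starRingEnd ℂ z)).conj_conj
    rw [Complex.conj_conj] at this
    exact this
  · simpa using h0
  · intro z
    have := xi_conj (starRingEnd ℂ z)
    rw [Complex.conj_conj] at this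
    rw [this, h]
    simp [mz]

lemma mz_pos {ρ : ℂ} (h : xi ρ = 0) : 1 ≤ mz ρ := by
  obtain ⟨g, hg, h0, h1⟩ := factor_one differentiable_xi xi_ne ρ
  by_contra! h2
  have : analyticOrderNatAt xi ρ = 0 := by unfold mz at h2; omega
  rw [h1, this] at h
  simp at h; exact h0 h

lemma xi_half_ne : xi (1 / 2) ≠ 0 := by
  intro h
  have := xi_zero_im h
  have e : ((1:ℂ)/2).im = 0 := by simp
  rw [e] at this; norm_num at this

lemma logDeriv_xi_one_sub (s : ℂ) : logDeriv xi (1 - s) = - logDeriv xi s := by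
  have h : xi = xi ∘ (fun s => 1 - s) := by ext s; simp [xi_one_sub]
  have h2 : logDeriv xi s = logDeriv (xi ∘ (fun s => 1 - s)) s := by rw [← h]
  rw [logDeriv_comp (differentiable_xi _) (by fun_prop)] at h2
  rw [h2]; simp [deriv_const_sub]

lemma finite_zeros (R : ℝ) : (closedBall (1/2:ℂ) R ∩ {s | xi s = 0}).Finite := by
  refine (isCompact_closedBall (1/2:ℂ) R).inter_riemannZetaZeros_finite.subset ?_
  exact fun s hs => ⟨hs.1, zeta_zero_of_xi hs.2⟩

lemma logDeriv_prod_xi {S : Finset ℂ} {g : ℂ → ℂ} (hg : Differentiable ℂ g)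
    (h : ∀ z, xi z = (∏ ρ ∈ S, (z - ρ) ^ (mz ρ)) * g z) {s : ℂ} (hs : ∀ ρ ∈ S, s ≠ ρ) (hgs : g s ≠ 0) :
    logDeriv xi s = ∑ ρ ∈ S, (mz ρ : ℂ) / (s - ρ) + logDeriv g s := by
  have e : xi = fun z => (∏ ρ ∈ S, (z - ρ) ^ (mz ρ)) * g z := funext h
  have hne : ∀ ρ ∈ S, (s - ρ) ^ (mz ρ) ≠ 0 := fun ρ hρ => pow_ne_zero _ (sub_ne_zero.2 (hs ρ hρ))
  rw [e, logDeriv_mul s (Finset.prod_ne_zero_iff.2 hne) hgs (by fun_prop) (hg s)]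
  congr 1
  rw [logDeriv_prod hne (fun i _ => by fun_prop)]
  apply Finset.sum_congr rfl
  intro ρ hρ
  rw [logDeriv_fun_pow (by fun_prop)]
  simp [logDeriv_apply, div_eq_mul_inv]

theorem hadamard (B ε : ℝ) (hB : 1 ≤ B) (hε : 0 < ε) : ∃ (S : Finset ℂ) (E : ℂ → ℂ),
    (∀ ρ ∈ S, xi ρ = 0) ∧ (∀ ρ, xi ρ = 0 → ρ ∈ closedBall (1/2:ℂ) B → ρ ∈ S) ∧
    (∀ ρ ∈ S, starRingEnd ℂ ρ ∈ S) ∧ (∀ ρ ∈ S, 1 - ρ ∈ S) ∧ DifferentiableOn ℂ E (ball (1/2:ℂ) B) ∧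
    (∀ s ∈ ball (1/2:ℂ) B, ‖E s‖ ≤ ε) ∧
    ∀ s ∈ ball (1/2:ℂ) B, xi s ≠ 0 → logDeriv xi s = ∑ ρ ∈ S, (mz ρ : ℂ) / (s - ρ) + E s := by
  obtain ⟨C, hC, hgrow⟩ := xi_growth
  have hx0 : 0 < ‖xi (1/2)‖ := norm_pos_iff.2 xi_half_ne
  -- choose R
  obtain ⟨R, hRB, hRε⟩ : ∃ R : ℝ, 4 * B ≤ R ∧
      32 * (C * ((2 * R) * √(2 * R)) + |Real.log ‖xi (1/2)‖| + 1) / R ^ 2 * B ≤ ε := by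
    set D := |Real.log ‖xi (1/2)‖| + 1 with hD
    have hDpos : 0 < D := by positivity
    set K := 4 * C + D with hK
    have hKpos : 0 < K := by positivity
    refine ⟨(32 * K * B / ε) ^ 2 + 4 * B, by nlinarith [sq_nonneg (32 * K * B / ε)], ?_⟩
    set R := (32 * K * B / ε) ^ 2 + 4 * B with hR
    have hR1 : 1 ≤ R := by nlinarith [sq_nonneg (32 * K * B / ε)]
    have hs : 32 * K * B / ε ≤ √R := by
      apply Real.le_sqrt_of_sq_le; rw [hR]; linarith
    have hs1 : 1 ≤ √R := Real.one_le_sqrt.2 hR1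
    have hs2 : √R * √R = R := Real.mul_self_sqrt (by linarith)
    have h2 : √(2 * R) ≤ 2 * √R := by
      rw [Real.sqrt_mul (by norm_num)]
      gcongr
      rw [Real.sqrt_le_left (by norm_num)]; norm_num
    have h3 : C * ((2 * R) * √(2 * R)) + |Real.log ‖xi (1/2)‖| + 1 ≤ K * (R * √R) := by
      have e1 : C * ((2 * R) * √(2 * R)) ≤ C * ((2 * R) * (2 * √R)) := by gcongr
      have e2 : D ≤ D * (R * √R) := le_mul_of_one_le_right hDpos.le (by nlinarith)
      calc _ ≤ C * ((2 * R) * (2 * √R)) + D * (R * √R) := by linarith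
        _ = _ := by rw [hK]; ring
    have h4 : 32 * K * B ≤ √R * ε := (div_le_iff₀ hε).1 hs
    calc _ ≤ 32 * (K * (R * √R)) / R ^ 2 * B := by gcongr
      _ = (32 * K * B) / √R := by
          have : R ^ 2 = R * (√R * √R) := by rw [hs2]; ring
          rw [this]; field_simp
      _ ≤ ε := by rw [div_le_iff₀ (by linarith)]; linarith
  have hR1 : 1 ≤ R := by linarith
  set M := C * ((2 * R) * √(2 * R)) + |Real.log ‖xi (1/2)‖| + 1 with hM
  have hMpos : 0 < M := by positivity
  set S := (finite_zeros R).toFinset with hS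
  have hmemS : ∀ ρ, ρ ∈ S ↔ ρ ∈ closedBall (1/2:ℂ) R ∧ xi ρ = 0 := by
    intro ρ; rw [hS, Set.Finite.mem_toFinset]; rfl
  have hSsub : ∀ ρ ∈ S, 1 - ρ ∈ S := by
    intro ρ hρ
    rw [hmemS] at hρ ⊢
    refine ⟨?_, by rw [xi_one_sub]; exact hρ.2⟩
    have := hρ.1
    rw [mem_closedBall, dist_eq_norm] at this ⊢
    rw [← norm_neg]; convert this using 1; congr 1; ring
  have hSconj : ∀ ρ ∈ S, starRingEnd ℂ ρ ∈ S := by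
    intro ρ hρ
    rw [hmemS] at hρ ⊢
    refine ⟨?_, by rw [xi_conj, hρ.2, map_zero]⟩
    have := hρ.1
    rw [mem_closedBall, dist_eq_norm] at this ⊢
    rw [← Complex.norm_conj]; convert this using 1; simp [map_ofNat]
  obtain ⟨g, hg, hg0, hfac⟩ := factor_finset differentiable_xi xi_ne S
  have hgball : ∀ z ∈ closedBall (1/2:ℂ) R, g z ≠ 0 := by
    intro z hz h
    have hxz : xi z = 0 := by rw [hfac, h, mul_zero]
    exact hg0 z ((hmemS z).2 ⟨hz, hxz⟩) h
  have hhalfS : ∀ ρ ∈ S, (1/2:ℂ) ≠ ρ := by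
    rintro ρ hρ rfl; exact xi_half_ne ((hmemS _).1 hρ).2
  have hghalf : g (1/2) ≠ 0 := hgball _ (mem_closedBall_self (by linarith))
  have hsphere : ∀ z ∈ sphere (1/2:ℂ) (2 * R), ‖g z‖ ≤ ‖g (1/2)‖ * Real.exp M := by
    intro z hz
    have hz' : ‖z - 1/2‖ = 2 * R := by simpa [dist_eq_norm] using hz
    have h1 : ‖xi z‖ ≤ Real.exp (C * (2 * R * √(2 * R))) := by
      have := hgrow (2 * R) (by linarith) (z - 1/2) hz'.le
      simpa using this
    have h2 : ∏ ρ ∈ S, ‖((1/2:ℂ) - ρ)‖ ^ mz ρ ≤ ∏ ρ ∈ S, ‖z - ρ‖ ^ mz ρ := by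
      apply Finset.prod_le_prod (fun _ _ => by positivity)
      intro ρ hρ
      gcongr
      have h3 := ((hmemS ρ).1 hρ).1
      rw [mem_closedBall, dist_eq_norm, norm_sub_rev] at h3
      have h4 : ‖z - 1/2‖ ≤ ‖z - ρ‖ + ‖1/2 - ρ‖ := by
        calc ‖z - 1/2‖ = ‖(z - ρ) - (1/2 - ρ)‖ := by ring_nf
          _ ≤ _ := norm_sub_le _ _
      linarith
    have h5 : 0 < ∏ ρ ∈ S, ‖((1/2:ℂ) - ρ)‖ ^ mz ρ := by
      apply Finset.prod_pos
      intro ρ hρ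
      have : 0 < ‖(1/2:ℂ) - ρ‖ := norm_pos_iff.2 (sub_ne_zero.2 (hhalfS ρ hρ))
      positivity
    have e1 : ‖xi z‖ = (∏ ρ ∈ S, ‖z - ρ‖ ^ mz ρ) * ‖g z‖ := by
      rw [hfac, norm_mul, norm_prod]; simp only [norm_pow]; rfl
    have e2 : ‖xi (1/2)‖ = (∏ ρ ∈ S, ‖(1/2:ℂ) - ρ‖ ^ mz ρ) * ‖g (1/2)‖ := by
      rw [hfac, norm_mul, norm_prod]; simp only [norm_pow]; rfl
    set P := ∏ ρ ∈ S, ‖((1/2:ℂ) - ρ)‖ ^ mz ρ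
    set Q := ∏ ρ ∈ S, ‖z - ρ‖ ^ mz ρ
    have h6 : Real.exp (C * (2 * R * √(2 * R))) ≤ ‖xi (1/2)‖ * Real.exp M := by
      conv_rhs => rw [← Real.exp_log hx0, ← Real.exp_add]
      apply Real.exp_le_exp.2
      rw [hM]
      linarith [neg_abs_le (Real.log ‖xi (1/2)‖)]
    have h7 : P * ‖g z‖ ≤ P * (‖g (1/2)‖ * Real.exp M) := by
      calc P * ‖g z‖ ≤ Q * ‖g z‖ := by gcongr
        _ = ‖xi z‖ := e1.symm
        _ ≤ _ := h1.trans h6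
        _ = _ := by rw [e2]; ring
    exact le_of_mul_le_mul_left h7 h5
  have hgM : ∀ z ∈ ball (1/2:ℂ) R, ‖g z‖ ≤ ‖g (1/2)‖ * Real.exp M := by
    intro z hz
    apply Complex.norm_le_of_forall_mem_frontier_norm_le (U := ball (1/2:ℂ) (2 * R)) isBounded_ball hg.diffContOnCl
    · rw [frontier_ball _ (by positivity)]; exact hsphere
    · exact subset_closure (ball_subset_ball (by linarith) hz)
  have hd : logDeriv g (1/2) = 0 := by
    have h1 := logDeriv_prod_xi hg hfac hhalfS hghalf
    have h2 : logDeriv xi (1/2) = 0 := by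
      have := logDeriv_xi_one_sub (1/2)
      rw [show (1 - 1/2 : ℂ) = 1/2 by norm_num] at this
      exact self_eq_neg.1 this
    have h3 : ∑ ρ ∈ S, (mz ρ : ℂ) / (1/2 - ρ) = 0 := by
      have : ∑ ρ ∈ S, (mz ρ : ℂ) / (1/2 - ρ) = - ∑ ρ ∈ S, (mz ρ : ℂ) / (1/2 - ρ) := by
        rw [← Finset.sum_neg_distrib]
        refine Finset.sum_nbij' (fun ρ => 1 - ρ) (fun ρ => 1 - ρ) hSsub hSsub (by simp) (by simp) ?_
        intro ρ hρ
        simp only [mz_one_sub]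
        rw [← div_neg]; congr 1; ring
      exact self_eq_neg.1 this
    rw [h2, h3, zero_add] at h1
    exact h1.symm
  refine ⟨S, logDeriv g, fun ρ hρ => ((hmemS ρ).1 hρ).2, fun ρ h1 h2 => (hmemS ρ).2 ⟨closedBall_subset_closedBall (by linarith) h2, h1⟩,
    hSconj, hSsub, ?_, ?_, ?_⟩
  · intro w hw
    have h1 : DifferentiableAt ℂ (deriv g) w := by
      have : Differentiable ℂ (deriv g) := by
        have := hg.contDiff (n := 2)
        exact (contDiff_succ_iff_deriv.1 (show ContDiff ℂ (1+1) g from by simpa [one_add_one_eq_two] using this)).2.2.differentiable (by norm_num)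
      exact this w
    exact (h1.div (hg w) (hgball w (ball_subset_closedBall (ball_subset_ball (by linarith) hw)))).differentiableWithinAt
  · intro s hs
    have h1 := logDeriv_bound (by linarith : 0 < R) hMpos hg (fun z hz => hgball z (ball_subset_closedBall hz)) hgM hd
      (z := s) (ball_subset_ball (by linarith) hs)
    refine h1.trans (le_trans ?_ hRε)
    gcongr
    exact le_of_lt (mem_ball.1 hs)
  · intro s hs hxs
    apply logDeriv_prod_xi hg hfac
    · rintro ρ hρ rfl; exact hxs ((hmemS _).1 hρ).2
    · exact hgball s (ball_subset_closedBall (ball_subset_ball (by linarith) hs))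
end PS
end

section
open Real Finset
namespace PS

noncomputable def pL (y : ℂ) : ℂ := Complex.log (1 + y) - Complex.log (1 - y) - 2 * y

lemma one_add_slit {y : ℂ} (h : ‖y‖ < 1) : 1 + y ∈ Complex.slitPlane := by
  left; have := (abs_le.1 (Complex.abs_re_le_norm y)).1; simp; linarith

lemma one_sub_slit {y : ℂ} (h : ‖y‖ < 1) : 1 - y ∈ Complex.slitPlane := by
  rw [sub_eq_add_neg]; apply one_add_slit; rwa [norm_neg]

lemma pL_deriv {y : ℂ} (h : ‖y‖ < 1) : HasDerivAt pL (2 * y ^ 2 / (1 - y ^ 2)) y := by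
  have h1 := ((hasDerivAt_id y).const_add 1).clog (one_add_slit h)
  have h2 := ((hasDerivAt_id y).const_sub 1).clog (one_sub_slit h)
  have h3 := (h1.sub h2).sub ((hasDerivAt_id y).const_mul 2)
  have n1 := Complex.slitPlane_ne_zero (one_add_slit h)
  have n2 := Complex.slitPlane_ne_zero (one_sub_slit h)
  have n3 : 1 - y ^ 2 ≠ 0 := by
    rw [show 1 - y ^ 2 = (1 + y) * (1 - y) by ring]; exact mul_ne_zero n1 n2
  refine h3.congr_deriv ?_
  simp only [id]
  have e : 1 - y ^ 2 = (1 + y) * (1 - y) := by ring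
  rw [e]
  field_simp
  ring

lemma pL_bound {y : ℂ} (h : ‖y‖ < 1) : ‖pL y‖ ≤ 2 / 3 * ‖y‖ ^ 3 / (1 - ‖y‖ ^ 2) := by
  set r := ‖y‖ with hr
  have hr0 : 0 ≤ r := norm_nonneg _
  have hr2 : 0 < 1 - r ^ 2 := by nlinarith
  have hd : ∀ t ∈ Set.Icc (0:ℝ) 1, HasDerivAt (fun t : ℝ => pL (t * y)) (2 * (t * y) ^ 2 / (1 - (t * y) ^ 2) * y) t := by
    intro t ht
    have hn : ‖(t:ℂ) * y‖ < 1 := by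
      rw [norm_mul, Complex.norm_real, Real.norm_of_nonneg ht.1]; nlinarith [ht.2]
    have h1 : HasDerivAt (fun t : ℝ => (t:ℂ) * y) y t := by
      simpa using (Complex.ofRealCLM.hasDerivAt (x := t)).mul_const y
    exact (pL_deriv hn).comp t h1
  have := image_norm_le_of_norm_deriv_right_le_deriv_boundary (f := fun t : ℝ => pL (t * y))
    (f' := fun t : ℝ => (2 * (t * y) ^ 2 / (1 - (t * y) ^ 2) * y)) (a := 0) (b := 1)
    (B := fun t : ℝ => 2 / 3 * r ^ 3 / (1 - r ^ 2) * t ^ 3) (B' := fun t => 2 * r ^ 3 / (1 - r ^ 2) * t ^ 2)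
    (fun t ht => (hd t ht).continuousAt.continuousWithinAt)
    (fun t ht => (hd t ⟨ht.1, ht.2.le⟩).hasDerivWithinAt)
    (by simp [pL])
    (fun t => by
      have := (hasDerivAt_pow 3 t).const_mul (2 / 3 * r ^ 3 / (1 - r ^ 2))
      refine this.congr_deriv ?_
      push_cast; ring)
    (fun t ht => by
      have hn : ‖(t:ℂ) * y‖ = t * r := by
        rw [norm_mul, Complex.norm_real, Real.norm_of_nonneg ht.1]
      rw [norm_mul, norm_div, norm_mul, norm_pow, hn, Complex.norm_ofNat]
      have h2 : 1 - r ^ 2 ≤ ‖1 - ((t:ℂ) * y) ^ 2‖ := by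
        have := norm_sub_norm_le (1:ℂ) (((t:ℂ) * y) ^ 2)
        rw [norm_one, norm_pow, hn] at this
        have h3 : (t * r) ^ 2 ≤ r ^ 2 := by
          apply pow_le_pow_left₀ (mul_nonneg ht.1 hr0)
          nlinarith [ht.2]
        linarith
      calc 2 * (t * r) ^ 2 / ‖1 - ((t:ℂ) * y) ^ 2‖ * r ≤ 2 * (t * r) ^ 2 / (1 - r ^ 2) * r := by gcongr
        _ = _ := by ring) (Set.right_mem_Icc.2 zero_le_one)
  simpa using this

noncomputable def dl (w : ℂ) : ℂ := pL (1 / (2 * w))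

lemma dl_bound {w : ℂ} {a : ℝ} (ha : 1 / 2 < a) (hw : a ≤ ‖w‖) :
    ‖dl w‖ ≤ 1 / 12 * (1 / (1 - 1 / (4 * a ^ 2))) / ‖w‖ ^ 3 := by
  have hw0 : 0 < ‖w‖ := by linarith
  have hn : ‖1 / (2 * w)‖ = 1 / (2 * ‖w‖) := by simp
  have hlt : ‖1 / (2 * w)‖ < 1 := by rw [hn, div_lt_one (by positivity)]; linarith
  have h := pL_bound hlt
  rw [hn] at h
  have h2 : 0 < 1 - 1 / (4 * a ^ 2) := by
    rw [sub_pos, div_lt_one (by positivity)]; nlinarith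
  have h3 : 1 - 1 / (4 * a ^ 2) ≤ 1 - (1 / (2 * ‖w‖)) ^ 2 := by
    have : (1 / (2 * ‖w‖)) ^ 2 = 1 / (4 * ‖w‖ ^ 2) := by field_simp; norm_num
    rw [this]; gcongr
  refine h.trans ?_
  calc 2 / 3 * (1 / (2 * ‖w‖)) ^ 3 / (1 - (1 / (2 * ‖w‖)) ^ 2) ≤ 2 / 3 * (1 / (2 * ‖w‖)) ^ 3 / (1 - 1 / (4 * a ^ 2)) := by gcongr
    _ = _ := by field_simp; norm_num

lemma dl_bound1 {w : ℂ} (hw : 1 ≤ ‖w‖) : ‖dl w‖ ≤ 1 / 9 / ‖w‖ ^ 3 := by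
  have := dl_bound (a := 1) (by norm_num) hw
  norm_num at this ⊢; exact this

/-- real digamma -/
noncomputable def dg (x : ℝ) : ℝ := deriv (Real.log ∘ Real.Gamma) x

lemma hasDerivAt_logGamma {x : ℝ} (hx : 0 < x) : HasDerivAt (Real.log ∘ Real.Gamma) (dg x) x := by
  apply DifferentiableAt.hasDerivAt
  apply DifferentiableAt.log
  · apply Real.differentiableAt_Gamma
    intro m; have : (0:ℝ) ≤ m := Nat.cast_nonneg m
    linarith
  · exact (Real.Gamma_pos_of_pos hx).ne'

lemma digamma_ofReal {x : ℝ} (hx : 0 < x) : Complex.digamma x = dg x := by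
  have hdR : DifferentiableAt ℝ Real.Gamma x := by
    apply Real.differentiableAt_Gamma
    intro m; have : (0:ℝ) ≤ m := Nat.cast_nonneg m
    linarith
  have hdC : DifferentiableAt ℂ Complex.Gamma x := by
    apply Complex.differentiableAt_Gamma
    intro m h
    have := congrArg Complex.re h
    simp at this
    have : (0:ℝ) ≤ m := Nat.cast_nonneg m
    linarith
  have h1 := hdC.hasDerivAt.comp_ofReal
  have h2 := hdR.hasDerivAt.ofReal_comp
  have e : (fun y : ℝ => Complex.Gamma y) = fun y : ℝ => ((Real.Gamma y : ℝ) : ℂ) := by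
    ext y; exact Complex.Gamma_ofReal y
  rw [e] at h1
  have h3 := h1.unique h2
  have h4 : dg x = deriv Real.Gamma x / Real.Gamma x :=
    (hdR.hasDerivAt.log (Real.Gamma_pos_of_pos hx).ne').deriv
  rw [Complex.digamma_def, logDeriv_apply, h3, h4, Complex.Gamma_ofReal]
  push_cast; rfl

lemma dg_add_one {x : ℝ} (hx : 0 < x) : dg (x + 1) = dg x + 1 / x := by
  have h := Complex.digamma_apply_add_one (x : ℂ) (by
    intro m h
    have := congrArg Complex.re h
    simp at this
    have : (0:ℝ) ≤ m := Nat.cast_nonneg m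
    linarith)
  rw [digamma_ofReal hx, show (x : ℂ) + 1 = ((x + 1 : ℝ) : ℂ) by push_cast; ring, digamma_ofReal (by linarith)] at h
  rw [one_div]; exact_mod_cast h

lemma dg_bounds {x : ℝ} (hx : 0 < x) : dg x ≤ Real.log x ∧ Real.log x ≤ dg (x + 1) := by
  have hs : slope (Real.log ∘ Real.Gamma) x (x + 1) = Real.log x := by
    rw [slope_def_field]
    simp only [Function.comp]
    rw [Real.Gamma_add_one hx.ne', Real.log_mul hx.ne' (Real.Gamma_pos_of_pos hx).ne']
    simp
  constructor
  · rw [← hs]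
    exact Real.convexOn_log_Gamma.le_slope_of_hasDerivAt (show x ∈ Set.Ioi 0 from hx) (show x + 1 ∈ Set.Ioi 0 from by simp; linarith) (by linarith) (hasDerivAt_logGamma hx)
  · rw [← hs]
    exact Real.convexOn_log_Gamma.slope_le_of_hasDerivAt (show x ∈ Set.Ioi 0 from hx) (show x + 1 ∈ Set.Ioi 0 from by simp; linarith) (by linarith) (hasDerivAt_logGamma (by linarith))

lemma dl_ofReal {x : ℝ} (hx : 1 / 2 < x) :
    dl x = ((Real.log (x + 1 / 2) - Real.log (x - 1 / 2) - 1 / x : ℝ) : ℂ) := by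
  have hx0 : 0 < x := by linarith
  have e1 : (1 + 1 / (2 * (x:ℂ))) = ((1 + 1 / (2 * x) : ℝ) : ℂ) := by push_cast; ring
  have e2 : (1 - 1 / (2 * (x:ℂ))) = ((1 - 1 / (2 * x) : ℝ) : ℂ) := by push_cast; ring
  have p2 : 0 < 1 - 1 / (2 * x) := by rw [sub_pos, div_lt_one (by positivity)]; linarith
  rw [dl, pL, e1, e2, ← Complex.ofReal_log (by positivity), ← Complex.ofReal_log p2.le]
  have f1 : 1 + 1 / (2 * x) = (x + 1 / 2) / x := by field_simp; try ring
  have f2 : 1 - 1 / (2 * x) = (x - 1 / 2) / x := by field_simp; try ring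
  rw [f1, f2, Real.log_div (by linarith) hx0.ne', Real.log_div (by linarith) hx0.ne']
  push_cast
  have : (x:ℂ) ≠ 0 := by exact_mod_cast hx0.ne'
  field_simp
  ring

noncomputable def DG (z : ℂ) : ℂ := Complex.log (z - 1 / 2) + ∑' k : ℕ, dl (z + k)

lemma add_nat_norm {z : ℂ} (hz : 1 < z.re) (k : ℕ) : (k:ℝ) + 1 ≤ ‖z + k‖ := by
  have := Complex.re_le_norm (z + k)
  simp at this; linarith

lemma dl_term_bound {z : ℂ} (hz : 1 < z.re) (k : ℕ) : ‖dl (z + k)‖ ≤ 1 / ((k:ℝ) + 1) ^ 2 := by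
  have h1 := add_nat_norm hz k
  have hk : (0:ℝ) ≤ k := Nat.cast_nonneg k
  refine (dl_bound1 (by linarith)).trans ?_
  rw [div_div]
  apply one_div_le_one_div_of_le (by positivity)
  calc ((k:ℝ) + 1) ^ 2 ≤ ‖z + k‖ ^ 2 := by gcongr
    _ ≤ ‖z + k‖ ^ 3 := pow_le_pow_right₀ (by linarith) (by norm_num)
    _ ≤ _ := by nlinarith [pow_nonneg (norm_nonneg (z + k)) 3]

lemma summable_sq : Summable fun k : ℕ => 1 / ((k:ℝ) + 1) ^ 2 := by
  have := (summable_nat_add_iff 1).2 (Real.summable_one_div_nat_pow.2 (by norm_num : 1 < 2))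
  simpa using this

lemma differentiableOn_DG : DifferentiableOn ℂ DG {z | 1 < z.re} := by
  have hU : IsOpen {z : ℂ | 1 < z.re} := isOpen_lt continuous_const Complex.continuous_re
  apply DifferentiableOn.add
  · intro z hz
    apply DifferentiableAt.differentiableWithinAt
    apply DifferentiableAt.clog (by fun_prop)
    left; simp at hz ⊢; linarith
  · apply Complex.differentiableOn_tsum_of_summable_norm summable_sq _ hU
    · exact fun k z hz => dl_term_bound hz k
    · intro k z hz
      apply DifferentiableAt.differentiableWithinAt
      have h1 := add_nat_norm hz k
      have hk : (0:ℝ) ≤ k := Nat.cast_nonneg k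
      have h2 : z + k ≠ 0 := by rw [← norm_pos_iff]; linarith
      have h3 : ‖1 / (2 * (z + k))‖ < 1 := by
        rw [norm_div, norm_one, norm_mul, Complex.norm_ofNat, div_lt_one (by positivity)]; linarith
      exact DifferentiableAt.comp z (pL_deriv h3).differentiableAt (by
        apply DifferentiableAt.div <;> first | fun_prop | skip
        exact mul_ne_zero two_ne_zero h2)

lemma DG_ofReal {x : ℝ} (hx : 1 < x) : DG x = Complex.digamma x := by
  rw [digamma_ofReal (by linarith), DG]
  have hpart : ∀ N : ℕ, ∑ k ∈ Finset.range N, dl ((x:ℂ) + k) =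
      ((dg x - Real.log (x - 1 / 2) - (dg (x + N) - Real.log (x + N - 1 / 2)) : ℝ) : ℂ) := by
    intro N
    induction N with
    | zero => simp
    | succ N ih =>
      have hN : (0:ℝ) ≤ N := Nat.cast_nonneg N
      rw [Finset.sum_range_succ, ih, show (x:ℂ) + N = ((x + N : ℝ) : ℂ) by push_cast; ring, dl_ofReal (by linarith)]
      rw [← Complex.ofReal_add]
      congr 1
      have := dg_add_one (x := x + N) (by linarith)
      push_cast
      rw [← add_assoc, this]
      rw [show x + N + 1 - 1 / 2 = x + N + 1 / 2 by ring]
      ring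
  have hlim : Filter.Tendsto (fun N : ℕ => dg (x + N) - Real.log (x + N - 1 / 2)) Filter.atTop (nhds 0) := by
    have hb : ∀ N : ℕ, 1 ≤ N → |dg (x + N) - Real.log (x + N - 1 / 2)| ≤ 1 / (N:ℝ) := by
      intro N hN
      have hN' : (1:ℝ) ≤ N := by exact_mod_cast hN
      have h1 := (dg_bounds (x := x + N) (by linarith)).1
      have h2 := (dg_bounds (x := x + N - 1) (by linarith)).2
      rw [show x + N - 1 + 1 = x + N by ring] at h2
      have h3 : Real.log (x + N) - Real.log (x + N - 1 / 2) ≤ 1 / N := by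
        rw [← Real.log_div (by linarith) (by linarith)]
        refine (Real.log_le_sub_one_of_pos (by apply div_pos <;> linarith)).trans ?_
        rw [div_sub_one (by linarith), div_le_div_iff₀ (by linarith) (by linarith)]; nlinarith
      have h4 : Real.log (x + N - 1 / 2) - Real.log (x + N - 1) ≤ 1 / N := by
        rw [← Real.log_div (by linarith) (by linarith)]
        refine (Real.log_le_sub_one_of_pos (by apply div_pos <;> linarith)).trans ?_
        rw [div_sub_one (by linarith), div_le_div_iff₀ (by linarith) (by linarith)]; nlinarith
      rw [abs_le]; constructor <;> linarith
    apply squeeze_zero_norm' (a := fun N : ℕ => 1 / (N:ℝ))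
    · filter_upwards [Filter.eventually_ge_atTop 1] with N hN
      exact hb N hN
    · exact tendsto_one_div_atTop_nhds_zero_nat
  have hsum : Summable fun k : ℕ => dl ((x:ℂ) + k) :=
    Summable.of_norm_bounded summable_sq (fun k => dl_term_bound (by simpa using hx) k)
  have ht := hsum.hasSum.tendsto_sum_nat
  have ht2 : Filter.Tendsto (fun N : ℕ => ∑ k ∈ Finset.range N, dl ((x:ℂ) + k)) Filter.atTop
      (nhds ((dg x - Real.log (x - 1 / 2) : ℝ) : ℂ)) := by
    simp only [hpart]
    have h5 : Filter.Tendsto (fun N : ℕ => dg x - Real.log (x - 1 / 2) - (dg (x + N) - Real.log (x + N - 1 / 2)))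
      Filter.atTop (nhds (dg x - Real.log (x - 1 / 2))) := by simpa using hlim.const_sub (dg x - Real.log (x - 1 / 2))
    exact (Complex.continuous_ofReal.tendsto _).comp h5
  rw [tendsto_nhds_unique ht ht2]
  rw [show ((x:ℂ) - 1 / 2) = ((x - 1 / 2 : ℝ) : ℂ) by push_cast; ring, ← Complex.ofReal_log (by linarith), ← Complex.ofReal_add]
  congr 1; ring

lemma differentiableOn_digamma : DifferentiableOn ℂ Complex.digamma {z | 0 < z.re} := by
  have hU : IsOpen {z : ℂ | 0 < z.re} := isOpen_lt continuous_const Complex.continuous_re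
  have hG : DifferentiableOn ℂ Complex.Gamma {z | 0 < z.re} := by
    intro z hz
    refine (Complex.differentiableAt_Gamma _ ?_).differentiableWithinAt
    intro m h
    have h1 : 0 < z.re := hz
    rw [h] at h1; simp at h1
    have : (0:ℝ) ≤ m := Nat.cast_nonneg m
    linarith
  have hG' := hG.deriv hU
  intro z hz
  exact (hG' z hz).div (hG z hz) (Complex.Gamma_ne_zero_of_re_pos hz)

theorem digamma_eq {z : ℂ} (hz : 1 < z.re) : Complex.digamma z = DG z := by
  have hU : IsOpen {z : ℂ | 1 < z.re} := isOpen_lt continuous_const Complex.continuous_re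
  have h1 := differentiableOn_DG.analyticOnNhd hU
  have h2 := (differentiableOn_digamma.mono (fun z (hz : 1 < z.re) => (show 0 < z.re by linarith))).analyticOnNhd hU
  have hc : IsPreconnected {z : ℂ | 1 < z.re} := (convex_halfSpace_re_gt 1).isPreconnected
  refine h2.eqOn_of_preconnected_of_frequently_eq h1 hc (z₀ := 2) (show (1:ℝ) < (2:ℂ).re by norm_num) ?_ hz
  have : Filter.Tendsto (fun n : ℕ => ((2 + 1 / ((n:ℝ) + 1) : ℝ) : ℂ)) Filter.atTop (nhdsWithin 2 {2}ᶜ) := by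
    apply tendsto_nhdsWithin_of_tendsto_nhds_of_eventually_within
    · have := (tendsto_one_div_add_atTop_nhds_zero_nat (𝕜 := ℝ)).const_add 2
      have h3 := (Complex.continuous_ofReal.tendsto _).comp this
      rw [show ((2 + 0 : ℝ) : ℂ) = 2 by simp] at h3
      exact h3
    · filter_upwards with n
      simp only [Set.mem_compl_iff, Set.mem_singleton_iff]
      intro h
      have h4 : (2 + 1 / ((n:ℝ) + 1)) = 2 := by exact_mod_cast h
      have : 0 < 1 / ((n:ℝ) + 1) := by positivity
      linarith
  refine this.frequently (Filter.Frequently.of_forall fun n => ?_)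
  rw [DG_ofReal]
  have : 0 < 1 / ((n:ℝ) + 1) := by positivity
  linarith
end PS
end

section
open Real Finset
namespace PS

lemma tele_sq {a : ℝ} (ha : 1/2 < a) (k : ℕ) :
    1 / (a + k) ^ 2 ≤ 1 / (a + k - 1/2) - 1 / (a + (k+1:ℕ) - 1/2) := by
  have hk : (0:ℝ) ≤ k := Nat.cast_nonneg k
  push_cast
  rw [div_sub_div _ _ (by linarith) (by linarith), div_le_div_iff₀ (by positivity) (by apply mul_pos <;> linarith)]
  nlinarith

lemma sum_sq_le {a : ℝ} (ha : 1/2 < a) (N : ℕ) :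
    ∑ k ∈ Finset.range N, 1 / (a + k) ^ 2 ≤ 1 / (a - 1/2) := by
  refine (Finset.sum_le_sum fun k _ => tele_sq ha k).trans ?_
  rw [Finset.sum_range_sub' (fun k : ℕ => 1 / (a + k - 1/2))]
  have : 0 ≤ 1 / (a + N - 1/2) := by
    have hk : (0:ℝ) ≤ N := Nat.cast_nonneg N
    apply one_div_nonneg.2; linarith
  simp only [Nat.cast_zero, add_zero]
  linarith

lemma norm_add_nat {z : ℂ} {a : ℝ} (ha : 0 ≤ a) (hz : a ≤ z.re) (k : ℕ) : a + k ≤ ‖z + k‖ ∧ ‖z‖ ≤ ‖z + k‖ := by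
  have hk : (0:ℝ) ≤ k := Nat.cast_nonneg k
  constructor
  · refine le_trans ?_ (Complex.re_le_norm _); simp; exact hz
  · rw [Complex.norm_eq_sqrt_sq_add_sq, Complex.norm_eq_sqrt_sq_add_sq]
    apply Real.sqrt_le_sqrt
    simp
    nlinarith

lemma digamma_gen {z : ℂ} {a : ℝ} (ha : 1 < a) (hz : a ≤ z.re) :
    ‖Complex.digamma z - Complex.log (z - 1/2)‖ ≤ (1/12 * (1 / (1 - 1/(4*a^2))) / (a - 1/2)) / ‖z‖ := by
  rw [digamma_eq (by linarith), DG, add_sub_cancel_left]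
  have hz0 : 0 < ‖z‖ := by
    have := Complex.re_le_norm z
    linarith
  set C := 1/12 * (1 / (1 - 1/(4*a^2))) with hC
  have hC0 : 0 ≤ C := by
    have : 1/(4*a^2) ≤ 1 := by rw [div_le_one (by positivity)]; nlinarith
    have : 0 ≤ 1 / (1 - 1/(4*a^2)) := one_div_nonneg.2 (by linarith)
    positivity
  have hb : ∀ k : ℕ, ‖dl (z + k)‖ ≤ C / ‖z‖ * (1 / (a + k) ^ 2) := by
    intro k
    obtain ⟨h1, h2⟩ := norm_add_nat (by linarith) hz k
    have hk : (0:ℝ) ≤ k := Nat.cast_nonneg k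
    refine (dl_bound (a := a) (by linarith) (by linarith)).trans ?_
    rw [← hC, div_mul_div_comm, mul_one]
    apply div_le_div_of_nonneg_left hC0 (by positivity)
    calc ‖z‖ * (a + k)^2 ≤ ‖z + k‖ * ‖z+k‖^2 := by gcongr
      _ = _ := by ring
  have hs : ∀ N : ℕ, ∑ k ∈ Finset.range N, C / ‖z‖ * (1 / (a + k) ^ 2) ≤ C / ‖z‖ * (1 / (a - 1/2)) := by
    intro N
    rw [← Finset.mul_sum]
    exact mul_le_mul_of_nonneg_left (sum_sq_le (by linarith) N) (by positivity)
  have hsum : Summable fun k : ℕ => C / ‖z‖ * (1 / (a + k) ^ 2) :=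
    summable_of_sum_range_le (fun k => by positivity) hs
  have h1 := tsum_of_norm_bounded hsum.hasSum hb
  refine h1.trans ?_
  have h2 : ∑' k : ℕ, C / ‖z‖ * (1 / (a + k) ^ 2) ≤ C / ‖z‖ * (1 / (a - 1/2)) :=
    Real.tsum_le_of_sum_range_le (fun k => by positivity) hs
  refine h2.trans (le_of_eq ?_)
  field_simp

lemma digamma_main {z : ℂ} (hz : 7/4 ≤ z.re) :
    ‖Complex.digamma z - Complex.log (z - 1/2)‖ ≤ 0.0726 / ‖z‖ := by
  refine (digamma_gen (by norm_num) hz).trans ?_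
  apply div_le_div_of_nonneg_right _ (norm_nonneg _)
  norm_num

lemma norm_log_le {w : ℂ} (hw : 0 ≤ w.re) : ‖Complex.log w‖ ≤ |Real.log ‖w‖| + π / 2 := by
  refine (Complex.norm_le_abs_re_add_abs_im _).trans ?_
  rw [Complex.log_re, Complex.log_im]
  have := Complex.abs_arg_le_pi_div_two_iff.2 hw
  linarith

lemma digamma_crude {z : ℂ} (hz : 3/2 ≤ z.re) :
    ‖Complex.digamma z‖ ≤ |Real.log ‖z - 1/2‖| + π / 2 + 1/10 := by
  have h := digamma_gen (a := 3/2) (by norm_num) hz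
  have hz0 : 3/2 ≤ ‖z‖ := hz.trans (Complex.re_le_norm z)
  have h2 : (1/12 * (1 / (1 - 1/(4*(3/2:ℝ)^2))) / (3/2 - 1/2)) / ‖z‖ ≤ 1/10 := by
    rw [div_le_iff₀ (by linarith)]; norm_num; linarith
  have h3 := norm_log_le (w := z - 1/2) (by simp; linarith)
  have h4 := norm_add_le (Complex.digamma z - Complex.log (z - 1/2)) (Complex.log (z - 1/2))
  rw [sub_add_cancel] at h4
  linarith

lemma digamma_half {z : ℂ} (hz : 1/2 ≤ z.re) :
    ‖Complex.digamma z‖ ≤ |Real.log ‖z + 1/2‖| + π / 2 + 1/10 + 1 / ‖z‖ := by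
  have h := Complex.digamma_apply_add_one z (by
    intro m h
    have : (0:ℝ) ≤ m := Nat.cast_nonneg m
    rw [h] at hz; simp at hz; linarith)
  have h1 : Complex.digamma z = Complex.digamma (z + 1) - 1 / z := by rw [h]; ring
  have h2 := digamma_crude (z := z + 1) (by simp; linarith)
  rw [show z + 1 - 1/2 = z + 1/2 by ring] at h2
  rw [h1]
  refine (norm_sub_le _ _).trans ?_
  rw [norm_div, norm_one]; linarith
end PS
end

section
open Real Finset
namespace PS

/-- regular part of the negative log derivative of zeta at 1 -/
noncomputable def Zr (s : ℂ) : ℂ :=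
  1/2 * Complex.digamma (s/2 + 1) - 1/2 * (Real.log π : ℂ) - logDeriv xi s

noncomputable def Zf (s : ℂ) : ℂ := 1 / (s - 1) + Zr s

lemma deriv_xi_one : deriv xi 1 = completedRiemannZeta₀ 1 := by
  have h : HasDerivAt xi (0 + ((1 * (1 - 1) + 1 * 1) * completedRiemannZeta₀ 1 + 1 * (1 - 1) * deriv completedRiemannZeta₀ 1)) 1 := by
    have h1 := (differentiable_completedZeta₀ 1).hasDerivAt
    have h2 : HasDerivAt (fun s : ℂ => s * (s - 1)) (1 * (1 - 1) + 1 * 1) 1 :=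
      (hasDerivAt_id' (1:ℂ)).mul ((hasDerivAt_id' (1:ℂ)).sub_const 1)
    exact (hasDerivAt_const (1:ℂ) (1:ℂ)).add (h2.mul h1)
  rw [h.deriv]; ring

lemma logDeriv_xi_at_one : logDeriv xi 1 = completedRiemannZeta₀ 1 := by
  rw [logDeriv_apply, deriv_xi_one, xi_one, div_one]

lemma logDeriv_xi_at_zero : logDeriv xi 0 = - completedRiemannZeta₀ 1 := by
  have := logDeriv_xi_one_sub 1
  rw [sub_self] at this
  rw [this, logDeriv_xi_at_one]

lemma log_four_pi_split : (Complex.log (4 * π) : ℂ) = ((2 * Real.log 2 + Real.log π : ℝ) : ℂ) := by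
  rw [show (4 * π : ℂ) = ((4 * π : ℝ) : ℂ) by push_cast; ring, ← Complex.ofReal_log (by positivity)]
  rw [Real.log_mul (by norm_num) (by positivity), show (4:ℝ) = 2 ^ 2 by norm_num, Real.log_pow]
  norm_num

lemma Zr_zero : Zr 0 = ((1 - Real.log (2 * π) : ℝ) : ℂ) := by
  unfold Zr
  rw [logDeriv_xi_at_zero, completedRiemannZeta₀_one, zero_div, zero_add, Complex.digamma_one, log_four_pi_split,
    Real.log_mul (by norm_num) (by positivity)]
  push_cast; ring

lemma Zr_one : Zr 1 = ((- Real.eulerMascheroniConstant : ℝ) : ℂ) := by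
  unfold Zr
  rw [logDeriv_xi_at_one, completedRiemannZeta₀_one, log_four_pi_split,
    Complex.digamma_apply_add_one, Complex.digamma_one_half]
  · rw [show Complex.log 2 = ((Real.log 2 : ℝ) : ℂ) by rw [Complex.ofReal_log (by norm_num)]; simp]
    push_cast; ring
  · intro m h
    have := congrArg Complex.re h
    have h0 : (0:ℝ) ≤ m := Nat.cast_nonneg m
    simp at this; linarith

lemma logDeriv_Gammaℝ {s : ℂ} (hs : 0 < s.re) :
    logDeriv Complex.Gammaℝ s = 1/2 * Complex.digamma (s/2) - 1/2 * (Real.log π : ℂ) := by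
  have hG : Complex.Gammaℝ = fun s => (π:ℂ) ^ (-s/2) * Complex.Gamma (s/2) := by
    ext s; exact Complex.Gammaℝ_def s
  have hpi : (π:ℂ) ≠ 0 := by exact_mod_cast Real.pi_ne_zero
  have h2 : 0 < (s/2).re := by
    rw [show s/2 = s / ((2:ℝ):ℂ) by norm_num, Complex.div_ofReal_re]; linarith
  have hne : ∀ m : ℕ, s/2 ≠ -m := by
    intro m h
    have h0 : (0:ℝ) ≤ m := Nat.cast_nonneg m
    rw [h] at h2; simp at h2; linarith
  have hd1 : HasDerivAt (fun s : ℂ => (π:ℂ) ^ (-s/2)) ((π:ℂ) ^ (-s/2) * Complex.log π * (-1/2)) s := by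
    have : HasDerivAt (fun s : ℂ => -s/2) (-1/2) s := ((hasDerivAt_id' s).neg).div_const 2
    exact this.const_cpow (Or.inl hpi)
  have hdG : DifferentiableAt ℂ Complex.Gamma (s/2) := Complex.differentiableAt_Gamma _ hne
  have hid : DifferentiableAt ℂ (fun s : ℂ => s/2) s := by fun_prop
  rw [hG, logDeriv_mul (f := fun s : ℂ => (π:ℂ) ^ (-s/2)) (g := fun s => Complex.Gamma (s/2))]
  · have e1 : logDeriv (fun s : ℂ => (π:ℂ) ^ (-s/2)) s = - (1/2) * (Real.log π : ℂ) := by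
      rw [logDeriv_apply, hd1.deriv, Complex.ofReal_log Real.pi_pos.le]
      have : (π:ℂ) ^ (-s/2) ≠ 0 := by simp [Complex.cpow_eq_zero_iff, hpi]
      field_simp
    have e2 : logDeriv (fun s => Complex.Gamma (s/2)) s = 1/2 * Complex.digamma (s/2) := by
      have := logDeriv_comp (f := Complex.Gamma) (g := fun s : ℂ => s/2) (x := s) hdG hid
      rw [Function.comp_def] at this
      rw [this, Complex.digamma_def]
      have : deriv (fun s : ℂ => s/2) s = 1/2 := by
        simp
      rw [this]; ring
    rw [e1, e2]; ring
  · simp [Complex.cpow_eq_zero_iff, hpi]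
  · exact Complex.Gamma_ne_zero_of_re_pos h2
  · exact hd1.differentiableAt
  · exact hdG.comp s hid

lemma Zf_eq_logDeriv {s : ℂ} (hs : 1 < s.re) : Zf s = - deriv riemannZeta s / riemannZeta s := by
  have hs0 : s ≠ 0 := by rintro rfl; simp at hs; linarith
  have hs1 : s ≠ 1 := by rintro rfl; simp at hs
  have hs2 : s - 1 ≠ 0 := sub_ne_zero.2 hs1
  have hz : riemannZeta s ≠ 0 := riemannZeta_ne_zero_of_one_lt_re hs
  have hGr : Complex.Gammaℝ s ≠ 0 := Complex.Gammaℝ_ne_zero_of_re_pos (by linarith)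
  have hev : xi =ᶠ[nhds s] fun s => (s * (s - 1)) * (Complex.Gammaℝ s * riemannZeta s) := by
    have : ∀ᶠ w in nhds s, 1 < w.re := (isOpen_lt continuous_const Complex.continuous_re).mem_nhds hs
    filter_upwards [this] with w hw
    exact xi_eq_zeta (by rintro rfl; simp at hw; linarith) (by rintro rfl; simp at hw)
      (Complex.Gammaℝ_ne_zero_of_re_pos (by linarith))
  have hGd : DifferentiableAt ℂ Complex.Gammaℝ s := by
    have hi := Complex.differentiable_Gammaℝ_inv s
    have := hi.inv (by simpa using hGr)
    refine this.congr_of_eventuallyEq (Filter.Eventually.of_forall fun w => ?_)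
    simp
  have hzd : DifferentiableAt ℂ riemannZeta s := differentiableAt_riemannZeta hs1
  have h1 : logDeriv xi s = (1/s + 1/(s-1)) + (logDeriv Complex.Gammaℝ s + logDeriv riemannZeta s) := by
    have e : logDeriv xi s = logDeriv (fun s => (s * (s - 1)) * (Complex.Gammaℝ s * riemannZeta s)) s := by
      rw [logDeriv_apply, logDeriv_apply, hev.deriv_eq, hev.eq_of_nhds]
    rw [e, logDeriv_mul (f := fun s : ℂ => s * (s-1)) (g := fun s => Complex.Gammaℝ s * riemannZeta s),
      logDeriv_mul (f := Complex.Gammaℝ) (g := riemannZeta),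
      logDeriv_mul (f := fun s : ℂ => s) (g := fun s : ℂ => s - 1)]
    · simp [logDeriv_apply]
    · exact hs0
    · exact hs2
    · fun_prop
    · fun_prop
    · exact hGr
    · exact hz
    · exact hGd
    · exact hzd
    · exact mul_ne_zero hs0 hs2
    · exact mul_ne_zero hGr hz
    · fun_prop
    · exact hGd.mul hzd
  unfold Zf Zr
  have h2 : 0 < (s/2).re := by
    rw [show s/2 = s / ((2:ℝ):ℂ) by norm_num, Complex.div_ofReal_re]; linarith
  rw [h1, logDeriv_Gammaℝ (by linarith), Complex.digamma_apply_add_one _ (by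
    intro m h
    have h0 : (0:ℝ) ≤ m := Nat.cast_nonneg m
    rw [h] at h2; simp at h2; linarith), logDeriv_apply]
  field_simp
  ring

lemma Zf_eq_LSeries {s : ℂ} (hs : 1 < s.re) :
    Zf s = LSeries (fun n => (ArithmeticFunction.vonMangoldt n : ℂ)) s := by
  rw [Zf_eq_logDeriv hs, ArithmeticFunction.LSeries_vonMangoldt_eq_deriv_riemannZeta_div hs]

lemma differentiableAt_Zr {s : ℂ} (hs : -2 < s.re) (hx : xi s ≠ 0) : DifferentiableAt ℂ Zr s := by
  have h2 : 0 < (s/2+1).re := by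
    rw [show s/2 + 1 = s / ((2:ℝ):ℂ) + 1 by norm_num, Complex.add_re, Complex.div_ofReal_re]; simp; linarith
  have hd : DifferentiableAt ℂ Complex.digamma (s/2+1) :=
    differentiableOn_digamma.differentiableAt ((isOpen_lt continuous_const Complex.continuous_re).mem_nhds h2)
  have hl : DifferentiableAt ℂ (logDeriv xi) s := by
    have : DifferentiableAt ℂ (deriv xi) s :=
      (differentiable_xi.contDiff (n := 2)).differentiable_deriv_two s
    exact this.div (differentiable_xi s) hx
  have hc : DifferentiableAt ℂ (fun s : ℂ => Complex.digamma (s/2+1)) s :=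
    DifferentiableAt.comp (g := Complex.digamma) (f := fun s : ℂ => s/2+1) s hd (by fun_prop)
  exact ((hc.const_mul _).sub_const _).sub hl

lemma logDeriv_xi_conj (s : ℂ) : logDeriv xi (starRingEnd ℂ s) = starRingEnd ℂ (logDeriv xi s) := by
  have h : (starRingEnd ℂ) ∘ xi ∘ (starRingEnd ℂ) = xi := by ext s; simp [xi_conj]
  have h2 := congrFun (deriv_conj_conj (f := xi)) s
  rw [h] at h2
  simp only [Function.comp_apply] at h2
  have h3 : deriv xi (starRingEnd ℂ s) = starRingEnd ℂ (deriv xi s) := by rw [h2]; simp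
  rw [logDeriv_apply, logDeriv_apply, map_div₀, xi_conj, h3]

lemma logDeriv_xi_real (σ : ℝ) : (logDeriv xi σ).im = 0 := by
  have := logDeriv_xi_conj σ
  rw [Complex.conj_ofReal] at this
  exact Complex.conj_eq_iff_im.1 this.symm

lemma Zr_im_zero {σ : ℝ} (hσ : -2 < σ) : (Zr σ).im = 0 := by
  unfold Zr
  rw [show ((σ:ℂ)/2 + 1) = ((σ/2+1 : ℝ) : ℂ) by push_cast; ring, digamma_ofReal (by linarith)]
  have h1 := logDeriv_xi_real σ
  rw [show (1/2 : ℂ) * (dg (σ/2+1) : ℂ) - 1/2 * (Real.log π : ℂ) = ((1/2 * dg (σ/2+1) - 1/2 * Real.log π : ℝ) : ℂ) by push_cast; ring]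
  rw [Complex.sub_im, Complex.ofReal_im, h1, sub_zero]

lemma Zf_im_zero {σ : ℝ} (hσ : -2 < σ) : (Zf σ).im = 0 := by
  unfold Zf
  rw [Complex.add_im, Zr_im_zero hσ, show (1 / ((σ:ℂ) - 1)) = ((1/(σ-1) : ℝ) : ℂ) by push_cast; ring, Complex.ofReal_im, add_zero]
end PS
end

section
open Real Finset
namespace PS

structure Had (B ε : ℝ) (S : Finset ℂ) (E : ℂ → ℂ) : Prop where
  hB : 10 ≤ B
  he : ε ≤ 1/20000
  he0 : 0 ≤ ε
  zero : ∀ ρ ∈ S, xi ρ = 0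
  mem : ∀ ρ, xi ρ = 0 → ρ ∈ Metric.closedBall (1/2:ℂ) B → ρ ∈ S
  conj : ∀ ρ ∈ S, starRingEnd ℂ ρ ∈ S
  refl : ∀ ρ ∈ S, 1 - ρ ∈ S
  diff : DifferentiableOn ℂ E (Metric.ball (1/2:ℂ) B)
  small : ∀ s ∈ Metric.ball (1/2:ℂ) B, ‖E s‖ ≤ ε
  eq : ∀ s ∈ Metric.ball (1/2:ℂ) B, xi s ≠ 0 → logDeriv xi s = ∑ ρ ∈ S, (mz ρ : ℂ) / (s - ρ) + E s

lemma Had.exist (B ε : ℝ) (hB : 10 ≤ B) (h0 : 0 < ε) (h1 : ε ≤ 1/20000) : ∃ S E, Had B ε S E := by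
  obtain ⟨S, E, a, b, c, d, e, f, g⟩ := hadamard B ε (by linarith) h0
  exact ⟨S, E, ⟨hB, h1, h0.le, a, b, c, d, e, f, g⟩⟩

variable {B ε : ℝ} {S : Finset ℂ} {E : ℂ → ℂ}

lemma Had.re0 (H : Had B ε S E) {ρ : ℂ} (h : ρ ∈ S) : 0 < ρ.re := (xi_zero_re (H.zero ρ h)).1
lemma Had.re1 (H : Had B ε S E) {ρ : ℂ} (h : ρ ∈ S) : ρ.re < 1 := (xi_zero_re (H.zero ρ h)).2
lemma Had.im (H : Had B ε S E) {ρ : ℂ} (h : ρ ∈ S) : 6.49 ≤ |ρ.im| := xi_zero_im (H.zero ρ h)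
lemma Had.im_sq (H : Had B ε S E) {ρ : ℂ} (h : ρ ∈ S) : 42.12 ≤ ρ.im ^ 2 := by
  have := H.im h
  rw [← sq_abs]; nlinarith

lemma re_one_div_sub (s ρ : ℂ) (m : ℕ) : ((m:ℂ) / (s - ρ)).re = m * ((s.re - ρ.re) / ((s.re - ρ.re)^2 + (s.im - ρ.im)^2)) := by
  rw [Complex.div_re, Complex.normSq_apply]; simp; ring

lemma Had.sum_re (H : Had B ε S E) {s : ℂ} (hs : s ∈ Metric.ball (1/2:ℂ) B) (h1 : 1 ≤ s.re) :
    ∑ ρ ∈ S, (mz ρ : ℝ) * ((s.re - ρ.re) / ((s.re - ρ.re)^2 + (s.im - ρ.im)^2)) ≤ (logDeriv xi s).re + ε := by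
  have h := H.eq s hs (xi_ne_zero_of_one_le_re h1)
  have h2 := (Complex.abs_re_le_norm (E s)).trans (H.small s hs)
  rw [h, Complex.add_re, Complex.re_sum]
  simp only [re_one_div_sub]
  linarith [(abs_le.1 h2).1]

lemma Had.sum_flip (H : Had B ε S E) (f : ℂ → ℝ) : ∑ ρ ∈ S, f (1 - starRingEnd ℂ ρ) = ∑ ρ ∈ S, f ρ := by
  refine Finset.sum_nbij' (fun ρ => 1 - starRingEnd ℂ ρ) (fun ρ => 1 - starRingEnd ℂ ρ) ?_ ?_ ?_ ?_ ?_
  · intro a ha; exact H.refl _ (H.conj _ ha)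
  · intro a ha; exact H.refl _ (H.conj _ ha)
  · intro a _; simp
  · intro a _; simp
  · intro a _; rfl

lemma mz_flip (ρ : ℂ) : mz (1 - starRingEnd ℂ ρ) = mz ρ := by rw [mz_one_sub, mz_conj]

lemma Had.ball_of (H : Had B ε S E) {s : ℂ} (h : |s.re - 1/2| + |s.im| < B) : s ∈ Metric.ball (1/2:ℂ) B := by
  rw [mem_ball_iff_norm]
  refine (Complex.norm_le_abs_re_add_abs_im _).trans_lt ?_
  simpa using h

lemma Had.sum_inv_sq (H : Had B ε S E) : ∑ ρ ∈ S, (mz ρ : ℝ) / ρ.im ^ 2 ≤ 0.0482 := by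
  have hb : (1:ℂ) ∈ Metric.ball (1/2:ℂ) B := H.ball_of (by have := H.hB; norm_num; linarith)
  have h := H.sum_re hb (by simp)
  have hL : (logDeriv xi 1).re ≤ 0.0234 := by
    rw [logDeriv_xi_at_one, show (1:ℂ) = ((1:ℝ):ℂ) by simp, Lam0_ofReal, Complex.ofReal_re]; exact Lr_one_le
  have h2 := H.sum_flip (fun ρ => (mz ρ : ℝ) * (((1:ℂ).re - ρ.re) / (((1:ℂ).re - ρ.re)^2 + ((1:ℂ).im - ρ.im)^2)))
  have h3 : ∑ ρ ∈ S, (mz ρ : ℝ) / ρ.im ^ 2 ≤ 1.02375 * (∑ ρ ∈ S, (mz ρ : ℝ) * (((1:ℂ).re - ρ.re) / (((1:ℂ).re - ρ.re)^2 + ((1:ℂ).im - ρ.im)^2))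
      + ∑ ρ ∈ S, (mz (1 - starRingEnd ℂ ρ) : ℝ) * (((1:ℂ).re - (1 - starRingEnd ℂ ρ).re) / (((1:ℂ).re - (1 - starRingEnd ℂ ρ).re)^2 + ((1:ℂ).im - (1 - starRingEnd ℂ ρ).im)^2))) := by
    rw [← Finset.sum_add_distrib, Finset.mul_sum]
    refine Finset.sum_le_sum fun ρ hρ => ?_
    rw [mz_flip, ← mul_add, mul_left_comm, div_eq_mul_inv]
    refine mul_le_mul_of_nonneg_left ?_ (Nat.cast_nonneg _)
    have a0 := H.re0 hρ
    have a1 := H.re1 hρ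
    have a2 := H.im_sq hρ
    simp only [Complex.one_re, Complex.one_im, Complex.sub_re, Complex.conj_re, Complex.sub_im, Complex.conj_im]
    rw [show 1 - (1 - ρ.re) = ρ.re by ring, show (0 - (0 - -ρ.im))^2 = ρ.im^2 by ring, show (0 - ρ.im)^2 = ρ.im^2 by ring]
    generalize ρ.re = b at *
    generalize ρ.im ^ 2 = g at *
    have e1 : (1 - b) / (1 + g) ≤ (1 - b) / ((1-b)^2 + g) := by
      apply div_le_div_of_nonneg_left (by linarith) (by positivity); nlinarith
    have e2 : b / (1 + g) ≤ b / (b^2 + g) := by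
      apply div_le_div_of_nonneg_left (by linarith) (by positivity); nlinarith
    have e3 : g⁻¹ ≤ 1.02375 * (1 / (1 + g)) := by
      rw [inv_eq_one_div, mul_one_div, div_le_div_iff₀ (by linarith) (by linarith)]; nlinarith
    have e4 : (1 - b) / (1 + g) + b / (1 + g) = 1 / (1 + g) := by rw [← add_div]; congr 1; ring
    nlinarith
  have he := H.he
  rw [h2] at h3
  norm_num at h3 h hL he ⊢
  linarith

lemma Had.sum_inv_sq_pos (H : Had B ε S E) : ∑ ρ ∈ S with 0 < ρ.im, (mz ρ : ℝ) / ρ.im ^ 2 ≤ 0.0241 := by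
  have h := H.sum_inv_sq
  rw [← Finset.sum_filter_add_sum_filter_not S (fun ρ => 0 < ρ.im)] at h
  have h2 : ∑ ρ ∈ S with ¬ 0 < ρ.im, (mz ρ : ℝ) / ρ.im ^ 2 = ∑ ρ ∈ S with 0 < ρ.im, (mz ρ : ℝ) / ρ.im ^ 2 := by
    refine Finset.sum_nbij' (fun ρ => starRingEnd ℂ ρ) (fun ρ => starRingEnd ℂ ρ) ?_ ?_ ?_ ?_ ?_
    · intro a ha
      rw [Finset.mem_filter] at ha ⊢
      refine ⟨H.conj _ ha.1, ?_⟩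
      have := H.im_sq ha.1
      have h3 : a.im ≠ 0 := by intro h; rw [h] at this; norm_num at this
      have h4 := lt_of_le_of_ne (not_lt.1 ha.2) h3
      simpa using h4
    · intro a ha
      rw [Finset.mem_filter] at ha ⊢
      refine ⟨H.conj _ ha.1, ?_⟩
      have := ha.2
      simp; linarith
    · intro a _; simp
    · intro a _; simp
    · intro a _; simp [mz_conj]
  rw [h2] at h
  linarith

lemma Had.logDeriv_real (H : Had B ε S E) {σ : ℝ} (h1 : -1 ≤ σ) (h2 : σ ≤ 2) : |(logDeriv xi σ).re| ≤ 0.08 := by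
  have hb : (σ:ℂ) ∈ Metric.ball (1/2:ℂ) B := H.ball_of (by
    have := H.hB
    have : |σ - 1/2| ≤ 3/2 := by rw [abs_le]; constructor <;> linarith
    simp; norm_num at *; linarith)
  have hne : xi σ ≠ 0 := by
    intro h
    have := xi_zero_im h
    norm_num at this
  have h := H.eq _ hb hne
  have hfl : ∑ ρ ∈ S, (mz ρ : ℂ) / (σ - ρ) = ∑ ρ ∈ S, (mz ρ : ℂ) / (σ - (1 - ρ)) := by
    refine Finset.sum_nbij' (fun ρ => 1 - ρ) (fun ρ => 1 - ρ) (fun a ha => H.refl _ ha) (fun a ha => H.refl _ ha) ?_ ?_ ?_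
    · intro a _; simp
    · intro a _; simp
    · intro a _; simp [mz_one_sub]
  have hs : ‖∑ ρ ∈ S, (mz ρ : ℂ) / (σ - ρ)‖ ≤ 3/2 * ∑ ρ ∈ S, (mz ρ : ℝ) / ρ.im ^ 2 := by
    have e : ∑ ρ ∈ S, (mz ρ : ℂ) / (σ - ρ) = 1/2 * ∑ ρ ∈ S, ((mz ρ : ℂ) / (σ - ρ) + (mz ρ : ℂ) / (σ - (1 - ρ))) := by
      rw [Finset.sum_add_distrib, ← hfl]; ring
    rw [e, norm_mul, show (3/2:ℝ) * ∑ ρ ∈ S, (mz ρ : ℝ) / ρ.im ^ 2 = 1/2 * (3 * ∑ ρ ∈ S, (mz ρ : ℝ) / ρ.im ^ 2) by ring, Finset.mul_sum]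
    rw [show ‖(1/2:ℂ)‖ = 1/2 by norm_num]
    refine mul_le_mul_of_nonneg_left ((norm_sum_le _ _).trans (Finset.sum_le_sum fun ρ hρ => ?_)) (by norm_num)
    have hi : 0 < |ρ.im| := by have := H.im hρ; linarith
    have n1 : |ρ.im| ≤ ‖(σ:ℂ) - ρ‖ := by have := Complex.abs_im_le_norm ((σ:ℂ) - ρ); simpa using this
    have n2 : |ρ.im| ≤ ‖(σ:ℂ) - (1 - ρ)‖ := by have := Complex.abs_im_le_norm ((σ:ℂ) - (1 - ρ)); simpa using this
    have z1 : (σ:ℂ) - ρ ≠ 0 := norm_pos_iff.1 (by linarith)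
    have z2 : (σ:ℂ) - (1 - ρ) ≠ 0 := norm_pos_iff.1 (by linarith)
    rw [show (mz ρ : ℂ) / (σ - ρ) + (mz ρ : ℂ) / (σ - (1 - ρ)) = (mz ρ : ℂ) * ((2 * σ - 1 : ℝ) : ℂ) / ((σ - ρ) * (σ - (1 - ρ))) by
      field_simp; push_cast; ring]
    rw [norm_div, norm_mul, norm_mul, Complex.norm_natCast, Complex.norm_real, ← sq_abs, mul_div_assoc', sq]
    apply div_le_div₀ (by positivity) _ (by positivity) (by gcongr)
    rw [mul_comm]
    refine mul_le_mul_of_nonneg_right ?_ (by positivity)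
    rw [Real.norm_eq_abs, abs_le]; constructor <;> linarith
  have h3 := H.small _ hb
  have h4 : ‖logDeriv xi σ‖ ≤ 0.08 := by
    rw [h]
    refine (norm_add_le _ _).trans ?_
    have := H.sum_inv_sq
    have := H.he
    norm_num at *
    linarith
  exact (Complex.abs_re_le_norm _).trans h4

lemma Had.Zr_real (H : Had B ε S E) {σ : ℝ} (h1 : -1 ≤ σ) (h2 : σ ≤ 1) : ‖Zr σ‖ ≤ 2.2 := by
  have him := Zr_im_zero (σ := σ) (by linarith)
  have e : Zr σ = ((Zr σ).re : ℂ) := by apply Complex.ext <;> simp [him]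
  rw [e, Complex.norm_real, Real.norm_eq_abs]
  unfold Zr
  rw [show ((σ:ℂ)/2 + 1) = ((σ/2+1 : ℝ) : ℂ) by push_cast; ring, digamma_ofReal (by linarith)]
  rw [show (1/2 : ℂ) * (dg (σ/2+1) : ℂ) - 1/2 * (Real.log π : ℂ) = ((1/2 * dg (σ/2+1) - 1/2 * Real.log π : ℝ) : ℂ) by push_cast; ring]
  rw [Complex.sub_re, Complex.ofReal_re]
  have h3 := H.logDeriv_real h1 (by linarith)
  have hz : 0 < σ/2+1 := by linarith
  have h4 := (dg_bounds hz).1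
  have h5 := (dg_bounds hz).2
  rw [dg_add_one hz] at h5
  have h6 : Real.log (σ/2+1) ≤ σ/2 := by have := Real.log_le_sub_one_of_pos hz; linarith
  have l2 := Real.log_two_lt_d9
  have h7 : - 0.6932 ≤ Real.log (σ/2+1) := by
    have : Real.log (1/2) ≤ Real.log (σ/2+1) := Real.log_le_log (by norm_num) (by linarith)
    rw [Real.log_div (by norm_num) (by norm_num), Real.log_one] at this
    linarith
  have h8 : 1 / (σ/2+1) ≤ 2 := by rw [div_le_iff₀ hz]; linarith
  have h9 : Real.log π ≤ 1.3864 := by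
    have : Real.log π ≤ Real.log (2^2) := Real.log_le_log Real.pi_pos (by have := Real.pi_le_four; linarith)
    rw [Real.log_pow] at this; push_cast at this; linarith
  have h10 : 0 ≤ Real.log π := Real.log_nonneg (by have := Real.pi_gt_three; linarith)
  rw [abs_le] at h3 ⊢
  constructor <;> linarith
end PS
end

section
open Real Finset
namespace PS

noncomputable def fV (V t : ℝ) : ℝ := 1/t + 1/(4*V) - t/(4*V^2) - t^2/V^3
noncomputable def fV' (V t : ℝ) : ℝ := -1/t^2 - 1/(4*V^2) - 2*t/V^3
noncomputable def fV'' (V t : ℝ) : ℝ := 2/t^3 - 2/V^3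
noncomputable def gL (V t : ℝ) : ℝ := fV V (2*π) + fV' V (2*π) * (t - 2*π)

lemma hasDerivAt_fV {V t : ℝ} (ht : t ≠ 0) : HasDerivAt (fV V) (fV' V t) t := by
  have h1 := hasDerivAt_inv ht
  have h2 := ((hasDerivAt_id' t).div_const (4*V^2))
  have h3 := ((hasDerivAt_pow 2 t).div_const (V^3))
  have := ((h1.add_const (1/(4*V))).sub h2).sub h3
  refine (this.congr_deriv ?_).congr_of_eventuallyEq (Filter.Eventually.of_forall fun y => ?_)
  · simp [fV']; ring
  · simp [fV]

lemma hasDerivAt_fV' {V t : ℝ} (ht : t ≠ 0) : HasDerivAt (fV' V) (fV'' V t) t := by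
  have h1 := ((hasDerivAt_pow 2 t).inv (pow_ne_zero 2 ht)).neg
  have h2 := (((hasDerivAt_id' t).const_mul 2).div_const (V^3))
  have := ((h1.sub_const (1/(4*V^2)))).sub h2
  refine (this.congr_deriv ?_).congr_of_eventuallyEq (Filter.Eventually.of_forall fun y => ?_)
  · simp [fV'']; field_simp
  · simp [fV', neg_div]

lemma fV_V {V : ℝ} (hV : 0 < V) : fV V V = 0 := by
  unfold fV; field_simp; norm_num

lemma fV'_neg {V t : ℝ} (hV : 0 < V) (ht : 0 < t) : fV' V t < 0 := by
  unfold fV'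
  have h1 : 0 < 1/t^2 := by positivity
  have h2 : 0 < 1/(4*V^2) := by positivity
  have h3 : 0 < 2*t/V^3 := by positivity
  rw [neg_div]; linarith

/-- tangent line inequality -/
lemma fV_tangent {V t u : ℝ} (hV : 0 < V) (ht : 0 < t) (hu : 0 < u) (htV : t ≤ V) (huV : u ≤ V) :
    fV V u + fV' V u * (t - u) ≤ fV V t := by
  have h : fV V t - (fV V u + fV' V u * (t - u)) = (t-u)^2 * (1/(t*u^2) - 1/V^3) := by
    unfold fV fV'; field_simp; ring
  have h2 : 1/V^3 ≤ 1/(t*u^2) := by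
    apply one_div_le_one_div_of_le (by positivity)
    calc t*u^2 ≤ V*V^2 := by gcongr
      _ = V^3 := by ring
  nlinarith [mul_nonneg (sq_nonneg (t-u)) (sub_nonneg.2 h2)]

lemma fV'_mono {V t u : ℝ} (hV : 0 < V) (ht : 0 < t) (htu : t ≤ u) (huV : u ≤ V) : fV' V t ≤ fV' V u := by
  have h : fV' V u - fV' V t = (u - t) * ((u+t)/(t^2*u^2) - 2/V^3) := by
    have hu : 0 < u := by linarith
    unfold fV'; field_simp; ring
  have hu : 0 < u := by linarith
  have h2 : 2/V^3 ≤ (u+t)/(t^2*u^2) := by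
    rw [div_le_div_iff₀ (by positivity) (by positivity)]
    have a1 : t^2*u^2 ≤ t * (u*u^2) := by nlinarith [mul_nonneg (mul_nonneg ht.le (sub_nonneg.2 htu)) (sq_nonneg u)]
    have a2 : u*u^2 ≤ V^3 := by
      calc u*u^2 ≤ V*V^2 := by gcongr
        _ = V^3 := by ring
    have a3 : t*(u*u^2) ≤ t * V^3 := by gcongr
    have a4 : t * V^3 ≤ u * V^3 := by gcongr
    nlinarith
  nlinarith [mul_nonneg (sub_nonneg.2 htu) (sub_nonneg.2 h2)]

lemma gL_tangent {V t u : ℝ} (hV : 0 < V) (ht : t ≤ 2*π) (hu : 2*π ≤ u) (huV : u ≤ V) :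
    fV V u + fV' V u * (t - u) ≤ gL V t := by
  have hp := Real.pi_pos
  have h1 := fV_tangent (V := V) (t := 2*π) (u := u) hV (by linarith) (by linarith) (by linarith) huV
  have h2 := fV'_mono (V := V) (t := 2*π) (u := u) hV (by linarith) hu huV
  unfold gL
  nlinarith

lemma fV_nonneg {V t : ℝ} (hV : 0 < V) (ht : 0 < t) (htV : t ≤ V) : 0 ≤ fV V t := by
  have := fV_tangent hV ht hV htV le_rfl
  rw [fV_V hV] at this
  have h2 := fV'_neg hV hV
  nlinarith

lemma continuous_gL (V : ℝ) : Continuous (gL V) := by unfold gL; fun_prop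

lemma continuousOn_fV (V : ℝ) : ContinuousOn (fV V) (Set.uIcc (2*π) V ∩ {t | 0 < t}) := by
  intro t ht
  exact (hasDerivAt_fV (ne_of_gt ht.2)).continuousAt.continuousWithinAt

lemma continuousOn_fV2 {V : ℝ} (hV : 2*π ≤ V) : ContinuousOn (fV V) (Set.uIcc (2*π) V) := by
  intro t ht
  rw [Set.uIcc_of_le hV] at ht
  have : 0 < t := by have := Real.pi_pos; linarith [ht.1]
  exact (hasDerivAt_fV (ne_of_gt this)).continuousAt.continuousWithinAt

/-- The weighting functional -/
noncomputable def IV (V : ℝ) (X : ℝ → ℝ) : ℝ :=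
  (∫ t in (0:ℝ)..(2*π), gL V t * X t) + ∫ t in (2*π)..V, fV V t * X t

lemma polya {V ω : ℝ} (hV : 2*π ≤ V) (hω : 0 < ω) : 0 ≤ IV V (fun t => Real.cos (ω * t)) := by
  have hp := Real.pi_pos
  have hV0 : 0 < V := by linarith
  have hs : ∀ t, HasDerivAt (fun t => Real.sin (ω*t)) (Real.cos (ω*t) * ω) t := fun t => by
    have := ((hasDerivAt_id' t).const_mul ω).sin
    simpa only [mul_one] using this
  have hc : ∀ t, HasDerivAt (fun t => Real.cos (ω*t)) (-Real.sin (ω*t) * ω) t := fun t => by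
    have := ((hasDerivAt_id' t).const_mul ω).cos
    simpa only [mul_one] using this
  set p := fV' V (2*π) with hpdef
  have h1 : ∫ t in (0:ℝ)..(2*π), gL V t * Real.cos (ω*t) = 
      (gL V (2*π) * Real.sin (ω*(2*π)) / ω + p * (Real.cos (ω*(2*π)) - 1) / ω^2) - (gL V 0 * Real.sin (ω*0) / ω + p * (Real.cos (ω*0) - 1) / ω^2) := by
    refine intervalIntegral.integral_eq_sub_of_hasDerivAt (f := fun t => gL V t * Real.sin (ω*t) / ω + p * (Real.cos (ω*t) - 1) / ω^2) (fun t _ => ?_) ?_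
    · have hg : HasDerivAt (gL V) p t := by
        have := (((hasDerivAt_id' t).sub_const (2*π)).const_mul p).const_add (fV V (2*π))
        rw [mul_one] at this
        exact this
      have := ((hg.mul (hs t)).div_const ω).add (((hc t).sub_const 1).const_mul p |>.div_const (ω^2))
      refine this.congr_deriv ?_
      field_simp; ring
    · apply Continuous.intervalIntegrable
      have := continuous_gL V
      fun_prop
  have hpos : ∀ t ∈ Set.uIcc (2*π) V, 0 < t := fun t ht => by
    rw [Set.uIcc_of_le hV] at ht; linarith [ht.1]
  have hc2 : ContinuousOn (fV'' V) (Set.uIcc (2*π) V) := by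
    unfold fV''
    apply ContinuousOn.sub _ continuousOn_const
    apply ContinuousOn.div continuousOn_const (by fun_prop)
    intro t ht; have := hpos t ht; positivity
  have hcf := continuousOn_fV2 hV
  have hintg : IntervalIntegrable (fun t => fV V t * Real.cos (ω*t) + fV'' V t * (Real.cos (ω*t) - 1)/ω^2) MeasureTheory.volume (2*π) V := by
    apply ContinuousOn.intervalIntegrable
    exact (hcf.mul (by fun_prop)).add ((hc2.mul (by fun_prop)).div_const _)
  have h2 : ∫ t in (2*π)..V, (fV V t * Real.cos (ω*t) + fV'' V t * (Real.cos (ω*t) - 1)/ω^2) =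
      (fV V V * Real.sin (ω*V) / ω + fV' V V * (Real.cos (ω*V) - 1) / ω^2) - (fV V (2*π) * Real.sin (ω*(2*π)) / ω + fV' V (2*π) * (Real.cos (ω*(2*π)) - 1) / ω^2) := by
    refine intervalIntegral.integral_eq_sub_of_hasDerivAt (f := fun t => fV V t * Real.sin (ω*t) / ω + fV' V t * (Real.cos (ω*t) - 1) / ω^2) (fun t ht => ?_) hintg
    have h0 := ne_of_gt (hpos t ht)
    have := (((hasDerivAt_fV (V := V) h0).mul (hs t)).div_const ω).add (((hasDerivAt_fV' (V := V) h0).mul ((hc t).sub_const 1)).div_const (ω^2))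
    refine this.congr_deriv ?_
    field_simp; ring
  have h3 : ∫ t in (2*π)..V, (fV V t * Real.cos (ω*t) + fV'' V t * (Real.cos (ω*t) - 1)/ω^2) ≤ ∫ t in (2*π)..V, fV V t * Real.cos (ω*t) := by
    apply intervalIntegral.integral_mono_on hV hintg
    · apply ContinuousOn.intervalIntegrable; exact hcf.mul (by fun_prop)
    · intro t ht
      have ht0 : 0 < t := by linarith [ht.1]
      have hf2 : 0 ≤ fV'' V t := by
        unfold fV''
        have : 2/V^3 ≤ 2/t^3 := by
          apply div_le_div_of_nonneg_left (by norm_num) (by positivity)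
          have := ht.2
          gcongr
        linarith
      have : fV'' V t * (Real.cos (ω*t) - 1)/ω^2 ≤ 0 := by
        apply div_nonpos_of_nonpos_of_nonneg _ (by positivity)
        exact mul_nonpos_of_nonneg_of_nonpos hf2 (by linarith [Real.cos_le_one (ω*t)])
      linarith
  unfold IV
  have h4 : 0 ≤ fV' V V * (Real.cos (ω*V) - 1) / ω^2 := by
    apply div_nonneg _ (by positivity)
    exact mul_nonneg_of_nonpos_of_nonpos (fV'_neg hV0 hV0).le (by linarith [Real.cos_le_one (ω*V)])
  have h5 : gL V (2*π) = fV V (2*π) := by simp [gL]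
  rw [h1, h5]
  rw [h2, fV_V hV0] at h3
  simp only [mul_zero, Real.sin_zero, Real.cos_zero, sub_self, zero_div, add_zero, sub_zero, zero_mul, zero_add] at h3 ⊢
  linarith

lemma gL_nonneg {V t : ℝ} (hV : 2*π ≤ V) (ht : t ≤ 2*π) : 0 ≤ gL V t := by
  have hp := Real.pi_pos
  have h1 := fV_nonneg (V := V) (t := 2*π) (by linarith) (by linarith) hV
  have h2 := fV'_neg (V := V) (t := 2*π) (by linarith) (by linarith)
  unfold gL; nlinarith

lemma IV_kernel {V γ : ℝ} (hγ : 2*π ≤ γ) (hγV : γ ≤ V) :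
    fV V γ * (π - 2/γ) ≤ IV V (fun t => 1 / (1 + (t - γ)^2)) := by
  have hp := Real.pi_pos
  have hV : 2*π ≤ V := by linarith
  have hV0 : 0 < V := by linarith
  have hγ0 : 0 < γ := by linarith
  set τ : ℝ → ℝ := fun t => fV V γ + fV' V γ * (t - γ) with hτ
  have hP : Continuous fun t : ℝ => 1 / (1 + (t - γ)^2) := by
    apply Continuous.div continuous_const (by fun_prop)
    intro t; positivity
  have hPn : ∀ t : ℝ, 0 ≤ 1 / (1 + (t - γ)^2) := fun t => by positivity
  have hτc : Continuous τ := by fun_prop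
  have hmc : Continuous fun t => max (τ t) 0 := by fun_prop
  have hintg : ∀ a b : ℝ, IntervalIntegrable (fun t => max (τ t) 0 * (1 / (1 + (t - γ)^2))) MeasureTheory.volume a b :=
    fun a b => (hmc.mul hP).intervalIntegrable a b
  have h1 : ∫ t in (0:ℝ)..(2*π), max (τ t) 0 * (1 / (1 + (t - γ)^2)) ≤ ∫ t in (0:ℝ)..(2*π), gL V t * (1 / (1 + (t - γ)^2)) := by
    apply intervalIntegral.integral_mono_on (by linarith) (hintg _ _) (((continuous_gL V).mul hP).intervalIntegrable _ _)
    intro t ht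
    exact mul_le_mul_of_nonneg_right (max_le (gL_tangent hV0 ht.2 hγ hγV) (gL_nonneg hV ht.2)) (hPn t)
  have h2 : ∫ t in (2*π)..V, max (τ t) 0 * (1 / (1 + (t - γ)^2)) ≤ ∫ t in (2*π)..V, fV V t * (1 / (1 + (t - γ)^2)) := by
    apply intervalIntegral.integral_mono_on hV (hintg _ _) ((continuousOn_fV2 hV).mul hP.continuousOn).intervalIntegrable
    intro t ht
    have ht0 : 0 < t := by linarith [ht.1]
    exact mul_le_mul_of_nonneg_right (max_le (fV_tangent hV0 ht0 hγ0 ht.2 hγV) (fV_nonneg hV0 ht0 ht.2)) (hPn t)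
  have h3 := intervalIntegral.integral_add_adjacent_intervals (hintg 0 (2*π)) (hintg (2*π) V)
  have h4 : ∫ t in (0:ℝ)..(2*γ), τ t * (1 / (1 + (t - γ)^2)) ≤ ∫ t in (0:ℝ)..V, max (τ t) 0 * (1 / (1 + (t - γ)^2)) := by
    have e1 : ∫ t in (0:ℝ)..(2*γ), τ t * (1 / (1 + (t - γ)^2)) ≤ ∫ t in (0:ℝ)..(2*γ), max (τ t) 0 * (1 / (1 + (t - γ)^2)) := by
      apply intervalIntegral.integral_mono_on (by linarith) ((hτc.mul hP).intervalIntegrable _ _) (hintg _ _)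
      intro t _
      exact mul_le_mul_of_nonneg_right (le_max_left _ _) (hPn t)
    refine e1.trans ?_
    have e2 := intervalIntegral.integral_add_adjacent_intervals (hintg 0 V) (hintg V (2*γ))
    rcases le_total (2*γ) V with h | h
    · have e3 : 0 ≤ ∫ t in (2*γ)..V, max (τ t) 0 * (1 / (1 + (t - γ)^2)) :=
        intervalIntegral.integral_nonneg h fun t _ => mul_nonneg (le_max_right _ _) (hPn t)
      have e4 := intervalIntegral.integral_symm (μ := MeasureTheory.volume) (f := fun t => max (τ t) 0 * (1 / (1 + (t - γ)^2))) (2*γ) V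
      linarith
    · have e3 : ∫ t in V..(2*γ), max (τ t) 0 * (1 / (1 + (t - γ)^2)) = ∫ t in V..(2*γ), (0:ℝ) := by
        apply intervalIntegral.integral_congr
        intro t ht
        rw [Set.uIcc_of_le h] at ht
        have : τ t ≤ 0 := by
          have a1 := fV_tangent (V := V) (t := V) (u := γ) hV0 hV0 hγ0 le_rfl hγV
          rw [fV_V hV0] at a1
          have a2 := fV'_neg hV0 hγ0
          have := ht.1
          simp only [hτ]; nlinarith
        simp [max_eq_right this]
      rw [e3, intervalIntegral.integral_zero, add_zero] at e2; linarith
  have h5 : ∫ t in (0:ℝ)..(2*γ), τ t * (1 / (1 + (t - γ)^2)) = 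
      (fV V γ * Real.arctan (2*γ - γ) + fV' V γ * Real.log (1 + (2*γ-γ)^2)/2) - (fV V γ * Real.arctan (0 - γ) + fV' V γ * Real.log (1 + (0-γ)^2)/2) := by
    refine intervalIntegral.integral_eq_sub_of_hasDerivAt (f := fun t => fV V γ * Real.arctan (t - γ) + fV' V γ * Real.log (1 + (t-γ)^2)/2) (fun t _ => ?_) ((hτc.mul hP).intervalIntegrable _ _)
    have a0 := (hasDerivAt_id' t).sub_const γ
    have a1 := a0.arctan
    have a2 : HasDerivAt (fun y => Real.log (1+(y-γ)^2)) (2*(t-γ)/(1+(t-γ)^2)) t :=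
      (((a0.fun_pow 2).const_add 1).log (show (1 + (t - γ)^2) ≠ 0 by positivity)).congr_deriv (by norm_num)
    have := (a1.const_mul (fV V γ)).add ((a2.const_mul (fV' V γ)).div_const 2)
    refine this.congr_deriv ?_
    simp only [hτ]
    field_simp
  have h6 : π/2 - 1/γ ≤ Real.arctan γ := by
    have a1 := Real.arctan_inv_of_pos hγ0
    have a2 : Real.arctan (γ⁻¹) ≤ γ⁻¹ := by
      have hg : 0 < γ⁻¹ := by positivity
      have b1 := Real.le_tan (Real.arctan_nonneg.2 hg.le) (Real.arctan_lt_pi_div_two _)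
      rwa [Real.tan_arctan] at b1
    rw [one_div]; linarith
  rw [show 2*γ-γ = γ by ring, show 0 - γ = -γ by ring, Real.arctan_neg, neg_sq] at h5
  have h7 := fV_nonneg hV0 hγ0 hγV
  unfold IV
  have h8 : fV V γ * (π - 2/γ) ≤ fV V γ * (2 * Real.arctan γ) := by
    apply mul_le_mul_of_nonneg_left _ h7
    rw [show 2/γ = 2*(1/γ) by ring]; linarith
  linarith
end PS
end

section
open Real Finset
namespace PS

lemma IV_intL (V : ℝ) {X : ℝ → ℝ} (hX : Continuous X) : IntervalIntegrable (fun t => gL V t * X t) MeasureTheory.volume 0 (2*π) :=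
  ((continuous_gL V).mul hX).intervalIntegrable _ _
lemma IV_intH {V : ℝ} (hV : 2*π ≤ V) {X : ℝ → ℝ} (hX : Continuous X) : IntervalIntegrable (fun t => fV V t * X t) MeasureTheory.volume (2*π) V :=
  ((continuousOn_fV2 hV).mul hX.continuousOn).intervalIntegrable

lemma IV_add {V : ℝ} (hV : 2*π ≤ V) {X Y : ℝ → ℝ} (hX : Continuous X) (hY : Continuous Y) :
    IV V (fun t => X t + Y t) = IV V X + IV V Y := by
  unfold IV
  simp only [mul_add]
  rw [intervalIntegral.integral_add (IV_intL V hX) (IV_intL V hY), intervalIntegral.integral_add (IV_intH hV hX) (IV_intH hV hY)]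
  ring

lemma IV_smul (V c : ℝ) (X : ℝ → ℝ) : IV V (fun t => c * X t) = c * IV V X := by
  unfold IV
  simp only [mul_left_comm _ c]
  rw [intervalIntegral.integral_const_mul, intervalIntegral.integral_const_mul]; ring

lemma IV_sum {V : ℝ} (hV : 2*π ≤ V) {ι : Type*} (A : Finset ι) (X : ι → ℝ → ℝ) (hX : ∀ i, Continuous (X i)) :
    IV V (fun t => ∑ i ∈ A, X i t) = ∑ i ∈ A, IV V (X i) := by
  classical
  induction A using Finset.induction_on with
  | empty => simp [IV]
  | insert a A ha ih =>
    simp only [Finset.sum_insert ha]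
    rw [IV_add hV (hX a) (by have := hX; fun_prop), ih]

lemma IV_mono {V : ℝ} (hV : 2*π ≤ V) {X Y : ℝ → ℝ} (hX : Continuous X) (hY : Continuous Y) (h : ∀ t, 0 ≤ t → t ≤ V → X t ≤ Y t) :
    IV V X ≤ IV V Y := by
  have hp := Real.pi_pos
  unfold IV
  apply add_le_add
  · apply intervalIntegral.integral_mono_on (by positivity) (IV_intL V hX) (IV_intL V hY)
    intro t ht
    exact mul_le_mul_of_nonneg_left (h t ht.1 (ht.2.trans hV)) (gL_nonneg hV ht.2)
  · apply intervalIntegral.integral_mono_on hV (IV_intH hV hX) (IV_intH hV hY)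
    intro t ht
    exact mul_le_mul_of_nonneg_left (h t (by linarith [ht.1]) ht.2) (fV_nonneg (by linarith) (by linarith [ht.1]) ht.2)

noncomputable def s32 (t : ℝ) : ℂ := 3/2 + t * Complex.I
lemma s32_re (t : ℝ) : (s32 t).re = 3/2 := by simp [s32]
lemma s32_im (t : ℝ) : (s32 t).im = t := by simp [s32]
lemma continuous_s32 : Continuous s32 := by unfold s32; fun_prop

lemma continuous_Zf32 : Continuous (fun t => (Zf (s32 t)).re) := by
  apply Complex.continuous_re.comp
  unfold Zf
  apply Continuous.add
  · apply Continuous.div continuous_const (continuous_s32.sub continuous_const)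
    intro t h
    have := congrArg Complex.re h
    simp [s32_re] at this; norm_num at this
  · rw [continuous_iff_continuousAt]; intro t
    have h := (differentiableAt_Zr (s := s32 t) (by rw [s32_re]; norm_num) (xi_ne_zero_of_one_le_re (by rw [s32_re]; norm_num))).continuousAt
    exact ContinuousAt.comp (f := s32) h continuous_s32.continuousAt

noncomputable def zt (n : ℕ) : ℝ := ArithmeticFunction.vonMangoldt n * (n:ℝ)^(-(3/2):ℝ)

lemma zt_nonneg (n : ℕ) : 0 ≤ zt n := mul_nonneg ArithmeticFunction.vonMangoldt_nonneg (by positivity)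

lemma term_re (n : ℕ) (t : ℝ) : (LSeries.term (fun n => (ArithmeticFunction.vonMangoldt n : ℂ)) (s32 t) n).re = zt n * Real.cos (Real.log n * t) := by
  rcases Nat.eq_zero_or_pos n with rfl | hn
  · simp [zt]
  · have hn' : (n:ℂ) ≠ 0 := by exact_mod_cast hn.ne'
    have hnr : (0:ℝ) < n := by exact_mod_cast hn
    rw [LSeries.term_of_ne_zero hn.ne', zt, div_eq_mul_inv, ← Complex.cpow_neg, Complex.cpow_def_of_ne_zero hn', Complex.re_ofReal_mul,
      Complex.exp_re, Real.rpow_def_of_pos hnr, ← Complex.natCast_log]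
    simp only [Complex.re_ofReal_mul, Complex.im_ofReal_mul, Complex.neg_re, Complex.neg_im, s32_re, s32_im]
    rw [mul_neg (Real.log n) t, Real.cos_neg]; ring

lemma hasSum_zf (t : ℝ) : HasSum (fun n => zt n * Real.cos (Real.log n * t)) (Zf (s32 t)).re := by
  have h1 : 1 < (s32 t).re := by rw [s32_re]; norm_num
  rw [Zf_eq_LSeries h1]
  have := Complex.hasSum_re (ArithmeticFunction.LSeriesSummable_vonMangoldt h1).hasSum
  simp only [term_re] at this
  exact this

lemma summable_zt : Summable zt := by
  have := (hasSum_zf 0).summable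
  simpa using this

lemma hasSum_int_zf {a b : ℝ} {w : ℝ → ℝ} (hw : ContinuousOn w (Set.uIcc a b)) :
    HasSum (fun n => ∫ t in a..b, w t * (zt n * Real.cos (Real.log n * t))) (∫ t in a..b, w t * (Zf (s32 t)).re) := by
  apply intervalIntegral.hasSum_integral_of_dominated_convergence (fun n t => zt n * |w t|)
  · intro n
    have : ContinuousOn (fun t => w t * (zt n * Real.cos (Real.log n * t))) (Set.uIcc a b) := hw.mul (by fun_prop)
    exact (this.mono Set.uIoc_subset_uIcc).aestronglyMeasurable measurableSet_uIoc
  · intro n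
    refine Filter.Eventually.of_forall fun t _ => ?_
    rw [norm_mul, norm_mul, Real.norm_of_nonneg (zt_nonneg n), Real.norm_eq_abs, Real.norm_eq_abs, mul_comm]
    have := Real.abs_cos_le_one (Real.log n * t)
    have h2 := zt_nonneg n
    apply mul_le_mul_of_nonneg_right _ (abs_nonneg _)
    nlinarith
  · exact Filter.Eventually.of_forall fun t _ => summable_zt.mul_right _
  · simp only [tsum_mul_right]
    exact (continuousOn_const.mul hw.abs).intervalIntegrable
  · exact Filter.Eventually.of_forall fun t _ => (hasSum_zf t).mul_left _

lemma IV_Zf_nonneg {V : ℝ} (hV : 2*π ≤ V) : 0 ≤ IV V (fun t => (Zf (s32 t)).re) := by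
  have h := (hasSum_int_zf (a := 0) (b := 2*π) (continuous_gL V).continuousOn).add (hasSum_int_zf (continuousOn_fV2 hV))
  refine h.nonneg fun n => ?_
  change 0 ≤ IV V (fun t => zt n * Real.cos (Real.log n * t))
  rw [IV_smul]
  rcases le_or_gt n 1 with h1 | h1
  · have : zt n = 0 := by
      interval_cases n <;> simp [zt]
    simp [this]
  · exact mul_nonneg (zt_nonneg n) (polya hV (Real.log_pos (by exact_mod_cast h1)))

noncomputable def Ks (t : ℝ) : ℝ := 0.5/(0.25+t^2) + 1/4*Real.log ((25/4+t^2)/(4*π^2)) + 0.0726/Real.sqrt (12.25+t^2)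

lemma continuous_Ks : Continuous Ks := by
  unfold Ks
  have hp := Real.pi_pos
  refine Continuous.add (Continuous.add ?_ ?_) ?_
  · exact continuous_const.div (by fun_prop) (fun t => by positivity)
  · exact continuous_const.mul (Continuous.log (by fun_prop) (fun t => by positivity))
  · exact continuous_const.div (by fun_prop) (fun t => by positivity)

lemma logDeriv_le_Ks (t : ℝ) : (logDeriv xi (s32 t)).re ≤ Ks t - (Zf (s32 t)).re := by
  have hp := Real.pi_pos
  set z : ℂ := s32 t / 2 + 1 with hz
  have hre : z.re = 7/4 := by simp [hz, s32]; norm_num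
  have him : z.im = t/2 := by simp [hz, s32]
  have h1 := digamma_main (z := z) (by rw [hre])
  have e1 : ‖z‖ = Real.sqrt (12.25+t^2)/2 := by
    rw [Complex.norm_eq_sqrt_sq_add_sq, hre, him, show (12.25:ℝ)+t^2 = ((7/4)^2+(t/2)^2)*2^2 by ring, Real.sqrt_mul' _ (by norm_num), Real.sqrt_sq (by norm_num)]; ring
  have e2 : (Complex.log (z - 1/2)).re = 1/2*Real.log ((25/4+t^2)/4) := by
    rw [Complex.log_re, Complex.norm_eq_sqrt_sq_add_sq, Real.log_sqrt (by positivity)]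
    simp only [Complex.sub_re, Complex.sub_im, hre, him]
    norm_num
    rw [show (25/16:ℝ)+(t/2)^2 = (25/4+t^2)/4 by ring]; ring
  have h2 := (Complex.abs_re_le_norm _).trans h1
  rw [Complex.sub_re, e2, e1] at h2
  have h3 := (abs_le.1 h2).2
  have e3 : (1/(s32 t - 1)).re = 0.5/(0.25+t^2) := by
    rw [one_div, Complex.inv_re, Complex.normSq_apply]
    simp [s32]; norm_num; ring_nf
  have e4 : Real.log ((25/4+t^2)/(4*π^2)) = Real.log ((25/4+t^2)/4) - 2*Real.log π := by
    rw [show (25/4+t^2)/(4*π^2) = ((25/4+t^2)/4)/π^2 by field_simp, Real.log_div (by positivity) (by positivity), Real.log_pow]; norm_num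
  have e5 : (Zf (s32 t)).re = (1/(s32 t - 1)).re + (1/2*(Complex.digamma z).re - 1/2*Real.log π - (logDeriv xi (s32 t)).re) := by
    unfold Zf Zr
    rw [Complex.add_re, Complex.sub_re, Complex.sub_re]
    congr 3
    · rw [show (1/2:ℂ) = ((1/2:ℝ):ℂ) by norm_num, Complex.re_ofReal_mul]
    · rw [show (1/2:ℂ) = ((1/2:ℝ):ℂ) by norm_num, Complex.re_ofReal_mul, Complex.ofReal_re]
  have e6 : 0.0726/(Real.sqrt (12.25+t^2)/2) = 2*(0.0726/Real.sqrt (12.25+t^2)) := by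
    field_simp
  rw [e6] at h3
  rw [e3] at e5
  unfold Ks
  linarith

variable {B ε : ℝ} {S : Finset ℂ} {E : ℂ → ℂ}

lemma Had.sum_fV (H : Had B ε S E) {V : ℝ} (hV : 2*π ≤ V) (hB : V + 1 < B) {A : Finset ℂ} (hA : A ⊆ S)
    (h1 : ∀ ρ ∈ A, ρ.re = 1/2) (h2 : ∀ ρ ∈ A, 2*π ≤ ρ.im) (h3 : ∀ ρ ∈ A, ρ.im ≤ V) :
    ∑ ρ ∈ A, (mz ρ : ℝ) * (fV V ρ.im * (π - 2/ρ.im)) ≤ IV V Ks + ε * IV V (fun _ => 1) := by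
  have c1 : ∀ γ : ℝ, Continuous (fun t : ℝ => 1/(1+(t-γ)^2)) := fun γ => continuous_const.div (by fun_prop) (fun t => by positivity)
  calc _ ≤ ∑ ρ ∈ A, IV V (fun t => (mz ρ : ℝ) * (1/(1+(t-ρ.im)^2))) := by
        apply Finset.sum_le_sum
        intro ρ hρ
        rw [IV_smul]
        exact mul_le_mul_of_nonneg_left (IV_kernel (h2 ρ hρ) (h3 ρ hρ)) (by positivity)
    _ = IV V (fun t => ∑ ρ ∈ A, (mz ρ : ℝ) * (1/(1+(t-ρ.im)^2))) := by
        rw [IV_sum hV A (fun ρ t => (mz ρ : ℝ) * (1/(1+(t-ρ.im)^2))) (fun ρ => continuous_const.mul (c1 _))]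
    _ ≤ IV V (fun t => (Ks t + ε * 1) + (-1) * (Zf (s32 t)).re) := by
        apply IV_mono hV
        · exact continuous_finsetSum _ fun ρ _ => continuous_const.mul (c1 _)
        · exact (continuous_Ks.add continuous_const).add (continuous_const.mul continuous_Zf32)
        · intro t ht htV
          have g1 := H.sum_re (s := s32 t) (H.ball_of (by rw [s32_re, s32_im, abs_of_nonneg ht]; norm_num; linarith)) (by rw [s32_re]; norm_num)
          rw [s32_re, s32_im] at g1
          have g2 := logDeriv_le_Ks t
          have g3 : ∑ ρ ∈ A, (mz ρ : ℝ) * (1/(1+(t-ρ.im)^2)) ≤ ∑ ρ ∈ S, (mz ρ : ℝ) * ((3/2 - ρ.re) / ((3/2 - ρ.re)^2 + (t - ρ.im)^2)) := by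
            refine le_trans (le_of_eq ?_) (Finset.sum_le_sum_of_subset_of_nonneg hA ?_)
            · apply Finset.sum_congr rfl
              intro ρ hρ
              rw [h1 ρ hρ]; norm_num
            · intro ρ hρ _
              have := H.re1 hρ
              apply mul_nonneg (by positivity) (div_nonneg (by linarith) (by positivity))
          linarith
    _ = IV V Ks + ε * IV V (fun _ => 1) - IV V (fun t => (Zf (s32 t)).re) := by
        rw [IV_add hV (X := fun t => Ks t + ε * 1) (Y := fun t => (-1) * (Zf (s32 t)).re) (continuous_Ks.add continuous_const) (continuous_const.mul continuous_Zf32),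
          IV_add hV (X := Ks) (Y := fun _ => ε * 1) continuous_Ks continuous_const, IV_smul V (-1), IV_smul V ε]; ring
    _ ≤ _ := by linarith [IV_Zf_nonneg hV]

end PS
end

section
open Real Finset
namespace PS

lemma exp56 : Real.exp (5/6) ≤ 2.302 := by
  have h := Real.exp_bound' (x := 5/6) (by norm_num) (by norm_num) (n := 7) (by norm_num)
  refine h.trans ?_
  norm_num [Finset.sum_range_succ, Nat.factorial]

lemma two_pi_bounds : 6.2831 ≤ 2*π ∧ 2*π ≤ 6.2832 := by
  constructor <;> linarith [Real.pi_gt_d6, Real.pi_lt_d6]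

lemma gL_eq {V : ℝ} (hV : 0 < V) (t : ℝ) : gL V t = 1/(2*π)*(2 - t/(2*π)) + (1/(4*V) - (2*π)/(4*V^2) - (2*π)^2/V^3 + (2*π - t)*(1/(4*V^2)+2*(2*π)/V^3)) := by
  have hp := Real.pi_pos
  unfold gL fV fV'
  field_simp; ring

set_option maxHeartbeats 1000000 in
lemma low_part {V : ℝ} (hV : 10^6 ≤ V) : ∫ t in (0:ℝ)..(2*π), gL V t * Ks t ≤ 0.1887 := by
  have hp := Real.pi_pos
  obtain ⟨hc1, hc2⟩ := two_pi_bounds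
  set c := 2*π with hc
  have hc0 : 0 < c := by positivity
  have hV0 : 0 < V := by linarith
  let Ku : ℝ → ℝ := fun t => 0.5/(0.25+t^2) + 1/4*(-11/6 + 2.302*((25/4+t^2)/c^2)) + 0.0208
  have hKu : ∀ t, Ks t ≤ Ku t := by
    intro t
    have h1 : Real.log ((25/4+t^2)/c^2) ≤ -11/6 + 2.302*((25/4+t^2)/c^2) := by
      have hy : 0 < (25/4+t^2)/c^2 := by positivity
      have := Real.log_le_sub_one_of_pos (x := (25/4+t^2)/c^2 * Real.exp (5/6)) (by positivity)
      rw [Real.log_mul hy.ne' (by positivity), Real.log_exp] at this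
      have h2 := mul_le_mul_of_nonneg_left exp56 hy.le
      linarith
    have h2 : 0.0726/Real.sqrt (12.25+t^2) ≤ 0.0208 := by
      have : 3.5 ≤ Real.sqrt (12.25+t^2) := by
        apply Real.le_sqrt_of_sq_le; nlinarith [sq_nonneg t]
      rw [div_le_iff₀ (by positivity)]; linarith
    have h3 : 4*π^2 = c^2 := by rw [hc]; ring
    simp only [Ks, Ku, h3]; linarith
  have hKu3 : ∀ t ∈ Set.Icc 0 c, Ku t ≤ 3 := by
    intro t ht
    have h1 : 0.5/(0.25+t^2) ≤ 2 := by
      rw [div_le_iff₀ (by positivity)]; nlinarith [sq_nonneg t]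
    have h2 : (25/4+t^2)/c^2 ≤ 1.2 := by
      rw [div_le_iff₀ (by positivity)]; nlinarith [ht.1, ht.2]
    simp only [Ku]; linarith
  have hg : ∀ t ∈ Set.Icc 0 c, 0 ≤ gL V t - 1/c*(2-t/c) ∧ gL V t - 1/c*(2-t/c) ≤ 1/V := by
    intro t ht
    rw [gL_eq hV0, ← hc, add_sub_cancel_left]
    have q : c/V ≤ 1/100 := by rw [div_le_iff₀ hV0]; linarith
    have q0 : 0 ≤ c/V := by positivity
    have e1 : 1/(4*V) - c/(4*V^2) - c^2/V^3 = (1/V)*(1/4 - (c/V)/4 - (c/V)^2) := by field_simp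
    have e2 : 1/(4*V^2)+2*c/V^3 = (1/V)*(1/V)*(1/4 + 2*(c/V)) := by field_simp
    have e3 : (c-t)*((1/V)*(1/V)*(1/4 + 2*(c/V))) ≤ 1/V*(1/2) := by
      have : (c-t)*(1/V) ≤ 1/100 := by
        refine le_trans ?_ q
        rw [mul_one_div]; apply div_le_div_of_nonneg_right _ hV0.le; linarith [ht.1]
      have h0 : 0 ≤ (c-t)*(1/V) := mul_nonneg (by linarith [ht.2]) (by positivity)
      calc _ = 1/V*(((c-t)*(1/V))*(1/4 + 2*(c/V))) := by ring
        _ ≤ _ := by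
          apply mul_le_mul_of_nonneg_left _ (by positivity)
          nlinarith
    have e4 : 0 ≤ (c-t)*((1/V)*(1/V)*(1/4 + 2*(c/V))) := mul_nonneg (by linarith [ht.2]) (by positivity)
    rw [e1, e2]
    have i : 0 < 1/V := by positivity
    constructor
    · have : 0 ≤ (1/V)*(1/4 - (c/V)/4 - (c/V)^2) := mul_nonneg i.le (by nlinarith)
      linarith
    · have : (1/V)*(1/4 - (c/V)/4 - (c/V)^2) ≤ 1/V*(1/2) := mul_le_mul_of_nonneg_left (by nlinarith) i.le
      linarith
  let W : ℝ → ℝ := fun t => 1/c*(2-t/c) * Ku t + 3/V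
  have hKuc : Continuous Ku := by
    refine ((continuous_const.div (by fun_prop) (fun t => by positivity)).add (by fun_prop)).add continuous_const
  have hWc : Continuous W := by
    have := hKuc
    simp only [W]; fun_prop
  have h1 : ∫ t in (0:ℝ)..c, gL V t * Ks t ≤ ∫ t in (0:ℝ)..c, W t := by
    apply intervalIntegral.integral_mono_on hc0.le (IV_intL V continuous_Ks) (hWc.intervalIntegrable _ _)
    intro t ht
    obtain ⟨a, b⟩ := hg t ht
    have a1 := mul_le_mul_of_nonneg_left (hKu t) (gL_nonneg (V := V) (by linarith) ht.2)
    have a2 := mul_le_mul_of_nonneg_left (hKu3 t ht) a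
    have a3 : 3/V = 1/V*3 := by ring
    simp only [W]; rw [a3]
    nlinarith
  let Pr : ℝ → ℝ := fun t => 2/c*Real.arctan (2*t) - 1/c^2*(1/4*Real.log (0.25+t^2))
      + (1/4*(-11/6+2.302*(25/4)/c^2)+0.0208)*(2/c*t - t^2/(2*c^2)) + 1/4*2.302/c^2*(2/c*(t^3/3) - t^4/(4*c^2)) + 3/V*t
  have h2 : ∫ t in (0:ℝ)..c, W t = Pr c - Pr 0 := by
    refine intervalIntegral.integral_eq_sub_of_hasDerivAt (fun t _ => ?_) (hWc.intervalIntegrable _ _)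
    have b0 := hasDerivAt_id' t
    have b1 := ((b0.const_mul 2).arctan).const_mul (2/c)
    have b2 : HasDerivAt (fun t => Real.log (0.25+t^2)) (2*t/(0.25+t^2)) t :=
      (((b0.fun_pow 2).const_add 0.25).log (show (0.25 + t^2:ℝ) ≠ 0 by positivity)).congr_deriv (by norm_num)
    have b3 := (b2.const_mul (1/4)).const_mul (1/c^2)
    have b4 := ((b0.const_mul (2/c)).sub ((b0.fun_pow 2).div_const (2*c^2))).const_mul (1/4*(-11/6+2.302*(25/4)/c^2)+0.0208)
    have b5 := ((((b0.fun_pow 3).div_const 3).const_mul (2/c)).sub ((b0.fun_pow 4).div_const (4*c^2))).const_mul (1/4*2.302/c^2)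
    refine ((((b1.sub b3).add b4).add b5).add (b0.const_mul (3/V))).congr_deriv ?_
    simp only [W, Ku]
    have : (1+(2*t)^2) = 4*(0.25+t^2) := by ring
    rw [this]
    have n1 : (0.25+t^2) ≠ 0 := by positivity
    generalize hD : (0.25+t^2) = D at *
    field_simp
    norm_num
    ring
  rw [h2] at h1
  refine h1.trans ?_
  have h3 : Real.arctan (2*c) ≤ π/2 := (Real.arctan_lt_pi_div_two _).le
  have h4 : 5 ≤ Real.log (0.25+c^2) - Real.log (0.25+0^2) := by
    rw [← Real.log_div (by positivity) (by norm_num), Real.le_log_iff_exp_le (by positivity)]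
    have : Real.exp 5 = (Real.exp 1)^5 := by rw [← Real.exp_nat_mul]; norm_num
    rw [this]
    have e := Real.exp_one_lt_d9
    calc (Real.exp 1)^5 ≤ 2.72^5 := by gcongr; linarith
      _ ≤ _ := by
        rw [le_div_iff₀ (by norm_num)]; norm_num; nlinarith
  have h5 : 2/c*Real.arctan (2*c) ≤ 1/2 := by
    calc _ ≤ 2/c*(π/2) := by gcongr
      _ = _ := by rw [hc]; field_simp
  have i1 : 1/c^2 ≤ 0.02535 := by rw [div_le_iff₀ (by positivity)]; nlinarith
  have i2 : 3/V*c ≤ 0.00002 := by rw [div_mul_eq_mul_div, div_le_iff₀ hV0]; nlinarith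
  have j1 : 2/c*c - c^2/(2*c^2) = 3/2 := by field_simp; norm_num
  have j2 : 1/4*2.302/c^2*(2/c*(c^3/3) - c^4/(4*c^2)) = 2.302/4*(5/12) := by field_simp; norm_num
  have j3 : 2.302*(25/4)/c^2 = 2.302*(25/4)*(1/c^2) := by ring
  simp only [Pr, mul_zero, Real.arctan_zero]
  rw [j1, j2, j3]
  have h6 := mul_le_mul_of_nonneg_left h4 (show 0 ≤ 1/c^2*(1/4) by positivity)
  norm_num at h6 i1 i2 ⊢
  nlinarith


noncomputable def MY (Y : ℝ) : ℝ := Y^2/2 - 5/24*Y - 1/4 + 1/16 + 1/9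

set_option maxHeartbeats 1000000 in
lemma high_part {V : ℝ} (hV : 10^6 ≤ V) : ∫ t in (2*π)..V, fV V t * Ks t ≤ 1/2*MY (Real.log (V/(2*π))) + 0.0408 := by
  have hp := Real.pi_pos
  obtain ⟨hc1, hc2⟩ := two_pi_bounds
  set c := 2*π with hc
  have hc0 : 0 < c := by positivity
  have hV0 : 0 < V := by linarith
  have hcV : c ≤ V := by linarith
  let W : ℝ → ℝ := fun t => 1/2*(fV V t * Real.log (t/c)) + (33/(16*t^3) + 0.0726/t^2 + (33/(64*V))/t^2 + 0.0726/(4*V*c))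
  have hWc : ContinuousOn W (Set.uIcc c V) := by
    have h0 := continuousOn_fV2 hcV
    have hpos : ∀ t ∈ Set.uIcc c V, 0 < t := fun t ht => by
      rw [Set.uIcc_of_le hcV] at ht; linarith [ht.1]
    refine ContinuousOn.add (continuousOn_const.mul (h0.mul ?_)) (ContinuousOn.add (ContinuousOn.add (ContinuousOn.add ?_ ?_) ?_) continuousOn_const)
    · apply ContinuousOn.log (by fun_prop); intro t ht; have := hpos t ht; positivity
    all_goals apply ContinuousOn.div continuousOn_const (by fun_prop); intro t ht; have := hpos t ht; positivity
  have h1 : ∫ t in c..V, fV V t * Ks t ≤ ∫ t in c..V, W t := by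
    apply intervalIntegral.integral_mono_on hcV (IV_intH hcV continuous_Ks) hWc.intervalIntegrable
    intro t ht
    have ht0 : 0 < t := by linarith [ht.1]
    have f0 := fV_nonneg hV0 ht0 ht.2
    have f1 : fV V t ≤ 1/t + 1/(4*V) := by
      unfold fV
      have : 0 ≤ t/(4*V^2) := by positivity
      have : 0 ≤ t^2/V^3 := by positivity
      linarith
    have k1 : Ks t ≤ 1/2*Real.log (t/c) + (33/(16*t^2) + 0.0726/t) := by
      have a1 : 0.5/(0.25+t^2) ≤ 8/(16*t^2) := by
        rw [div_le_div_iff₀ (by positivity) (by positivity)]; nlinarith [sq_nonneg t]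
      have a2 : 0.0726/Real.sqrt (12.25+t^2) ≤ 0.0726/t := by
        apply div_le_div_of_nonneg_left (by norm_num) ht0
        apply Real.le_sqrt_of_sq_le; linarith
      have a3 : Real.log ((25/4+t^2)/c^2) ≤ 2*Real.log (t/c) + 25/(4*t^2) := by
        have : (25/4+t^2)/c^2 = (t/c)^2*(1+25/(4*t^2)) := by field_simp; ring
        rw [this, Real.log_mul (by positivity) (by positivity), Real.log_pow]
        have := Real.log_le_sub_one_of_pos (x := 1+25/(4*t^2)) (by positivity)
        push_cast; linarith
      have h3 : 4*π^2 = c^2 := by rw [hc]; ring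
      have a4 : 33/(16*t^2) = 8/(16*t^2) + 1/4*(25/(4*t^2)) := by ring
      simp only [Ks, h3]; rw [a4]; linarith
    have k2 := mul_le_mul_of_nonneg_left k1 f0
    have k3 := mul_le_mul_of_nonneg_right f1 (show 0 ≤ 33/(16*t^2) + 0.0726/t by positivity)
    have k4 : (1/t+1/(4*V))*(33/(16*t^2) + 0.0726/t) ≤ 33/(16*t^3) + 0.0726/t^2 + (33/(64*V))/t^2 + 0.0726/(4*V*c) := by
      have : (1/t+1/(4*V))*(33/(16*t^2) + 0.0726/t) = 33/(16*t^3) + 0.0726/t^2 + (33/(64*V))/t^2 + 0.0726/(4*V*t) := by field_simp; ring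
      rw [this]
      gcongr; exact ht.1
    simp only [W]; nlinarith
  let Pr : ℝ → ℝ := fun t => 1/2*(Real.log (t/c)^2/2 + 1/(4*V)*(t*Real.log (t/c) - t) - 1/(4*V^2)*(t^2/2*Real.log (t/c) - t^2/4) - 1/V^3*(t^3/3*Real.log (t/c) - t^3/9))
    + (-(33/(32*t^2)) - 0.0726/t - (33/(64*V))/t + 0.0726/(4*V*c)*t)
  have h2 : ∫ t in c..V, W t = Pr V - Pr c := by
    refine intervalIntegral.integral_eq_sub_of_hasDerivAt (fun t ht => ?_) hWc.intervalIntegrable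
    have ht0 : 0 < t := by
      rw [Set.uIcc_of_le hcV] at ht; linarith [ht.1]
    have b0 := hasDerivAt_id' t
    have l : HasDerivAt (fun t => Real.log (t/c)) (1/t) t :=
      ((b0.div_const c).log (by positivity)).congr_deriv (by field_simp)
    have p1 := (l.fun_pow 2).div_const 2
    have p2 := ((b0.mul l).sub b0).const_mul (1/(4*V))
    have p3 := ((((b0.fun_pow 2).div_const 2).mul l).sub ((b0.fun_pow 2).div_const 4)).const_mul (1/(4*V^2))
    have p4 := ((((b0.fun_pow 3).div_const 3).mul l).sub ((b0.fun_pow 3).div_const 9)).const_mul (1/V^3)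
    have q1 : HasDerivAt (fun t => 33/(32*t^2)) (-(33/(16*t^3))) t := by
      refine (((b0.fun_pow 2).const_mul 32).fun_inv (by positivity) |>.const_mul 33).congr_deriv ?_
      field_simp; norm_num; ring
    have q2 : ∀ k : ℝ, HasDerivAt (fun t => k/t) (-(k/t^2)) t := fun k => by
      refine ((b0.fun_inv ht0.ne').const_mul k).congr_deriv ?_
      field_simp
    refine ((((((p1.add p2).sub p3).sub p4).const_mul (1/2)).add (((q1.neg.sub (q2 0.0726)).sub (q2 (33/(64*V)))).add (b0.const_mul (0.0726/(4*V*c)))))).congr_deriv ?_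
    simp only [W, fV]
    field_simp
    norm_num
    ring
  rw [h2] at h1
  refine h1.trans ?_
  simp only [Pr, MY]
  rw [div_self hc0.ne', Real.log_one]
  have i1 : 1/c^2 ≤ 0.02535 := by rw [div_le_iff₀ (by positivity)]; nlinarith
  have i3 : 1/c ≤ 0.15916 := by rw [div_le_iff₀ (by positivity)]; nlinarith
  have i4 : c/V ≤ 0.00001 := by rw [div_le_iff₀ hV0]; linarith
  have i5 : 1/V ≤ 0.000001 := by rw [div_le_iff₀ hV0]; linarith
  have i6 : 0 ≤ 1/V := by positivity
  set Y := Real.log (V/c)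
  have e1 : 1/2*(Y^2/2 + 1/(4*V)*(V*Y - V) - 1/(4*V^2)*(V^2/2*Y - V^2/4) - 1/V^3*(V^3/3*Y - V^3/9)) = 1/2*(Y^2/2 - 5/24*Y - 1/4 + 1/16 + 1/9) := by
    field_simp; ring
  have e2 : 1/2*((0:ℝ)^2/2 + 1/(4*V)*(c*0 - c) - 1/(4*V^2)*(c^2/2*0 - c^2/4) - 1/V^3*(c^3/3*0 - c^3/9)) = 1/2*(-(1/4)*(c/V) + (c/V)^2/16 + (c/V)^3/9) := by
    field_simp; ring
  have e3 : (0.0726/(4*V*c)*V:ℝ) = 0.0726/4*(1/c) := by field_simp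
  have e4 : (0.0726/(4*V*c)*c:ℝ) = 0.0726/4*(1/V) := by field_simp
  have e5 : 33/(32*c^2) = 33/32*(1/c^2) := by field_simp
  have e6 : 33/(64*V)/c = 33/64*(1/V*(1/c)) := by field_simp
  have e7 : 0.0726/c = 0.0726*(1/c) := by ring
  have n1 : 0 ≤ 33/(32*V^2) := by positivity
  have n2 : 0 ≤ 0.0726/V := by positivity
  have n3 : 0 ≤ 33/(64*V)/V := by positivity
  have n4 : 0 ≤ c/V := by positivity
  have n5 : (1/V)*(1/c) ≤ 0.000001 := by
    have h0 : 1/c ≤ 1 := by linarith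
    have := mul_le_mul i5 h0 (by positivity) (by norm_num)
    linarith
  have n6 : 0 ≤ (c/V)^2/16 + (c/V)^3/9 := by positivity
  rw [e1, e2, e3, e4, e5, e6, e7]
  generalize 1/c^2 = a1 at *
  generalize 1/V*(1/c) = a2 at *
  linarith

end PS
end

section
open Real Finset
namespace PS

lemma IV_one_le {V : ℝ} (hV : 10^6 ≤ V) : IV V (fun _ => 1) ≤ V := by
  have hp := Real.pi_pos
  obtain ⟨hc1, hc2⟩ := two_pi_bounds
  have hV0 : 0 < V := by linarith
  have hcV : 2*π ≤ V := by linarith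
  have iv : 1/V ≤ 0.000001 := by rw [div_le_iff₀ hV0]; linarith
  have hf : ∀ t, 2*π ≤ t → t ≤ V → fV V t ≤ 0.5 := by
    intro t h1 h2
    have ht0 : 0 < t := by linarith
    unfold fV
    have : 0 ≤ t/(4*V^2) := by positivity
    have : 0 ≤ t^2/V^3 := by positivity
    have : 1/t ≤ 0.2 := by rw [div_le_iff₀ ht0]; linarith
    have : 1/(4*V) = 1/4*(1/V) := by field_simp
    linarith
  have hg : ∀ t, 0 ≤ t → t ≤ 2*π → gL V t ≤ 1 := by
    intro t h1 h2
    have a1 := hf (2*π) le_rfl hcV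
    have a2 : fV' V (2*π) * (t - 2*π) ≤ 0.5 := by
      have e : -fV' V (2*π) * (2*π) = 1/(2*π) + (2*π)/V*((1/V)*(1/4) + 2*((2*π)/V)*(1/V)) := by
        unfold fV'; field_simp; ring
      have b1 : 1/(2*π) ≤ 0.2 := by rw [div_le_iff₀ (by positivity)]; linarith
      have b2 : (2*π)/V ≤ 0.1 := by rw [div_le_iff₀ hV0]; linarith
      have b3 : (2*π)/V*((1/V)*(1/4) + 2*((2*π)/V)*(1/V)) ≤ 0.1*(1*(1/4)+2*0.1*1) := by
        have : 1/V ≤ 1 := by linarith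
        gcongr
      have n := fV'_neg hV0 (show 0 < 2*π by positivity)
      nlinarith
    unfold gL; linarith
  unfold IV
  have i1 := intervalIntegral.integral_mono_on (show (0:ℝ) ≤ 2*π by positivity) (IV_intL V (X := fun _ => 1) continuous_const) (intervalIntegrable_const (c := (1:ℝ))) (fun t ht => by
    rw [mul_one]; exact hg t ht.1 ht.2)
  have i2 := intervalIntegral.integral_mono_on hcV (IV_intH hcV (X := fun _ => 1) continuous_const) (intervalIntegrable_const (c := (1:ℝ))) (fun t ht => by
    rw [mul_one]; exact (hf t ht.1 ht.2).trans (by norm_num))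
  simp only [intervalIntegral.integral_const, smul_eq_mul] at i1 i2
  linarith

variable {B ε : ℝ} {S : Finset ℂ} {E : ℂ → ℂ}

lemma fV_le_inv {V t : ℝ} (hV : 0 < V) (ht : 0 < t) (htV : t ≤ V) : fV V t ≤ 1.0325/t := by
  have e : fV V t = (1 + (t/V)/4 - (t/V)^2/4 - (t/V)^3)/t := by unfold fV; field_simp
  rw [e]
  apply div_le_div_of_nonneg_right _ ht.le
  have h0 : 0 ≤ t/V := by positivity
  have h1 : t/V ≤ 1 := by rw [div_le_one hV]; exact htV
  set b := t/V
  nlinarith [mul_nonneg h0 (sq_nonneg (b-0.22)), sq_nonneg (b-0.22)]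

lemma inv_le_fV {V t : ℝ} (hV : 0 < V) (ht : 0 < t) (htV : t ≤ V/2) : 15/(16*t) ≤ fV V t := by
  have e : fV V t = (1 + (t/V)/4 - (t/V)^2/4 - (t/V)^3)/t := by unfold fV; field_simp
  rw [e, show 15/(16*t) = (15/16)/t by field_simp]
  apply div_le_div_of_nonneg_right _ ht.le
  have h0 : 0 ≤ t/V := by positivity
  have h1 : t/V ≤ 1/2 := by rw [div_le_iff₀ hV]; linarith
  set b := t/V
  nlinarith [mul_nonneg h0 (sub_nonneg.2 h1), mul_nonneg (mul_nonneg h0 h0) (sub_nonneg.2 h1)]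

lemma Had.sum_lemma (H : Had B ε S E) {V : ℝ} (hV : 10^6 ≤ V) (hB : V + 1 < B) (hε : ε ≤ 1/V^2) {A : Finset ℂ} (hA : A ⊆ S)
    (h1 : ∀ ρ ∈ A, ρ.re = 1/2) (h2 : ∀ ρ ∈ A, 0 < ρ.im) (h3 : ∀ ρ ∈ A, ρ.im ≤ V) :
    2 * ∑ ρ ∈ A, (mz ρ : ℝ) * fV V ρ.im ≤ 1/π * MY (Real.log (V/(2*π))) + 0.18 := by
  have hp := Real.pi_pos
  obtain ⟨hc1, hc2⟩ := two_pi_bounds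
  have hV0 : 0 < V := by linarith
  have h2' : ∀ ρ ∈ A, 2*π ≤ ρ.im := fun ρ hρ => by
    have := H.im (hA hρ)
    rw [abs_of_pos (h2 ρ hρ)] at this
    norm_num at this hc2; linarith
  have m := H.sum_fV (by linarith) hB hA h1 h2' h3
  have l := low_part hV
  have hh := high_part hV
  have i : IV V Ks ≤ 1/2*MY (Real.log (V/(2*π))) + 0.2295 := by unfold IV; linarith
  have e1 : ε * IV V (fun _ => 1) ≤ 0.000001 := by
    have a := mul_le_mul_of_nonneg_left (IV_one_le hV) H.he0
    have b := mul_le_mul_of_nonneg_right hε hV0.le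
    have c : 1/V^2*V = 1/V := by field_simp
    have d : 1/V ≤ 0.000001 := by rw [div_le_iff₀ hV0]; linarith
    linarith
  have e2 : ∑ ρ ∈ A, (mz ρ : ℝ) * fV V ρ.im * (1/ρ.im) ≤ 1.0325*0.0241 := by
    have a : ∑ ρ ∈ A, (mz ρ : ℝ) / ρ.im ^ 2 ≤ 0.0241 := by
      refine le_trans (Finset.sum_le_sum_of_subset_of_nonneg ?_ ?_) H.sum_inv_sq_pos
      · intro ρ hρ; rw [Finset.mem_filter]; exact ⟨hA hρ, h2 ρ hρ⟩
      · intro ρ _ _; positivity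
    refine le_trans ?_ (mul_le_mul_of_nonneg_left a (by norm_num : (0:ℝ) ≤ 1.0325))
    rw [Finset.mul_sum]
    apply Finset.sum_le_sum
    intro ρ hρ
    have g := h2 ρ hρ
    have := mul_le_mul_of_nonneg_left (fV_le_inv hV0 g (h3 ρ hρ)) (show (0:ℝ) ≤ mz ρ by positivity)
    have := mul_le_mul_of_nonneg_right this (show 0 ≤ 1/ρ.im by positivity)
    refine this.trans (le_of_eq ?_)
    field_simp
  have e3 : ∑ ρ ∈ A, (mz ρ : ℝ) * (fV V ρ.im * (π - 2/ρ.im)) = π * (∑ ρ ∈ A, (mz ρ : ℝ) * fV V ρ.im) - 2 * ∑ ρ ∈ A, (mz ρ : ℝ) * fV V ρ.im * (1/ρ.im) := by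
    rw [Finset.mul_sum, Finset.mul_sum, ← Finset.sum_sub_distrib]
    apply Finset.sum_congr rfl; intro ρ _; ring
  rw [e3] at m
  set Q := ∑ ρ ∈ A, (mz ρ : ℝ) * fV V ρ.im
  have f : 1/π * MY (Real.log (V/(2*π))) + 0.18 = (MY (Real.log (V/(2*π))) + 0.18*π)/π := by field_simp
  rw [f, le_div_iff₀ hp]
  nlinarith [Real.pi_gt_d6]

end PS
end

section
open Real Finset
namespace PS

lemma cot_q {a : ℝ} (h0 : 0 < a) (h1 : a < 1) : ∃ q : ℝ, 2/3 ≤ q ∧ q ≤ 1 ∧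
    π * (Real.cos (π*a) / Real.sin (π*a)) = 1/a - 1/(1-a) + (1-2*a)*q := by
  have hx : (a:ℂ) ∈ Complex.integerComplement := by
    rw [Complex.mem_integerComplement_iff]
    rintro ⟨n, hn⟩
    have : (n:ℝ) = a := by exact_mod_cast hn
    have h2 : (0:ℝ) < n := by rw [this]; exact h0
    have h3 : (n:ℝ) < 1 := by rw [this]; exact h1
    have h2' : 0 < n := by exact_mod_cast h2
    have h3' : n < 1 := by exact_mod_cast h3
    omega
  have ht := tendsto_logDeriv_euler_cot_sub hx
  set Q : ℕ → ℝ := fun N => ∑ n ∈ range N, 1/(((n:ℝ)+1+a)*((n:ℝ)+2-a)) with hQ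
  have hp : ∀ N : ℕ, ∑ j ∈ range (N+1), cotTerm (a:ℂ) j
      = (((1-2*a)*Q N + 1/(a+N+1) - 1/(1-a) : ℝ) : ℂ) := by
    intro N
    have : ∑ j ∈ range (N+1), cotTerm (a:ℂ) j
      = ((∑ j ∈ range (N+1), (1/(a-((j:ℝ)+1)) + 1/(a+((j:ℝ)+1))) : ℝ) : ℂ) := by
      push_cast; rfl
    rw [this]
    congr 1
    induction N with
    | zero => 
      simp [hQ]
      have : a - 1 = -(1-a) := by ring
      rw [this, inv_neg]; ring
    | succ N ih =>
      rw [sum_range_succ, ih]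
      · simp only [hQ]; rw [sum_range_succ]
        have e1 : (N:ℝ)+1+a ≠ 0 := by positivity
        have hN0 : (0:ℝ) ≤ N := by positivity
        have e2 : (N:ℝ)+2-a ≠ 0 := ne_of_gt (by linarith)
        have e3 : a - ((N:ℝ)+1+1) ≠ 0 := ne_of_lt (by linarith)
        have e4 : a + ((N:ℝ)+1) ≠ 0 := by positivity
        have e5 : a + ((N:ℝ)+1+1) ≠ 0 := by positivity
        have e6 : 1/(a-((N:ℝ)+1+1)) = -(1/((N:ℝ)+2-a)) := by
          rw [← one_div_neg_eq_neg_one_div]; ring_nf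
        have e7 : (1-2*a)*(1/(((N:ℝ)+1+a)*((N:ℝ)+2-a))) = 1/((N:ℝ)+1+a) - 1/((N:ℝ)+2-a) := by
          field_simp; ring
        push_cast
        rw [mul_add, e7, e6]
        ring_nf
      · push_cast; rfl
  have hQl : ∀ N : ℕ, 2/3 - 1/((N:ℝ)+3/2) ≤ Q N ∧ Q N ≤ 1 - 1/((N:ℝ)+1) := by
    intro N
    induction N with
    | zero => simp [hQ]
    | succ N ih =>
      have hN : (0:ℝ) ≤ N := by positivity
      have e : Q (N+1) = Q N + 1/(((N:ℝ)+1+a)*((N:ℝ)+2-a)) := by simp only [hQ]; rw [sum_range_succ]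
      have hpos : 0 < ((N:ℝ)+1+a)*((N:ℝ)+2-a) := by
        apply mul_pos <;> linarith
      have e1 : 1/(((N:ℝ)+1+a)*((N:ℝ)+2-a)) ≤ 1/((N:ℝ)+1) - 1/((N:ℝ)+1+1) := by
        have : 1/((N:ℝ)+1) - 1/((N:ℝ)+1+1) = 1/(((N:ℝ)+1)*((N:ℝ)+1+1)) := by field_simp; ring
        rw [this]
        apply one_div_le_one_div_of_le (by positivity)
        nlinarith
      have e2 : 1/((N:ℝ)+3/2) - 1/((N:ℝ)+1+3/2) ≤ 1/(((N:ℝ)+1+a)*((N:ℝ)+2-a)) := by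
        have : 1/((N:ℝ)+3/2) - 1/((N:ℝ)+1+3/2) = 1/(((N:ℝ)+3/2)*((N:ℝ)+1+3/2)) := by field_simp; ring
        rw [this]
        apply one_div_le_one_div_of_le hpos
        nlinarith [sq_nonneg (a-1/2)]
      rw [e]; push_cast
      constructor <;> linarith [ih.1, ih.2]
  -- limit
  have ht2 := (Filter.tendsto_add_atTop_iff_nat 1).mpr ht
  simp_rw [hp] at ht2
  have hlim : (π * Complex.cot (π * a) - 1/(a:ℂ)) = ((π * (Real.cos (π*a) / Real.sin (π*a)) - 1/a : ℝ) : ℂ) := by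
    rw [Complex.cot]; push_cast; rfl
  rw [hlim] at ht2
  have ht3 : Filter.Tendsto (fun N : ℕ => (1-2*a)*Q N + 1/(a+N+1) - 1/(1-a)) Filter.atTop
      (nhds (π * (Real.cos (π*a) / Real.sin (π*a)) - 1/a)) := by
    have := (Complex.continuous_re.tendsto _).comp ht2
    simpa only [Function.comp_def, Complex.ofReal_re] using this
  have hQm : Monotone Q := by
    apply monotone_nat_of_le_succ
    intro N
    simp only [hQ]; rw [sum_range_succ]
    have hN : (0:ℝ) ≤ N := by positivity
    have hpos : 0 < ((N:ℝ)+1+a)*((N:ℝ)+2-a) := by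
        apply mul_pos <;> linarith
    have := one_div_pos.mpr hpos
    linarith
  have hQb : BddAbove (Set.range Q) := ⟨1, by
    rintro _ ⟨N, rfl⟩
    have h := (hQl N).2
    have : 0 ≤ 1/((N:ℝ)+1) := by positivity
    linarith⟩
  have htQ := tendsto_atTop_ciSup hQm hQb
  have h32 : Filter.Tendsto (fun N : ℕ => 1/((N:ℝ)+3/2)) Filter.atTop (nhds 0) := by
    apply Filter.Tendsto.div_atTop tendsto_const_nhds
    exact Filter.tendsto_atTop_add_const_right _ _ tendsto_natCast_atTop_atTop
  have h33 : Filter.Tendsto (fun N : ℕ => 1/(a+(N:ℝ)+1)) Filter.atTop (nhds 0) := by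
    apply Filter.Tendsto.div_atTop tendsto_const_nhds
    exact Filter.tendsto_atTop_add_const_right _ _ (Filter.tendsto_atTop_add_const_left _ _ tendsto_natCast_atTop_atTop)
  refine ⟨⨆ i, Q i, ?_, ?_, ?_⟩
  · have h1 : Filter.Tendsto (fun N : ℕ => 2/3 - 1/((N:ℝ)+3/2)) Filter.atTop (nhds (2/3-0)) :=
      tendsto_const_nhds.sub h32
    have := le_of_tendsto_of_tendsto' h1 htQ (fun N => (hQl N).1)
    simpa using this
  · apply le_of_tendsto' htQ
    intro N
    have h := (hQl N).2
    have : 0 ≤ 1/((N:ℝ)+1) := by positivity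
    linarith
  · have h4 : Filter.Tendsto (fun N : ℕ => (1-2*a)*Q N + 1/(a+N+1) - 1/(1-a)) Filter.atTop
      (nhds ((1-2*a)*(⨆ i, Q i) + 0 - 1/(1-a))) :=
      ((htQ.const_mul _).add h33).sub_const _
    have := tendsto_nhds_unique ht3 h4
    linarith

noncomputable def F2 (a : ℝ) : ℝ := (1-a)*(1/a+5/4+a)

lemma F2_core {a : ℝ} (h0 : 0 < a) (h1 : a < 1) :
    (1 + π*(1-a)*(Real.cos (π*a) / Real.sin (π*a)))^2 + (π*(1-a))^2 ≤ F2 a ^2 := by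
  obtain ⟨q, hq1, hq2, hq⟩ := cot_q h0 h1
  have ha1 : (1-a) ≠ 0 := ne_of_gt (by linarith)
  have e : 1 + π*(1-a)*(Real.cos (π*a) / Real.sin (π*a)) = (1-a)*(1/a + (1-2*a)*q) := by
    have : π*(1-a)*(Real.cos (π*a) / Real.sin (π*a)) = (1-a)*(π*(Real.cos (π*a) / Real.sin (π*a))) := by ring
    rw [this, hq]; field_simp; ring
  rw [e]
  have hpi : π^2 ≤ 9.8697 := by nlinarith [Real.pi_lt_d6, Real.pi_pos]
  have key : π^2 ≤ (5/4+a-(1-2*a)*q)*(2/a+5/4+a+(1-2*a)*q) := by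
    refine hpi.trans ?_
    have hinv : 1 ≤ 1/a := by rw [le_div_iff₀ h0]; linarith
    have h2a : 2/a = 2*(1/a) := by ring
    rcases le_total a (1/2) with h | h
    · have hs : (1/4+3*a)*(2/a+9/4-a) ≤ (5/4+a-(1-2*a)*q)*(2/a+5/4+a+(1-2*a)*q) := by
        have hr : 0 ≤ (1-2*a)*(1-q) := mul_nonneg (by linarith) (by linarith)
        have hr2 : 0 ≤ (1-2*a)*q := mul_nonneg (by linarith) (by linarith)
        rw [h2a]
        nlinarith [mul_nonneg hr hr2, mul_nonneg hr (by linarith : (0:ℝ) ≤ 1/a), mul_nonneg hr (by linarith : (0:ℝ) ≤ 1-2*a)]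
      refine le_trans ?_ hs
      have : (1/4+3*a)*(2/a+9/4-a) = 9.8697 + (0.5 - 3.3072*a+6.5*a^2-3*a^3)/a := by
        field_simp; ring
      rw [this]
      have : 0 ≤ (0.5 - 3.3072*a+6.5*a^2-3*a^3)/a := by
        apply div_nonneg _ h0.le
        nlinarith [mul_nonneg (sq_nonneg (a-0.335)) (by linarith : (0:ℝ) ≤ 0.5-a), sq_nonneg (a-0.335)]
      linarith
    · have hs : (7/12+7*a/3)*(2/a+23/12-a/3) ≤ (5/4+a-(1-2*a)*q)*(2/a+5/4+a+(1-2*a)*q) := by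
        have hr : 0 ≤ (2*a-1)*(q-2/3) := mul_nonneg (by linarith) (by linarith)
        have hr2 : (2*a-1)*q ≤ 1 := by nlinarith
        rw [h2a]
        nlinarith [mul_nonneg hr (by linarith : (0:ℝ) ≤ 1-(2*a-1)*q), mul_nonneg hr (by linarith : (0:ℝ) ≤ 1/a-1), mul_nonneg hr (by linarith : (0:ℝ) ≤ 2*a-1), mul_nonneg hr (by linarith : (0:ℝ) ≤ 1-a)]
      refine le_trans ?_ hs
      have : (7/12+7*a/3)*(2/a+23/12-a/3) = 9.8697 + (7/6 + (161/144+14/3-9.8697)*a+(161/36-7/36)*a^2-7/9*a^3)/a := by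
        field_simp; ring
      rw [this]
      have : 0 ≤ (7/6 + (161/144+14/3-9.8697)*a+(161/36-7/36)*a^2-7/9*a^3)/a := by
        apply div_nonneg _ h0.le
        nlinarith [mul_nonneg (sq_nonneg (a-0.6)) (by linarith : (0:ℝ) ≤ 1-a), sq_nonneg (a-0.6)]
      linarith
  have : F2 a^2 - (((1-a)*(1/a + (1-2*a)*q))^2 + (π*(1-a))^2) = (1-a)^2*((5/4+a-(1-2*a)*q)*(2/a+5/4+a+(1-2*a)*q) - π^2) := by
    rw [F2]; ring
  nlinarith [mul_nonneg (sq_nonneg (1-a)) (sub_nonneg.mpr key)]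

end PS
end

section
open Real Finset
namespace PS

lemma hc_conj (z : ℂ) : hc (starRingEnd ℂ z) = starRingEnd ℂ (hc z) := by
  by_cases h : z = 0
  · subst h; simp [hc_zero]
  · have h' : starRingEnd ℂ z ≠ 0 := by simpa using h
    rw [hc_of_ne h, hc_of_ne h']
    simp [Complex.exp_conj]

lemma F2_nonneg {a : ℝ} (h0 : 0 < a) (h1 : a < 1) : 0 ≤ F2 a := by
  have : 0 < 1 - a := by linarith
  unfold F2; positivity

lemma exp_itau (a : ℝ) : Complex.exp ((2*π*(1-a) : ℝ) * Complex.I) =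
   ((Real.cos (2*π*a) : ℝ):ℂ) - ((Real.sin (2*π*a):ℝ):ℂ) * Complex.I := by
  have : (((2*π*(1-a) : ℝ):ℂ) * Complex.I) = 2*π*Complex.I + ((-(2*π*a):ℝ):ℂ) * Complex.I := by
    push_cast; ring
  rw [this, Complex.exp_add, Complex.exp_two_pi_mul_I, one_mul, Complex.exp_mul_I,
    ← Complex.ofReal_cos, ← Complex.ofReal_sin, Real.cos_neg, Real.sin_neg]
  push_cast; ring

lemma hc_itau {a : ℝ} (h0 : 0 < a) (h1 : a < 1) :
    1 - hc ((2*π*(1-a) : ℝ) * Complex.I) =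
      ((1 + π*(1-a)*(Real.cos (π*a) / Real.sin (π*a)) : ℝ) : ℂ) + ((π*(1-a):ℝ):ℂ) * Complex.I := by
  have hs : 0 < Real.sin (π*a) := Real.sin_pos_of_pos_of_lt_pi (by positivity) (by nlinarith [Real.pi_pos])
  have hne : ((2*π*(1-a) : ℝ):ℂ) * Complex.I ≠ 0 := by
    apply mul_ne_zero _ Complex.I_ne_zero
    have : 2*π*(1-a) ≠ 0 := ne_of_gt (mul_pos (by positivity) (by linarith))
    exact_mod_cast this
  rw [hc_of_ne hne, exp_itau]
  set c := Real.cos (π*a) with hc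
  set s := Real.sin (π*a) with hs'
  have e1 : Real.cos (2*π*a) = 1 - 2*s^2 := by
    rw [show 2*π*a = 2*(π*a) by ring, Real.cos_two_mul]
    nlinarith [Real.sin_sq_add_cos_sq (π*a)]
  have e2 : Real.sin (2*π*a) = 2*s*c := by
    rw [show 2*π*a = 2*(π*a) by ring, Real.sin_two_mul]
  have hcs : (s:ℂ)^2 + (c:ℂ)^2 = 1 := by exact_mod_cast Real.sin_sq_add_cos_sq (π*a)
  rw [e1, e2]
  have hsC : (s:ℂ) ≠ 0 := by exact_mod_cast hs.ne'
  have hden : ((1 - 2*s^2 : ℝ):ℂ) - ((2*s*c:ℝ):ℂ)*Complex.I - 1 = -2*s*(s + c*Complex.I) := by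
    push_cast; ring
  have hsc : (s:ℂ) + c*Complex.I ≠ 0 := by
    intro h
    have := congrArg Complex.re h
    simp at this
    exact hs.ne' this
  have hinv : ((s:ℂ) + c*Complex.I)⁻¹ = s - c*Complex.I := by
    rw [inv_eq_iff_eq_inv, eq_comm, inv_eq_iff_eq_inv, eq_comm]
    apply inv_eq_of_mul_eq_one_left
    linear_combination hcs - (c:ℂ)^2 * Complex.I_sq
  rw [hden, div_eq_mul_inv, mul_inv, hinv]
  push_cast
  field_simp
  linear_combination (-(c:ℂ)*π*(1-a)) * Complex.I_sq

lemma one_sub_hc_itau_le {a : ℝ} (h0 : 0 < a) (h1 : a < 1) :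
    ‖1 - hc ((2*π*(1-a) : ℝ) * Complex.I)‖ ≤ F2 a := by
  rw [hc_itau h0 h1]
  apply abs_le_of_sq_le_sq' _ (F2_nonneg h0 h1) |>.2
  rw [Complex.sq_norm, Complex.normSq_add_mul_I]
  exact F2_core h0 h1

lemma one_sub_hc_le {a r : ℝ} (h0 : 0 < a) (h1 : a < 1) (hr : |r| ≤ 1) :
    ‖1 - hc ((r:ℂ) + (2*π*(1-a) : ℝ) * Complex.I)‖ ≤ (1+|r|) * F2 a + 7*|r| := by
  have hF := F2_nonneg h0 h1
  have hi := one_sub_hc_itau_le h0 h1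
  set w : ℂ := (2*π*(1-a) : ℝ) * Complex.I with hw
  have hs : 0 < Real.sin (π*a) := Real.sin_pos_of_pos_of_lt_pi (by positivity) (by nlinarith [Real.pi_pos])
  set E : ℂ := Complex.exp w - 1 with hE
  have hE2 : ‖E‖^2 = 4 * Real.sin (π*a)^2 := by
    rw [hE, hw, exp_itau, Complex.sq_norm]
    have : ((Real.cos (2*π*a) : ℝ):ℂ) - ((Real.sin (2*π*a):ℝ):ℂ) * Complex.I - 1
      = ((Real.cos (2*π*a) - 1 : ℝ):ℂ) + ((-Real.sin (2*π*a):ℝ):ℂ) * Complex.I := by push_cast; ring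
    rw [this, Complex.normSq_add_mul_I]
    have h3 : Real.cos (2*π*a) = 1 - 2*Real.sin (π*a)^2 := by
      rw [show 2*π*a = 2*(π*a) by ring, Real.cos_two_mul]
      nlinarith [Real.sin_sq_add_cos_sq (π*a)]
    nlinarith [Real.sin_sq_add_cos_sq (2*π*a)]
  have hE0 : 0 < ‖E‖ := by
    rcases (norm_nonneg E).lt_or_eq with h | h
    · exact h
    · rw [← h] at hE2
      have := pow_pos hs 2
      linarith
  have hv2 : ‖Complex.exp (r + w) - 1‖^2 = (Real.exp r - 1)^2 + Real.exp r * ‖E‖^2 := by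
    rw [Complex.exp_add, hE2, hw, exp_itau, Complex.sq_norm, ← Complex.ofReal_exp]
    have : (((Real.exp r:ℝ):ℂ) * (((Real.cos (2*π*a) : ℝ):ℂ) - ((Real.sin (2*π*a):ℝ):ℂ) * Complex.I)) - 1
      = ((Real.exp r * Real.cos (2*π*a) - 1 : ℝ):ℂ) + ((-(Real.exp r * Real.sin (2*π*a)):ℝ):ℂ) * Complex.I := by
      push_cast; ring
    rw [this, Complex.normSq_add_mul_I]
    have h3 : Real.cos (2*π*a) = 1 - 2*Real.sin (π*a)^2 := by
      rw [show 2*π*a = 2*(π*a) by ring, Real.cos_two_mul]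
      nlinarith [Real.sin_sq_add_cos_sq (π*a)]
    have h4 : Real.sin (2*π*a)^2 = 1 - Real.cos (2*π*a)^2 := by
      have := Real.sin_sq_add_cos_sq (2*π*a); linarith
    have : (-(Real.exp r * Real.sin (2*π*a)))^2 = Real.exp r^2 * (1 - Real.cos (2*π*a)^2) := by
      rw [← h4]; ring
    rw [this, h3]; ring
  have hg1 : Real.exp (r/2) * ‖E‖ ≤ ‖Complex.exp (r + w) - 1‖ := by
    apply abs_le_of_sq_le_sq' _ (norm_nonneg _) |>.2
    rw [hv2, mul_pow, ← Real.exp_nat_mul]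
    have : ((2:ℕ):ℝ)*(r/2) = r := by push_cast; ring
    rw [this]
    nlinarith [sq_nonneg (Real.exp r - 1)]
  have hg2 : |Real.exp r - 1| ≤ ‖Complex.exp (r + w) - 1‖ := by
    apply abs_le_of_sq_le_sq' _ (norm_nonneg _) |>.2
    rw [hv2, sq_abs]
    have := mul_nonneg (Real.exp_pos r).le (sq_nonneg ‖E‖)
    linarith
  set D := ‖Complex.exp (r + w) - 1‖ with hD
  have hD0 : 0 < D := lt_of_lt_of_le (by positivity) hg1
  have hne1 : Complex.exp (r + w) ≠ 1 := by
    intro h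
    rw [hD, h] at hD0; simp at hD0
  have hne2 : Complex.exp w ≠ 1 := by
    intro h
    rw [hE, h] at hE0; simp at hE0
  -- numerator identity
  have hnum : (1 - hc (r+w)) * (Complex.exp (r+w) - 1) = (1 - hc w) * E + ((Real.exp r - 1 : ℝ):ℂ) * E
      + ((Real.exp r - 1 - r:ℝ):ℂ) := by
    have e1 := hc_mul hne1
    have e2 := hc_mul hne2
    have e3 : Complex.exp (r+w) = ((Real.exp r:ℝ):ℂ) * Complex.exp w := by
      rw [Complex.exp_add, Complex.ofReal_exp]
    have e4 : (1 - hc (r+w)) * (Complex.exp (r+w) - 1) = Complex.exp (r+w) - 1 - (r+w) := by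
      rw [sub_mul, e1]; ring
    have e5 : (1 - hc w) * E = Complex.exp w - 1 - w := by
      rw [hE, sub_mul, e2]; ring
    rw [e4, e5, hE, e3]; push_cast; ring
  have hn2 : ‖1 - hc (r+w)‖ * D ≤ F2 a * ‖E‖ + |Real.exp r - 1| * ‖E‖ + |Real.exp r - 1 - r| := by
    rw [hD, ← norm_mul, hnum]
    refine (norm_add_le _ _).trans ?_
    refine add_le_add ((norm_add_le _ _).trans (add_le_add ?_ ?_)) ?_
    · rw [norm_mul]; exact mul_le_mul_of_nonneg_right hi (norm_nonneg _)
    · rw [norm_mul, Complex.norm_real, Real.norm_eq_abs]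
    · rw [Complex.norm_real, Real.norm_eq_abs]
  have hr' := abs_le.mp hr
  have hx1 : |Real.exp r - 1 - r| ≤ r^2 := Real.abs_exp_sub_one_sub_id_le hr
  have hx2 : |Real.exp r - 1| ≤ 2*|r| := by
    have := Real.abs_exp_sub_one_le hr; exact this
  have hx3 : |r|/3 ≤ |Real.exp r - 1| := by
    rcases le_total 0 r with h | h
    · rw [abs_of_nonneg h]
      have := Real.add_one_le_exp r
      rw [abs_of_nonneg (by linarith)]; linarith
    · rw [abs_of_nonpos h]
      have h2 := Real.add_one_le_exp (-r)
      have h3 : Real.exp r ≤ 1/(1-r) := by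
        rw [le_div_iff₀ (by linarith)]
        have : Real.exp r * Real.exp (-r) = 1 := by rw [← Real.exp_add]; simp
        nlinarith [Real.exp_pos r]
      have h4 : 1/(1-r) ≤ 1 + r/3 := by
        rw [div_le_iff₀ (by linarith)]; nlinarith
      rw [abs_of_nonpos (by linarith)]; linarith
  have hx4 : 1 ≤ (1+|r|) * Real.exp (r/2) := by
    have h2 : 1 + r/2 ≤ Real.exp (r/2) := by linarith [Real.add_one_le_exp (r/2)]
    rcases le_total 0 r with h | h
    · nlinarith [abs_nonneg r]
    · rw [abs_of_nonpos h]; nlinarith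
  have hq1 : F2 a * ‖E‖ ≤ (1+|r|)*F2 a * D := by
    have : 0 ≤ (1+|r|)*F2 a := by positivity
    calc F2 a * ‖E‖ = F2 a * ‖E‖ * 1 := by ring
      _ ≤ F2 a * ‖E‖ * ((1+|r|) * Real.exp (r/2)) := by gcongr
      _ = (1+|r|)*F2 a * (Real.exp (r/2) * ‖E‖) := by ring
      _ ≤ _ := by gcongr
  have hq2 : |Real.exp r - 1| * ‖E‖ ≤ 2*(1+|r|)*|r| * D := by
    calc |Real.exp r - 1| * ‖E‖ ≤ 2*|r| * ‖E‖ * 1 := by rw [mul_one]; gcongr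
      _ ≤ 2*|r| * ‖E‖ * ((1+|r|) * Real.exp (r/2)) := by gcongr
      _ = 2*(1+|r|)*|r| * (Real.exp (r/2) * ‖E‖) := by ring
      _ ≤ _ := by gcongr
  have hq3 : |Real.exp r - 1 - r| ≤ 3*|r| * D := by
    calc |Real.exp r - 1 - r| ≤ r^2 := hx1
      _ = 3*|r| * (|r|/3) := by rw [← sq_abs]; ring
      _ ≤ 3*|r| * D := by gcongr; linarith
  have : ‖1 - hc (r+w)‖ * D ≤ ((1+|r|)*F2 a + 2*(1+|r|)*|r| + 3*|r|) * D := by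
    linarith
  have h7 := le_of_mul_le_mul_right this hD0
  have h8 : 2*(1+|r|)*|r| ≤ 4*|r| := by nlinarith [abs_nonneg r]
  linarith


/-- The analytic kernel. -/
noncomputable def PhiC (b U k : ℝ) (s : ℂ) : ℂ :=
  (1/(2*π*Complex.I)) * (hc (-((2*π*k/U:ℝ):ℂ)) - hc (2*π*Complex.I - ((2*π/U:ℝ):ℂ)*(s-1+k)))
    - b * (1 - (s-1)/(U*Complex.I))

lemma norm_one_sub_hc_neg {l : ℝ} (hl : 0 < l) : ‖1 - hc (-(l:ℂ))‖ ≤ l ∧ ‖1 - hc (l:ℂ)‖ ≤ l := by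
  have h1 := hr_le_one hl
  have h2 := exp_neg_le_hr hl
  have h3 := Real.add_one_le_exp (-l)
  have e1 : hc (-(l:ℂ)) = ((hr l + l:ℝ):ℂ) := by
    rw [← hr_neg hl.ne', ← hc_ofReal (neg_ne_zero.mpr hl.ne')]; push_cast; rfl
  rw [e1, hc_ofReal hl.ne']
  constructor
  · rw [← Complex.ofReal_one, ← Complex.ofReal_sub, Complex.norm_real, Real.norm_eq_abs, abs_le]
    constructor <;> linarith
  · rw [← Complex.ofReal_one, ← Complex.ofReal_sub, Complex.norm_real, Real.norm_eq_abs, abs_le]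
    constructor <;> linarith

lemma hc_neg_l {l : ℝ} (hl : 0 < l) : hc (-(l:ℂ)) = hc (l:ℂ) + l := by
  apply hc_neg
  rw [← Complex.ofReal_exp]
  have : Real.exp l ≠ 1 := by
    have := Real.add_one_lt_exp hl.ne'
    linarith
  exact_mod_cast this

lemma PhiC_one {U k : ℝ} (hU : 0 < U) (hk : 0 < k) {s : ℂ}
    (hs : Complex.exp (2*π*Complex.I - ((2*π/U:ℝ):ℂ)*(s-1+k)) ≠ 1) :
    PhiC 1 U k s = (1/(2*π*Complex.I)) * (hc ((2*π*k/U:ℝ):ℂ)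
      - hc (-(2*π*Complex.I - ((2*π/U:ℝ):ℂ)*(s-1+k)))) := by
  have hl : 0 < 2*π*k/U := by positivity
  rw [PhiC, hc_neg_l hl, hc_neg hs]
  have hpi : (π:ℂ) ≠ 0 := by exact_mod_cast Real.pi_ne_zero
  have hUC : (U:ℂ) ≠ 0 := by exact_mod_cast hU.ne'
  push_cast
  field_simp
  ring

lemma PhiC_zero_bound {b U k g : ℝ} (hb : b = 0 ∨ b = 1) (hU : 100 ≤ U) (hk : 0 < k) (hk1 : k ≤ 1)
    (hg : 0 < g) (hgU : g < U) :
    4*π/U * ‖PhiC b U k ((1/2:ℝ) + g*Complex.I)‖ ≤ 2*fV U g + 64/(U*g) := by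
  have hU0 : 0 < U := by linarith
  have hUC : (U:ℂ) ≠ 0 := by exact_mod_cast hU0.ne'
  have hl : 0 < 2*π*k/U := by positivity
  have hl2 : 2*π*k/U ≤ 2*π/U := by
    apply div_le_div_of_nonneg_right _ hU0.le
    nlinarith [Real.pi_pos]
  have ha0 : 0 < g/U := by positivity
  have ha1 : g/U < 1 := by rw [div_lt_one hU0]; exact hgU
  set r : ℝ := 2*π/U*(1/2-k) with hr
  have hv : 2*π*Complex.I - ((2*π/U:ℝ):ℂ)*((((1/2:ℝ):ℂ) + g*Complex.I)-1+k)
     = (r:ℂ) + ((2*π*(1-g/U):ℝ):ℂ)*Complex.I := by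
    rw [hr]; push_cast; field_simp; ring
  have hrb : |r| ≤ π/U := by
    rw [hr, abs_mul, abs_of_pos (by positivity)]
    have : |1/2-k| ≤ 1/2 := by rw [abs_le]; constructor <;> linarith
    calc 2*π/U*|1/2-k| ≤ 2*π/U*(1/2) := by gcongr
      _ = _ := by ring
  have hpiU : π/U ≤ 1 := by rw [div_le_one hU0]; linarith [Real.pi_lt_d6]
  have hr1 : |r| ≤ 1 := hrb.trans hpiU
  have hF0 := F2_nonneg ha0 ha1
  have hexp : Complex.exp ((r:ℂ) + ((2*π*(1-g/U):ℝ):ℂ)*Complex.I) ≠ 1 := by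
    intro h
    rw [Complex.exp_eq_one_iff] at h
    obtain ⟨n, hn⟩ := h
    have := congrArg Complex.im hn
    simp at this
    have h2 : (1-g/U) = n := by
      have hp := Real.pi_pos
      have : 2*π*(1-g/U) = 2*π*n := by linarith
      exact mul_left_cancel₀ (by positivity) this
    have h3 : (0:ℝ) < n := by rw [← h2]; linarith
    have h4 : (n:ℝ) < 1 := by rw [← h2]; linarith
    have h3' : 0 < n := by exact_mod_cast h3
    have h4' : n < 1 := by exact_mod_cast h4
    omega
  have n2 : ‖(1/(2*π*Complex.I) : ℂ)‖ = 1/(2*π) := by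
    rw [norm_div, norm_mul, norm_mul, Complex.norm_I, Complex.norm_real]
    simp [abs_of_pos Real.pi_pos]
  have hmain : ‖PhiC b U k ((1/2:ℝ) + g*Complex.I)‖ ≤ 1/(2*π) * ((1+|r|)*F2 (g/U) + 7*|r| + 2*π/U) := by
    have htri : ∀ A B : ℂ, ‖1-A‖ ≤ 2*π/U → ‖1-B‖ ≤ (1+|r|)*F2 (g/U) + 7*|r| →
        ‖(1/(2*π*Complex.I) : ℂ) * (A-B)‖ ≤ 1/(2*π) * ((1+|r|)*F2 (g/U) + 7*|r| + 2*π/U) := by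
      intro A B hA hB
      rw [norm_mul, n2]
      have : A - B = (1-B) - (1-A) := by ring
      have h3 : ‖A-B‖ ≤ ‖1-B‖ + ‖1-A‖ := by rw [this]; exact norm_sub_le _ _
      have : ‖A-B‖ ≤ (1+|r|)*F2 (g/U) + 7*|r| + 2*π/U := by linarith
      gcongr
    rcases hb with rfl | rfl
    · rw [PhiC, hv]
      simp only [Complex.ofReal_zero, zero_mul, sub_zero]
      exact htri _ _ ((norm_one_sub_hc_neg hl).1.trans hl2) (one_sub_hc_le ha0 ha1 hr1)
    · rw [PhiC_one hU0 hk (by rw [hv]; exact hexp), hv]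
      apply htri _ _ ((norm_one_sub_hc_neg hl).2.trans hl2)
      have e : -((r:ℂ) + ((2*π*(1-g/U):ℝ):ℂ)*Complex.I)
          = starRingEnd ℂ (((-r:ℝ):ℂ) + ((2*π*(1-g/U):ℝ):ℂ)*Complex.I) := by
        rw [map_add, map_mul, Complex.conj_ofReal, Complex.conj_ofReal, Complex.conj_I]
        push_cast; ring
      rw [e, hc_conj]
      have e2 : ∀ z : ℂ, ‖1 - starRingEnd ℂ z‖ = ‖1 - z‖ := by
        intro z
        rw [← Complex.norm_conj]; simp
      rw [e2]
      have := one_sub_hc_le ha0 ha1 (r := -r) (by rwa [abs_neg])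
      rwa [abs_neg] at this
  have hFf : F2 (g/U) = U * fV U g := by
    rw [F2, fV]; field_simp; ring
  have hf1 := fV_le_inv hU0 hg hgU.le
  have hf0 : 0 ≤ fV U g := by
    have : 0 ≤ U * fV U g := hFf ▸ hF0
    exact nonneg_of_mul_nonneg_right this hU0
  have hgi : 1/U ≤ 1/g := one_div_le_one_div_of_le hg hgU.le
  calc 4*π/U * ‖PhiC b U k ((1/2:ℝ) + g*Complex.I)‖
      ≤ 4*π/U * (1/(2*π) * ((1+|r|)*F2 (g/U) + 7*|r| + 2*π/U)) := by gcongr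
    _ ≤ 4*π/U * (1/(2*π) * ((1+π/U)*F2 (g/U) + 7*(π/U) + 2*π/U)) := by gcongr
    _ = 2*fV U g + 2*π/U*fV U g + 18*π/U*(1/U) := by
      rw [hFf]; field_simp; ring
    _ ≤ 2*fV U g + 2*π/U*(1.0325/g) + 18*π/U*(1/g) := by gcongr
    _ = 2*fV U g + (20.065*π)/(U*g) := by field_simp; ring
    _ ≤ 2*fV U g + 64/(U*g) := by
      have : 20.065*π ≤ 64 := by linarith [Real.pi_lt_d6]
      gcongr

end PS
end

section
open Real Finset
namespace PS

lemma log_ten_le : Real.log 10 ≤ 2.303 := by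
  have h1 : Real.log 10 = Real.log 2 + Real.log 5 := by rw [← Real.log_mul (by norm_num) (by norm_num)]; norm_num
  have h5 : 3 * Real.log 5 ≤ 7 * Real.log 2 + Real.log (125/128) := by
    rw [← Real.log_rpow (by norm_num), ← Real.log_rpow (by norm_num), ← Real.log_mul (by positivity) (by norm_num)]
    apply Real.log_le_log (by positivity)
    norm_num
  have h6 : Real.log (125/128) ≤ 125/128 - 1 := Real.log_le_sub_one_of_pos (by norm_num)
  have := Real.log_two_lt_d9
  linarith

lemma log_sq_le {U : ℝ} (hU : 10^6 ≤ U) : Real.log U ^ 2 ≤ 196/10^6*U ∧ 0 ≤ Real.log U := by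
  have h0 : 0 ≤ Real.log U := Real.log_nonneg (by linarith)
  refine ⟨?_, h0⟩
  set y := U/10^6 with hy
  have hy1 : 1 ≤ y := by rw [hy, le_div_iff₀ (by norm_num)]; linarith
  have e : U = 10^6*y := by rw [hy]; ring
  have hl : Real.log U = 6 * Real.log 10 + 2*Real.log (√y) := by
    rw [e, Real.log_mul (by norm_num) (by positivity), Real.log_pow, Real.log_sqrt (by linarith)]; push_cast; ring
  have hs := Real.log_le_sub_one_of_pos (Real.sqrt_pos.mpr (by linarith : 0 < y))
  have h1s : 1 ≤ √y := Real.one_le_sqrt.mpr hy1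
  have : Real.log U ≤ 14*√y := by rw [hl]; linarith [log_ten_le]
  calc Real.log U^2 ≤ (14*√y)^2 := by gcongr
    _ = 196*y := by rw [mul_pow, Real.sq_sqrt (by linarith)]; norm_num
    _ = _ := by rw [hy]; ring

lemma MY_le {Y : ℝ} (hY : 0 ≤ Y) : MY Y ≤ Y^2/2 := by
  unfold MY; linarith

theorem Had.zero_total {B ε : ℝ} {S : Finset ℂ} {E : ℂ → ℂ} (H : Had B ε S E) {U : ℝ} (hU : 10^6 ≤ U)
    (hB : 2*U+1 < B) (he : ε ≤ 1/(2*U)^2) {A : Finset ℂ} (hA : A ⊆ S) (hre : ∀ ρ ∈ A, ρ.re = 1/2)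
    (him : ∀ ρ ∈ A, 0 < ρ.im) (hle : ∀ ρ ∈ A, ρ.im < U) {b k : ℝ} (hb : b = 0 ∨ b = 1)
    (hk : 0 < k) (hk1 : k ≤ 1) :
    4*π/U * ∑ ρ ∈ A, (mz ρ:ℝ) * ‖PhiC b U k ρ‖ ≤ 1/π*MY (Real.log (U/(2*π))) + 0.182 := by
  have hU0 : 0 < U := by linarith
  have h1 := H.sum_lemma hU (by linarith) (he.trans (by gcongr; linarith)) hA hre him (fun ρ h => (hle ρ h).le)
  have h2 := H.sum_lemma (V := 2*U) (by linarith) (by linarith) he hA hre him (fun ρ h => by linarith [hle ρ h])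
  have h3 : 15/16 * ∑ ρ ∈ A, (mz ρ:ℝ)/ρ.im ≤ ∑ ρ ∈ A, (mz ρ:ℝ) * fV (2*U) ρ.im := by
    rw [mul_sum]
    apply sum_le_sum
    intro ρ hρ
    have := inv_le_fV (V := 2*U) (t := ρ.im) (by linarith) (him ρ hρ) (by linarith [hle ρ hρ])
    calc 15/16*((mz ρ:ℝ)/ρ.im) = (mz ρ:ℝ) * (15/(16*ρ.im)) := by ring
      _ ≤ _ := by gcongr
  have h4 : 4*π/U * ∑ ρ ∈ A, (mz ρ:ℝ) * ‖PhiC b U k ρ‖ ≤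
      2 * (∑ ρ ∈ A, (mz ρ:ℝ) * fV U ρ.im) + 64/U * ∑ ρ ∈ A, (mz ρ:ℝ)/ρ.im := by
    rw [mul_sum, mul_sum, mul_sum, ← sum_add_distrib]
    apply sum_le_sum
    intro ρ hρ
    have e : ρ = ((1/2:ℝ):ℂ) + (ρ.im:ℂ)*Complex.I := by
      rw [← hre ρ hρ]; exact (Complex.re_add_im ρ).symm
    have := PhiC_zero_bound (b := b) (U := U) (k := k) (g := ρ.im) hb (by linarith) hk hk1 (him ρ hρ) (hle ρ hρ)
    rw [← e] at this
    calc 4*π/U*((mz ρ:ℝ) * ‖PhiC b U k ρ‖) = (mz ρ:ℝ) * (4*π/U*‖PhiC b U k ρ‖) := by ring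
      _ ≤ (mz ρ:ℝ) * (2*fV U ρ.im + 64/(U*ρ.im)) := by gcongr
      _ = _ := by ring
  have hlog := log_sq_le hU
  have hY : Real.log (2*U/(2*π)) ≤ Real.log U := by
    apply Real.log_le_log (by positivity)
    rw [mul_div_mul_left _ _ (by norm_num)]
    apply div_le_self hU0.le; linarith [Real.pi_gt_d6]
  have hY0 : 0 ≤ Real.log (2*U/(2*π)) := by
    apply Real.log_nonneg
    rw [le_div_iff₀ (by positivity)]; linarith [Real.pi_lt_d6]
  have hM : MY (Real.log (2*U/(2*π))) ≤ Real.log U^2/2 := (MY_le hY0).trans (by gcongr)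
  have hpi : 1/π ≤ 0.3184 := by
    rw [div_le_iff₀ Real.pi_pos]; linarith [Real.pi_gt_d6]
  have h5 : 1/π*MY (Real.log (2*U/(2*π))) ≤ 0.3184*(Real.log U^2/2) := by
    calc 1/π*MY (Real.log (2*U/(2*π))) ≤ 1/π*(Real.log U^2/2) := by gcongr
      _ ≤ _ := by gcongr
  set G := ∑ ρ ∈ A, (mz ρ:ℝ)/ρ.im
  have h6 : G ≤ 8/15*(0.3184*(98/10^6*U)+0.18) := by linarith
  have h7 : 64/U*G ≤ 64/U*(8/15*(0.3184*(98/10^6*U)+0.18)) := by gcongr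
  have h8 : 64/U*(8/15*(0.3184*(98/10^6*U)+0.18)) = 64*8/15*(0.3184*(98/10^6)) + 64*8/15*0.18*(1/U) := by
    field_simp
  have h9 : 1/U ≤ 1/10^6 := by gcongr
  linarith

end PS
end

section
open Real Finset
namespace PS

lemma seg_log (a c p u : ℂ) (hu : u ≠ 0) (t0 t1 : ℝ)
    (h : ∀ t ∈ Set.uIcc t0 t1, u * (a + c*t - p) ∈ Complex.slitPlane) :
    c * ∫ t in t0..t1, (1/(a + c*(t:ℂ) - p)) = Complex.log (u*(a+c*t1-p)) - Complex.log (u*(a+c*t0-p)) := by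
  rw [← intervalIntegral.integral_const_mul]
  apply intervalIntegral.integral_eq_sub_of_hasDerivAt (f := fun t : ℝ => Complex.log (u*(a+c*(t:ℂ)-p)))
  · intro t ht
    have h1 : HasDerivAt (fun t : ℝ => u*(a+c*(t:ℂ)-p)) (u*(c*1)) t := by
      apply HasDerivAt.const_mul
      apply HasDerivAt.sub_const
      apply HasDerivAt.const_add
      apply HasDerivAt.const_mul
      exact (hasDerivAt_id (t:ℂ)).comp_ofReal
    have h2 := h1.clog_real (h t ht)
    refine h2.congr_deriv ?_
    have h3 : a + c*(t:ℂ) - p ≠ 0 := by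
      intro h0
      have := h t ht
      rw [h0, mul_zero] at this
      exact Complex.zero_notMem_slitPlane this
    field_simp
  · apply ContinuousOn.intervalIntegrable
    apply ContinuousOn.mul continuousOn_const
    apply ContinuousOn.div continuousOn_const (by fun_prop)
    intro t ht h0
    have := h t ht
    rw [h0, mul_zero] at this
    exact Complex.zero_notMem_slitPlane this

/-- path integral over the three upper sides of `[-1,e]×[0,U]`, counterclockwise -/
noncomputable def PI (e U : ℝ) (f : ℂ → ℂ) : ℂ :=
  - (∫ x in (-1:ℝ)..e, f (x + U*Complex.I)) + Complex.I * (∫ y in (0:ℝ)..U, f (e + y*Complex.I))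
   - Complex.I * (∫ y in (0:ℝ)..U, f (-1 + y*Complex.I))

lemma log_ne (w : ℂ) (hw : w.im < 0) : Complex.log (-w) = Complex.log w + π*Complex.I := by
  simp only [Complex.log, norm_neg, Complex.arg_neg_eq_arg_add_pi_of_im_neg hw]
  push_cast; ring

lemma log_ne' (w : ℂ) (hw : 0 < w.im) : Complex.log (-w) = Complex.log w - π*Complex.I := by
  simp only [Complex.log, norm_neg, Complex.arg_neg_eq_arg_sub_pi_of_im_pos hw]
  push_cast; ring

lemma PI_inv {e U : ℝ} (hU : 0 < U) (he : -1 < e) {p : ℂ} (h1 : -1 < p.re) (h2 : p.re < e)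
    (h4 : p.im < U) (h3 : 0 ≤ p.im) :
    PI e U (fun s => 1/(s-p)) = Complex.log (-Complex.I*(-1-p)) - Complex.log (-Complex.I*(e-p)) := by
  have hI : -Complex.I ≠ 0 := neg_ne_zero.mpr Complex.I_ne_zero
  have a1 := seg_log (U*Complex.I) 1 p (-Complex.I) hI (-1) e (by
    intro t ht
    left; simp; linarith)
  have a2 := seg_log (e:ℂ) Complex.I p (-Complex.I) hI 0 U (by
    intro t ht
    right; simp; linarith)
  have a3 := seg_log (-1:ℂ) Complex.I p (-Complex.I) hI 0 U (by
    intro t ht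
    right; simp; linarith)
  rw [PI]
  have e1 : (∫ x in (-1:ℝ)..e, 1/((x:ℂ) + U*Complex.I - p)) = 1 * ∫ x in (-1:ℝ)..e, 1/(U*Complex.I + 1*(x:ℂ) - p) := by
    rw [one_mul]; congr 1; ext t; ring_nf
  have e2 : (∫ y in (0:ℝ)..U, 1/((e:ℂ) + y*Complex.I - p)) = ∫ y in (0:ℝ)..U, 1/(e + Complex.I*(y:ℂ) - p) := by
    congr 1; ext t; ring_nf
  have e3 : (∫ y in (0:ℝ)..U, 1/((-1:ℂ) + y*Complex.I - p)) = ∫ y in (0:ℝ)..U, 1/(-1 + Complex.I*(y:ℂ) - p) := by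
    congr 1; ext t; ring_nf
  rw [e1, e2, e3, a1, a2, a3]
  push_cast
  have f1 : (U:ℂ)*Complex.I + 1*e - p = e + Complex.I*U - p := by ring
  have f2 : (U:ℂ)*Complex.I + 1*(-1) - p = -1 + Complex.I*U - p := by ring
  rw [f1, f2, mul_zero, add_zero, add_zero]
  ring

lemma PI_inv_im {e U : ℝ} (hU : 0 < U) (he : -1 < e) {p : ℝ} (h1 : -1 < p) (h2 : p < e) :
    (PI e U (fun s => 1/(s-p))).im = π := by
  rw [PI_inv hU he (by simpa using h1) (by simpa using h2) (by simpa using hU) (by simp)]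
  rw [Complex.sub_im, Complex.log_im, Complex.log_im]
  have f1 : -Complex.I * (-1 - (p:ℂ)) = ((1+p:ℝ):ℂ) * Complex.I := by push_cast; ring
  have f2 : -Complex.I * (e - (p:ℂ)) = ((e-p:ℝ):ℂ) * (-Complex.I) := by push_cast; ring
  rw [f1, f2, Complex.arg_real_mul _ (by linarith), Complex.arg_real_mul _ (by linarith), Complex.arg_I, Complex.arg_neg_I]
  ring

lemma PI_inv_full {e U : ℝ} (hU : 0 < U) (he : -1 < e) {p : ℂ} (h1 : -1 < p.re) (h2 : p.re < e)
    (h4 : p.im < U) (h3 : 0 < p.im) :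
    PI e U (fun s => 1/(s-p)) + ∫ x in (-1:ℝ)..e, 1/((x:ℂ)-p) = 2*π*Complex.I := by
  have a1 := seg_log 0 1 p Complex.I Complex.I_ne_zero (-1) e (by
    intro t ht
    left; simp; linarith)
  have e1 : (∫ x in (-1:ℝ)..e, 1/((x:ℂ) - p)) = 1 * ∫ x in (-1:ℝ)..e, 1/(0 + 1*(x:ℂ) - p) := by
    rw [one_mul]; congr 1; ext t; ring_nf
  rw [e1, a1, PI_inv hU he h1 h2 h4 h3.le]
  have f1 : -Complex.I*(-1-p) = -(Complex.I*(0+1*((-1:ℝ):ℂ)-p)) := by push_cast; ring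
  have f2 : -Complex.I*(e-p) = -(Complex.I*(0+1*(e:ℂ)-p)) := by push_cast; ring
  rw [f1, f2, log_ne _ (by simp; linarith), log_ne' _ (by simp; linarith)]
  ring

/-- continuity on the path -/
def PC (e U : ℝ) (f : ℂ → ℂ) : Prop :=
  ContinuousOn (fun x : ℝ => f (x + U*Complex.I)) (Set.uIcc (-1) e) ∧
  ContinuousOn (fun y : ℝ => f (e + y*Complex.I)) (Set.uIcc 0 U) ∧
  ContinuousOn (fun y : ℝ => f (-1 + y*Complex.I)) (Set.uIcc 0 U)

lemma PC.add {e U : ℝ} {f g : ℂ → ℂ} (hf : PC e U f) (hg : PC e U g) : PC e U (fun s => f s + g s) :=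
  ⟨hf.1.add hg.1, hf.2.1.add hg.2.1, hf.2.2.add hg.2.2⟩

lemma PI_add {e U : ℝ} {f g : ℂ → ℂ} (hf : PC e U f) (hg : PC e U g) :
    PI e U (fun s => f s + g s) = PI e U f + PI e U g := by
  simp only [PI]
  rw [intervalIntegral.integral_add hf.1.intervalIntegrable hg.1.intervalIntegrable,
    intervalIntegral.integral_add hf.2.1.intervalIntegrable hg.2.1.intervalIntegrable,
    intervalIntegral.integral_add hf.2.2.intervalIntegrable hg.2.2.intervalIntegrable]
  ring

lemma PI_smul {e U : ℝ} (c : ℂ) (f : ℂ → ℂ) : PI e U (fun s => c * f s) = c * PI e U f := by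
  simp only [PI, intervalIntegral.integral_const_mul]; ring

lemma PC.smul {e U : ℝ} {f : ℂ → ℂ} (c : ℂ) (hf : PC e U f) : PC e U (fun s => c * f s) :=
  ⟨continuousOn_const.mul hf.1, continuousOn_const.mul hf.2.1, continuousOn_const.mul hf.2.2⟩

lemma PC_sum {e U : ℝ} (A : Finset ℂ) (f : ℂ → ℂ → ℂ) (h : ∀ a ∈ A, PC e U (f a)) :
    PC e U (fun s => ∑ a ∈ A, f a s) :=
  ⟨continuousOn_finsetSum _ fun a ha => (h a ha).1, continuousOn_finsetSum _ fun a ha => (h a ha).2.1,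
    continuousOn_finsetSum _ fun a ha => (h a ha).2.2⟩

lemma PI_sum {e U : ℝ} (A : Finset ℂ) (f : ℂ → ℂ → ℂ) (h : ∀ a ∈ A, PC e U (f a)) :
    PI e U (fun s => ∑ a ∈ A, f a s) = ∑ a ∈ A, PI e U (f a) := by
  classical
  induction A using Finset.induction_on with
  | empty => simp [PI]
  | insert a A ha ih =>
    simp only [sum_insert ha]
    rw [PI_add (h a (mem_insert_self _ _)) (PC_sum A f fun b hb => h b (mem_insert_of_mem hb)),
      ih fun b hb => h b (mem_insert_of_mem hb)]

lemma PC_inv {e U : ℝ} (hU : 0 < U) (he : -1 < e) {p : ℂ} (h1 : -1 < p.re) (h2 : p.re < e)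
    (h4 : p.im < U) : PC e U (fun s => 1/(s-p)) := by
  refine ⟨?_, ?_, ?_⟩
  · apply ContinuousOn.div continuousOn_const (by fun_prop)
    intro t _ h
    have := congrArg Complex.im h
    simp at this; linarith
  · apply ContinuousOn.div continuousOn_const (by fun_prop)
    intro t _ h
    have := congrArg Complex.re h
    simp at this; linarith
  · apply ContinuousOn.div continuousOn_const (by fun_prop)
    intro t _ h
    have := congrArg Complex.re h
    simp at this; linarith

lemma PI_congr {e U : ℝ} (hU : 0 < U) (he : -1 < e) {f g : ℂ → ℂ}
    (h : ∀ s : ℂ, -1 ≤ s.re → s.re ≤ e → 0 ≤ s.im → s.im ≤ U → (s.re = -1 ∨ s.re = e ∨ s.im = U) → f s = g s) :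
    PI e U f = PI e U g := by
  have i1 : (∫ x in (-1:ℝ)..e, f (x + U*Complex.I)) = ∫ x in (-1:ℝ)..e, g (x + U*Complex.I) := by
    apply intervalIntegral.integral_congr
    intro t ht
    rw [Set.uIcc_of_le he.le] at ht
    exact h _ (by simpa using ht.1) (by simpa using ht.2) (by simpa using hU.le) (by simp) (by simp)
  have i2 : (∫ y in (0:ℝ)..U, f (e + y*Complex.I)) = ∫ y in (0:ℝ)..U, g (e + y*Complex.I) := by
    apply intervalIntegral.integral_congr
    intro t ht
    rw [Set.uIcc_of_le hU.le] at ht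
    exact h _ (by simpa using he.le) (by simp) (by simpa using ht.1) (by simpa using ht.2) (by simp)
  have i3 : (∫ y in (0:ℝ)..U, f (-1 + y*Complex.I)) = ∫ y in (0:ℝ)..U, g (-1 + y*Complex.I) := by
    apply intervalIntegral.integral_congr
    intro t ht
    rw [Set.uIcc_of_le hU.le] at ht
    exact h _ (by simp) (by simpa using he.le) (by simpa using ht.1) (by simpa using ht.2) (by simp)
  rw [PI, PI, i1, i2, i3]

theorem contour {e U : ℝ} (hU : 0 < U) (he : -1 < e) {R H : ℂ → ℂ} {p1 p2 c1 c2 : ℝ} {A : Finset ℂ} {c : ℂ → ℂ}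
    (hp1 : -1 < p1) (hp1' : p1 < e) (hp2 : -1 < p2) (hp2' : p2 < e)
    (hA : ∀ ρ ∈ A, -1 < ρ.re ∧ ρ.re < e ∧ 0 < ρ.im ∧ ρ.im < U)
    (hR : ∀ s : ℂ, -1 ≤ s.re → s.re ≤ e → 0 ≤ s.im → s.im ≤ U → DifferentiableAt ℂ R s)
    (hH : ∀ s : ℂ, -1 ≤ s.re → s.re ≤ e → 0 ≤ s.im → s.im ≤ U → s ≠ p1 → s ≠ p2 → s ∉ A →
      H s = R s + c1*(1/(s-p1)) + c2*(1/(s-p2)) + ∑ ρ ∈ A, c ρ * (1/(s-ρ)))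
    {g : ℝ → ℝ} (hg : IntervalIntegrable g MeasureTheory.volume (-1) e)
    (hb : ∀ x : ℝ, -1 ≤ x → x ≤ e → x ≠ p1 → x ≠ p2 → |(H x).im| ≤ g x) :
    |(PI e U H).im - π*(c1+c2) - 2*π*∑ ρ ∈ A, (c ρ).re| ≤ ∫ x in (-1:ℝ)..e, g x := by
  have hRc : ∀ s : ℂ, -1 ≤ s.re → s.re ≤ e → 0 ≤ s.im → s.im ≤ U → ContinuousAt R s :=
    fun s a b c d => (hR s a b c d).continuousAt
  have hPR : PC e U R := by
    refine ⟨?_, ?_, ?_⟩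
    · intro t ht
      rw [Set.uIcc_of_le he.le] at ht
      apply ContinuousAt.continuousWithinAt
      apply ContinuousAt.comp (f := fun t : ℝ => (t:ℂ) + U*Complex.I) (g := R)
      · exact hRc _ (by simpa using ht.1) (by simpa using ht.2) (by simpa using hU.le) (by simp)
      · fun_prop
    · intro t ht
      rw [Set.uIcc_of_le hU.le] at ht
      apply ContinuousAt.continuousWithinAt
      apply ContinuousAt.comp (f := fun t : ℝ => (e:ℂ) + t*Complex.I) (g := R)
      · exact hRc _ (by simpa using he.le) (by simp) (by simpa using ht.1) (by simpa using ht.2)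
      · fun_prop
    · intro t ht
      rw [Set.uIcc_of_le hU.le] at ht
      apply ContinuousAt.continuousWithinAt
      apply ContinuousAt.comp (f := fun t : ℝ => (-1:ℂ) + t*Complex.I) (g := R)
      · exact hRc _ (by simp) (by simpa using he.le) (by simpa using ht.1) (by simpa using ht.2)
      · fun_prop
  have hbR : ContinuousOn (fun x : ℝ => R x) (Set.uIcc (-1) e) := by
    intro t ht
    rw [Set.uIcc_of_le he.le] at ht
    apply ContinuousAt.continuousWithinAt
    apply ContinuousAt.comp (f := fun t : ℝ => (t:ℂ)) (g := R)
    · exact hRc _ (by simpa using ht.1) (by simpa using ht.2) (by simp) (by simpa using hU.le)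
    · fun_prop
  have hcau : PI e U R = - ∫ x in (-1:ℝ)..e, R x := by
    have := Complex.integral_boundary_rect_eq_zero_of_differentiableOn R (-1) (e + U*Complex.I) (by
      intro s hs
      rw [Complex.mem_reProdIm] at hs
      simp at hs
      rw [Set.uIcc_of_le he.le, Set.uIcc_of_le hU.le] at hs
      exact (hR s hs.1.1 hs.1.2 hs.2.1 hs.2.2).differentiableWithinAt)
    simp at this
    rw [PI]
    linear_combination this
  have hp1C : PC e U (fun s => 1/(s-(p1:ℂ))) := PC_inv hU he (by simpa using hp1) (by simpa using hp1') (by simpa using hU)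
  have hp2C : PC e U (fun s => 1/(s-(p2:ℂ))) := PC_inv hU he (by simpa using hp2) (by simpa using hp2') (by simpa using hU)
  have hAC : ∀ ρ ∈ A, PC e U (fun s => c ρ * (1/(s-ρ))) := fun ρ hρ =>
    (PC_inv hU he (hA ρ hρ).1 (hA ρ hρ).2.1 (hA ρ hρ).2.2.2).smul _
  have hPI : PI e U H = PI e U R + c1 * PI e U (fun s => 1/(s-(p1:ℂ))) + c2 * PI e U (fun s => 1/(s-(p2:ℂ)))
      + ∑ ρ ∈ A, c ρ * PI e U (fun s => 1/(s-ρ)) := by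
    rw [PI_congr (g := fun s => R s + c1*(1/(s-p1)) + c2*(1/(s-p2)) + ∑ ρ ∈ A, c ρ * (1/(s-ρ))) hU he]
    · rw [PI_add ((hPR.add (hp1C.smul _)).add (hp2C.smul _)) (PC_sum A (fun ρ s => c ρ * (1/(s-ρ))) hAC),
        PI_add (hPR.add (hp1C.smul _)) (hp2C.smul _), PI_add hPR (hp1C.smul _), PI_smul, PI_smul,
        PI_sum A (fun ρ s => c ρ * (1/(s-ρ))) hAC]
      simp only [PI_smul]
    · intro s s1 s2 s3 s4 s5
      have hne : ∀ p : ℂ, -1 < p.re → p.re < e → p.im < U → s ≠ p := by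
        intro p q1 q2 q3 h
        subst h
        rcases s5 with h | h | h <;> linarith
      apply hH s s1 s2 s3 s4
      · exact hne _ (by simpa using hp1) (by simpa using hp1') (by simpa using hU)
      · exact hne _ (by simpa using hp2) (by simpa using hp2') (by simpa using hU)
      · intro hs
        exact hne s (hA s hs).1 (hA s hs).2.1 (hA s hs).2.2.2 rfl
  have hρc : ∀ ρ ∈ A, ContinuousOn (fun x : ℝ => c ρ * (1/((x:ℂ)-ρ))) (Set.uIcc (-1) e) := by
    intro ρ hρ
    apply ContinuousOn.mul continuousOn_const
    apply ContinuousOn.div continuousOn_const (by fun_prop)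
    intro t _ h
    have := congrArg Complex.im h
    simp at this; linarith [(hA ρ hρ).2.2.1]
  have hbot : PI e U R + ∑ ρ ∈ A, c ρ * PI e U (fun s => 1/(s-ρ)) =
      2*π*Complex.I * (∑ ρ ∈ A, c ρ) - ∫ x in (-1:ℝ)..e, (R x + ∑ ρ ∈ A, c ρ * (1/((x:ℂ)-ρ))) := by
    rw [intervalIntegral.integral_add hbR.intervalIntegrable
      (continuousOn_finsetSum _ hρc).intervalIntegrable,
      intervalIntegral.integral_finsetSum (fun ρ hρ => (hρc ρ hρ).intervalIntegrable), hcau]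
    have : ∑ ρ ∈ A, c ρ * PI e U (fun s => 1/(s-ρ)) =
        ∑ ρ ∈ A, (2*π*Complex.I * c ρ - ∫ x in (-1:ℝ)..e, c ρ * (1/((x:ℂ)-ρ))) := by
      apply sum_congr rfl
      intro ρ hρ
      have := PI_inv_full hU he (hA ρ hρ).1 (hA ρ hρ).2.1 (hA ρ hρ).2.2.2 (hA ρ hρ).2.2.1
      rw [intervalIntegral.integral_const_mul, ← eq_sub_iff_add_eq] at *
      rw [this]; ring
    rw [this, sum_sub_distrib, mul_sum]
    ring
  have him : (PI e U H).im - π*(c1+c2) - 2*π*∑ ρ ∈ A, (c ρ).re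
      = - (∫ x in (-1:ℝ)..e, (R x + ∑ ρ ∈ A, c ρ * (1/((x:ℂ)-ρ)))).im := by
    have : PI e U H = (2*π*Complex.I * (∑ ρ ∈ A, c ρ) - ∫ x in (-1:ℝ)..e, (R x + ∑ ρ ∈ A, c ρ * (1/((x:ℂ)-ρ))))
      + c1 * PI e U (fun s => 1/(s-(p1:ℂ))) + c2 * PI e U (fun s => 1/(s-(p2:ℂ))) := by
      rw [hPI, ← hbot]; ring
    rw [this]
    have q : (2*π*Complex.I * (∑ ρ ∈ A, c ρ)).im = 2*π*∑ ρ ∈ A, (c ρ).re := by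
      simp [Complex.mul_im, Complex.re_sum]
    rw [Complex.add_im, Complex.add_im, Complex.sub_im, q, Complex.im_ofReal_mul, Complex.im_ofReal_mul,
      PI_inv_im hU he hp1 hp1', PI_inv_im hU he hp2 hp2']
    ring
  rw [him, abs_neg]
  have hcont : ContinuousOn (fun x : ℝ => R x + ∑ ρ ∈ A, c ρ * (1/((x:ℂ)-ρ))) (Set.uIcc (-1) e) :=
    hbR.add (continuousOn_finsetSum _ hρc)
  have : (∫ x in (-1:ℝ)..e, (R x + ∑ ρ ∈ A, c ρ * (1/((x:ℂ)-ρ)))).im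
     = ∫ x in (-1:ℝ)..e, (R x + ∑ ρ ∈ A, c ρ * (1/((x:ℂ)-ρ))).im := by
    have := (Complex.imCLM.intervalIntegral_comp_comm (μ := MeasureTheory.volume) hcont.intervalIntegrable).symm
    simpa using this
  rw [this, ← Real.norm_eq_abs]
  apply intervalIntegral.norm_integral_le_of_norm_le he.le _ hg
  have hfin : ({p1, p2} : Set ℝ).Finite := by simp
  have hae := hfin.countable.ae_notMem MeasureTheory.volume
  filter_upwards [hae] with x hx hx2
  simp at hx
  have h1 := hb x hx2.1.le hx2.2 hx.1 hx.2
  have h2 := hH x (by simpa using hx2.1.le) (by simpa using hx2.2) (by simp) (by simpa using hU.le)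
    (by exact_mod_cast hx.1) (by exact_mod_cast hx.2) (by
      intro h
      have := (hA _ h).2.2.1
      simp at this)
  rw [h2] at h1
  rw [Real.norm_eq_abs]
  refine le_of_eq_of_le ?_ h1
  congr 1
  have z1 : ((c1:ℂ)*(1/((x:ℂ)-p1))).im = 0 := by
    rw [← Complex.ofReal_sub, ← Complex.ofReal_one, ← Complex.ofReal_div, ← Complex.ofReal_mul, Complex.ofReal_im]
  have z2 : ((c2:ℂ)*(1/((x:ℂ)-p2))).im = 0 := by
    rw [← Complex.ofReal_sub, ← Complex.ofReal_one, ← Complex.ofReal_div, ← Complex.ofReal_mul, Complex.ofReal_im]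
  rw [Complex.add_im, Complex.add_im, Complex.add_im, Complex.add_im, z1, z2]
  ring

end PS
end

section
open Real Finset
namespace PS

lemma hr_lip {u v : ℝ} (hu : u ≠ 0) (hv : v ≠ 0) : |hr u - hr v| ≤ |u - v| := by
  have key : ∀ u v : ℝ, u ≠ 0 → v ≠ 0 → u ≤ v → |hr u - hr v| ≤ |u - v| := by
    intro u v hu hv h
    have h1 := hr_antitone hu hv h
    have h2 := hr_antitone (neg_ne_zero.mpr hv) (neg_ne_zero.mpr hu) (neg_le_neg h)
    rw [hr_neg hu, hr_neg hv] at h2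
    rw [abs_of_nonneg (by linarith), abs_of_nonpos (by linarith)]; linarith
  rcases le_total u v with h | h
  · exact key u v hu hv h
  · rw [abs_sub_comm, abs_sub_comm u v]; exact key v u hv hu h

lemma hc_one_lip (v : ℝ) : ‖1 - hc (v:ℂ)‖ ≤ |v| := by
  rcases lt_trichotomy v 0 with h | h | h
  · have := (norm_one_sub_hc_neg (l := -v) (by linarith)).1
    rw [abs_of_neg h]; simpa using this
  · subst h; simp [hc_zero]
  · rw [abs_of_pos h]; exact (norm_one_sub_hc_neg h).2

lemma hc_lip (u v : ℝ) : ‖hc (u:ℂ) - hc (v:ℂ)‖ ≤ |u - v| := by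
  by_cases hu : u = 0
  · subst hu
    have := hc_one_lip v
    simpa [hc_zero] using this
  by_cases hv : v = 0
  · subst hv
    have := hc_one_lip u
    rw [norm_sub_rev]
    simpa [hc_zero] using this
  rw [hc_ofReal hu, hc_ofReal hv, ← Complex.ofReal_sub, Complex.norm_real]
  exact hr_lip hu hv

lemma hc_neg_real (a : ℝ) : hc (-(a:ℂ)) = hc (a:ℂ) + a := by
  rcases lt_trichotomy a 0 with h | h | h
  · have := hc_neg_l (l := -a) (by linarith)
    push_cast at this
    rw [neg_neg] at this
    rw [this]; ring
  · subst h; simp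
  · exact hc_neg_l h

lemma hc_real_im (a : ℝ) : (hc (a:ℂ)).im = 0 := by
  have := hc_conj (a:ℂ)
  rw [Complex.conj_ofReal] at this
  exact Complex.conj_eq_iff_im.mp this.symm

/-- imaginary part of the kernel on the horizontal lines -/
noncomputable def QC (b U k σ : ℝ) : ℂ :=
  (1/(2*π*Complex.I)) * (hc (-((2*π*k/U:ℝ):ℂ)) - hc (-((2*π/U*(σ-1+k):ℝ):ℂ))) + b * ((σ-1)/(U*Complex.I))

lemma norm_inv_2piI : ‖(1/(2*π*Complex.I) : ℂ)‖ = 1/(2*π) := by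
  rw [norm_div, norm_mul, norm_mul, Complex.norm_I, Complex.norm_real]
  simp [abs_of_pos Real.pi_pos]

lemma norm_QC {b U k σ : ℝ} (hb : b = 0 ∨ b = 1) (hU : 0 < U) : ‖QC b U k σ‖ ≤ |σ-1|/U := by
  have hUC : (U:ℂ) ≠ 0 := by exact_mod_cast hU.ne'
  have hpi : (π:ℂ) ≠ 0 := by exact_mod_cast Real.pi_ne_zero
  have e2 : 1/(2*π) * |2*π/U*(σ-1)| = |σ-1|/U := by
    rw [abs_mul, abs_of_pos (by positivity)]; field_simp
  rcases hb with rfl | rfl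
  · rw [QC]
    simp only [Complex.ofReal_zero, zero_mul, add_zero]
    rw [norm_mul, norm_inv_2piI, ← e2]
    gcongr
    have := hc_lip (-(2*π*k/U)) (-(2*π/U*(σ-1+k)))
    rw [Complex.ofReal_neg, Complex.ofReal_neg] at this
    refine this.trans (le_of_eq ?_)
    congr 1; ring
  · have : QC 1 U k σ = (1/(2*π*Complex.I)) * (hc (((2*π*k/U:ℝ):ℂ)) - hc (((2*π/U*(σ-1+k):ℝ):ℂ))) := by
      rw [QC, hc_neg_real, hc_neg_real]
      push_cast
      field_simp; ring
    rw [this, norm_mul, norm_inv_2piI, ← e2]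
    gcongr
    refine (hc_lip _ _).trans (le_of_eq ?_)
    rw [← abs_neg]
    congr 1; ring

lemma PhiC_top {b U k σ : ℝ} (hU : 0 < U) : PhiC b U k (σ + U*Complex.I) = QC b U k σ := by
  have hUC : (U:ℂ) ≠ 0 := by exact_mod_cast hU.ne'
  have e : 2*π*Complex.I - ((2*π/U:ℝ):ℂ)*(((σ:ℂ) + U*Complex.I)-1+k) = -((2*π/U*(σ-1+k):ℝ):ℂ) := by
    push_cast; field_simp; ring
  rw [PhiC, QC, e]
  have : ((σ:ℂ) + U*Complex.I - 1)/(U*Complex.I) = 1 + ((σ:ℂ)-1)/(U*Complex.I) := by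
    field_simp; ring
  rw [this]; ring

lemma PhiC_real {b U k σ : ℝ} (hU : 0 < U) (h : σ - 1 + k ≠ 0) :
    PhiC b U k σ = QC b U k σ + ((1/(1 - Real.exp (-(2*π/U*(σ-1+k)))) - b : ℝ):ℂ) := by
  have hUC : (U:ℂ) ≠ 0 := by exact_mod_cast hU.ne'
  have hpi : (π:ℂ) ≠ 0 := by exact_mod_cast Real.pi_ne_zero
  set a := 2*π/U*(σ-1+k) with ha
  have ha0 : a ≠ 0 := mul_ne_zero (by positivity) h
  have haC : (-(a:ℂ)) ≠ 0 := by rw [neg_ne_zero]; exact_mod_cast ha0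
  have e : 2*π*Complex.I - ((2*π/U:ℝ):ℂ)*((σ:ℂ)-1+k) = 2*π*Complex.I + -(a:ℂ) := by
    rw [ha]; push_cast; ring
  have hne : 2*π*Complex.I + -(a:ℂ) ≠ 0 := by
    intro h0
    have := congrArg Complex.re h0
    simp at this
    exact ha0 this
  rw [PhiC, QC, ← ha, e, hc_of_ne hne, hc_of_ne haC, Complex.exp_add, Complex.exp_two_pi_mul_I, one_mul]
  have hx : Real.exp (-a) ≠ 1 := by
    rw [Ne, Real.exp_eq_one_iff]; exact neg_ne_zero.mpr ha0
  have hx2 : (1:ℂ) - Complex.exp (-(a:ℂ)) ≠ 0 := by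
    rw [← Complex.ofReal_neg, ← Complex.ofReal_exp, sub_ne_zero]
    exact_mod_cast hx.symm
  have hx3 : Complex.exp (-(a:ℂ)) - 1 ≠ 0 := by
    rw [← neg_ne_zero]; simpa using hx2
  have hx4 : Complex.exp (-(a:ℂ)) - 1 = - (1 - Complex.exp (-(a:ℂ))) := by ring
  push_cast
  rw [hx4]
  field_simp
  ring

lemma QC_re {b U k σ : ℝ} : (QC b U k σ).re = 0 := by
  have h1 : (hc (-((2*π*k/U:ℝ):ℂ))).im = 0 := by rw [← Complex.ofReal_neg]; exact hc_real_im _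
  have h2 : (hc (-((2*π/U*(σ-1+k):ℝ):ℂ))).im = 0 := by rw [← Complex.ofReal_neg]; exact hc_real_im _
  rw [QC]
  set p := hc (-((2*π*k/U:ℝ):ℂ))
  set q := hc (-((2*π/U*(σ-1+k):ℝ):ℂ))
  have e1 : (1/(2*π*Complex.I) : ℂ) = ((-(1/(2*π)):ℝ):ℂ) * Complex.I := by
    rw [one_div, mul_inv, Complex.inv_I]; push_cast; ring
  have e2 : (b:ℂ) * (((σ:ℂ)-1)/(U*Complex.I)) = ((-(b*((σ-1)/U)):ℝ):ℂ) * Complex.I := by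
    rw [div_eq_mul_inv, mul_inv, Complex.inv_I]; push_cast; ring
  rw [e1, e2]
  simp [Complex.mul_re, h1, h2]

lemma PhiC_real_im {b U k σ : ℝ} (hb : b = 0 ∨ b = 1) (hU : 0 < U) (h : σ - 1 + k ≠ 0) :
    |(PhiC b U k σ).im| ≤ |σ-1|/U := by
  rw [PhiC_real hU h, Complex.add_im, Complex.ofReal_im, add_zero]
  exact (Complex.abs_im_le_norm _).trans (norm_QC hb hU)

lemma PhiC_at_one {b U k : ℝ} (hU : 0 < U) (hk : 0 < k) :
    PhiC b U k 1 = ((1/(1 - Real.exp (-(2*π*k/U))) - b : ℝ):ℂ) := by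
  have h := PhiC_real (b := b) (k := k) (σ := 1) hU (by simpa using hk.ne')
  rw [Complex.ofReal_one] at h
  rw [h]
  have e : 2*π/U*(1-1+k) = 2*π*k/U := by ring
  rw [QC, e]; simp

lemma PhiC_left {b U k y : ℝ} (hb : b = 0 ∨ b = 1) (hU : 100 ≤ U) (hk : 0 < k) (hk1 : k ≤ 1)
    (hy : 0 ≤ y) (hyU : y ≤ U) : ‖PhiC b U k (-1 + y*Complex.I)‖ ≤ U := by
  have hU0 : 0 < U := by linarith
  have hUC : (U:ℂ) ≠ 0 := by exact_mod_cast hU0.ne'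
  set r : ℝ := 2*π/U*(2-k) with hr
  have hr0 : 2*π/U ≤ r := by
    rw [hr]; have : 0 < 2*π/U := by positivity
    nlinarith
  have hr1 : r ≤ 4*π/U := by
    rw [hr]; have : 0 < 2*π/U := by positivity
    have e : 4*π/U = 2*π/U*2 := by ring
    rw [e]; gcongr; linarith
  have hrp : 0 < r := lt_of_lt_of_le (by positivity) hr0
  have hv : 2*π*Complex.I - ((2*π/U:ℝ):ℂ)*((-1 + y*Complex.I)-1+k)
     = (r:ℂ) + ((2*π*(1-y/U):ℝ):ℂ)*Complex.I := by
    rw [hr]; push_cast; field_simp; ring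
  have hyU1 : y/U ≤ 1 := by rw [div_le_one hU0]; exact hyU
  have hyU0 : 0 ≤ y/U := by positivity
  set v : ℂ := (r:ℂ) + ((2*π*(1-y/U):ℝ):ℂ)*Complex.I with hvdef
  have hpi := Real.pi_gt_d6
  have hpi2 := Real.pi_lt_d6
  have h4U : 4*π/U ≤ 0.13 := by rw [div_le_iff₀ hU0]; linarith
  have hvn : ‖v‖ ≤ 2*π + 4*π/U := by
    refine (norm_add_le _ _).trans ?_
    rw [norm_mul, Complex.norm_I, Complex.norm_real, Complex.norm_real, Real.norm_eq_abs, Real.norm_eq_abs,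
      abs_of_pos hrp, abs_of_nonneg (by apply mul_nonneg (by positivity); linarith)]
    have : 2*π*(1-y/U) ≤ 2*π := by nlinarith
    linarith
  have hden : r ≤ ‖Complex.exp v - 1‖ := by
    have h1 : ‖Complex.exp v‖ = Real.exp r := by
      rw [Complex.norm_exp]; simp [hvdef]
    have h2 : ‖Complex.exp v‖ ≤ ‖Complex.exp v - 1‖ + 1 := by
      calc ‖Complex.exp v‖ = ‖(Complex.exp v - 1) + 1‖ := by ring_nf
        _ ≤ _ := by simpa using norm_add_le (Complex.exp v - 1) 1
    have := Real.add_one_le_exp r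
    linarith
  have hv0 : v ≠ 0 := by
    intro h
    have := congrArg Complex.re h
    simp [hvdef] at this
    linarith
  have hhc : ‖hc v‖ ≤ U + 2 := by
    rw [hc_of_ne hv0, norm_div, div_le_iff₀ (by linarith)]
    calc ‖v‖ ≤ 2*π + 4*π/U := hvn
      _ = (U+2) * (2*π/U) := by field_simp; ring
      _ ≤ (U+2) * ‖Complex.exp v - 1‖ := by gcongr; linarith
  have hl0 : ‖hc (-((2*π*k/U:ℝ):ℂ))‖ ≤ 2 := by
    have h1 := hc_one_lip (-(2*π*k/U))
    rw [abs_neg, abs_of_pos (by positivity), Complex.ofReal_neg] at h1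
    have h2 : 2*π*k/U ≤ 4*π/U := by
      apply div_le_div_of_nonneg_right _ hU0.le; nlinarith
    have h3 : hc (-((2*π*k/U:ℝ):ℂ)) = 1 - (1 - hc (-((2*π*k/U:ℝ):ℂ))) := by ring
    have h4 : ‖hc (-((2*π*k/U:ℝ):ℂ))‖ ≤ 1 + ‖(1 - hc (-((2*π*k/U:ℝ):ℂ)))‖ := by
      conv_lhs => rw [h3]
      simpa using norm_sub_le (1:ℂ) (1 - hc (-((2*π*k/U:ℝ):ℂ)))
    linarith
  have hbt : ‖(b:ℂ) * (1 - ((-1 + y*Complex.I)-1)/(U*Complex.I))‖ ≤ 3 := by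
    have hb1 : ‖(b:ℂ)‖ ≤ 1 := by rcases hb with rfl | rfl <;> simp
    have e : 1 - ((-1 + y*Complex.I)-1)/(U*Complex.I) = ((1 - y/U:ℝ):ℂ) + ((-(2/U):ℝ):ℂ)*Complex.I := by
      push_cast; field_simp; ring_nf; simp; ring
    rw [norm_mul, e]
    have h1 : ‖((1 - y/U:ℝ):ℂ) + ((-(2/U):ℝ):ℂ)*Complex.I‖ ≤ 3 := by
      refine (norm_add_le _ _).trans ?_
      rw [norm_mul, Complex.norm_I, Complex.norm_real, Complex.norm_real, Real.norm_eq_abs, Real.norm_eq_abs,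
        abs_neg, abs_of_nonneg (by linarith), abs_of_pos (by positivity)]
      have : 2/U ≤ 1 := by rw [div_le_one hU0]; linarith
      linarith
    calc ‖(b:ℂ)‖ * _ ≤ 1 * 3 := by gcongr
      _ = 3 := by norm_num
  rw [PhiC, hv]
  refine (norm_sub_le _ _).trans ?_
  have h5 : ‖(1/(2*π*Complex.I)) * (hc (-((2*π*k/U:ℝ):ℂ)) - hc v)‖ ≤ 1/2 * (U+4) := by
    rw [norm_mul, norm_inv_2piI]
    have h1 : 1/(2*π) ≤ 1/2 := by apply one_div_le_one_div_of_le <;> linarith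
    have h2 : ‖hc (-((2*π*k/U:ℝ):ℂ)) - hc v‖ ≤ U+4 := (norm_sub_le _ _).trans (by linarith)
    gcongr
  linarith

noncomputable def XC (x : ℝ) (s : ℂ) : ℂ := Complex.exp ((s-1)*Real.log x)

noncomputable def OmC (b U k x : ℝ) (s : ℂ) : ℂ :=
  if s = 1 - k then U/(2*π) * XC x s else (s-(1-k)) * PhiC b U k s * XC x s

lemma differentiable_XC (x : ℝ) : Differentiable ℂ (XC x) := by
  unfold XC; fun_prop

lemma OmC_diff {b U k x : ℝ} (hU : 0 < U) {s : ℂ} (h1 : -(U/2) < s.im) (h2 : s.im < 3*U/2) :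
    DifferentiableAt ℂ (OmC b U k x) s := by
  have hUC : (U:ℂ) ≠ 0 := by exact_mod_cast hU.ne'
  have hpi : (π:ℂ) ≠ 0 := by exact_mod_cast Real.pi_ne_zero
  have hX : DifferentiableAt ℂ (XC x) s := differentiable_XC x s
  by_cases hs : s = 1 - k
  · have hev : OmC b U k x =ᶠ[nhds s] fun s => ((1/(2*π*Complex.I)) * ((s-(1-k)) * hc (-((2*π*k/U:ℝ):ℂ))
        + U/(2*π) * ((2*π*Complex.I - ((2*π/U:ℝ):ℂ)*(s-1+k)) * hc (-(((2*π/U:ℝ):ℂ)*(s-1+k)))))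
        - (s-(1-k)) * (b * (1 - (s-1)/(U*Complex.I)))) * XC x s := by
      have hopen : {z : ℂ | 2*π*Complex.I - ((2*π/U:ℝ):ℂ)*(z-1+k) ≠ 0} ∈ nhds s := by
        apply IsOpen.mem_nhds
        · exact isOpen_ne_fun (by fun_prop) (by fun_prop)
        · simp only [Set.mem_ofPred_eq]
          rw [hs]; ring_nf
          simp [Real.pi_ne_zero]
      filter_upwards [hopen] with z hz
      rw [OmC]
      split_ifs with h
      · rw [h]
        have e1 : (1 - (k:ℂ) - 1 + k) = 0 := by ring
        rw [e1]
        simp [hc_zero]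
        field_simp
        ring_nf
        simp [Complex.I_sq]
      · rw [PhiC, hc_of_ne hz]
        have e3 : (z-1+k) ≠ 0 := by
          intro h0; apply h; linear_combination h0
        have e2 : -(((2*π/U:ℝ):ℂ)*(z-1+k)) ≠ 0 := by
          rw [neg_ne_zero]
          apply mul_ne_zero _ e3
          have : 2*π/U ≠ 0 := by positivity
          exact_mod_cast this
        rw [hc_of_ne e2]
        have e4 : Complex.exp (2*π*Complex.I - ((2*π/U:ℝ):ℂ)*(z-1+k)) = Complex.exp (-(((2*π/U:ℝ):ℂ)*(z-1+k))) := by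
          rw [sub_eq_add_neg, Complex.exp_add, Complex.exp_two_pi_mul_I, one_mul]
        rw [e4]
        generalize Complex.exp (-(((2*π/U:ℝ):ℂ)*(z-1+k))) - 1 = EE
        push_cast
        by_cases hE : EE = 0
        · subst hE; simp; left; ring
        · field_simp; ring
    refine DifferentiableAt.congr_of_eventuallyEq ?_ hev
    apply DifferentiableAt.mul _ hX
    have hd : DifferentiableAt ℂ (fun s : ℂ => hc (-(((2*π/U:ℝ):ℂ)*(s-1+k)))) s := by
      apply DifferentiableAt.comp (f := fun s : ℂ => -(((2*π/U:ℝ):ℂ)*(s-1+k))) (g := hc)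
      · apply hc_differentiableAt; right; rw [hs]; ring
      · fun_prop
    apply DifferentiableAt.sub
    · apply DifferentiableAt.mul (by fun_prop)
      apply DifferentiableAt.add (by fun_prop)
      apply DifferentiableAt.mul (by fun_prop)
      apply DifferentiableAt.mul (by fun_prop) hd
    · apply DifferentiableAt.mul (by fun_prop)
      apply DifferentiableAt.mul (by fun_prop)
      apply DifferentiableAt.sub (by fun_prop)
      exact DifferentiableAt.div_const (by fun_prop) _
  · have hev : OmC b U k x =ᶠ[nhds s] fun s => (s-(1-k)) * PhiC b U k s * XC x s := by
      filter_upwards [isOpen_ne.mem_nhds hs] with z hz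
      rw [OmC, if_neg hz]
    refine DifferentiableAt.congr_of_eventuallyEq ?_ hev
    apply DifferentiableAt.mul _ hX
    apply DifferentiableAt.mul (by fun_prop)
    unfold PhiC
    apply DifferentiableAt.sub
    · apply DifferentiableAt.mul (by fun_prop)
      apply DifferentiableAt.sub (by fun_prop)
      apply DifferentiableAt.comp (f := fun s : ℂ => 2*π*Complex.I - ((2*π/U:ℝ):ℂ)*(s-1+k)) (g := hc)
      · apply hc_differentiableAt
        by_contra hcon
        push Not at hcon
        obtain ⟨c1, c2⟩ := hcon
        rw [Complex.exp_eq_one_iff] at c1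
        obtain ⟨n, hn⟩ := c1
        have him := congrArg Complex.im hn
        have e : (2*π*Complex.I - ((2*π/U:ℝ):ℂ)*(s-1+k)).im = 2*π - 2*π/U*s.im := by
          rw [Complex.sub_im, Complex.im_ofReal_mul]
          simp
        have e' : ((n:ℂ)*(2*π*Complex.I)).im = 2*π*n := by simp; ring
        rw [e, e'] at him
        have h3 : U - s.im = U*n := by
          have hp := Real.pi_pos
          field_simp at him
          linarith
        have h4 : (-1:ℝ) < n := by by_contra h; push Not at h; nlinarith
        have h5 : (n:ℝ) < 2 := by by_contra h; push Not at h; nlinarith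
        have h4' : -1 < n := by exact_mod_cast h4
        have h5' : n < 2 := by exact_mod_cast h5
        have : n = 0 ∨ n = 1 := by omega
        rcases this with rfl | rfl
        · apply c2; rw [hn]; simp
        · apply hs
          have : ((2*π/U:ℝ):ℂ)*(s-1+k) = 0 := by
            push_cast at hn ⊢
            linear_combination -hn
          rcases mul_eq_zero.mp this with h | h
          · exfalso
            have h0 : 2*π/U ≠ 0 := by positivity
            exact h0 (by exact_mod_cast h)
          · linear_combination h
      · fun_prop
    · apply DifferentiableAt.mul (by fun_prop)
      apply DifferentiableAt.sub (by fun_prop)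
      exact DifferentiableAt.div_const (by fun_prop) _

end PS
end

section
open Real Finset
namespace PS
variable {B ε : ℝ} {S : Finset ℂ} {E : ℂ → ℂ}

noncomputable def GG (S A : Finset ℂ) (E : ℂ → ℂ) (s : ℂ) : ℂ :=
  1/2*Complex.digamma (s/2+1) - 1/2*(Real.log π : ℂ) - (∑ ρ ∈ S \ A, (mz ρ : ℂ)/(s-ρ)) - E s

noncomputable def KK (k : ℝ) (S A : Finset ℂ) (E : ℂ → ℂ) (s : ℂ) : ℂ :=
  -(1/(k:ℂ)) + (∑ ρ ∈ A, (mz ρ : ℂ)/(ρ-(1-k))) + GG S A E s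

lemma GG_diff (H : Had B ε S E) {A : Finset ℂ} {s : ℂ} (h1 : s ∈ Metric.ball (1/2:ℂ) B)
    (h2 : -2 < s.re) (h3 : s ∉ S \ A) : DifferentiableAt ℂ (GG S A E) s := by
  unfold GG
  apply DifferentiableAt.sub
  · apply DifferentiableAt.sub
    · apply DifferentiableAt.sub
      · apply DifferentiableAt.const_mul
        apply DifferentiableAt.comp (f := fun s : ℂ => s/2+1) (g := Complex.digamma)
        · apply differentiableOn_digamma.differentiableAt
          apply (isOpen_lt continuous_const Complex.continuous_re).mem_nhds
          simp; linarith
        · fun_prop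
      · fun_prop
    · apply DifferentiableAt.fun_sum
      intro ρ hρ
      apply DifferentiableAt.fun_div (by fun_prop) (by fun_prop)
      intro h0
      apply h3
      rwa [sub_eq_zero.1 h0]
  · exact H.diff.differentiableAt (Metric.isOpen_ball.mem_nhds h1)

lemma Zf_eq_GG (H : Had B ε S E) {A : Finset ℂ} (hA : A ⊆ S) {s : ℂ} (h1 : s ∈ Metric.ball (1/2:ℂ) B)
    (h2 : xi s ≠ 0) : Zf s = 1/(s-1) - (∑ ρ ∈ A, (mz ρ : ℂ)/(s-ρ)) + GG S A E s := by
  rw [Zf, Zr, H.eq s h1 h2, GG, ← Finset.sum_sdiff hA]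
  ring

noncomputable def HC (b U k x : ℝ) (s : ℂ) : ℂ := PhiC b U k s * XC x s * Zf s

noncomputable def RR (b U k x : ℝ) (S A : Finset ℂ) (E : ℂ → ℂ) (s : ℂ) : ℂ :=
  (1/(k:ℂ)) * dslope (OmC b U k x) 1 s - (∑ ρ ∈ A, (mz ρ : ℂ)/(ρ-(1-k)) * dslope (OmC b U k x) ρ s)
    + dslope (fun s => OmC b U k x s * KK k S A E s) (1-k) s

lemma XC_real {x : ℝ} (σ : ℝ) : XC x σ = ((Real.exp ((σ-1)*Real.log x) : ℝ):ℂ) := by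
  rw [XC]; push_cast; rfl

lemma norm_XC {x : ℝ} (s : ℂ) : ‖XC x s‖ = Real.exp ((s.re-1)*Real.log x) := by
  rw [XC, Complex.norm_exp, Complex.re_mul_ofReal]; simp

lemma dslope_frac {f : ℂ → ℂ} {a s : ℂ} (h : s ≠ a) : f s * (1/(s-a)) = dslope f a s + f a * (1/(s-a)) := by
  rw [dslope_of_ne _ h, slope_def_field]; ring

set_option maxHeartbeats 1000000 in
lemma explicit1 (H : Had B ε S E) {b U k x η : ℝ} (hb : b = 0 ∨ b = 1) (hU : 0 < U) (hk : 0 < k) (hk1 : k ≤ 1)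
    (hη : 0 < η) (hη1 : η ≤ 1) (hB : U + 2 < B) (hS : ∀ ρ ∈ S, ρ.im ≠ U)
    {g : ℝ → ℝ} (hg : IntervalIntegrable g MeasureTheory.volume (-1) (1+η))
    (hgb : ∀ σ : ℝ, -1 ≤ σ → σ ≤ 1+η → σ ≠ 1 → |σ-1|/U*Real.exp ((σ-1)*Real.log x)*‖Zf σ‖ ≤ g σ) :
    |(PI (1+η) U (HC b U k x)).im - π*((1/(1-Real.exp (-(2*π*k/U))) - b)
        + U/(2*π)*Real.exp (-k*Real.log x) * (Zf ((1-k:ℝ):ℂ)).re)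
      - 2*π*∑ ρ ∈ S.filter (fun ρ => 0 < ρ.im ∧ ρ.im < U), (-(mz ρ : ℂ)*PhiC b U k ρ * XC x ρ).re| ≤ ∫ σ in (-1:ℝ)..(1+η), g σ := by
  set A := S.filter (fun ρ => 0 < ρ.im ∧ ρ.im < U) with hAd
  have hAS : A ⊆ S := Finset.filter_subset _ _
  have hkC : (k:ℂ) ≠ 0 := by exact_mod_cast hk.ne'
  have hpiC : (π:ℂ) ≠ 0 := by exact_mod_cast Real.pi_ne_zero
  have hUC : (U:ℂ) ≠ 0 := by exact_mod_cast hU.ne'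
  have hρk : ∀ ρ ∈ A, ρ - (1-(k:ℂ)) ≠ 0 := by
    intro ρ hρ h0
    have := congrArg Complex.im h0
    rw [hAd, Finset.mem_filter] at hρ
    simp at this
    linarith [hρ.2.1]
  have hball : ∀ s : ℂ, -1 ≤ s.re → s.re ≤ 1+η → 0 ≤ s.im → s.im ≤ U → s ∈ Metric.ball (1/2:ℂ) B := by
    intro s h1 h2 h3 h4
    apply H.ball_of
    rw [abs_of_nonneg h3]
    have : |s.re - 1/2| ≤ 3/2 := by rw [abs_le]; constructor <;> linarith
    linarith
  have hnS : ∀ s : ℂ, 0 ≤ s.im → s.im ≤ U → s ∈ S → s ∈ A := by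
    intro s h3 h4 hs
    rw [hAd, Finset.mem_filter]
    have h := H.im hs
    rw [abs_of_nonneg h3] at h
    exact ⟨hs, by linarith, lt_of_le_of_ne h4 (hS s hs)⟩
  have hxi0 : ∀ s : ℂ, -1 ≤ s.re → s.re ≤ 1+η → 0 ≤ s.im → s.im ≤ U → s ∉ A → xi s ≠ 0 := by
    intro s h1 h2 h3 h4 h5 h0
    exact h5 (hnS s h3 h4 (H.mem s h0 (Metric.ball_subset_closedBall (hball s h1 h2 h3 h4))))
  -- the strip and the domain
  set W : Set ℂ := {s : ℂ | -(U/2) < s.im ∧ s.im < 3*U/2} with hW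
  have hWo : IsOpen W := by
    apply IsOpen.inter
    · exact isOpen_lt continuous_const Complex.continuous_im
    · exact isOpen_lt Complex.continuous_im continuous_const
  have hOmW : DifferentiableOn ℂ (OmC b U k x) W := fun s hs =>
    (OmC_diff hU hs.1 hs.2).differentiableWithinAt
  set D : Set ℂ := (W ∩ Metric.ball (1/2:ℂ) B) ∩ ({s : ℂ | -2 < s.re} ∩ (↑(S \ A) : Set ℂ)ᶜ) with hD
  have hDo : IsOpen D := by
    apply (hWo.inter Metric.isOpen_ball).inter
    apply IsOpen.inter
    · exact isOpen_lt continuous_const Complex.continuous_re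
    · exact (Finset.finite_toSet _).isClosed.isOpen_compl
  have hKD : DifferentiableOn ℂ (fun s => OmC b U k x s * KK k S A E s) D := by
    intro s hs
    apply DifferentiableAt.differentiableWithinAt
    apply DifferentiableAt.mul (OmC_diff hU hs.1.1.1 hs.1.1.2)
    unfold KK
    exact (differentiableAt_const _).add (GG_diff H hs.1.2 hs.2.1 (by simpa using hs.2.2))
  have hmemW : ∀ s : ℂ, 0 ≤ s.im → s.im ≤ U → s ∈ W := by
    intro s h1 h2; exact ⟨by linarith, by linarith⟩
  have hmemD : ∀ s : ℂ, -1 ≤ s.re → s.re ≤ 1+η → 0 ≤ s.im → s.im ≤ U → s ∈ D := by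
    intro s h1 h2 h3 h4
    refine ⟨⟨hmemW s h3 h4, hball s h1 h2 h3 h4⟩, by simp only [Set.mem_ofPred_eq]; linarith, ?_⟩
    intro hs
    rw [Finset.mem_coe, Finset.mem_sdiff] at hs
    exact hs.2 (hnS s h3 h4 hs.1)
  have hbr : ((1-k:ℝ):ℂ) = 1 - (k:ℂ) := by push_cast; rfl
  have hb0D : (1-(k:ℂ)) ∈ D := by
    rw [← hbr]
    apply hmemD <;> simp <;> linarith
  have hb0A : (1-(k:ℂ)) ∉ A := by
    intro h
    rw [hAd, Finset.mem_filter] at h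
    have := h.2.1
    simp at this
  have hZb : Zf (1-(k:ℂ)) = KK k S A E (1-k) := by
    have e1 : xi (1-(k:ℂ)) ≠ 0 := by
      apply hxi0 _ _ _ _ _ hb0A
      · simp; linarith
      · simp; linarith
      · simp
      · simp; linarith
    rw [Zf_eq_GG H hAS hb0D.1.2 e1, KK, sub_eq_add_neg (1/(1-(k:ℂ)-1)), ← Finset.sum_neg_distrib]
    congr 2
    · rw [show 1-(k:ℂ)-1 = -k by ring]; field_simp
    · apply Finset.sum_congr rfl
      intro ρ hρ
      rw [← neg_sub ρ, div_neg, neg_neg]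
  have hZre : ((Zf ((1-k:ℝ):ℂ)).re : ℂ) = Zf (1-(k:ℂ)) := by
    rw [← hbr]
    apply Complex.ext
    · simp
    · rw [Complex.ofReal_im, Zf_im_zero (by linarith)]
  have hOm1 : OmC b U k x 1 = k * ((1/(1-Real.exp (-(2*π*k/U))) - b:ℝ):ℂ) := by
    rw [OmC, if_neg, PhiC_at_one hU hk]
    · simp [XC]
    · intro h
      apply hkC
      linear_combination h
  have hOmb : OmC b U k x (1-k) = ((U/(2*π)*Real.exp (-k*Real.log x):ℝ):ℂ) := by
    rw [OmC, if_pos rfl, ← hbr, XC_real]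
    push_cast
    congr 3; ring
  have hOms : ∀ s : ℂ, s ≠ 1 - k → OmC b U k x s = (s-(1-k)) * PhiC b U k s * XC x s := by
    intro s hs; rw [OmC, if_neg hs]
  have key := contour (e := 1+η) (U := U) hU (by linarith) (R := RR b U k x S A E) (H := HC b U k x)
    (p1 := 1) (p2 := 1-k) (c1 := 1/(1-Real.exp (-(2*π*k/U))) - b)
    (c2 := U/(2*π)*Real.exp (-k*Real.log x) * (Zf ((1-k:ℝ):ℂ)).re) (A := A)
    (c := fun ρ => -(mz ρ : ℂ)*PhiC b U k ρ * XC x ρ)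
    (by norm_num) (by linarith) (by linarith) (by linarith) ?_ ?_ ?_ hg ?_
  · exact key
  · intro ρ hρ
    have h := hρ
    rw [hAd, Finset.mem_filter] at h
    have h0 := H.re0 h.1
    have h1 := H.re1 h.1
    exact ⟨by linarith, by linarith, h.2.1, h.2.2⟩
  · intro s h1 h2 h3 h4
    unfold RR
    have hs := hmemD s h1 h2 h3 h4
    have hds : ∀ a ∈ W, DifferentiableAt ℂ (dslope (OmC b U k x) a) s := by
      intro a ha
      exact ((Complex.differentiableOn_dslope (hWo.mem_nhds ha)).2 hOmW).differentiableAt (hWo.mem_nhds hs.1.1)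
    apply DifferentiableAt.add
    · apply DifferentiableAt.sub
      · apply DifferentiableAt.const_mul
        apply hds
        apply hmemW <;> simp
        exact hU.le
      · apply DifferentiableAt.fun_sum
        intro ρ hρ
        apply DifferentiableAt.const_mul
        apply hds
        rw [hAd, Finset.mem_filter] at hρ
        exact hmemW ρ hρ.2.1.le hρ.2.2.le
    · exact ((Complex.differentiableOn_dslope (hDo.mem_nhds hb0D)).2 hKD).differentiableAt (hDo.mem_nhds hs)
  · intro s h1 h2 h3 h4 hs1 hs2 hsA
    rw [Complex.ofReal_one] at hs1
    rw [hbr] at hs2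
    have hZ := Zf_eq_GG H hAS (hball s h1 h2 h3 h4) (hxi0 s h1 h2 h3 h4 hsA)
    have hs1' : s - 1 ≠ 0 := sub_ne_zero.2 hs1
    have hs2' : s - (1-(k:ℂ)) ≠ 0 := sub_ne_zero.2 hs2
    have d1 := dslope_frac (f := OmC b U k x) hs1
    have d2 := dslope_frac (f := fun s => OmC b U k x s * KK k S A E s) hs2
    have d3 : ∀ ρ ∈ A, OmC b U k x s * (1/(s-ρ)) = dslope (OmC b U k x) ρ s + OmC b U k x ρ * (1/(s-ρ)) := by
      intro ρ hρ
      apply dslope_frac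
      intro h; exact hsA (h ▸ hρ)
    have hΦ : PhiC b U k s * XC x s = OmC b U k x s * (1/(s-(1-k))) := by
      rw [hOms s hs2]; field_simp
    have hsum : ∑ ρ ∈ A, -(mz ρ : ℂ)*PhiC b U k ρ * XC x ρ * (1/(s-ρ)) =
        - ∑ ρ ∈ A, (mz ρ : ℂ)/(ρ-(1-k)) * (OmC b U k x s * (1/(s-ρ)))
        + ∑ ρ ∈ A, (mz ρ : ℂ)/(ρ-(1-k)) * dslope (OmC b U k x) ρ s := by
      rw [← Finset.sum_neg_distrib, ← Finset.sum_add_distrib]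
      apply Finset.sum_congr rfl
      intro ρ hρ
      rw [d3 ρ hρ, hOms ρ (sub_ne_zero.1 (hρk ρ hρ))]
      have := hρk ρ hρ
      field_simp
      ring
    have hc2 : ((U/(2*π)*Real.exp (-k*Real.log x) * (Zf ((1-k:ℝ):ℂ)).re:ℝ):ℂ) = OmC b U k x (1-k) * KK k S A E (1-k) := by
      rw [Complex.ofReal_mul, hZre, hZb, hOmb]
    have hc1 : ((1/(1-Real.exp (-(2*π*k/U))) - b:ℝ):ℂ) = OmC b U k x 1 / k := by
      rw [hOm1]; field_simp
    rw [hc1, hc2, hsum, HC, hΦ, hZ, RR, hbr, Complex.ofReal_one]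
    have e1 : dslope (OmC b U k x) 1 s = OmC b U k x s * (1/(s-1)) - OmC b U k x 1 * (1/(s-1)) := by
      rw [d1]; ring
    have e2 : dslope (fun s => OmC b U k x s * KK k S A E s) (1-k) s
       = OmC b U k x s * KK k S A E s * (1/(s-(1-k))) - OmC b U k x (1-k) * KK k S A E (1-k) * (1/(s-(1-k))) := by
      rw [d2]; ring
    rw [e1, e2]
    have e3 : ∑ ρ ∈ A, (mz ρ : ℂ)/(ρ-(1-k)) * (OmC b U k x s * (1/(s-ρ))) =
       OmC b U k x s * (1/(s-(1-k))) * (∑ ρ ∈ A, (mz ρ : ℂ)/(s-ρ)) + OmC b U k x s * (1/(s-(1-k))) * ∑ ρ ∈ A, (mz ρ : ℂ)/(ρ-(1-k)) := by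
      rw [Finset.mul_sum, Finset.mul_sum, ← Finset.sum_add_distrib]
      apply Finset.sum_congr rfl
      intro ρ hρ
      have h5 := hρk ρ hρ
      have h6 : s - ρ ≠ 0 := by
        intro h; exact hsA ((sub_eq_zero.1 h) ▸ hρ)
      field_simp
      ring
    rw [e3, KK]
    generalize ∑ ρ ∈ A, (mz ρ : ℂ)/(s-ρ) = Q1
    generalize ∑ ρ ∈ A, (mz ρ : ℂ)/(ρ-(1-k)) = Q2
    generalize ∑ ρ ∈ A, (mz ρ : ℂ)/(ρ-(1-k)) * dslope (OmC b U k x) ρ s = Q3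
    generalize KK k S A E (1-k) = Q4
    generalize OmC b U k x (1-k) = Q5
    generalize OmC b U k x 1 = Q6
    generalize OmC b U k x s = Q7
    generalize GG S A E s = Q8
    field_simp
    ring
  · intro σ h1 h2 h3 h4
    refine le_trans ?_ (hgb σ h1 h2 h3)
    have hz : (Zf σ).im = 0 := Zf_im_zero (by linarith)
    have hz2 : |(Zf σ).re| = ‖Zf σ‖ := by
      rw [← Complex.abs_re_eq_norm.2 hz]
    have e : (HC b U k x σ).im = (PhiC b U k σ).im * Real.exp ((σ-1)*Real.log x) * (Zf σ).re := by
      rw [HC, XC_real, Complex.mul_im, hz, Complex.im_mul_ofReal]; ring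
    rw [e, abs_mul, abs_mul, hz2, abs_of_pos (Real.exp_pos _)]
    have := PhiC_real_im (U := U) (k := k) (σ := σ) hb hU (by intro h; apply h4; linarith)
    gcongr

end PS
end

section
open Real Finset
namespace PS
variable {B ε : ℝ} {S : Finset ℂ} {E : ℂ → ℂ}

lemma Had.Zr_real2 (H : Had B ε S E) {σ : ℝ} (h1 : -1 ≤ σ) (h2 : σ ≤ 2) : ‖Zr σ‖ ≤ 2.2 := by
  have him := Zr_im_zero (σ := σ) (by linarith)
  have e : Zr σ = ((Zr σ).re : ℂ) := by apply Complex.ext <;> simp [him]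
  rw [e, Complex.norm_real, Real.norm_eq_abs]
  unfold Zr
  rw [show ((σ:ℂ)/2 + 1) = ((σ/2+1 : ℝ) : ℂ) by push_cast; ring, digamma_ofReal (by linarith)]
  rw [show (1/2 : ℂ) * (dg (σ/2+1) : ℂ) - 1/2 * (Real.log π : ℂ) = ((1/2 * dg (σ/2+1) - 1/2 * Real.log π : ℝ) : ℂ) by push_cast; ring]
  rw [Complex.sub_re, Complex.ofReal_re]
  have h3 := H.logDeriv_real h1 (by linarith)
  have hz : 0 < σ/2+1 := by linarith
  have h4 := (dg_bounds hz).1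
  have h5 := (dg_bounds hz).2
  rw [dg_add_one hz] at h5
  have h6 : Real.log (σ/2+1) ≤ σ/2 := by have := Real.log_le_sub_one_of_pos hz; linarith
  have l2 := Real.log_two_lt_d9
  have h7 : - 0.6932 ≤ Real.log (σ/2+1) := by
    have : Real.log (1/2) ≤ Real.log (σ/2+1) := Real.log_le_log (by norm_num) (by linarith)
    rw [Real.log_div (by norm_num) (by norm_num), Real.log_one] at this
    linarith
  have h8 : 1 / (σ/2+1) ≤ 2 := by rw [div_le_iff₀ hz]; linarith
  have h9 : Real.log π ≤ 1.3864 := by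
    have : Real.log π ≤ Real.log (2^2) := Real.log_le_log Real.pi_pos (by have := Real.pi_le_four; linarith)
    rw [Real.log_pow] at this; push_cast at this; linarith
  have h10 : 0 ≤ Real.log π := Real.log_nonneg (by have := Real.pi_gt_three; linarith)
  rw [abs_le] at h3 ⊢
  constructor <;> linarith

lemma int_exp1 {a p q : ℝ} (ha : 0 < a) : ∫ σ in p..q, Real.exp ((σ-1)*a) ≤ Real.exp ((q-1)*a)/a := by
  have hd : ∀ σ ∈ Set.uIcc p q, HasDerivAt (fun σ => Real.exp ((σ-1)*a)/a) (Real.exp ((σ-1)*a)) σ := by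
    intro σ _
    have h := ((((hasDerivAt_id σ).sub_const 1).mul_const a).exp).div_const a
    refine h.congr_deriv ?_
    simp; field_simp
  rw [intervalIntegral.integral_eq_sub_of_hasDerivAt hd (Continuous.intervalIntegrable (by fun_prop) _ _)]
  have : 0 ≤ Real.exp ((p-1)*a)/a := by positivity
  linarith

lemma int_exp2 {a p : ℝ} (ha : 0 < a) (hp : p ≤ 1) : ∫ σ in p..1, (1-σ)*Real.exp ((σ-1)*a) ≤ 1/a^2 := by
  have hd : ∀ σ ∈ Set.uIcc p 1, HasDerivAt (fun σ => Real.exp ((σ-1)*a)*((1-σ)/a+1/a^2)) ((1-σ)*Real.exp ((σ-1)*a)) σ := by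
    intro σ _
    have h := ((((hasDerivAt_id σ).sub_const 1).mul_const a).exp).mul ((((hasDerivAt_id σ).const_sub 1).div_const a).add_const (1/a^2))
    refine h.congr_deriv ?_
    simp; field_simp; ring
  rw [intervalIntegral.integral_eq_sub_of_hasDerivAt hd (Continuous.intervalIntegrable (by fun_prop) _ _)]
  have : 0 ≤ Real.exp ((p-1)*a)*((1-p)/a+1/a^2) := by
    have : 0 ≤ 1 - p := by linarith
    positivity
  simp at this ⊢
  linarith

/-- weight `|σ-1| e^{(σ-1)a}` on `[-1,1+η]` -/
lemma int_exp3 {a η : ℝ} (ha : 0 < a) (hη : 0 < η) (hη1 : η ≤ 1) :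
    ∫ σ in (-1:ℝ)..(1+η), |σ-1| * Real.exp ((σ-1)*a) ≤ 1/a^2 + Real.exp a*η := by
  have hc : Continuous (fun σ : ℝ => |σ-1| * Real.exp ((σ-1)*a)) := by fun_prop
  rw [← intervalIntegral.integral_add_adjacent_intervals (b := 1) (hc.intervalIntegrable _ _) (hc.intervalIntegrable _ _)]
  apply add_le_add
  · refine le_trans (le_of_eq ?_) (int_exp2 (p := -1) ha (by norm_num))
    apply intervalIntegral.integral_congr
    intro σ hσ
    rw [Set.uIcc_of_le (by norm_num)] at hσ
    simp only
    rw [abs_of_nonpos (by linarith [hσ.2])]; ring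
  · have : ∫ σ in (1:ℝ)..(1+η), |σ-1| * Real.exp ((σ-1)*a) ≤ ∫ σ in (1:ℝ)..(1+η), Real.exp a := by
      apply intervalIntegral.integral_mono_on (by linarith) (hc.intervalIntegrable _ _) (by simp)
      intro σ hσ
      have h1 : |σ-1| ≤ 1 := by rw [abs_le]; constructor <;> linarith [hσ.1, hσ.2]
      have h2 : Real.exp ((σ-1)*a) ≤ Real.exp a := by
        apply Real.exp_le_exp.2; nlinarith [hσ.2]
      calc _ ≤ 1 * Real.exp a := by gcongr
        _ = _ := one_mul _
    refine this.trans (le_of_eq ?_)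
    simp; ring

lemma int_exp4 {a η : ℝ} (ha : 0 < a) (hη : 0 < η) (hη1 : η ≤ 1) :
    ∫ σ in (-1:ℝ)..(1+η), Real.exp ((σ-1)*a) ≤ 1/a + Real.exp a*η := by
  have hc : Continuous (fun σ : ℝ => Real.exp ((σ-1)*a)) := by fun_prop
  rw [← intervalIntegral.integral_add_adjacent_intervals (b := 1) (hc.intervalIntegrable _ _) (hc.intervalIntegrable _ _)]
  apply add_le_add
  · simpa using int_exp1 (p := -1) (q := 1) ha
  · have : ∫ σ in (1:ℝ)..(1+η), Real.exp ((σ-1)*a) ≤ ∫ σ in (1:ℝ)..(1+η), Real.exp a := by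
      apply intervalIntegral.integral_mono_on (by linarith) (hc.intervalIntegrable _ _) (by simp)
      intro σ hσ
      apply Real.exp_le_exp.2; nlinarith [hσ.2]
    refine this.trans (le_of_eq ?_)
    simp; ring

lemma int_exp5 {a η : ℝ} (ha : 0 < a) (hη : 0 < η) :
    ∫ σ in (-1:ℝ)..(1+η), Real.exp (-(a/4) - |σ-3/4| * a) ≤ 2*Real.exp (-(a/4))/a := by
  have hc : Continuous (fun σ : ℝ => Real.exp (-(a/4) - |σ-3/4| * a)) := by fun_prop
  rw [← intervalIntegral.integral_add_adjacent_intervals (b := 3/4) (hc.intervalIntegrable _ _) (hc.intervalIntegrable _ _)]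
  have h1 : ∫ σ in (-1:ℝ)..(3/4), Real.exp (-(a/4) - |σ-3/4| * a) ≤ Real.exp (-(a/4))/a := by
    refine le_trans (le_of_eq ?_) ((int_exp1 (p := -1) (q := 3/4) ha).trans (le_of_eq ?_))
    · apply intervalIntegral.integral_congr
      intro σ hσ
      rw [Set.uIcc_of_le (by norm_num)] at hσ
      simp only
      rw [abs_of_nonpos (by linarith [hσ.2])]; congr 1; ring
    · congr 2; ring
  have h2 : ∫ σ in (3/4:ℝ)..(1+η), Real.exp (-(a/4) - |σ-3/4| * a) ≤ Real.exp (-(a/4))/a := by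
    have e : ∫ σ in (3/4:ℝ)..(1+η), Real.exp (-(a/4) - |σ-3/4| * a) = ∫ σ in (3/4:ℝ)..(1+η), Real.exp (-(a/4) - (σ-3/4) * a) := by
      apply intervalIntegral.integral_congr
      intro σ hσ
      rw [Set.uIcc_of_le (by linarith)] at hσ
      simp only
      rw [abs_of_nonneg (by linarith [hσ.1])]
    rw [e]
    have hd : ∀ σ ∈ Set.uIcc (3/4:ℝ) (1+η), HasDerivAt (fun σ => -(Real.exp (-(a/4) - (σ-3/4)*a)/a)) (Real.exp (-(a/4) - (σ-3/4)*a)) σ := by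
      intro σ _
      have h := ((((((hasDerivAt_id σ).sub_const (3/4)).mul_const a).const_sub (-(a/4))).exp).div_const a).neg
      refine h.congr_deriv ?_
      simp; field_simp
    rw [intervalIntegral.integral_eq_sub_of_hasDerivAt hd (Continuous.intervalIntegrable (by fun_prop) _ _)]
    have : 0 ≤ Real.exp (-(a/4) - (1+η-3/4)*a)/a := by positivity
    simp at this ⊢
    linarith
  calc _ ≤ Real.exp (-(a/4))/a + Real.exp (-(a/4))/a := add_le_add h1 h2
    _ = _ := by ring

set_option maxHeartbeats 1000000 in
lemma explicit2 (H : Had B ε S E) {b U k x η Z1 Z2 ZL : ℝ} (hb : b = 0 ∨ b = 1) (hU : 100 ≤ U) (hk : 0 < k) (hk1 : k ≤ 1)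
    (hη : 0 < η) (hη1 : η ≤ 1) (hB : U + 2 < B) (hS : ∀ ρ ∈ S, ρ.im ≠ U) (hx : 1 < x) (hZ10 : 0 ≤ Z1) (hZ20 : 0 ≤ Z2)
    (hZ1 : ∀ σ : ℝ, 3/4 ≤ σ → σ ≤ 2 → ‖Zf (σ + U*Complex.I)‖ ≤ Z1)
    (hZ2 : ∀ σ : ℝ, -1 ≤ σ → σ ≤ 3/4 → ‖Zf (σ + U*Complex.I)‖ ≤ Z2)
    (hZL : ∀ y : ℝ, 0 ≤ y → y ≤ U → ‖Zf (-1 + y*Complex.I)‖ ≤ ZL) :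
    |(∫ y in (0:ℝ)..U, HC b U k x (((1+η:ℝ):ℂ) + y*Complex.I)).re - π*((1/(1-Real.exp (-(2*π*k/U))) - b)
        + U/(2*π)*Real.exp (-k*Real.log x) * (Zf ((1-k:ℝ):ℂ)).re)
      - 2*π*∑ ρ ∈ S.filter (fun ρ => 0 < ρ.im ∧ ρ.im < U), (-(mz ρ : ℂ)*PhiC b U k ρ * XC x ρ).re|
      ≤ 1/U*(1/Real.log x + 2.2/(Real.log x)^2 + 3.2*x*η)
        + 1/U*(Z1*(1/(Real.log x)^2+x*η) + 4*Z2*Real.exp (-(Real.log x/4))/Real.log x) + U*U*ZL/x^2 := by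
  have hU0 : 0 < U := by linarith
  have hx0 : 0 < x := by linarith
  have ha : 0 < Real.log x := Real.log_pos hx
  have hea : Real.exp (Real.log x) = x := Real.exp_log hx0
  set a := Real.log x with had
  have c3 : Continuous (fun σ : ℝ => |σ-1| * Real.exp ((σ-1)*a)) := by fun_prop
  have c4 : Continuous (fun σ : ℝ => Real.exp ((σ-1)*a)) := by fun_prop
  have c5 : Continuous (fun σ : ℝ => Real.exp (-(a/4) - |σ-3/4| * a)) := by fun_prop
  have i3 := int_exp3 ha hη hη1
  have i4 := int_exp4 ha hη hη1
  have i5 := int_exp5 ha hη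
  rw [hea] at i3 i4
  have hcg : Continuous (fun σ : ℝ => 1/U*(Real.exp ((σ-1)*a) + 2.2*(|σ-1| * Real.exp ((σ-1)*a)))) := by fun_prop
  have key := explicit1 H (x := x) hb hU0 hk hk1 hη hη1 hB hS
    (g := fun σ => 1/U*(Real.exp ((σ-1)*a) + 2.2*(|σ-1| * Real.exp ((σ-1)*a)))) (hcg.intervalIntegrable _ _) (by
      intro σ h1 h2 h3
      have h4 := H.Zr_real2 h1 (by linarith)
      have h5 : 0 < |σ-1| := abs_pos.2 (sub_ne_zero.2 h3)
      have h6 : ‖Zf σ‖ ≤ 1/|σ-1| + 2.2 := by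
        rw [Zf]
        refine (norm_add_le _ _).trans (add_le_add (le_of_eq ?_) h4)
        rw [norm_div, norm_one, ← Complex.ofReal_one, ← Complex.ofReal_sub, Complex.norm_real, Real.norm_eq_abs]
      calc |σ-1|/U*Real.exp ((σ-1)*a)*‖Zf σ‖ ≤ |σ-1|/U*Real.exp ((σ-1)*a)*(1/|σ-1| + 2.2) := by gcongr
        _ = _ := by field_simp)
  have ig : ∫ σ in (-1:ℝ)..(1+η), 1/U*(Real.exp ((σ-1)*a) + 2.2*(|σ-1| * Real.exp ((σ-1)*a)))
      ≤ 1/U*(1/a + 2.2/a^2 + 3.2*x*η) := by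
    rw [intervalIntegral.integral_const_mul, intervalIntegral.integral_add (c4.intervalIntegrable _ _) ((c3.const_mul _).intervalIntegrable _ _), intervalIntegral.integral_const_mul]
    have : 1/a + x*η + 2.2*(1/a^2+x*η) = 1/a + 2.2/a^2 + 3.2*x*η := by ring
    rw [← this]
    gcongr
  -- top
  have htop : ‖∫ σ in (-1:ℝ)..(1+η), HC b U k x (σ + U*Complex.I)‖ ≤
      1/U*(Z1*(1/a^2+x*η) + 4*Z2*Real.exp (-(a/4))/a) := by
    have h1 : ‖∫ σ in (-1:ℝ)..(1+η), HC b U k x (σ + U*Complex.I)‖ ≤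
        ∫ σ in (-1:ℝ)..(1+η), 1/U*(Z1*(|σ-1| * Real.exp ((σ-1)*a)) + 2*Z2*Real.exp (-(a/4) - |σ-3/4| * a)) := by
      apply intervalIntegral.norm_integral_le_of_norm_le (by linarith)
      · refine Filter.Eventually.of_forall fun σ hσ => ?_
        have hq := norm_QC (b := b) (U := U) (k := k) (σ := σ) hb hU0
        rw [HC, norm_mul, norm_mul, PhiC_top hU0, norm_XC]
        simp only [Complex.add_re, Complex.ofReal_re, Complex.mul_re, Complex.I_re, mul_zero, Complex.ofReal_im, Complex.I_im, zero_mul, sub_zero, add_zero]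
        rw [← had]
        have hee := Real.exp_pos ((σ-1)*a)
        rcases le_or_gt (3/4) σ with h | h
        · have hz := hZ1 σ h (by linarith [hσ.2])
          calc _ ≤ |σ-1|/U * Real.exp ((σ-1)*a) * Z1 := by gcongr
            _ = 1/U*(Z1*(|σ-1| * Real.exp ((σ-1)*a))) := by ring
            _ ≤ _ := by
              have : 0 ≤ 2*Z2*Real.exp (-(a/4) - |σ-3/4| * a) := by positivity
              gcongr; linarith
        · have hz := hZ2 σ (by linarith [hσ.1]) h.le
          have h2 : |σ-1| ≤ 2 := by rw [abs_le]; constructor <;> linarith [hσ.1]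
          have e : -(a/4) - |σ-3/4| * a = (σ-1)*a := by
            rw [abs_of_neg (by linarith)]; ring
          rw [e]
          calc _ ≤ 2/U * Real.exp ((σ-1)*a) * Z2 := by
                have : |σ-1|/U ≤ 2/U := by gcongr
                have := hq.trans this
                gcongr
            _ = 1/U*(2*Z2*Real.exp ((σ-1)*a)) := by ring
            _ ≤ _ := by
              have : 0 ≤ Z1*(|σ-1| * Real.exp ((σ-1)*a)) := by positivity
              gcongr; linarith
      · exact Continuous.intervalIntegrable (by fun_prop) _ _
    refine h1.trans ?_
    rw [intervalIntegral.integral_const_mul, intervalIntegral.integral_add ((c3.const_mul _).intervalIntegrable _ _) ((c5.const_mul _).intervalIntegrable _ _), intervalIntegral.integral_const_mul, intervalIntegral.integral_const_mul]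
    have : 2*Z2*(2*Real.exp (-(a/4))/a) = 4*Z2*Real.exp (-(a/4))/a := by ring
    rw [← this]
    gcongr
  have hleft : ‖∫ y in (0:ℝ)..U, HC b U k x (-1 + y*Complex.I)‖ ≤ U*U*ZL/x^2 := by
    have h1 : ‖∫ y in (0:ℝ)..U, HC b U k x (-1 + y*Complex.I)‖ ≤ U*(1/x^2)*ZL * |U - 0| := by
      apply intervalIntegral.norm_integral_le_of_norm_le_const
      intro y hy
      rw [Set.uIoc_of_le hU0.le] at hy
      rw [HC, norm_mul, norm_mul, norm_XC]
      have h2 := PhiC_left (b := b) (k := k) (y := y) hb hU hk hk1 hy.1.le hy.2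
      have h3 := hZL y hy.1.le hy.2
      have e : Real.exp (((-1 + y*Complex.I : ℂ).re - 1)*a) = 1/x^2 := by
        simp
        rw [show (-1-1)*a = -(a+a) by ring, Real.exp_neg, Real.exp_add, hea, sq]
      rw [← had, e]
      gcongr
    refine h1.trans (le_of_eq ?_)
    rw [sub_zero, abs_of_pos hU0]; ring
  have e : (PI (1+η) U (HC b U k x)).im = -(∫ σ in (-1:ℝ)..(1+η), HC b U k x (σ + U*Complex.I)).im
      + (∫ y in (0:ℝ)..U, HC b U k x (((1+η:ℝ):ℂ) + y*Complex.I)).re - (∫ y in (0:ℝ)..U, HC b U k x (-1 + y*Complex.I)).re := by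
    rw [PI]; simp
  rw [e] at key
  have ht := (Complex.abs_im_le_norm _).trans htop
  have hl := (Complex.abs_re_le_norm _).trans hleft
  have key2 := key.trans ig
  generalize (∫ y in (0:ℝ)..U, HC b U k x (((1+η:ℝ):ℂ) + y*Complex.I)).re = q1 at *
  generalize (∫ σ in (-1:ℝ)..(1+η), HC b U k x (σ + U*Complex.I)).im = q2 at *
  generalize (∫ y in (0:ℝ)..U, HC b U k x (-1 + y*Complex.I)).re = q3 at *
  generalize (1/(1-Real.exp (-(2*π*k/U))) - b) + U/(2*π)*Real.exp (-k*a) * (Zf ((1-k:ℝ):ℂ)).re = q4 at *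
  generalize ∑ ρ ∈ S.filter (fun ρ => 0 < ρ.im ∧ ρ.im < U), (-(mz ρ : ℂ)*PhiC b U k ρ * XC x ρ).re = q5 at *
  rw [abs_le] at *
  constructor <;> linarith [ht.1, ht.2, hl.1, hl.2, key2.1, key2.2]
end PS
end

section
open Real Finset
namespace PS

noncomputable def sl (η y : ℝ) : ℂ := ((1+η:ℝ):ℂ) + y*Complex.I

lemma sl_re (η y : ℝ) : (sl η y).re = 1+η := by simp [sl]
lemma sl_im (η y : ℝ) : (sl η y).im = y := by simp [sl]

lemma PhiK_eq {b U k η y : ℝ} (hU : 0 < U) :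
    PhiK b (2*π*(k+η)/U) (y/U) = PhiC b U k (sl η y)
      + ((1/(2*π*Complex.I)) * (hc ((-(2*π*(k+η)/U):ℝ):ℂ) - hc ((-(2*π*k/U):ℝ):ℂ)) + b*Complex.I*(η/U)) := by
  have hUC : (U:ℂ) ≠ 0 := by exact_mod_cast hU.ne'
  have e : vK (2*π*(k+η)/U) (y/U) = 2*π*Complex.I - ((2*π/U:ℝ):ℂ)*(sl η y - 1 + k) := by
    rw [vK, sl]; push_cast; field_simp; ring
  rw [PhiK, PhiC, e, sl]
  have e2 : (1 - (((1+η:ℝ):ℂ) + y*Complex.I - 1)/(U*Complex.I)) = 1 - (y/U:ℝ) + Complex.I*(η/U) := by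
    push_cast; field_simp; ring_nf; simp; ring
  rw [e2]
  push_cast
  ring

lemma delta_le {b U k η : ℝ} (hb : b = 0 ∨ b = 1) (hU : 0 < U) (hη : 0 < η) :
    ‖((1/(2*π*Complex.I)) * (hc ((-(2*π*(k+η)/U):ℝ):ℂ) - hc ((-(2*π*k/U):ℝ):ℂ)) + b*Complex.I*(η/U))‖ ≤ 2*η/U := by
  have hp := Real.pi_pos
  refine (norm_add_le _ _).trans ?_
  have h1 := hc_lip (-(2*π*(k+η)/U)) (-(2*π*k/U))
  have e : |(-(2*π*(k+η)/U)) - (-(2*π*k/U))| = 2*π*η/U := by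
    rw [show (-(2*π*(k+η)/U)) - (-(2*π*k/U)) = -(2*π*η/U) by ring, abs_neg, abs_of_pos (by positivity)]
  rw [e] at h1
  rw [norm_mul, norm_inv_2piI]
  have h2 : ‖(b:ℂ)*Complex.I*(η/U)‖ ≤ η/U := by
    have hb1 : ‖(b:ℂ)‖ ≤ 1 := by rcases hb with rfl | rfl <;> simp
    have h0 : 0 ≤ η/U := by positivity
    have h3 : ‖((η:ℂ)/U)‖ = η/U := by
      rw [← Complex.ofReal_div, Complex.norm_real, Real.norm_of_nonneg h0]
    rw [norm_mul, norm_mul, Complex.norm_I, h3]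
    nlinarith
  calc _ ≤ 1/(2*π)*(2*π*η/U) + η/U := by gcongr
    _ = _ := by field_simp; ring

lemma Zr_bdd (U : ℝ) : ∃ C, 0 ≤ C ∧ ∀ η y : ℝ, 0 ≤ η → η ≤ 1 → 0 ≤ y → y ≤ U → ‖Zr (sl η y)‖ ≤ C := by
  have hcpt : IsCompact ((Set.Icc (1:ℝ) 2) ×ℂ (Set.Icc (0:ℝ) U)) := isCompact_Icc.reProdIm isCompact_Icc
  have hcont : ContinuousOn Zr ((Set.Icc (1:ℝ) 2) ×ℂ (Set.Icc (0:ℝ) U)) := by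
    intro s hs
    rw [Complex.mem_reProdIm] at hs
    exact (differentiableAt_Zr (by linarith [hs.1.1]) (xi_ne_zero_of_one_le_re hs.1.1)).continuousAt.continuousWithinAt
  obtain ⟨C, hC⟩ := hcpt.exists_bound_of_continuousOn hcont
  refine ⟨max C 0, le_max_right _ _, fun η y h1 h2 h3 h4 => le_trans (hC _ ?_) (le_max_left _ _)⟩
  rw [Complex.mem_reProdIm, sl_re, sl_im]
  exact ⟨⟨by linarith, by linarith⟩, h3, h4⟩

lemma Zf_cont {η : ℝ} (hη : 0 < η) : Continuous (fun y : ℝ => Zf (sl η y)) := by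
  rw [continuous_iff_continuousAt]
  intro y
  apply ContinuousAt.comp (f := fun y : ℝ => sl η y) (g := Zf)
  · have h1 : (sl η y - 1) ≠ 0 := by
      intro h
      have := congrArg Complex.re h
      simp [sl] at this; linarith
    have h2 := differentiableAt_Zr (s := sl η y) (by rw [sl_re]; linarith) (xi_ne_zero_of_one_le_re (by rw [sl_re]; linarith))
    have : DifferentiableAt ℂ Zf (sl η y) := by
      unfold Zf
      have h3 : DifferentiableAt ℂ (fun s : ℂ => 1/(s-1)) (sl η y) := by
        apply DifferentiableAt.fun_div
        · fun_prop
        · fun_prop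
        · exact h1
      exact h3.add h2
    exact this.continuousAt
  · unfold sl; fun_prop

lemma int_Zf {U C η : ℝ} (hU : 0 < U) (hC0 : 0 ≤ C) (hη : 0 < η) (hη1 : η ≤ 1)
    (hC : ∀ η y : ℝ, 0 ≤ η → η ≤ 1 → 0 ≤ y → y ≤ U → ‖Zr (sl η y)‖ ≤ C) :
    η * ∫ y in (0:ℝ)..U, ‖Zf (sl η y)‖ ≤ Real.sqrt η * (4*Real.sqrt (U+1) + C*U) := by
  have hsη : 0 < Real.sqrt η := Real.sqrt_pos.2 hη
  have hsq : Real.sqrt η * Real.sqrt η = η := Real.mul_self_sqrt hη.le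
  have hb : ∀ y ∈ Set.Icc (0:ℝ) U, ‖Zf (sl η y)‖ ≤ 2/Real.sqrt η * (1/Real.sqrt (η+y)) + C := by
    intro y hy
    rw [Zf]
    refine (norm_add_le _ _).trans (add_le_add ?_ (hC η y hη.le hη1 hy.1 hy.2))
    have h0 : 0 < η + y := by linarith [hy.1]
    have hs2 : 0 < Real.sqrt (η+y) := Real.sqrt_pos.2 h0
    have e : sl η y - 1 = (η:ℂ) + y*Complex.I := by rw [sl]; push_cast; ring
    rw [norm_div, norm_one, e, show 2/Real.sqrt η * (1/Real.sqrt (η+y)) = 1/(Real.sqrt η*Real.sqrt (η+y)/2) by field_simp]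
    apply one_div_le_one_div_of_le (by positivity)
    have h1 : (η+y)/2 ≤ ‖(η:ℂ) + y*Complex.I‖ := by
      have h2 := Complex.re_le_norm ((η:ℂ) + y*Complex.I)
      have h3 := Complex.abs_im_le_norm ((η:ℂ) + y*Complex.I)
      have h4 := le_abs_self ((η:ℂ) + y*Complex.I).im
      simp at h2 h3 h4
      linarith
    have h5 : Real.sqrt η ≤ Real.sqrt (η+y) := Real.sqrt_le_sqrt (by linarith [hy.1])
    have h6 : Real.sqrt (η+y) * Real.sqrt (η+y) = η+y := Real.mul_self_sqrt h0.le
    nlinarith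
  have hcs : ContinuousOn (fun y : ℝ => 1/Real.sqrt (η+y)) (Set.uIcc 0 U) := by
    rw [Set.uIcc_of_le hU.le]
    apply ContinuousOn.div continuousOn_const (by fun_prop)
    intro y hy
    exact (Real.sqrt_pos.2 (by linarith [hy.1])).ne'
  have hi : ∫ y in (0:ℝ)..U, 1/Real.sqrt (η+y) ≤ 2*Real.sqrt (U+1) := by
    have hd : ∀ y ∈ Set.uIcc (0:ℝ) U, HasDerivAt (fun y => 2*Real.sqrt (η+y)) (1/Real.sqrt (η+y)) y := by
      intro y hy
      rw [Set.uIcc_of_le hU.le] at hy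
      have h := (((hasDerivAt_id y).const_add η).sqrt (by simp; linarith [hy.1])).const_mul 2
      refine h.congr_deriv ?_
      simp; field_simp
    rw [intervalIntegral.integral_eq_sub_of_hasDerivAt hd hcs.intervalIntegrable]
    have h1 : Real.sqrt (η+U) ≤ Real.sqrt (U+1) := Real.sqrt_le_sqrt (by linarith)
    have h2 := Real.sqrt_nonneg (η+0)
    linarith
  have hcs2 : ContinuousOn (fun y : ℝ => 2/Real.sqrt η * (1/Real.sqrt (η+y))) (Set.uIcc 0 U) := continuousOn_const.mul hcs
  have h1 : ∫ y in (0:ℝ)..U, ‖Zf (sl η y)‖ ≤ 2/Real.sqrt η*(2*Real.sqrt (U+1)) + C*U := by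
    calc _ ≤ ∫ y in (0:ℝ)..U, (2/Real.sqrt η * (1/Real.sqrt (η+y)) + C) := by
          apply intervalIntegral.integral_mono_on hU.le ((Zf_cont hη).norm.intervalIntegrable _ _)
          · exact (hcs2.add continuousOn_const).intervalIntegrable
          · exact hb
      _ = 2/Real.sqrt η*(∫ y in (0:ℝ)..U, 1/Real.sqrt (η+y)) + C*U := by
          rw [intervalIntegral.integral_add hcs2.intervalIntegrable (by simp), intervalIntegral.integral_const_mul]
          simp; ring
      _ ≤ _ := by gcongr
  have h2 : η ≤ Real.sqrt η := by
    have : Real.sqrt η ≤ 1 := by rw [Real.sqrt_le_one]; exact hη1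
    nlinarith
  have h3 : η * (C*U) ≤ Real.sqrt η*(C*U) := by gcongr
  calc _ ≤ η * (2/Real.sqrt η*(2*Real.sqrt (U+1)) + C*U) := by gcongr
    _ = Real.sqrt η*(4*Real.sqrt (U+1)) + η*(C*U) := by
        have : η * (2/Real.sqrt η*(2*Real.sqrt (U+1))) = Real.sqrt η*(4*Real.sqrt (U+1)) := by
          nth_rewrite 1 [← hsq]; field_simp; norm_num
        rw [mul_add, this]
    _ ≤ _ := by linarith


noncomputable def vM (n : ℕ) : ℂ := (ArithmeticFunction.vonMangoldt n : ℂ)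

lemma term_eq {x η y : ℝ} (hx : 0 < x) {n : ℕ} (hn : n ≠ 0) :
    XC x (sl η y) * LSeries.term vM (sl η y) n =
      ((ArithmeticFunction.vonMangoldt n / n * Real.exp (η*Real.log (x/n)):ℝ):ℂ) * Complex.exp (Complex.I*y*(Real.log (x/n):ℝ)) := by
  have hnr : (n:ℝ) ≠ 0 := by exact_mod_cast hn
  have hn0 : (n:ℂ) ≠ 0 := by exact_mod_cast hn
  rw [LSeries.term_of_ne_zero hn, XC, vM, Complex.cpow_def_of_ne_zero hn0, ← Complex.natCast_log, Real.log_div hx.ne' hnr, sl]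
  have e1 : (n:ℂ) = Complex.exp (Real.log n) := by
    rw [← Complex.ofReal_exp, Real.exp_log (by positivity)]; simp
  rw [Complex.ofReal_mul, Complex.ofReal_div, Complex.ofReal_exp, Complex.ofReal_natCast]
  rw [e1]
  rw [div_eq_mul_inv, ← Complex.exp_neg, div_eq_mul_inv, ← Complex.exp_neg, mul_comm (Complex.exp _), mul_assoc, mul_assoc, mul_assoc, ← Complex.exp_add, ← Complex.exp_add, ← Complex.exp_add]
  congr 2
  push_cast
  ring

set_option maxHeartbeats 1000000 in
lemma hasSum_MK {b U l x η : ℝ} (hU : 0 < U) (hl : 0 < l) (hη : 0 < η) (hx : 0 < x) :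
    HasSum (fun n : ℕ => ArithmeticFunction.vonMangoldt n / n * Real.exp (η*Real.log (x/n)) * MK b l (U/(2*π)*Real.log (x/n)))
      (2/U*(∫ y in (0:ℝ)..U, PhiK b l (y/U) * (XC x (sl η y) * Zf (sl η y))).re) := by
  have hp := Real.pi_pos
  have hUC : (U:ℂ) ≠ 0 := by exact_mod_cast hU.ne'
  have hpC : (π:ℂ) ≠ 0 := by exact_mod_cast hp.ne'
  have hPc : Continuous (fun y : ℝ => PhiK b l (y/U)) := (continuous_PhiK hl).comp (by fun_prop)
  have hsum : ∀ y : ℝ, LSeriesSummable vM (sl η y) := fun y =>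
    ArithmeticFunction.LSeriesSummable_vonMangoldt (by rw [sl_re]; linarith)
  have hnt : ∀ (y : ℝ) (n : ℕ), ‖LSeries.term vM (sl η y) n‖ = ‖LSeries.term vM (sl η 0) n‖ := by
    intro y n
    rw [LSeries.norm_term_eq, LSeries.norm_term_eq, sl_re, sl_re]
  have hcx : Continuous (fun y : ℝ => XC x (sl η y)) := by unfold XC sl; fun_prop
  have hct : ∀ n : ℕ, Continuous (fun y : ℝ => LSeries.term vM (sl η y) n) := by
    intro n
    rcases eq_or_ne n 0 with rfl | hn
    · simp only [LSeries.term_zero]; exact continuous_const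
    · have hn0 : (n:ℂ) ≠ 0 := by exact_mod_cast hn
      simp only [LSeries.term_of_ne_zero hn, Complex.cpow_def_of_ne_zero hn0]
      unfold sl
      exact continuous_const.div (by fun_prop) (fun y => Complex.exp_ne_zero _)
  have key : HasSum (fun n : ℕ => ∫ y in (0:ℝ)..U, PhiK b l (y/U) * (XC x (sl η y) * LSeries.term vM (sl η y) n))
      (∫ y in (0:ℝ)..U, PhiK b l (y/U) * (XC x (sl η y) * Zf (sl η y))) := by
    apply intervalIntegral.hasSum_integral_of_dominated_convergence
      (fun n y => ‖PhiK b l (y/U)‖ * Real.exp (η*Real.log x) * ‖LSeries.term vM (sl η 0) n‖)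
    · intro n
      exact (hPc.mul (hcx.mul (hct n))).aestronglyMeasurable
    · intro n
      refine Filter.Eventually.of_forall fun y _ => le_of_eq ?_
      rw [norm_mul, norm_mul, hnt, norm_XC, sl_re]
      simp; ring
    · exact Filter.Eventually.of_forall fun y _ => (hsum 0).norm.mul_left _
    · simp only [tsum_mul_left]
      exact Continuous.intervalIntegrable (by fun_prop) _ _
    · refine Filter.Eventually.of_forall fun y _ => ?_
      apply HasSum.mul_left
      apply HasSum.mul_left
      rw [Zf_eq_LSeries (by rw [sl_re]; linarith)]
      exact (hsum y).hasSum
  have key2 := (Complex.hasSum_re key).mul_left (2/U)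
  have hfun : (fun n : ℕ => ArithmeticFunction.vonMangoldt n / n * Real.exp (η*Real.log (x/n)) * MK b l (U/(2*π)*Real.log (x/n)))
      = fun n => 2/U*(∫ y in (0:ℝ)..U, PhiK b l (y/U) * (XC x (sl η y) * LSeries.term vM (sl η y) n)).re := by
    funext n
    rcases eq_or_ne n 0 with rfl | hn
    · simp
    simp only [term_eq hx hn]
    set w : ℝ := Real.log (x/n) with hw
    set c : ℝ := ArithmeticFunction.vonMangoldt n / n * Real.exp (η*w) with hcd
    have e : ∫ y in (0:ℝ)..U, PhiK b l (y/U) * ((c:ℂ) * Complex.exp (Complex.I*y*(w:ℂ)))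
        = (c:ℂ) * (U * ∫ t in (0:ℝ)..1, PhiK b l t * Complex.exp (2*π*Complex.I*((U/(2*π)*w:ℝ):ℂ)*t)) := by
      have h1 := intervalIntegral.integral_comp_div (a := 0) (b := U)
        (fun t : ℝ => PhiK b l t * Complex.exp (2*π*Complex.I*((U/(2*π)*w:ℝ):ℂ)*t)) hU.ne'
      rw [zero_div, div_self hU.ne', Complex.real_smul] at h1
      rw [← h1, ← intervalIntegral.integral_const_mul]
      apply intervalIntegral.integral_congr
      intro y _
      have e2 : Complex.I*y*(w:ℂ) = 2*π*Complex.I*((U/(2*π)*w:ℝ):ℂ)*((y/U:ℝ):ℂ) := by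
        push_cast; field_simp
      simp only
      rw [e2]; ring
    rw [e, MK, Complex.re_ofReal_mul, Complex.re_ofReal_mul]
    field_simp
  rw [hfun]; exact key2

noncomputable def Ak (k x : ℝ) : ℝ := ∑ n ∈ Finset.Icc 1 ⌊x⌋₊, ArithmeticFunction.vonMangoldt n / n * Real.exp (-k*Real.log (x/n))

lemma hasSum_EK {U k x η : ℝ} (hU : 0 < U) (hx : 1 < x) :
    HasSum (fun n : ℕ => ArithmeticFunction.vonMangoldt n / n * Real.exp (η*Real.log (x/n)) * EK (2*π*(k+η)/U) (U/(2*π)*Real.log (x/n))) (Ak k x) := by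
  have hp := Real.pi_pos
  have h : Ak k x = ∑ n ∈ Finset.Icc 1 ⌊x⌋₊, ArithmeticFunction.vonMangoldt n / n * Real.exp (η*Real.log (x/n)) * EK (2*π*(k+η)/U) (U/(2*π)*Real.log (x/n)) := by
    apply Finset.sum_congr rfl
    intro n hn
    rw [Finset.mem_Icc] at hn
    have hn0 : (0:ℝ) < n := by exact_mod_cast hn.1
    have h1 : (n:ℝ) ≤ x := (Nat.le_floor_iff (by linarith)).1 hn.2
    have h2 : 0 ≤ Real.log (x/n) := Real.log_nonneg (by rw [le_div_iff₀ hn0]; linarith)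
    rw [EK, if_pos (by positivity), mul_assoc, ← Real.exp_add]
    congr 2
    field_simp
    ring
  rw [h]
  apply hasSum_sum_of_ne_finset_zero
  intro n hn
  rcases eq_or_ne n 0 with rfl | hn0
  · simp
  have hn1 : ¬ (n ≤ ⌊x⌋₊) := fun h => hn (Finset.mem_Icc.2 ⟨Nat.one_le_iff_ne_zero.2 hn0, h⟩)
  rw [Nat.le_floor_iff (by linarith)] at hn1
  push Not at hn1
  have hnr : (0:ℝ) < n := by positivity
  have h2 : Real.log (x/n) < 0 := Real.log_neg (by positivity) (by rw [div_lt_one hnr]; exact hn1)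
  rw [EK, if_neg, mul_zero]
  push Not
  have : 0 < U/(2*π) := by positivity
  nlinarith

lemma nonneg_coef {x η : ℝ} (n : ℕ) : 0 ≤ ArithmeticFunction.vonMangoldt n / n * Real.exp (η*Real.log (x/n)) := by
  have := ArithmeticFunction.vonMangoldt_nonneg (n := n)
  positivity

lemma Ak_le {U k x η : ℝ} (hU : 0 < U) (hx : 1 < x) (hk : 0 < k) (hη : 0 < η) :
    Ak k x ≤ 2/U*(∫ y in (0:ℝ)..U, PhiK 0 (2*π*(k+η)/U) (y/U) * (XC x (sl η y) * Zf (sl η y))).re := by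
  have hl : 0 < 2*π*(k+η)/U := by have := Real.pi_pos; positivity
  refine hasSum_le (fun n => ?_) (hasSum_EK (η := η) hU hx) (hasSum_MK hU hl hη (by linarith))
  exact mul_le_mul_of_nonneg_left (MK_bounds hl _).1 (nonneg_coef n)

lemma le_Ak {U k x η : ℝ} (hU : 0 < U) (hx : 1 < x) (hk : 0 < k) (hη : 0 < η) :
    2/U*(∫ y in (0:ℝ)..U, PhiK 1 (2*π*(k+η)/U) (y/U) * (XC x (sl η y) * Zf (sl η y))).re ≤ Ak k x := by
  have hl : 0 < 2*π*(k+η)/U := by have := Real.pi_pos; positivity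
  refine hasSum_le (fun n => ?_) (hasSum_MK hU hl hη (by linarith)) (hasSum_EK (η := η) hU hx)
  exact mul_le_mul_of_nonneg_left (MK_bounds hl _).2 (nonneg_coef n)

lemma int_delta {b U k x : ℝ} (hb : b = 0 ∨ b = 1) (hU : 0 < U) (hx : 1 < x) (hk : 0 < k) :
    ∃ D, 0 ≤ D ∧ ∀ η, 0 < η → η ≤ 1 →
    |2/U*(∫ y in (0:ℝ)..U, PhiK b (2*π*(k+η)/U) (y/U) * (XC x (sl η y) * Zf (sl η y))).re
      - 2/U*(∫ y in (0:ℝ)..U, HC b U k x (sl η y)).re| ≤ D*Real.sqrt η := by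
  obtain ⟨C, hC0, hC⟩ := Zr_bdd U
  refine ⟨2/U*(2/U)*x*(4*Real.sqrt (U+1) + C*U), by positivity, fun η hη hη1 => ?_⟩
  have hl : 0 < 2*π*(k+η)/U := by have := Real.pi_pos; positivity
  have hPc : Continuous (fun y : ℝ => PhiK b (2*π*(k+η)/U) (y/U)) := (continuous_PhiK hl).comp (by fun_prop)
  have hcx : Continuous (fun y : ℝ => XC x (sl η y)) := by unfold XC sl; fun_prop
  have hcz : Continuous (fun y : ℝ => XC x (sl η y) * Zf (sl η y)) := hcx.mul (Zf_cont hη)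
  have hc1 : Continuous (fun y : ℝ => PhiK b (2*π*(k+η)/U) (y/U) * (XC x (sl η y) * Zf (sl η y))) := hPc.mul hcz
  have hd := delta_le (k := k) hb hU hη
  set δ := ((1/(2*π*Complex.I)) * (hc ((-(2*π*(k+η)/U):ℝ):ℂ) - hc ((-(2*π*k/U):ℝ):ℂ)) + b*Complex.I*(η/U)) with hδ
  have e : ∀ y : ℝ, HC b U k x (sl η y) = PhiK b (2*π*(k+η)/U) (y/U) * (XC x (sl η y) * Zf (sl η y)) - δ * (XC x (sl η y) * Zf (sl η y)) := by
    intro y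
    rw [PhiK_eq hU, HC]; ring
  have e2 : ∫ y in (0:ℝ)..U, HC b U k x (sl η y) = (∫ y in (0:ℝ)..U, PhiK b (2*π*(k+η)/U) (y/U) * (XC x (sl η y) * Zf (sl η y)))
      - δ * ∫ y in (0:ℝ)..U, (XC x (sl η y) * Zf (sl η y)) := by
    simp only [e]
    rw [intervalIntegral.integral_sub (hc1.intervalIntegrable _ _) ((hcz.const_mul δ).intervalIntegrable _ _), intervalIntegral.integral_const_mul]
  have h3 : ‖∫ y in (0:ℝ)..U, (XC x (sl η y) * Zf (sl η y))‖ ≤ x * ∫ y in (0:ℝ)..U, ‖Zf (sl η y)‖ := by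
    rw [← intervalIntegral.integral_const_mul]
    apply intervalIntegral.norm_integral_le_of_norm_le hU.le
    · refine Filter.Eventually.of_forall fun y _ => ?_
      rw [norm_mul, norm_XC, sl_re]
      have hlx : 0 < Real.log x := Real.log_pos hx
      have : Real.exp ((1+η-1)*Real.log x) ≤ x := by
        calc _ ≤ Real.exp (Real.log x) := Real.exp_le_exp.2 (by nlinarith)
          _ = x := Real.exp_log (by linarith)
      gcongr
    · exact ((Zf_cont hη).norm.const_mul x).intervalIntegrable _ _
  have h4 := int_Zf hU hC0 hη hη1 hC
  have h5 : 0 ≤ ∫ y in (0:ℝ)..U, ‖Zf (sl η y)‖ := intervalIntegral.integral_nonneg hU.le (fun y _ => norm_nonneg _)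
  rw [← mul_sub, ← Complex.sub_re, e2, sub_sub_cancel, abs_mul, abs_of_pos (by positivity)]
  calc _ ≤ 2/U * ‖δ * ∫ y in (0:ℝ)..U, (XC x (sl η y) * Zf (sl η y))‖ := by
        gcongr; exact Complex.abs_re_le_norm _
    _ ≤ 2/U * ((2*η/U) * (x * ∫ y in (0:ℝ)..U, ‖Zf (sl η y)‖)) := by
        rw [norm_mul]; gcongr
    _ = 2/U*(2/U)*x*(η * ∫ y in (0:ℝ)..U, ‖Zf (sl η y)‖) := by ring
    _ ≤ 2/U*(2/U)*x*(Real.sqrt η * (4*Real.sqrt (U+1) + C*U)) := by gcongr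
    _ = _ := by ring
end PS
end

section
open Real Finset
namespace PS
variable {B ε : ℝ} {S : Finset ℂ} {E : ℂ → ℂ}

lemma norm_Zf_le_tsum {s : ℂ} (hs : 3/2 ≤ s.re) : ‖Zf s‖ ≤ (Zf (s32 0)).re := by
  have h1 : 1 < s.re := by linarith
  have h0 : HasSum zt (Zf (s32 0)).re := by simpa using hasSum_zf 0
  rw [Zf_eq_LSeries h1]
  refine tsum_of_norm_bounded h0 fun n => ?_
  rw [LSeries.norm_term_eq]
  split_ifs with hn
  · exact zt_nonneg n
  · have hn1 : (1:ℝ) ≤ n := by exact_mod_cast Nat.one_le_iff_ne_zero.2 hn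
    rw [zt, Complex.norm_real, Real.norm_of_nonneg ArithmeticFunction.vonMangoldt_nonneg, div_eq_mul_inv, ← Real.rpow_neg (by linarith)]
    apply mul_le_mul_of_nonneg_left _ ArithmeticFunction.vonMangoldt_nonneg
    exact Real.rpow_le_rpow_of_exponent_le hn1 (by linarith)

lemma Had.K_nonneg (H : Had B ε S E) {s : ℂ} (hs : s ∈ Metric.ball (1/2:ℂ) B) (h1 : 1 ≤ s.re) :
    0 ≤ (logDeriv xi s).re + ε := by
  refine le_trans (Finset.sum_nonneg fun ρ hρ => ?_) (H.sum_re hs h1)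
  have := H.re1 hρ
  have h2 : 0 ≤ s.re - ρ.re := by linarith
  positivity

lemma Had.norm_Zf_le (H : Had B ε S E) {s : ℂ} (hs : 3/2 ≤ s.re) : ‖Zf s‖ ≤ 2.1 := by
  refine (norm_Zf_le_tsum hs).trans ?_
  have h1 := logDeriv_le_Ks 0
  have h2 := H.K_nonneg (s := s32 0) (H.ball_of (by rw [s32_re, s32_im]; norm_num; linarith [H.hB])) (by rw [s32_re]; norm_num)
  have h3 : Ks 0 ≤ 2.03 := by
    unfold Ks
    have h4 : Real.log ((25/4+0^2)/(4*π^2)) ≤ 0 := by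
      apply Real.log_nonpos (by positivity)
      rw [div_le_one (by positivity)]
      nlinarith [Real.pi_gt_three]
    have h5 : (3:ℝ) ≤ Real.sqrt (12.25+0^2) := by
      apply Real.le_sqrt_of_sq_le; norm_num
    have h6 : 0.0726/Real.sqrt (12.25+0^2) ≤ 0.0726/3 := by gcongr
    norm_num at *
    linarith
  linarith [H.he]

lemma log_T_ge {T : ℝ} (hT : 10^7 ≤ T) : 16 ≤ Real.log T := by
  have h2 := Real.log_two_gt_d9
  have h4 : 1 - (10^7 / 2^(23:ℕ) : ℝ)⁻¹ ≤ Real.log (10^7 / 2^(23:ℕ)) :=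
    Real.one_sub_inv_le_log_of_pos (by norm_num)
  have h5 : (0.16:ℝ) ≤ 1 - (10^7 / 2^(23:ℕ) : ℝ)⁻¹ := by norm_num
  have h6 : Real.log (10^7) ≤ Real.log T := Real.log_le_log (by norm_num) hT
  have h7 : Real.log (2^(23:ℕ)) = 23 * Real.log 2 := by rw [Real.log_pow]; norm_num
  rw [Real.log_div (by norm_num) (by norm_num), h7] at h4
  have h8 := h5.trans h4
  clear h4 h5 h7
  generalize Real.log (10^7) = w at *
  linarith

lemma Had.K_le (H : Had B ε S E) {T t : ℝ} (hT : 10^7 ≤ T) (h1 : T - 1 ≤ t) (h2 : t ≤ T) :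
    (logDeriv xi (s32 t)).re + ε ≤ Real.log T := by
  have hL := log_T_ge hT
  have hT0 : (10:ℝ)^7 ≤ T := hT
  norm_num at hT0
  have k := logDeriv_le_Ks t
  have z := (Complex.abs_re_le_norm _).trans (H.norm_Zf_le (s := s32 t) (by rw [s32_re]))
  have h3 : Ks t ≤ 1 + 1/2*Real.log T + 1 := by
    unfold Ks
    have e1 : 0.5/(0.25+t^2) ≤ 1 := by
      rw [div_le_one (by positivity)]; nlinarith
    have e2 : 0.0726/Real.sqrt (12.25+t^2) ≤ 1 := by
      have h5 : (3:ℝ) ≤ Real.sqrt (12.25+t^2) := by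
        apply Real.le_sqrt_of_sq_le; nlinarith
      rw [div_le_one (by linarith)]; linarith
    have e3 : Real.log ((25/4+t^2)/(4*π^2)) ≤ 2*Real.log T := by
      rw [show 2*Real.log T = Real.log (T^2) by rw [Real.log_pow]; push_cast; ring]
      apply Real.log_le_log (by have := Real.pi_pos; positivity)
      rw [div_le_iff₀ (by have := Real.pi_pos; positivity)]
      have : 9 ≤ π^2 := by nlinarith [Real.pi_gt_three]
      have : t^2 ≤ T^2 := by nlinarith
      nlinarith
    linarith
  linarith [(abs_le.1 z).1, H.he]

lemma Had.select (H : Had B ε S E) {T : ℝ} (hT : 10^7 ≤ T) (hB : T + 2 < B)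
    (hRH : ∀ ρ ∈ S, 0 < ρ.im → ρ.im ≤ T → ρ.re = 1/2) :
    ∃ U, T - 1/2 ≤ U ∧ U ≤ T - 1/4 ∧ ∀ ρ ∈ S, 1/(16*Real.log T) ≤ |U - ρ.im| := by
  have hL := log_T_ge hT
  have hT0 : (10:ℝ)^7 ≤ T := hT
  norm_num at hT0
  set Q := S.filter (fun ρ => T - 1 ≤ ρ.im ∧ ρ.im ≤ T) with hQ
  set n := Q.card with hn
  have hcard : 0.7*(n:ℝ) ≤ Real.log T := by
    have h1 := H.K_le (t := T - 3/8) hT (by linarith) (by linarith)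
    have h2 := H.sum_re (s := s32 (T-3/8)) (H.ball_of (by
      rw [s32_re, s32_im, abs_of_nonneg (by linarith : (0:ℝ) ≤ T-3/8)]; norm_num; linarith)) (by rw [s32_re]; norm_num)
    refine le_trans ?_ (h2.trans h1)
    rw [s32_re, s32_im]
    calc 0.7*(n:ℝ) = ∑ ρ ∈ Q, (0.7:ℝ) := by rw [Finset.sum_const, nsmul_eq_mul, mul_comm]
      _ ≤ ∑ ρ ∈ Q, (mz ρ : ℝ) * ((3/2 - ρ.re) / ((3/2 - ρ.re)^2 + (T-3/8 - ρ.im)^2)) := by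
        apply Finset.sum_le_sum
        intro ρ hρ
        rw [hQ, Finset.mem_filter] at hρ
        have hr := hRH ρ hρ.1 (by linarith [hρ.2.1]) hρ.2.2
        have hm : (1:ℝ) ≤ mz ρ := by exact_mod_cast mz_pos (H.zero ρ hρ.1)
        rw [hr]
        have h5 : (0.7:ℝ) ≤ ((3/2 - 1/2) / ((3/2 - 1/2)^2 + (T-3/8 - ρ.im)^2)) := by
          rw [le_div_iff₀ (by positivity)]
          nlinarith [hρ.2.1, hρ.2.2]
        nlinarith
      _ ≤ _ := by
        apply Finset.sum_le_sum_of_subset_of_nonneg (Finset.filter_subset _ _)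
        intro ρ hρ _
        have := H.re1 hρ
        have h2 : 0 ≤ 3/2 - ρ.re := by linarith
        positivity
  set h : ℝ := 1/(4*((n:ℝ)+1)) with hh
  have hn0 : (0:ℝ) ≤ n := Nat.cast_nonneg n
  have hh0 : 0 < h := by positivity
  have hnh : h*((n:ℝ)+1) = 1/4 := by rw [hh]; field_simp
  have hd : 1/(16*Real.log T) ≤ h/2 := by
    rw [hh, div_div, div_le_div_iff₀ (by positivity) (by positivity)]
    nlinarith
  have hd2 : 1/(16*Real.log T) ≤ 1/4 := by
    rw [div_le_div_iff₀ (by positivity) (by positivity)]; linarith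
  have hpig : ∃ j ∈ Finset.range (n+1), ∀ ρ ∈ Q, h/2 ≤ |(T - 1/2 + j*h) - ρ.im| := by
    by_contra hcon
    push Not at hcon
    choose! f hf using hcon
    obtain ⟨i, hi, j, hj, hij, hfe⟩ := Finset.exists_ne_map_eq_of_card_lt_of_maps_to (s := Finset.range (n+1)) (t := Q)
      (by rw [Finset.card_range]; omega) (f := f) (fun j hj => (hf j hj).1)
    have h1 := (hf i hi).2
    have h2 := (hf j hj).2
    rw [hfe] at h1
    have h3 : |((i:ℝ) - j)*h| < h := by
      have : ((i:ℝ)-j)*h = ((T - 1/2 + i*h) - (f j).im) - ((T - 1/2 + j*h) - (f j).im) := by ring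
      rw [this]
      refine (abs_sub _ _).trans_lt ?_
      linarith
    rw [abs_mul, abs_of_pos hh0] at h3
    have h4 : |(i:ℝ)-j| < 1 := by
      by_contra hc; push Not at hc; nlinarith
    have h5 : |((i:ℤ)-(j:ℤ))| < 1 := by exact_mod_cast h4
    rw [Int.abs_lt_one_iff] at h5
    apply hij; omega
  obtain ⟨j, hj, hjQ⟩ := hpig
  rw [Finset.mem_range] at hj
  have hjn : (j:ℝ) ≤ n := by exact_mod_cast Nat.lt_succ_iff.1 hj
  have hj0 : (0:ℝ) ≤ j := Nat.cast_nonneg j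
  refine ⟨T - 1/2 + j*h, by nlinarith, by nlinarith, fun ρ hρ => ?_⟩
  by_cases hq : ρ ∈ Q
  · exact hd.trans (hjQ ρ hq)
  · refine hd2.trans ?_
    rw [hQ, Finset.mem_filter] at hq
    rcases lt_or_ge ρ.im (T-1) with h1 | h1
    · rw [le_abs]; left; nlinarith
    · have h2 : T < ρ.im := by
        by_contra hc; push Not at hc; exact hq ⟨hρ, h1, hc⟩
      rw [le_abs]; right; nlinarith
end PS
end

section
open Real Finset
namespace PS
variable {B ε : ℝ} {S : Finset ℂ} {E : ℂ → ℂ}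

lemma inv_diff_bound {s s0 ρ : ℂ} {d r : ℝ} (hd : 0 < d) (h1 : d ≤ ‖s - ρ‖) (h2 : ‖s - s0‖ ≤ r)
    (h3 : ρ.re + 1/2 ≤ s0.re) :
    ‖1/(s-ρ) - 1/(s0-ρ)‖ ≤ 2*r*(1+r/d)*((s0.re - ρ.re) / ((s0.re - ρ.re)^2 + (s0.im - ρ.im)^2)) := by
  have hr : 0 ≤ r := (norm_nonneg _).trans h2
  have hs : s - ρ ≠ 0 := norm_pos_iff.1 (hd.trans_le h1)
  have hs0 : s0 - ρ ≠ 0 := by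
    intro h
    have := congrArg Complex.re h
    simp at this; linarith
  have e1 : 1/(s-ρ) - 1/(s0-ρ) = -(s-s0)/((s-ρ)*(s0-ρ)) := by
    field_simp; ring
  have e2 : (s0.re - ρ.re)^2 + (s0.im - ρ.im)^2 = ‖s0-ρ‖^2 := by
    rw [Complex.sq_norm, Complex.normSq_apply]; simp; ring
  rw [e1, e2, norm_div, norm_neg, norm_mul]
  have p1 : 0 < ‖s-ρ‖ := norm_pos_iff.2 hs
  have p2 : 0 < ‖s0-ρ‖ := norm_pos_iff.2 hs0
  have e3 : ‖s0-ρ‖ ≤ (1+r/d)*‖s-ρ‖ := by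
    have : s0 - ρ = (s-ρ) - (s-s0) := by ring
    rw [this]
    refine (norm_sub_le _ _).trans ?_
    have : r ≤ r/d*‖s-ρ‖ := by
      rw [div_mul_eq_mul_div, le_div_iff₀ hd]; gcongr
    linarith
  have e4 : 1/‖s-ρ‖ ≤ (1+r/d)/‖s0-ρ‖ := by
    rw [div_le_div_iff₀ p1 p2]; linarith
  calc ‖s-s0‖/(‖s-ρ‖*‖s0-ρ‖) = ‖s-s0‖*(1/‖s-ρ‖)*(1/‖s0-ρ‖) := by field_simp
    _ ≤ r*((1+r/d)/‖s0-ρ‖)*(1/‖s0-ρ‖) := by gcongr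
    _ = 2*r*(1+r/d)*((1/2)/‖s0-ρ‖^2) := by field_simp
    _ ≤ _ := by
      have : 1/2 ≤ s0.re - ρ.re := by linarith
      gcongr

lemma Had.diff_log (H : Had B ε S E) {s s0 : ℂ} {d r K : ℝ} (hd : 0 < d)
    (h1 : ∀ ρ ∈ S, d ≤ ‖s - ρ‖) (h2 : ‖s - s0‖ ≤ r)
    (h3 : 3/2 ≤ s0.re) (hs : s ∈ Metric.ball (1/2:ℂ) B) (hs0 : s0 ∈ Metric.ball (1/2:ℂ) B)
    (hK : (logDeriv xi s0).re + ε ≤ K) : xi s ≠ 0 ∧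
    ‖logDeriv xi s - logDeriv xi s0‖ ≤ 2*r*(1+r/d)*K + 2*ε := by
  have hr : 0 ≤ r := (norm_nonneg _).trans h2
  have hx : xi s ≠ 0 := by
    intro h
    have := h1 s (H.mem s h (Metric.ball_subset_closedBall hs))
    simp at this; linarith
  refine ⟨hx, ?_⟩
  rw [H.eq s hs hx, H.eq s0 hs0 (xi_ne_zero_of_one_le_re (by linarith))]
  have e : ∑ ρ ∈ S, (mz ρ : ℂ) / (s - ρ) + E s - (∑ ρ ∈ S, (mz ρ : ℂ) / (s0 - ρ) + E s0)
    = ∑ ρ ∈ S, (mz ρ : ℂ) * (1/(s - ρ) - 1/(s0-ρ)) + (E s - E s0) := by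
    simp only [mul_sub, Finset.sum_sub_distrib, mul_one_div]; ring
  rw [e]
  refine (norm_add_le _ _).trans ?_
  have a1 : ‖E s - E s0‖ ≤ 2*ε := (norm_sub_le _ _).trans (by linarith [H.small s hs, H.small s0 hs0])
  have a2 : ‖∑ ρ ∈ S, (mz ρ : ℂ) * (1/(s - ρ) - 1/(s0-ρ))‖ ≤ 2*r*(1+r/d)*K := by
    refine (norm_sum_le _ _).trans ?_
    calc _ ≤ ∑ ρ ∈ S, 2*r*(1+r/d)*((mz ρ : ℝ) * ((s0.re - ρ.re) / ((s0.re - ρ.re)^2 + (s0.im - ρ.im)^2))) := by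
          apply Finset.sum_le_sum
          intro ρ hρ
          rw [norm_mul, Complex.norm_natCast, mul_left_comm]
          gcongr
          exact inv_diff_bound hd (h1 ρ hρ) h2 (by linarith [H.re1 hρ])
      _ ≤ _ := by
          rw [← Finset.mul_sum]
          gcongr
          exact (H.sum_re hs0 (by linarith)).trans hK
  linarith

lemma log_norm_bound {w : ℂ} {T : ℝ} (hT : 1 ≤ T) (h1 : 1 ≤ ‖w‖) (h2 : ‖w‖ ≤ T) :
    |Real.log ‖w‖| ≤ Real.log T := by
  rw [abs_of_nonneg (Real.log_nonneg h1)]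
  exact Real.log_le_log (by linarith) h2

/-- top edge, generic -/
lemma Had.Zf_top (H : Had B ε S E) {T U σ d r : ℝ} (hT : 10^7 ≤ T) (hB : T + 4 < B)
    (hU1 : T - 1/2 ≤ U) (hU2 : U ≤ T) (hd : 0 < d) (h1 : -1 ≤ σ) (h2 : σ ≤ 2)
    (hS : ∀ ρ ∈ S, d ≤ ‖((σ:ℂ)+U*Complex.I) - ρ‖) (hr : |σ - 3/2| ≤ r) :
    ‖Zf ((σ:ℂ)+U*Complex.I)‖ ≤ 2*r*(1+r/d)*Real.log T + Real.log T + 5 := by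
  have hL := log_T_ge hT
  have hT0 : (10:ℝ)^7 ≤ T := hT
  norm_num at hT0
  have hU0 : 0 ≤ U := by linarith
  set s : ℂ := (σ:ℂ)+U*Complex.I with hs
  have sre : s.re = σ := by simp [hs]
  have sim : s.im = U := by simp [hs]
  have b1 : |σ - 1/2| ≤ 3/2 := by rw [abs_le]; constructor <;> linarith
  have hsb : s ∈ Metric.ball (1/2:ℂ) B := H.ball_of (by rw [sre, sim, abs_of_nonneg hU0]; linarith)
  have hs0b : s32 U ∈ Metric.ball (1/2:ℂ) B := H.ball_of (by
    rw [s32_re, s32_im, abs_of_nonneg hU0]; norm_num; linarith)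
  have hsub : s - s32 U = ((σ - 3/2 : ℝ):ℂ) := by simp [hs, s32]
  obtain ⟨hx, hD⟩ := H.diff_log (s := s) (s0 := s32 U) hd hS (r := r) (by
    rw [hsub, Complex.norm_real]; exact hr) (by rw [s32_re]) hsb hs0b (H.K_le hT (by linarith) hU2)
  have key : Zf s = Zf (s32 U) + (1/(s-1) - 1/(s32 U - 1))
      + (1/2)*(Complex.digamma (s/2+1) - Complex.digamma (s32 U/2+1)) - (logDeriv xi s - logDeriv xi (s32 U)) := by
    unfold Zf Zr; ring
  have dig : ∀ z : ℂ, z.im = U → -1 ≤ z.re → z.re ≤ 2 → ‖Complex.digamma (z/2+1)‖ ≤ Real.log T + 2 := by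
    intro z hz1 hz2 hz3
    have q := digamma_half (z := z/2+1) (by simp; linarith)
    have q0 : U/2 ≤ |(z/2+1).im| := by rw [show (z/2+1).im = U/2 by simp [hz1]]; exact le_abs_self _
    have q1 : U/2 ≤ ‖z/2+1‖ := q0.trans (Complex.abs_im_le_norm _)
    have q2 : U/2 ≤ ‖z/2+1+1/2‖ := by
      refine le_trans ?_ (Complex.abs_im_le_norm _)
      rw [show (z/2+1+1/2).im = U/2 by simp [hz1]]; exact le_abs_self _
    have q3 : ‖z/2+1+1/2‖ ≤ T := by
      refine (Complex.norm_le_abs_re_add_abs_im _).trans ?_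
      rw [show (z/2+1+1/2).im = U/2 by simp [hz1], show (z/2+1+1/2).re = z.re/2+3/2 by simp; ring,
        abs_of_nonneg (by linarith : 0 ≤ z.re/2+3/2), abs_of_nonneg (by linarith)]
      linarith
    have q4 := log_norm_bound (by linarith) (by linarith) q3
    have q5 : 1/‖z/2+1‖ ≤ 1/10 := one_div_le_one_div_of_le (by norm_num) (by linarith)
    linarith [Real.pi_lt_d6]
  have inv1 : ∀ z : ℂ, z.im = U → ‖1/(z-1)‖ ≤ 1/10 := by
    intro z hz
    rw [norm_div, norm_one]
    apply one_div_le_one_div_of_le (by norm_num)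
    refine le_trans ?_ (Complex.abs_im_le_norm _)
    rw [show (z-1).im = U by simp [hz]]
    exact le_trans (by linarith) (le_abs_self _)
  have c1 := H.norm_Zf_le (s := s32 U) (by rw [s32_re])
  have c2 := inv1 s sim
  have c3 := inv1 (s32 U) (s32_im U)
  have c4 := dig s sim (by rw [sre]; exact h1) (by rw [sre]; exact h2)
  have c5 := dig (s32 U) (s32_im U) (by rw [s32_re]; norm_num) (by rw [s32_re]; norm_num)
  have c6 : ‖(1/2:ℂ)*(Complex.digamma (s/2+1) - Complex.digamma (s32 U/2+1))‖ ≤ Real.log T + 2 := by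
    rw [norm_mul]
    have := norm_sub_le (Complex.digamma (s/2+1)) (Complex.digamma (s32 U/2+1))
    norm_num; linarith
  have c7 := norm_sub_le (1/(s-1)) (1/(s32 U - 1))
  rw [key]
  refine (norm_sub_le _ _).trans ?_
  refine (add_le_add (norm_add_le _ _) le_rfl).trans ?_
  refine (add_le_add (add_le_add (norm_add_le _ _) le_rfl) le_rfl).trans ?_
  linarith [H.he]

lemma Had.Zf_top1 (H : Had B ε S E) {T U σ : ℝ} (hT : 10^7 ≤ T) (hB : T + 4 < B)
    (hRH : ∀ ρ ∈ S, 0 < ρ.im → ρ.im ≤ T → ρ.re = 1/2)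
    (hU1 : T - 1/2 ≤ U) (hU2 : U ≤ T - 1/4) (h1 : 3/4 ≤ σ) (h2 : σ ≤ 2) :
    ‖Zf ((σ:ℂ)+U*Complex.I)‖ ≤ 8*Real.log T := by
  have hL := log_T_ge hT
  have hT0 : (10:ℝ)^7 ≤ T := hT
  norm_num at hT0
  have := H.Zf_top (T := T) (U := U) (σ := σ) (d := 1/4) (r := 3/4) hT hB hU1 (by linarith) (by norm_num)
    (by linarith) h2 (by
      intro ρ hρ
      have a1 := Complex.abs_im_le_norm ((σ:ℂ)+U*Complex.I - ρ)
      have a2 := Complex.abs_re_le_norm ((σ:ℂ)+U*Complex.I - ρ)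
      have i1 : ((σ:ℂ)+U*Complex.I - ρ).im = U - ρ.im := by simp
      have i2 : ((σ:ℂ)+U*Complex.I - ρ).re = σ - ρ.re := by simp
      rw [i1] at a1; rw [i2] at a2
      by_cases c1 : 0 < ρ.im
      · by_cases c2 : ρ.im ≤ T
        · rw [hRH ρ hρ c1 c2] at a2
          have := le_abs_self (σ - 1/2); linarith
        · have := neg_abs_le (U - ρ.im); linarith
      · have := le_abs_self (U - ρ.im); linarith)
    (by rw [abs_le]; constructor <;> linarith)
  norm_num at this
  linarith

lemma Had.Zf_top2 (H : Had B ε S E) {T U σ : ℝ} (hT : 10^7 ≤ T) (hB : T + 4 < B)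
    (hsel : ∀ ρ ∈ S, 1/(16*Real.log T) ≤ |U - ρ.im|)
    (hU1 : T - 1/2 ≤ U) (hU2 : U ≤ T - 1/4) (h1 : -1 ≤ σ) (h2 : σ ≤ 3/4) :
    ‖Zf ((σ:ℂ)+U*Complex.I)‖ ≤ 201*(Real.log T)^2 := by
  have hL := log_T_ge hT
  have := H.Zf_top (T := T) (U := U) (σ := σ) (d := 1/(16*Real.log T)) (r := 5/2) hT hB hU1 (by linarith) (by positivity)
    (by linarith) (by linarith) (by
      intro ρ hρ
      have a1 := Complex.abs_im_le_norm ((σ:ℂ)+U*Complex.I - ρ)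
      have i1 : ((σ:ℂ)+U*Complex.I - ρ).im = U - ρ.im := by simp
      rw [i1] at a1
      exact (hsel ρ hρ).trans a1)
    (by rw [abs_le]; constructor <;> linarith)
  refine this.trans ?_
  rw [div_div_eq_mul_div, div_one]
  nlinarith

lemma Had.Zf_left (H : Had B ε S E) {T y : ℝ} (hT : 10^7 ≤ T) (h0 : 0 ≤ y) (h1 : y ≤ T) :
    ‖Zf (-1+y*Complex.I)‖ ≤ Real.log T + 10 := by
  have hL := log_T_ge hT
  have hT0 : (10:ℝ)^7 ≤ T := hT
  norm_num at hT0
  set s : ℂ := -1+y*Complex.I with hs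
  have e1 : logDeriv xi s = -logDeriv xi (1-s) := by
    rw [logDeriv_xi_one_sub]; ring
  have e2 : logDeriv xi (1-s) = 1/(1-s-1) + 1/2*Complex.digamma ((1-s)/2+1) - 1/2*(Real.log π:ℂ) - Zf (1-s) := by
    unfold Zf Zr; ring
  have e3 : Zf s = 1/(s-1) + 1/2*Complex.digamma (s/2+1) - (Real.log π:ℂ) + 1/(1-s-1) +
      1/2*Complex.digamma ((1-s)/2+1) - Zf (1-s) := by
    have : Zf s = 1/(s-1) + (1/2*Complex.digamma (s/2+1) - 1/2*(Real.log π:ℂ) - logDeriv xi s) := rfl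
    rw [this, e1, e2]; ring
  have sre : s.re = -1 := by simp [hs]
  have sim : s.im = y := by simp [hs]
  have b1 : ‖1/(s-1)‖ ≤ 1 := by
    rw [norm_div, norm_one, div_le_one₀]
    · refine le_trans ?_ (Complex.abs_re_le_norm _)
      rw [Complex.sub_re, sre]; norm_num
    · apply lt_of_lt_of_le _ (Complex.abs_re_le_norm _)
      rw [Complex.sub_re, sre]; norm_num
  have b2 : ‖1/(1-s-1)‖ ≤ 1 := by
    rw [norm_div, norm_one, div_le_one₀]
    · refine le_trans ?_ (Complex.abs_re_le_norm _)
      rw [Complex.sub_re, Complex.sub_re, sre]; norm_num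
    · apply lt_of_lt_of_le _ (Complex.abs_re_le_norm _)
      rw [Complex.sub_re, Complex.sub_re, sre]; norm_num
  have b3 : ‖Complex.digamma (s/2+1)‖ ≤ Real.log T + 4 := by
    have re1 : (s/2+1).re = 1/2 := by simp [sre]; norm_num
    have re2 : (s/2+1+1/2).re = 1 := by simp [sre]; norm_num
    have im2 : (s/2+1+1/2).im = y/2 := by simp [sim]
    have q := digamma_half (z := s/2+1) (by rw [re1])
    have q1 : (1/2:ℝ) ≤ ‖s/2+1‖ := by rw [← re1]; exact Complex.re_le_norm _
    have q2 : (1:ℝ) ≤ ‖s/2+1+1/2‖ := by rw [← re2]; exact Complex.re_le_norm _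
    have q3 : ‖s/2+1+1/2‖ ≤ T := by
      refine (Complex.norm_le_abs_re_add_abs_im _).trans ?_
      rw [im2, re2, abs_of_nonneg (by linarith : 0 ≤ y/2), abs_one]
      linarith
    have q4 := log_norm_bound (by linarith) q2 q3
    have q5 : 1/‖s/2+1‖ ≤ 1/(1/2) := one_div_le_one_div_of_le (by norm_num) q1
    linarith [Real.pi_lt_d6]
  have b4 : ‖Complex.digamma ((1-s)/2+1)‖ ≤ Real.log T + 2 := by
    have re1 : ((1-s)/2+1).re = 2 := by simp [sre]; norm_num
    have re2 : ((1-s)/2+1-1/2).re = 3/2 := by simp [sre]; norm_num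
    have im2 : ((1-s)/2+1-1/2).im = -(y/2) := by simp [sim]; ring
    have q := digamma_crude (z := (1-s)/2+1) (by rw [re1]; norm_num)
    have q2 : (3/2:ℝ) ≤ ‖(1-s)/2+1-1/2‖ := by rw [← re2]; exact Complex.re_le_norm _
    have q3 : ‖(1-s)/2+1-1/2‖ ≤ T := by
      refine (Complex.norm_le_abs_re_add_abs_im _).trans ?_
      rw [im2, re2, abs_neg, abs_of_nonneg (by linarith : 0 ≤ y/2), abs_of_nonneg (by norm_num)]
      linarith
    have q4 := log_norm_bound (by linarith) (by linarith) q3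
    linarith [Real.pi_lt_d6]
  have b5 := H.norm_Zf_le (s := 1-s) (by rw [Complex.sub_re, sre]; norm_num)
  have b6 : ‖((Real.log π:ℝ):ℂ)‖ ≤ 1.2 := by
    rw [Complex.norm_real, Real.norm_of_nonneg (Real.log_nonneg (by linarith [Real.pi_gt_three]))]
    have h4 : Real.log π ≤ Real.log (2*2) - (1 - π/4) := by
      have : Real.log (π/4) ≤ π/4 - 1 := Real.log_le_sub_one_of_pos (by positivity)
      rw [Real.log_div (by positivity) (by norm_num)] at this
      norm_num at *; linarith
    rw [Real.log_mul (by norm_num) (by norm_num)] at h4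
    linarith [Real.log_two_lt_d9, Real.pi_lt_d6]
  have c3 : ‖1/2*Complex.digamma (s/2+1)‖ = 1/2*‖Complex.digamma (s/2+1)‖ := by rw [norm_mul]; norm_num
  have c4 : ‖1/2*Complex.digamma ((1-s)/2+1)‖ = 1/2*‖Complex.digamma ((1-s)/2+1)‖ := by rw [norm_mul]; norm_num
  rw [e3]
  refine (norm_sub_le _ _).trans ?_
  refine (add_le_add (norm_add_le _ _) le_rfl).trans ?_
  refine (add_le_add (add_le_add (norm_add_le _ _) le_rfl) le_rfl).trans ?_
  refine (add_le_add (add_le_add (add_le_add (norm_sub_le _ _) le_rfl) le_rfl) le_rfl).trans ?_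
  refine (add_le_add (add_le_add (add_le_add (add_le_add (norm_add_le _ _) le_rfl) le_rfl) le_rfl) le_rfl).trans ?_
  linarith

end PS
end

section
open Real Finset
namespace PS
variable {B ε : ℝ} {S : Finset ℂ} {E : ℂ → ℂ}

lemma le_of_sqrt {A M C : ℝ} (h : ∀ η, 0 < η → η ≤ 1 → A ≤ M + C*Real.sqrt η) : A ≤ M := by
  have h1 : Filter.Tendsto (fun η : ℝ => M + C*Real.sqrt η) (nhdsWithin 0 (Set.Ioi 0)) (nhds M) := by
    have : Continuous (fun η : ℝ => M + C*Real.sqrt η) := by fun_prop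
    have h2 := this.tendsto 0
    simp only [Real.sqrt_zero, mul_zero, add_zero] at h2
    exact h2.mono_left nhdsWithin_le_nhds
  refine ge_of_tendsto h1 ?_
  filter_upwards [Ioc_mem_nhdsGT (show (0:ℝ) < 1 by norm_num)] with η hη
  exact h η hη.1 hη.2

noncomputable def Gk (b U k x : ℝ) : ℝ :=
  2*π/U*(1/(1-Real.exp (-(2*π*k/U))) - b) + Real.exp (-k*Real.log x) * (Zf ((1-k:ℝ):ℂ)).re

noncomputable def Er (T U x : ℝ) : ℝ :=
  1/U*(1/Real.log x + 2.2/(Real.log x)^2)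
        + 1/U*(8*Real.log T*(1/(Real.log x)^2) + 4*(201*(Real.log T)^2)*Real.exp (-(Real.log x/4))/Real.log x)
        + U*U*(Real.log T+10)/x^2

lemma exp_half {x : ℝ} (hx : 0 < x) : Real.exp ((1/2-1)*Real.log x) = 1/Real.sqrt x := by
  rw [show (1/2-1)*Real.log x = -(1/2*Real.log x) by ring, Real.exp_neg, one_div, Real.sqrt_eq_rpow,
    Real.rpow_def_of_pos hx]
  ring_nf

set_option maxHeartbeats 1000000 in
lemma Had.main1 (H : Had B ε S E) {T U x : ℝ} (hT : 10^7 ≤ T) (hB : 2*T+4 < B) (he : ε ≤ 1/(2*T)^2)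
    (hRH : ∀ ρ ∈ S, 0 < ρ.im → ρ.im ≤ T → ρ.re = 1/2) (hx : 1 < x)
    (hU1 : T - 1/2 ≤ U) (hU2 : U ≤ T - 1/4) (hsel : ∀ ρ ∈ S, 1/(16*Real.log T) ≤ |U - ρ.im|)
    {b k : ℝ} (hb : b = 0 ∨ b = 1) (hk : 0 < k) (hk1 : k ≤ 1) :
    ∃ C, ∀ η, 0 < η → η ≤ 1 →
    |2/U*(∫ y in (0:ℝ)..U, PhiK b (2*π*(k+η)/U) (y/U) * (XC x (sl η y) * Zf (sl η y))).re - Gk b U k x|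
      ≤ ((1/π*MY (Real.log (U/(2*π))) + 0.182)/Real.sqrt x + 2/U*Er T U x) + C*Real.sqrt η := by
  have hL := log_T_ge hT
  have hT0 : (10:ℝ)^7 ≤ T := hT
  norm_num at hT0
  have hU0 : 0 < U := by linarith
  have hx0 : 0 < x := by linarith
  have hp := Real.pi_pos
  obtain ⟨D, hD0, hD⟩ := int_delta (b := b) hb hU0 hx hk
  refine ⟨D + 2/U*(1/U*(3.2*x) + 1/U*(8*Real.log T*x)), fun η hη hη1 => ?_⟩
  have q1 := hD η hη hη1
  have q2 := explicit2 H (b := b) (U := U) (k := k) (x := x) (η := η) (Z1 := 8*Real.log T) (Z2 := 201*(Real.log T)^2)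
    (ZL := Real.log T + 10) hb (by linarith) hk hk1 hη hη1 (by linarith) (by
      intro ρ hρ h
      have := hsel ρ hρ
      rw [h, sub_self, abs_zero] at this
      have : 0 < 1/(16*Real.log T) := by positivity
      linarith) hx (by positivity) (by positivity)
    (fun σ h1 h2 => H.Zf_top1 hT (by linarith) hRH hU1 hU2 h1 h2)
    (fun σ h1 h2 => H.Zf_top2 hT (by linarith) hsel hU1 hU2 h1 h2)
    (fun y h1 h2 => H.Zf_left hT h1 (by linarith))
  set A := S.filter (fun ρ => 0 < ρ.im ∧ ρ.im < U) with hA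
  have hAre : ∀ ρ ∈ A, ρ.re = 1/2 := by
    intro ρ hρ
    rw [hA, Finset.mem_filter] at hρ
    exact hRH ρ hρ.1 hρ.2.1 (by linarith [hρ.2.2])
  have q3 := H.zero_total (U := U) (A := A) (by linarith) (by linarith) (he.trans (by gcongr; linarith)) (Finset.filter_subset _ _)
    hAre (fun ρ hρ => (Finset.mem_filter.1 hρ).2.1) (fun ρ hρ => (Finset.mem_filter.1 hρ).2.2) hb hk hk1
  have hsx : 0 < Real.sqrt x := Real.sqrt_pos.2 hx0
  have q4 : |4*π/U*∑ ρ ∈ A, (-(mz ρ : ℂ)*PhiC b U k ρ * XC x ρ).re| ≤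
      (1/π*MY (Real.log (U/(2*π))) + 0.182)/Real.sqrt x := by
    rw [abs_mul, abs_of_pos (by positivity)]
    calc 4*π/U * |∑ ρ ∈ A, (-(mz ρ : ℂ)*PhiC b U k ρ * XC x ρ).re|
        ≤ 4*π/U * ∑ ρ ∈ A, (mz ρ:ℝ) * ‖PhiC b U k ρ‖ * (1/Real.sqrt x) := by
          gcongr
          refine (Finset.abs_sum_le_sum_abs _ _).trans (Finset.sum_le_sum fun ρ hρ => ?_)
          refine (Complex.abs_re_le_norm _).trans ?_
          rw [norm_mul, norm_mul, norm_neg, Complex.norm_natCast, norm_XC, hAre ρ hρ, exp_half hx0]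
      _ = (4*π/U * ∑ ρ ∈ A, (mz ρ:ℝ) * ‖PhiC b U k ρ‖)/Real.sqrt x := by
          rw [← Finset.sum_mul]; ring
      _ ≤ _ := by gcongr
  generalize hI : (∫ y in (0:ℝ)..U, PhiK b (2*π*(k+η)/U) (y/U) * (XC x (sl η y) * Zf (sl η y))).re = I1 at *
  have hJ : (∫ y in (0:ℝ)..U, HC b U k x (((1+η:ℝ):ℂ) + y*Complex.I)).re = (∫ y in (0:ℝ)..U, HC b U k x (sl η y)).re := rfl
  rw [hJ] at q2
  generalize (∫ y in (0:ℝ)..U, HC b U k x (sl η y)).re = J1 at *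
  generalize ∑ ρ ∈ A, (-(mz ρ : ℂ)*PhiC b U k ρ * XC x ρ).re = Sg at *
  have q5 : |2/U*J1 - Gk b U k x - 4*π/U*Sg| ≤ 2/U*(Er T U x + (1/U*(3.2*x) + 1/U*(8*Real.log T*x))*η) := by
    have e : 2/U*J1 - Gk b U k x - 4*π/U*Sg = 2/U*(J1 - π*((1/(1-Real.exp (-(2*π*k/U))) - b)
        + U/(2*π)*Real.exp (-k*Real.log x) * (Zf ((1-k:ℝ):ℂ)).re) - 2*π*Sg) := by
      unfold Gk; field_simp; ring
    rw [e, abs_mul, abs_of_pos (by positivity)]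
    gcongr
    refine q2.trans (le_of_eq ?_)
    unfold Er; ring
  have q6 : η ≤ Real.sqrt η := by
    apply Real.le_sqrt_of_sq_le; nlinarith
  have q7 : 2/U*((1/U*(3.2*x) + 1/U*(8*Real.log T*x))*η) ≤ 2/U*(1/U*(3.2*x) + 1/U*(8*Real.log T*x))*Real.sqrt η := by
    rw [← mul_assoc]; gcongr
  have q8 : 2/U*I1 - Gk b U k x = (2/U*I1 - 2/U*J1) + (2/U*J1 - Gk b U k x - 4*π/U*Sg) + 4*π/U*Sg := by ring
  rw [q8]
  refine (abs_add_le _ _).trans ((add_le_add (abs_add_le _ _) le_rfl).trans ?_)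
  rw [mul_add] at q5
  rw [add_mul]
  linarith

lemma Had.main2 (H : Had B ε S E) {T U x : ℝ} (hT : 10^7 ≤ T) (hB : 2*T+4 < B) (he : ε ≤ 1/(2*T)^2)
    (hRH : ∀ ρ ∈ S, 0 < ρ.im → ρ.im ≤ T → ρ.re = 1/2) (hx : 1 < x)
    (hU1 : T - 1/2 ≤ U) (hU2 : U ≤ T - 1/4) (hsel : ∀ ρ ∈ S, 1/(16*Real.log T) ≤ |U - ρ.im|)
    {k : ℝ} (hk : 0 < k) (hk1 : k ≤ 1) :
    Ak k x ≤ Gk 0 U k x + ((1/π*MY (Real.log (U/(2*π))) + 0.182)/Real.sqrt x + 2/U*Er T U x) ∧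
    Gk 1 U k x - ((1/π*MY (Real.log (U/(2*π))) + 0.182)/Real.sqrt x + 2/U*Er T U x) ≤ Ak k x := by
  have hT0 : (10:ℝ)^7 ≤ T := hT
  norm_num at hT0
  have hU0 : 0 < U := by linarith
  constructor
  · obtain ⟨C, hC⟩ := H.main1 (b := 0) hT hB he hRH hx hU1 hU2 hsel (Or.inl rfl) hk hk1
    apply le_of_sqrt (C := C)
    intro η hη hη1
    have h1 := Ak_le hU0 hx hk hη
    have h2 := (abs_le.1 (hC η hη hη1)).2
    linarith
  · obtain ⟨C, hC⟩ := H.main1 (b := 1) hT hB he hRH hx hU1 hU2 hsel (Or.inr rfl) hk hk1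
    rw [sub_le_iff_le_add]
    apply le_of_sqrt (C := C)
    intro η hη hη1
    have h1 := le_Ak hU0 hx hk hη
    have h2 := (abs_le.1 (hC η hη hη1)).1
    linarith

/-- z coth z -/
noncomputable def zc (z : ℝ) : ℝ := z * (Real.cosh z / Real.sinh z)

lemma Gk_eq {b U k x : ℝ} (hU : 0 < U) (hk : 0 < k) :
    Gk b U k x = π/U*(Real.cosh (π*k/U)/Real.sinh (π*k/U)) + π/U*(1-2*b)
      + Real.exp (-k*Real.log x) * (Zf ((1-k:ℝ):ℂ)).re := by
  have hp := Real.pi_pos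
  have hz : 0 < π*k/U := by positivity
  unfold Gk
  rw [show 2*π*k/U = 2*(π*k/U) by ring]
  set z := π*k/U
  have h1 : Real.exp z * Real.exp (-z) = 1 := by rw [← Real.exp_add]; simp
  have h2 : Real.exp (-(2*z)) = Real.exp (-z)*Real.exp (-z) := by rw [← Real.exp_add]; congr 1; ring
  have h3 : Real.exp (-z) < 1 := by rw [Real.exp_lt_one_iff]; linarith
  have h4 : 1 < Real.exp z := Real.one_lt_exp_iff.2 hz
  have h5 := Real.exp_pos (-z)
  have key : 1/(1-Real.exp (-(2*z))) = (Real.cosh z/Real.sinh z + 1)/2 := by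
    rw [Real.cosh_eq, Real.sinh_eq, h2]
    generalize Real.exp z = p at *
    generalize Real.exp (-z) = q at *
    have n1 : 1 - q*q ≠ 0 := by nlinarith
    have n2 : p - q ≠ 0 := by intro h; linarith
    have e1 : ((p+q)/2/((p-q)/2)+1)/2 = p/(p-q) := by field_simp; ring
    rw [e1, div_eq_div_iff n1 n2]
    linear_combination q*h1
  rw [key]; ring

lemma zc_deriv {z : ℝ} (hz : 0 < z) : HasDerivAt zc ((Real.sinh z*Real.cosh z - z)/(Real.sinh z)^2) z := by
  have hs : 0 < Real.sinh z := Real.sinh_pos_iff.2 hz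
  have h := (hasDerivAt_id z).mul ((Real.hasDerivAt_cosh z).div (Real.hasDerivAt_sinh z) hs.ne')
  refine (h.congr_deriv ?_)
  have := Real.cosh_sq z
  simp only [id, Pi.div_apply]
  field_simp
  linear_combination (-z)*this

lemma tanh_le {z : ℝ} (hz : 0 ≤ z) : Real.sinh z ≤ z*Real.cosh z := by
  have h : MonotoneOn (fun z : ℝ => z*Real.cosh z - Real.sinh z) (Set.Ici 0) := by
    apply monotoneOn_of_hasDerivWithinAt_nonneg (f' := fun z => z*Real.sinh z) (convex_Ici 0)
    · fun_prop
    · intro y hy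
      have := ((hasDerivAt_id y).mul (Real.hasDerivAt_cosh y)).sub (Real.hasDerivAt_sinh y)
      refine (this.congr_deriv ?_).hasDerivWithinAt
      simp
    · intro y hy
      rw [interior_Ici] at hy
      have h0 : (0:ℝ) < y := hy
      have := Real.sinh_pos_iff.2 h0
      positivity
  have := h (Set.mem_Ici.2 le_rfl) (Set.mem_Ici.2 hz) hz
  simp at this
  linarith

lemma zc_diff {z w : ℝ} (hz : 0 < z) (hzw : z < w) : 0 ≤ zc w - zc z ∧ zc w - zc z ≤ w*(w-z) := by
  obtain ⟨c, hc, h⟩ := exists_hasDerivAt_eq_slope zc (fun z => (Real.sinh z*Real.cosh z - z)/(Real.sinh z)^2) hzw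
    (fun y hy => (zc_deriv (hz.trans_le hy.1)).continuousAt.continuousWithinAt) (fun y hy => zc_deriv (hz.trans hy.1))
  have hc0 : 0 < c := hz.trans hc.1
  have hs : c < Real.sinh c := Real.self_lt_sinh_iff.2 hc0
  have hch := Real.one_le_cosh c
  have h1 : 0 ≤ (Real.sinh c*Real.cosh c - c)/(Real.sinh c)^2 := by
    apply div_nonneg _ (sq_nonneg _); nlinarith
  have h2 : (Real.sinh c*Real.cosh c - c)/(Real.sinh c)^2 ≤ c := by
    have hs0 : 0 < Real.sinh c := by linarith
    rw [div_le_iff₀ (by positivity)]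
    have := tanh_le hc0.le
    have := Real.cosh_sq c
    nlinarith
  rw [eq_div_iff (by linarith)] at h
  rw [← h]
  have hd : 0 < w - z := by linarith
  refine ⟨by positivity, ?_⟩
  gcongr
  exact h2.trans hc.2.le

lemma zc_near {z : ℝ} (hz : 0 < z) (hz1 : z ≤ 1) : 1 ≤ zc z ∧ zc z ≤ 1 + z^2 := by
  have hs0 : 0 < Real.sinh z := Real.sinh_pos_iff.2 hz
  have hs : z < Real.sinh z := Real.self_lt_sinh_iff.2 hz
  unfold zc
  rw [← mul_div_assoc]
  constructor
  · rw [le_div_iff₀ hs0]; linarith [tanh_le hz.le]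
  · rw [div_le_iff₀ hs0]
    have h1 := Real.cosh_le_exp_half_sq z
    have h2 : Real.exp (z^2/2) ≤ 1 + z^2 := by
      have h3 : 1 - z^2/2 ≤ Real.exp (-(z^2/2)) := by linarith [Real.add_one_le_exp (-(z^2/2))]
      have h4 : Real.exp (z^2/2) * Real.exp (-(z^2/2)) = 1 := by rw [← Real.exp_add]; simp
      have h5 := Real.exp_pos (z^2/2)
      have h6 : z^2 ≤ 1 := by nlinarith
      have h7 : Real.exp (z^2/2) * (1-z^2/2) ≤ 1 := by nlinarith
      have h8 : 1 ≤ (1+z^2)*(1-z^2/2) := by nlinarith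
      by_contra! h9
      nlinarith
    have : 0 < Real.cosh z := Real.cosh_pos z
    nlinarith

end PS
end

section
open Real Finset
namespace PS
variable {B ε : ℝ} {S : Finset ℂ} {E : ℂ → ℂ}

lemma log_x_bounds {x : ℝ} (hx : 10^9 < x) : 20.5 ≤ Real.log x ∧ Real.log x ≤ 0.001*Real.sqrt x ∧ 31622 ≤ Real.sqrt x := by
  norm_num at hx
  have h2 := Real.log_two_gt_d9
  have h2' := Real.log_two_lt_d9
  have hw : (31622:ℝ) ≤ Real.sqrt x := by
    apply Real.le_sqrt_of_sq_le; norm_num; linarith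
  refine ⟨?_, ?_, hw⟩
  · have h3 := Real.one_sub_inv_le_log_of_pos (x := x/2^(29:ℕ)) (by positivity)
    rw [Real.log_div (by positivity) (by positivity), Real.log_pow] at h3
    have h4 : (x/2^(29:ℕ))⁻¹ ≤ 0.537 := by
      rw [inv_div, div_le_iff₀ (by linarith)]; norm_num; linarith
    generalize (x/2^(29:ℕ))⁻¹ = q at *
    push_cast at h3
    linarith
  · have h5 : Real.log x = 2*Real.log (Real.sqrt x) := by
      rw [Real.log_sqrt (by linarith)]; ring
    rw [h5]
    set w := Real.sqrt x
    have h6 := Real.log_le_sub_one_of_pos (x := w/2^(15:ℕ)) (by positivity)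
    rw [Real.log_div (by positivity) (by positivity), Real.log_pow] at h6
    norm_num at h6
    linarith

lemma Er_le {T U x : ℝ} (hT : 10^7 ≤ T) (hU1 : T - 1/2 ≤ U) (hU2 : U ≤ T) (hTx : T < x) (hx : 10^9 < x) :
    2/U*Er T U x ≤ 1/U^2 + 0.005/Real.sqrt x := by
  have hL := log_T_ge hT
  obtain ⟨hLs, _⟩ := log_sq_le (U := T) (by linarith)
  have hT0 : (10:ℝ)^7 ≤ T := hT
  norm_num at hT0
  have hU0 : 0 < U := by linarith
  have hx0 : 0 < x := by linarith
  obtain ⟨ha, hax, hw⟩ := log_x_bounds hx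
  have hLa : Real.log T ≤ Real.log x := Real.log_le_log (by linarith) hTx.le
  have hu : Real.exp (-(Real.log x/4)) ^ 2 = 1/Real.sqrt x := by
    rw [← exp_half hx0, ← Real.exp_nat_mul]; congr 1; push_cast; ring
  have hu0 := Real.exp_pos (-(Real.log x/4))
  have hxx : x = Real.sqrt x * Real.sqrt x := (Real.mul_self_sqrt hx0.le).symm
  unfold Er
  set L := Real.log T
  set a := Real.log x
  set w := Real.sqrt x
  set u := Real.exp (-(a/4))
  have hw0 : 0 < w := by linarith
  have ha0 : 0 < a := by linarith
  have t1 : 1/a ≤ 1/20.5 := one_div_le_one_div_of_le (by norm_num) ha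
  have t1p : 0 < 1/a := by positivity
  have t2 : 2.2/a^2 ≤ 0.0053 := by
    have : 2.2/a^2 = 2.2*((1/a)*(1/a)) := by field_simp
    rw [this]
    have : (1/a)*(1/a) ≤ (1/20.5)*(1/20.5) := by gcongr
    norm_num at *; linarith
  have t3 : 8*L*(1/a^2) ≤ 0.3903 := by
    have : 8*L*(1/a^2) ≤ 8*a*(1/a^2) := by gcongr
    have e : 8*a*(1/a^2) = 8*(1/a) := by field_simp
    rw [e] at this
    norm_num at *; linarith
  have t4 : 4*(201*L^2)*u/a ≤ 804*L*u := by
    rw [div_le_iff₀ ha0]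
    have : L*u*L ≤ L*u*a := by gcongr
    linarith
  have t5 : 804*L*u ≤ 0.05 + 5*804^2*(L^2*u^2) := by nlinarith [sq_nonneg (804*L*u - 0.1)]
  have t6 : U*U*(L+10)/x^2 ≤ U*(0.002/w) := by
    rw [mul_assoc, mul_div_assoc]
    refine mul_le_mul_of_nonneg_left ?_ hU0.le
    rw [div_le_div_iff₀ (by positivity) hw0]
    have e : x^2 = x*w*w := by rw [pow_two]; nth_rewrite 2 [hxx]; ring
    have h1 : L + 10 ≤ 0.002*w := by linarith
    calc U*(L+10)*w ≤ x*(0.002*w)*w := by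
          have : U ≤ x := by linarith
          gcongr
      _ = 0.002*x^2 := by rw [e]; ring
  have t7 : 2/U*(1/U*(5*804^2*(L^2*u^2))) ≤ 0.001/w := by
    rw [hu]
    have : L^2 ≤ 2/10^4*U := by linarith
    calc 2/U*(1/U*(5*804^2*(L^2*(1/w)))) ≤ 2/U*(1/U*(5*804^2*((2/10^4*U)*(1/w)))) := by gcongr
      _ = (1292.832/U)*(1/w) := by field_simp; norm_num
      _ ≤ 0.001*(1/w) := by
          gcongr
          rw [div_le_iff₀ hU0]; linarith
      _ = _ := by ring
  calc 2/U*(1/U*(1/a+2.2/a^2) + 1/U*(8*L*(1/a^2)+4*(201*L^2)*u/a) + U*U*(L+10)/x^2)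
      ≤ 2/U*(1/U*(1/20.5+0.0053) + 1/U*(0.3903+(0.05 + 5*804^2*(L^2*u^2))) + U*(0.002/w)) := by
        gcongr
        exact t4.trans t5
    _ = (2*(1/20.5+0.0053+0.3903+0.05))/U^2 + 2/U*(1/U*(5*804^2*(L^2*u^2))) + 0.004/w := by
        field_simp; ring
    _ ≤ 1/U^2 + 0.001/w + 0.004/w := by
        gcongr
        norm_num
    _ = _ := by ring

lemma coef_le {T U : ℝ} (hT : 10^7 ≤ T) (hU1 : T - 1/2 ≤ U) (hU2 : U ≤ T) :
    1/π*MY (Real.log (U/(2*π))) + 0.188 ≤ 1 / (2 * π) * Real.log (T / (2 * π)) ^ 2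
            - 1 / (6 * π) * Real.log (T / (2 * π)) := by
  have hL := log_T_ge hT
  have hT0 : (10:ℝ)^7 ≤ T := hT
  norm_num at hT0
  have hU0 : 0 < U := by linarith
  have hp := Real.pi_pos
  have h2p : Real.log (2*π) ≤ 1.9 := by
    have h1 := Real.log_le_sub_one_of_pos (x := 2*π/2^(3:ℕ)) (by positivity)
    rw [Real.log_div (by positivity) (by positivity), Real.log_pow] at h1
    norm_num at h1
    linarith [Real.log_two_lt_d9, Real.pi_lt_d6]
  have hUT : Real.log (U/(2*π)) ≤ Real.log (T/(2*π)) := Real.log_le_log (by positivity) (by gcongr)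
  have hU1' : 1 ≤ Real.log (U/(2*π)) := by
    rw [Real.le_log_iff_exp_le (by positivity), le_div_iff₀ (by positivity)]
    have := Real.exp_one_lt_d9
    have := Real.pi_lt_d6
    nlinarith
  have hY : 14.1 ≤ Real.log (T/(2*π)) := by
    rw [Real.log_div (by linarith) (by positivity)]; linarith
  generalize Real.log (U/(2*π)) = V at *
  generalize Real.log (T/(2*π)) = Y at *
  have m1 : MY V ≤ MY Y := by unfold MY; nlinarith
  have m2 : 1/π*MY V ≤ 1/π*MY Y := by gcongr
  have m3 : 1 / (2 * π) * Y ^ 2 - 1 / (6 * π) * Y = 1/π*MY Y + 1/π*(Y/24+1/4-1/16-1/9) := by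
    unfold MY; field_simp; ring
  have m4 : 0.188 ≤ 1/π*(Y/24+1/4-1/16-1/9) := by
    rw [one_div_mul_eq_div, le_div_iff₀ hp]
    linarith [Real.pi_lt_d6]
  linarith

lemma piU_le {T U : ℝ} (hT : 10^7 ≤ T) (hU1 : T - 1/2 ≤ U) (hU2 : U ≤ T - 1/4) :
    π/U + 1/U^2 + π/U*(π/U - π/T) ≤ π/(T-1) := by
  have hT0 : (10:ℝ)^7 ≤ T := hT
  norm_num at hT0
  have hU0 : 0 < U := by linarith
  have hT1 : 0 < T := by linarith
  have hp := Real.pi_pos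
  have hp1 := Real.pi_gt_d6
  have hp2 := Real.pi_lt_d6
  have e1 : π/U*(π/U - π/T) ≤ 0.1/U^2 := by
    have e : π/U*(π/U - π/T) = π^2*((T-U)/T)/U^2 := by field_simp
    rw [e]
    gcongr
    have : (T-U)/T ≤ 1/1000 := by
      rw [div_le_iff₀ hT1]; linarith
    calc π^2*((T-U)/T) ≤ 4^2*(1/1000) := by
          have : 0 ≤ (T-U)/T := div_nonneg (by linarith) hT1.le
          gcongr; linarith
      _ ≤ 0.1 := by norm_num
  have e2 : π/(T-1) - π/U = π*(U-(T-1))/(U*(T-1)) := by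
    have : T - 1 ≠ 0 := by intro h; linarith
    field_simp
  have e3 : 1.5/U^2 ≤ π*(U-(T-1))/(U*(T-1)) := by
    have hT2 : 0 < T - 1 := by linarith
    rw [pow_two]
    have : 1.5 ≤ π*(U-(T-1)) := by nlinarith
    apply div_le_div₀ (by linarith) this (by positivity)
    gcongr; linarith
  have e4 : 1/U^2 + 0.1/U^2 ≤ 1.5/U^2 := by
    rw [← add_div]; gcongr; norm_num
  linarith

lemma Ak_one {x : ℝ} (hx : 0 < x) : Ak 1 x = (∑ n ∈ Finset.Icc 1 ⌊x⌋₊, ArithmeticFunction.vonMangoldt n)/x := by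
  unfold Ak
  rw [Finset.sum_div]
  apply Finset.sum_congr rfl
  intro n hn
  have hn0 : (0:ℝ) < n := by exact_mod_cast (Finset.mem_Icc.1 hn).1
  rw [neg_one_mul, Real.exp_neg, Real.exp_log (by positivity)]
  field_simp

lemma Gk_one {b U x : ℝ} (hU : 0 < U) (hx : 0 < x) :
    Gk b U 1 x = zc (π/U) + π/U*(1-2*b) - Real.log (2*π)/x := by
  rw [Gk_eq hU one_pos]
  have e : Zf (((1-1:ℝ)):ℂ) = ((-Real.log (2*π):ℝ):ℂ) := by
    rw [sub_self, Complex.ofReal_zero, Zf, Zr_zero]; push_cast; ring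
  rw [e, Complex.ofReal_re, neg_one_mul, Real.exp_neg, Real.exp_log hx, mul_one, zc]
  ring

lemma Ak_tendsto (x : ℝ) : Filter.Tendsto (fun k => Ak k x) (nhdsWithin 0 (Set.Ioi 0))
    (nhds (∑ n ∈ Finset.Icc 1 ⌊x⌋₊, ArithmeticFunction.vonMangoldt n / n)) := by
  have h : Continuous (fun k => Ak k x) := by unfold Ak; fun_prop
  have h2 := h.tendsto 0
  have e : Ak 0 x = ∑ n ∈ Finset.Icc 1 ⌊x⌋₊, ArithmeticFunction.vonMangoldt n / n := by
    unfold Ak; simp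
  rw [e] at h2
  exact h2.mono_left nhdsWithin_le_nhds

lemma Gk_tendsto {b U x : ℝ} (hU : 10 < U) : Filter.Tendsto (fun k => Gk b U k x) (nhdsWithin 0 (Set.Ioi 0))
    (nhds (Real.log x - Real.eulerMascheroniConstant + π/U*(1-2*b))) := by
  have hU0 : 0 < U := by linarith
  have hp := Real.pi_pos
  set a := Real.log x with had
  have h1 : Filter.Tendsto (fun k => (zc (π*k/U) - 1)/k) (nhdsWithin 0 (Set.Ioi 0)) (nhds 0) := by
    have hb : Filter.Tendsto (fun k : ℝ => (π/U)^2*k) (nhdsWithin 0 (Set.Ioi 0)) (nhds 0) := by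
      have : Continuous (fun k : ℝ => (π/U)^2*k) := by fun_prop
      have h := this.tendsto 0
      rw [mul_zero] at h
      exact h.mono_left nhdsWithin_le_nhds
    refine tendsto_of_tendsto_of_tendsto_of_le_of_le' tendsto_const_nhds hb ?_ ?_
    all_goals
      filter_upwards [Ioc_mem_nhdsGT (show (0:ℝ) < 1 by norm_num)] with k hk
      have hk0 : 0 < k := hk.1
      have hz := zc_near (z := π*k/U) (by positivity) (by
        rw [div_le_one hU0]
        have := hk.2
        nlinarith [Real.pi_lt_d6])
    · exact div_nonneg (by linarith [hz.1]) hk0.le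
    · rw [div_le_iff₀ hk0]
      have : (π*k/U)^2 = (π/U)^2*k*k := by ring
      linarith [hz.2]
  have h2 : Filter.Tendsto (fun k => (1 - Real.exp (-k*a))/k) (nhdsWithin 0 (Set.Ioi 0)) (nhds a) := by
    have hd : HasDerivAt (fun k : ℝ => -Real.exp (-k*a)) a 0 := by
      have := (((hasDerivAt_id (0:ℝ)).neg.mul_const a).exp).neg
      refine this.congr_deriv ?_
      simp
    have h := (hasDerivAt_iff_tendsto_slope_zero.1 hd).mono_left (nhdsWithin_mono 0 (fun y (hy : y ∈ Set.Ioi (0:ℝ)) => ne_of_gt hy))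
    refine h.congr fun k => ?_
    simp only [zero_add, neg_zero, zero_mul, Real.exp_zero, smul_eq_mul]
    ring
  have h3 : Filter.Tendsto (fun k : ℝ => Real.exp (-k*a) * (Zr ((1-k:ℝ):ℂ)).re) (nhdsWithin 0 (Set.Ioi 0))
      (nhds (-Real.eulerMascheroniConstant)) := by
    have hc : ContinuousAt (fun k : ℝ => Real.exp (-k*a) * (Zr ((1-k:ℝ):ℂ)).re) 0 := by
      have hz : ContinuousAt Zr (((1-0:ℝ)):ℂ) := by
        apply DifferentiableAt.continuousAt (𝕜 := ℂ)
        apply differentiableAt_Zr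
        · simp; norm_num
        · apply xi_ne_zero_of_one_le_re; simp
      have hz2 : ContinuousAt (fun k : ℝ => Zr ((1-k:ℝ):ℂ)) 0 :=
        ContinuousAt.comp (f := fun k : ℝ => ((1-k:ℝ):ℂ)) (g := Zr) hz (by fun_prop)
      exact ContinuousAt.mul (by fun_prop) (Complex.continuous_re.continuousAt.comp hz2)
    have h := hc.tendsto
    have e : Real.exp (-0*a) * (Zr ((1-0:ℝ):ℂ)).re = -Real.eulerMascheroniConstant := by
      rw [sub_zero, Complex.ofReal_one, Zr_one, Complex.ofReal_re]; simp
    rw [e] at h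
    exact h.mono_left nhdsWithin_le_nhds
  have h4 := ((h1.add h2).add h3).add_const (π/U*(1-2*b))
  rw [zero_add, ← sub_eq_add_neg] at h4
  refine h4.congr' ?_
  filter_upwards [self_mem_nhdsWithin] with k hk
  have hk0 : 0 < k := hk
  rw [Gk_eq hU0 hk0]
  have e : Zf (((1-k:ℝ)):ℂ) = ((-1/k:ℝ):ℂ) + Zr ((1-k:ℝ):ℂ) := by
    unfold Zf; congr 1; push_cast
    have : (k:ℂ) ≠ 0 := by exact_mod_cast hk0.ne'
    rw [show (1:ℂ)-k-1 = -k by ring]; field_simp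
  rw [e, Complex.add_re, Complex.ofReal_re, zc]
  have hs : 0 < Real.sinh (π*k/U) := Real.sinh_pos_iff.2 (by positivity)
  field_simp
  ring

theorem final {T x : ℝ} (hT : 10^7 ≤ T) (hRH : ∀ ρ : ℂ, riemannZeta ρ = 0 → 0 < ρ.im → ρ.im ≤ T → ρ.re = 1 / 2)
    (hTx : T < x) (hx : 10^9 < x) :
    |(∑ n ∈ Finset.Icc 1 ⌊x⌋₊, ArithmeticFunction.vonMangoldt n)/x - zc (π/T)| ≤ π / (T - 1)
        + (1 / (2 * π) * Real.log (T / (2 * π)) ^ 2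
            - 1 / (6 * π) * Real.log (T / (2 * π))) / Real.sqrt x ∧
    |(∑ n ∈ Finset.Icc 1 ⌊x⌋₊, ArithmeticFunction.vonMangoldt n / n)
        - (Real.log x - Real.eulerMascheroniConstant)|
      ≤ π / (T - 1)
        + (1 / (2 * π) * Real.log (T / (2 * π)) ^ 2
            - 1 / (6 * π) * Real.log (T / (2 * π))) / Real.sqrt x := by
  have hT0 : (10:ℝ)^7 ≤ T := hT
  norm_num at hT0
  have hp := Real.pi_pos
  obtain ⟨S, E, H⟩ := Had.exist (2*T+5) (1/(2*T)^2) (by linarith) (by positivity) (by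
    apply one_div_le_one_div_of_le (by norm_num); nlinarith)
  have hR : ∀ ρ ∈ S, 0 < ρ.im → ρ.im ≤ T → ρ.re = 1/2 := fun ρ hρ => hRH ρ (zeta_zero_of_xi (H.zero ρ hρ))
  obtain ⟨U, hU1, hU2, hsel⟩ := H.select hT (by linarith) hR
  have hU0 : 0 < U := by linarith
  have hx0 : 0 < x := by linarith
  have main := fun {k : ℝ} (hk : 0 < k) (hk1 : k ≤ 1) => H.main2 (x := x) hT (by linarith) le_rfl hR (by linarith) hU1 hU2 hsel hk hk1
  have hE := Er_le hT hU1 (by linarith) hTx hx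
  have hC := coef_le hT hU1 (by linarith)
  have hP := piU_le hT hU1 hU2
  obtain ⟨-, -, hw⟩ := log_x_bounds hx
  have hw0 : 0 < Real.sqrt x := by linarith
  have hzw : π/T < π/U := by gcongr; linarith
  obtain ⟨z1, z2⟩ := zc_diff (z := π/T) (w := π/U) (by positivity) hzw
  have hpos : 0 ≤ π/U*(π/U - π/T) := mul_nonneg (by positivity) (by linarith)
  have hl0 : 0 ≤ Real.log (2*π) := Real.log_nonneg (by linarith [Real.pi_gt_three])
  have hl : Real.log (2*π)/x ≤ 0.001/Real.sqrt x := by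
    have h1 : Real.log (2*π) ≤ 6 := (Real.log_le_sub_one_of_pos (by positivity)).trans (by linarith [Real.pi_lt_d6])
    have hxx : x = Real.sqrt x * Real.sqrt x := (Real.mul_self_sqrt hx0.le).symm
    rw [div_le_div_iff₀ hx0 hw0]
    nth_rewrite 2 [hxx]
    rw [← mul_assoc]
    gcongr
    linarith
  have hl' : 0 ≤ Real.log (2*π)/x := by positivity
  generalize (1 / (2 * π) * Real.log (T / (2 * π)) ^ 2 - 1 / (6 * π) * Real.log (T / (2 * π))) = C at *
  generalize hX : ((1/π*MY (Real.log (U/(2*π))) + 0.182)/Real.sqrt x + 2/U*Er T U x) = X at *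
  have hX2 : X + 0.001/Real.sqrt x ≤ 1/U^2 + C/Real.sqrt x := by
    have : (1/π*MY (Real.log (U/(2*π))) + 0.182 + 0.006)/Real.sqrt x ≤ C/Real.sqrt x := by
      gcongr; linarith
    rw [add_div] at this
    have e : (0.006:ℝ)/Real.sqrt x = 0.005/Real.sqrt x + 0.001/Real.sqrt x := by ring
    linarith
  have h00 : 0 ≤ 0.001/Real.sqrt x := by positivity
  constructor
  · obtain ⟨m1, m2⟩ := main (k := 1) one_pos le_rfl
    rw [Ak_one hx0, Gk_one hU0 hx0] at m1 m2
    rw [abs_le]; constructor <;> linarith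
  · have up : (∑ n ∈ Finset.Icc 1 ⌊x⌋₊, ArithmeticFunction.vonMangoldt n / n) ≤
        (Real.log x - Real.eulerMascheroniConstant + π/U*(1-2*0)) + X := by
      refine le_of_tendsto_of_tendsto (Ak_tendsto x) ((Gk_tendsto (b := 0) (by linarith)).add_const X) ?_
      filter_upwards [Ioc_mem_nhdsGT (show (0:ℝ) < 1 by norm_num)] with k hk
      exact (main hk.1 hk.2).1
    have lo : (Real.log x - Real.eulerMascheroniConstant + π/U*(1-2*1)) - X ≤
        (∑ n ∈ Finset.Icc 1 ⌊x⌋₊, ArithmeticFunction.vonMangoldt n / n) := by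
      refine le_of_tendsto_of_tendsto ((Gk_tendsto (b := 1) (by linarith)).sub_const X) (Ak_tendsto x) ?_
      filter_upwards [Ioc_mem_nhdsGT (show (0:ℝ) < 1 by norm_num)] with k hk
      exact (main hk.1 hk.2).2
    rw [abs_le]; constructor <;> linarith

end PS
end

theorem stmt_0 (T : ℝ) (hT : (10 : ℝ) ^ 7 ≤ T) (hRH : RHUpTo T)
    (x : ℝ) (hx : max T ((10 : ℝ) ^ 9) < x) :
    |chebyshevPsi x - x * (π / T) * (Real.cosh (π / T) / Real.sinh (π / T))|
      ≤ π / (T - 1) * x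
        + (1 / (2 * π) * Real.log (T / (2 * π)) ^ 2
            - 1 / (6 * π) * Real.log (T / (2 * π))) * Real.sqrt x
    ∧
    |(∑ n ∈ Finset.Icc 1 ⌊x⌋₊, ArithmeticFunction.vonMangoldt n / n)
        - (Real.log x - Real.eulerMascheroniConstant)|
      ≤ π / (T - 1)
        + (1 / (2 * π) * Real.log (T / (2 * π)) ^ 2
            - 1 / (6 * π) * Real.log (T / (2 * π))) / Real.sqrt x := by
  
  have hTx : T < x := (le_max_left _ _).trans_lt hx
  have hx9 : (10:ℝ)^9 < x := (le_max_right _ _).trans_lt hx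
  obtain ⟨h1, h2⟩ := PS.final hT hRH hTx hx9
  refine ⟨?_, h2⟩
  have hx0 : 0 < x := lt_trans (by norm_num) hx9
  have hs : 0 < Real.sqrt x := Real.sqrt_pos.2 hx0
  have hxx : x = Real.sqrt x * Real.sqrt x := (Real.mul_self_sqrt hx0.le).symm
  have e1 : chebyshevPsi x - x * (π / T) * (Real.cosh (π / T) / Real.sinh (π / T))
      = x * ((∑ n ∈ Finset.Icc 1 ⌊x⌋₊, ArithmeticFunction.vonMangoldt n) / x - PS.zc (π / T)) := by
    unfold chebyshevPsi PS.zc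
    field_simp
  rw [e1, abs_mul, abs_of_pos hx0]
  refine (mul_le_mul_of_nonneg_left h1 hx0.le).trans (le_of_eq ?_)
  generalize (1 / (2 * π) * Real.log (T / (2 * π)) ^ 2 - 1 / (6 * π) * Real.log (T / (2 * π))) = C
  have e2 : x * (C / Real.sqrt x) = C * Real.sqrt x := by
    nth_rewrite 1 [hxx]
    field_simp
  rw [mul_add, e2]
  ring
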